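/- Let d ≥ 1, T ∈ (-∞, ∞], ν ∈ (0,1), α ∈ (0,2), λ > 0, p ∈ (1,∞), and γ ∈ (p - 1, 2p - 1). Then there exists a constant N > 0, depending only on d, α, ν, γ, p, such that for every choice of measurable coefficients μ, ā₀, c̄₀, ā_{ij} as in the context and every smooth function u : ℝ × ℝ^d → ℝ with compact support contained in (-∞,T) × ℝ^{d-1} × (0,∞), setting f(t,x) = μ(x_d)^{-1}(ā₀(x_d) u_t + λ c̄₀(x_d) u) - ā_{ij}(x_d) D_iD_j u, one has λ ‖χ^{-α} u‖_{L_p(Ω_T, x_d^γ dz)} + λ^{1/2} ‖χ^{-α/2} Du‖_{L_p(Ω_T, x_d^γ dz)} + ‖D²u‖_{L_p(Ω_T, x_d^γ dz)} + ‖χ^{-α} u_t‖_{L_p(Ω_T, x_d^γ dz)} ≤ N ‖f‖_{L_p(Ω_T, x_d^γ dz)}. -/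

import Mathlib

open MeasureTheory ENNReal Set

noncomputable section

abbrev Ed (d : ℕ) : Type := EuclideanSpace ℝ (Fin d)

/-- The last coordinate `x_d` of a point `x ∈ ℝ^d` (junk value `0` if `d = 0`). -/
def xd {d : ℕ} (x : Ed d) : ℝ :=
  if h : 0 < d then x ⟨d - 1, Nat.sub_lt h one_pos⟩ else 0

/-- `Ω_T = (-∞, T) × ℝ^d_+`. -/
def OmegaT (d : ℕ) (T : EReal) : Set (ℝ × Ed d) :=
  {z | (z.1 : EReal) < T ∧ 0 < xd z.2}

/-- Time derivative `u_t`. -/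
def ut {d : ℕ} (u : ℝ × Ed d → ℝ) (z : ℝ × Ed d) : ℝ :=
  deriv (fun s => u (s, z.2)) z.1

/-- Spatial gradient `Du`. -/
def Du {d : ℕ} (u : ℝ × Ed d → ℝ) (z : ℝ × Ed d) : Ed d →L[ℝ] ℝ :=
  fderiv ℝ (fun y => u (z.1, y)) z.2

/-- Spatial Hessian `D²u`. -/
def D2u {d : ℕ} (u : ℝ × Ed d → ℝ) (z : ℝ × Ed d) : Ed d →L[ℝ] Ed d →L[ℝ] ℝ :=
  fderiv ℝ (fun y => Du u (z.1, y)) z.2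

/-- Spatial Laplacian `Δu`. -/
def lap {d : ℕ} (u : ℝ × Ed d → ℝ) (z : ℝ × Ed d) : ℝ :=
  ∑ i : Fin d, D2u u z (EuclideanSpace.single i 1) (EuclideanSpace.single i 1)

/-- Weighted Lebesgue norm `‖g‖_{L_p(Ω_T, x_d^γ dz)}`. -/
def wLp (d : ℕ) (T : EReal) (p γ : ℝ) (g : ℝ × Ed d → ℝ) : ℝ≥0∞ :=
  (∫⁻ z in OmegaT d T, ENNReal.ofReal (|g z| ^ p * xd z.2 ^ γ)) ^ (1 / p)

/-- Conditions (1.3)–(1.4) on the (measurable) coefficients `μ, ā₀, c̄₀, ā_{ij}`,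
depending only on the `x_d` variable. -/
def CoeffOK (d : ℕ) (ν α : ℝ) (μc a0 c0 : ℝ → ℝ) (aij : Fin d → Fin d → ℝ → ℝ) : Prop :=
  Measurable μc ∧ Measurable a0 ∧ Measurable c0 ∧ (∀ i j, Measurable (aij i j)) ∧
  (∀ s : ℝ, 0 < s →
      a0 s ∈ Set.Icc ν ν⁻¹ ∧ c0 s ∈ Set.Icc ν ν⁻¹ ∧ μc s / s ^ α ∈ Set.Icc ν ν⁻¹) ∧
  (∀ s : ℝ, 0 < s → ∀ ξ : Fin d → ℝ,
      ν * ∑ i, ξ i ^ 2 ≤ ∑ i, ∑ j, aij i j s * ξ i * ξ j) ∧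
  (∀ s : ℝ, 0 < s → ∀ i j, |aij i j s| ≤ ν⁻¹)

/-- `f = μ(x_d)⁻¹ (ā₀ u_t + λ c̄₀ u) - ā_{ij} D_i D_j u`, i.e. `𝓛₀ u = μ(x_d) f`. -/
def fL0 {d : ℕ} (μc a0 c0 : ℝ → ℝ) (aij : Fin d → Fin d → ℝ → ℝ) (lam : ℝ)
    (u : ℝ × Ed d → ℝ) (z : ℝ × Ed d) : ℝ :=
  (μc (xd z.2))⁻¹ * (a0 (xd z.2) * ut u z + lam * c0 (xd z.2) * u z) -
    ∑ i, ∑ j, aij i j (xd z.2) *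
      D2u u z (EuclideanSpace.single i 1) (EuclideanSpace.single j 1)

section Dyadic

variable {J : Type*} [Fintype J]

/-- Index of the anisotropic dyadic cell of generation `k` containing `z`. -/
def cellIdx (w : J → ℕ) (k : ℕ) (z : J → ℤ) : J → ℤ := fun j => z j / (2 : ℤ) ^ (w j * k)

/-- Union of the cells of generation `k` whose index is within distance `R` of `c`. -/
def cellNbd (w : J → ℕ) (R : ℤ) (k : ℕ) (c : J → ℤ) : Set (J → ℤ) :=
  {z | ∀ j, |cellIdx w k z j - c j| ≤ R}

/-- Number of points of a cell of generation `k`. -/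
def cellVol (w : J → ℕ) (k : ℕ) : ℝ≥0∞ := 2 ^ (k * ∑ j, w j)

lemma cellVol_ne_zero (w : J → ℕ) (k : ℕ) : cellVol w k ≠ 0 := by
  unfold cellVol; positivity

lemma cellVol_ne_top (w : J → ℕ) (k : ℕ) : cellVol w k ≠ ∞ := by
  unfold cellVol; exact ENNReal.pow_ne_top (by simp)

lemma cellVol_succ (w : J → ℕ) (k : ℕ) :
    cellVol w (k + 1) = 2 ^ (∑ j, w j) * cellVol w k := by
  unfold cellVol; rw [← pow_add]; congr 1; ring

lemma cellIdx_add (w : J → ℕ) (k m : ℕ) (z : J → ℤ) (j : J) :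
    cellIdx w (k + m) z j = cellIdx w k z j / (2 : ℤ) ^ (w j * m) := by
  simp only [cellIdx]
  rw [Int.ediv_ediv_of_nonneg (by positivity), ← pow_add, mul_add]

lemma cellIdx_eq_of_le (w : J → ℕ) {k k' : ℕ} (h : k ≤ k') {z z' : J → ℤ}
    (hz : cellIdx w k z = cellIdx w k z') : cellIdx w k' z = cellIdx w k' z' := by
  obtain ⟨m, rfl⟩ := Nat.exists_eq_add_of_le h
  ext j
  rw [cellIdx_add, cellIdx_add, hz]

lemma abs_ediv_sub_le_one {a b m : ℤ} (hm : 0 < m) (h : |a - b| ≤ m) : |a / m - b / m| ≤ 1 := by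
  rw [abs_le] at h ⊢
  have h1 : a / m ≤ (b + m) / m := Int.ediv_le_ediv hm (by linarith)
  have h2 : b / m ≤ (a + m) / m := Int.ediv_le_ediv hm (by linarith)
  rw [Int.add_ediv_of_dvd_right dvd_rfl, Int.ediv_self hm.ne'] at h1 h2
  constructor <;> linarith

lemma cellNbd_one_mono (w : J → ℕ) {k k' : ℕ} (h : k ≤ k') (z : J → ℤ) :
    cellNbd w 1 k (cellIdx w k z) ⊆ cellNbd w 1 k' (cellIdx w k' z) := by
  obtain ⟨m, rfl⟩ := Nat.exists_eq_add_of_le h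
  intro y hy j
  rw [cellIdx_add, cellIdx_add]
  exact abs_ediv_sub_le_one (by positivity) ((hy j).trans (one_le_pow₀ (by norm_num)))

lemma cellNbd_two_subset (w : J → ℕ) (hw : ∀ j, 1 ≤ w j) (k : ℕ) (z : J → ℤ) :
    cellNbd w 2 k (cellIdx w k z) ⊆ cellNbd w 1 (k + 1) (cellIdx w (k + 1) z) := by
  intro y hy j
  rw [cellIdx_add, cellIdx_add]
  refine abs_ediv_sub_le_one (by positivity) ((hy j).trans ?_)
  simpa using pow_le_pow_right₀ (show (1 : ℤ) ≤ 2 by norm_num) (hw j)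

lemma cellNbd_eq_Icc (w : J → ℕ) (R : ℤ) (k : ℕ) (c : J → ℤ) :
    cellNbd w R k c = Icc (fun j => (c j - R) * 2 ^ (w j * k))
      (fun j => (c j + R + 1) * 2 ^ (w j * k) - 1) := by
  ext z
  simp only [cellNbd, mem_ofPred_eq, mem_Icc, Pi.le_def, ← forall_and, cellIdx]
  refine forall_congr' fun j => ?_
  have hp : (0 : ℤ) < 2 ^ (w j * k) := by positivity
  have e1 := Int.le_ediv_iff_mul_le (a := c j - R) (b := z j) hp
  have e2 := Int.ediv_lt_iff_lt_mul (a := z j) (b := c j + R + 1) hp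
  rw [abs_le]
  constructor
  · rintro ⟨h1, h2⟩
    exact ⟨e1.1 (by linarith), by have := e2.1 (by linarith); linarith⟩
  · rintro ⟨h1, h2⟩
    have := e1.2 h1
    have := e2.2 (by linarith)
    constructor <;> linarith

lemma count_cellNbd (w : J → ℕ) (R : ℕ) (k : ℕ) (c : J → ℤ) :
    Measure.count (cellNbd w R k c) = (2 * R + 1) ^ (Fintype.card J) * cellVol w k := by
  classical
  rw [cellNbd_eq_Icc, ← Finset.coe_Icc, Measure.count_apply_finset, Pi.card_Icc]
  have : ∀ j, (Finset.Icc ((c j - R) * 2 ^ (w j * k)) ((c j + R + 1) * 2 ^ (w j * k) - 1)).card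
      = (2 * R + 1) * 2 ^ (w j * k) := by
    intro j
    rw [Int.card_Icc]
    have : ((c j + R + 1) * 2 ^ (w j * k) - 1 + 1 - (c j - R) * 2 ^ (w j * k) : ℤ)
      = (((2 * R + 1) * 2 ^ (w j * k) : ℕ) : ℤ) := by push_cast; ring
    rw [this, Int.toNat_natCast]
  simp only [this, Finset.prod_mul_distrib, Finset.prod_const, Finset.card_univ, cellVol,
    Finset.prod_pow_eq_pow_sum]
  push_cast
  congr 2
  rw [Finset.mul_sum]
  exact Finset.sum_congr rfl fun j _ => mul_comm _ _

lemma mem_cellNbd_self (w : J → ℕ) (R : ℕ) (k : ℕ) (z : J → ℤ) :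
    z ∈ cellNbd w R k (cellIdx w k z) := fun j => by simp

lemma cellNbd_zero (w : J → ℕ) (k : ℕ) (c : J → ℤ) :
    cellNbd w 0 k c = {z | cellIdx w k z = c} := by
  ext z
  simp only [cellNbd, abs_nonpos_iff, sub_eq_zero, mem_ofPred_eq, funext_iff]

/-- `(k, c)` is a maximal cell with property `P`. -/
def IsMaxCell (w : J → ℕ) (P : ℕ → (J → ℤ) → Prop) (k : ℕ) (c : J → ℤ) : Prop :=
  P k c ∧ ∀ k', k < k' → ∀ z, cellIdx w k z = c → ¬ P k' (cellIdx w k' z)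

/-- The maximal cell with property `P` and index `i`, or `∅` if there is none. -/
def maxCell (w : J → ℕ) (P : ℕ → (J → ℤ) → Prop) (i : ℕ × (J → ℤ)) : Set (J → ℤ) :=
  {z | cellIdx w i.1 z = i.2 ∧ IsMaxCell w P i.1 i.2}

lemma maxCell_pairwise_disjoint (w : J → ℕ) (P : ℕ → (J → ℤ) → Prop) :
    Pairwise (Function.onFun Disjoint (maxCell w P)) := by
  have key : ∀ i i' : ℕ × (J → ℤ), i.1 < i'.1 → ∀ z, z ∈ maxCell w P i → z ∉ maxCell w P i' := by
    rintro i i' h z ⟨hz, -, hm⟩ ⟨hz', hP, -⟩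
    exact hm i'.1 h z hz (hz' ▸ hP)
  intro i i' hne
  rw [Function.onFun, Set.disjoint_left]
  intro z hz hz'
  rcases lt_trichotomy i.1 i'.1 with h | h | h
  · exact key i i' h z hz hz'
  · exact hne (Prod.ext h (by rw [← hz.1, ← hz'.1, h]))
  · exact key i' i h z hz' hz

lemma iUnion_maxCell (w : J → ℕ) (P : ℕ → (J → ℤ) → Prop) (B : ℕ) (hB : ∀ k c, P k c → k ≤ B) :
    {z | ∃ k, P k (cellIdx w k z)} = ⋃ i, maxCell w P i := by
  classical
  ext z
  simp only [mem_ofPred_eq, mem_iUnion]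
  constructor
  · rintro ⟨k, hk⟩
    set m := Nat.findGreatest (fun k => P k (cellIdx w k z)) B with hm
    have h1 : P m (cellIdx w m z) :=
      Nat.findGreatest_spec (P := fun k => P k (cellIdx w k z)) (hB _ _ hk) hk
    refine ⟨(m, cellIdx w m z), rfl, h1, fun k' hk' z' hz' hP => ?_⟩
    rw [cellIdx_eq_of_le w hk'.le hz'] at hP
    exact Nat.findGreatest_is_greatest hk' (hB _ _ hP) hP
  · rintro ⟨i, hi, hP, -⟩
    exact ⟨i.1, hi ▸ hP⟩

lemma exists_bound_cellVol [Nonempty J] (w : J → ℕ) (hw : ∀ j, 1 ≤ w j) (t : ℝ≥0∞) (ht : t ≠ 0)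
    (A : ℝ≥0∞) (hA : A ≠ ∞) : ∃ B : ℕ, ∀ k, t * cellVol w k < A → k ≤ B := by
  have hW : 1 ≤ ∑ j, w j := by
    obtain ⟨j⟩ := ‹Nonempty J›
    exact (hw j).trans (Finset.single_le_sum (f := w) (fun _ _ => Nat.zero_le _) (Finset.mem_univ j))
  obtain ⟨B, hB⟩ := ENNReal.exists_nat_mul_gt ht hA
  refine ⟨B, fun k hk => ?_⟩
  by_contra! h
  have : (k : ℝ≥0∞) ≤ cellVol w k := by
    have h1 : k ≤ 2 ^ (k * ∑ j, w j) :=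
      (Nat.lt_two_pow_self (n := k)).le.trans
        (Nat.pow_le_pow_right (by norm_num) (Nat.le_mul_of_pos_right k hW))
    unfold cellVol
    exact_mod_cast h1
  have h2 : (B : ℝ≥0∞) * t ≤ t * cellVol w k := by
    rw [mul_comm]; gcongr; exact le_trans (by exact_mod_cast h.le) this
  exact absurd (hB.trans_le h2) (not_lt.2 hk.le)

/-- Dyadic maximal function over tripled cells. -/
def cellMax (w : J → ℕ) (F : (J → ℤ) → ℝ≥0∞) (z : J → ℤ) : ℝ≥0∞ :=
  ⨆ k, (∫⁻ y in cellNbd w 1 k (cellIdx w k z), F y ∂Measure.count) /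
    (3 ^ (Fintype.card J) * cellVol w k)

lemma tripleVol_ne_zero (w : J → ℕ) (k : ℕ) : (3 : ℝ≥0∞) ^ (Fintype.card J) * cellVol w k ≠ 0 :=
  mul_ne_zero (by positivity) (cellVol_ne_zero w k)

lemma tripleVol_ne_top (w : J → ℕ) (k : ℕ) : (3 : ℝ≥0∞) ^ (Fintype.card J) * cellVol w k ≠ ∞ :=
  ENNReal.mul_ne_top (ENNReal.pow_ne_top (by simp)) (cellVol_ne_top w k)

lemma lt_cellMax_iff (w : J → ℕ) (F : (J → ℤ) → ℝ≥0∞) (z : J → ℤ) (t : ℝ≥0∞) :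
    t < cellMax w F z ↔ ∃ k, t * (3 ^ (Fintype.card J) * cellVol w k) <
      ∫⁻ y in cellNbd w 1 k (cellIdx w k z), F y ∂Measure.count := by
  rw [cellMax, lt_iSup_iff]
  refine exists_congr fun k => ?_
  rw [ENNReal.lt_div_iff_mul_lt (Or.inl (tripleVol_ne_zero w k)) (Or.inl (tripleVol_ne_top w k))]

lemma setLIntegral_le_of_cellMax_le (w : J → ℕ) (F : (J → ℤ) → ℝ≥0∞) (z : J → ℤ) (t : ℝ≥0∞)
    (h : cellMax w F z ≤ t) (k : ℕ) :
    ∫⁻ y in cellNbd w 1 k (cellIdx w k z), F y ∂Measure.count ≤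
      t * (3 ^ (Fintype.card J) * cellVol w k) := by
  by_contra! h'
  exact absurd ((lt_cellMax_iff w F z t).2 ⟨k, h'⟩) (not_lt.2 h)

lemma exists_cell_of_lt (w : J → ℕ) (F : (J → ℤ) → ℝ≥0∞) (t : ℝ≥0∞) (k : ℕ)
    (c : J → ℤ) (h : t * (3 ^ (Fintype.card J) * cellVol w k) <
      ∫⁻ y in cellNbd w 1 k c, F y ∂Measure.count) :
    ∃ c', (∀ j, |c' j - c j| ≤ 1) ∧
      t * cellVol w k < ∫⁻ y in cellNbd w 0 k c', F y ∂Measure.count := by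
  classical
  by_contra! hc
  apply absurd h (not_lt.2 ?_)
  have hsub : cellNbd w 1 k c ⊆ ⋃ c' ∈ Finset.Icc (c - 1) (c + 1), cellNbd w 0 k c' := by
    intro y hy
    simp only [mem_iUnion]
    refine ⟨cellIdx w k y, ?_, mem_cellNbd_self w 0 k y⟩
    rw [Finset.mem_Icc]
    constructor <;> intro j <;> have := abs_le.1 (hy j) <;>
      simp only [Pi.sub_apply, Pi.add_apply, Pi.one_apply] <;> linarith
  calc ∫⁻ y in cellNbd w 1 k c, F y ∂Measure.count
      ≤ ∫⁻ y in ⋃ c' ∈ Finset.Icc (c - 1) (c + 1), cellNbd w 0 k c', F y ∂Measure.count :=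
        lintegral_mono_set hsub
    _ ≤ ∑ c' ∈ Finset.Icc (c - 1) (c + 1), ∫⁻ y in cellNbd w 0 k c', F y ∂Measure.count := by
        rw [lintegral_biUnion_finset]
        · intro i _ i' _ hne
          rw [Function.onFun, cellNbd_zero, cellNbd_zero, Set.disjoint_left]
          exact fun z hz hz' => hne (hz.symm.trans hz')
        · exact fun _ _ => MeasurableSet.of_discrete
    _ ≤ ∑ c' ∈ Finset.Icc (c - 1) (c + 1), t * cellVol w k := by
        refine Finset.sum_le_sum fun c' hc' => hc c' fun j => ?_
        rw [Finset.mem_Icc] at hc'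
        have h1 := hc'.1 j
        have h2 := hc'.2 j
        simp only [Pi.sub_apply, Pi.add_apply, Pi.one_apply] at h1 h2
        rw [abs_le]; constructor <;> linarith
    _ = t * (3 ^ (Fintype.card J) * cellVol w k) := by
        rw [Finset.sum_const, Pi.card_Icc]
        have : ∀ j, (Finset.Icc ((c - 1) j) ((c + 1) j)).card = 3 := by
          intro j
          simp only [Pi.sub_apply, Pi.add_apply, Pi.one_apply, Int.card_Icc]
          have : c j + 1 + 1 - (c j - 1) = 3 := by ring
          rw [this]; rfl
        simp only [this, Finset.prod_const, Finset.card_univ, nsmul_eq_mul]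
        push_cast
        ring

lemma count_lt_cellMax_le [Nonempty J] (w : J → ℕ) (hw : ∀ j, 1 ≤ w j) (F : (J → ℤ) → ℝ≥0∞)
    (hF : ∫⁻ y, F y ∂Measure.count ≠ ∞) (t : ℝ≥0∞) (ht : t ≠ 0) (ht' : t ≠ ∞) :
    t * Measure.count {z | t < cellMax w F z} ≤
      3 ^ (Fintype.card J) * ∫⁻ y, F y ∂Measure.count := by
  set P : ℕ → (J → ℤ) → Prop := fun k c =>
    t * cellVol w k < ∫⁻ y in cellNbd w 0 k c, F y ∂Measure.count with hP
  obtain ⟨B, hB⟩ := exists_bound_cellVol w hw t ht _ hF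
  have hunion := iUnion_maxCell w P B
    (fun k c h => hB k (h.trans_le (setLIntegral_le_lintegral _ _)))
  have hsub : {z | t < cellMax w F z} ⊆
      ⋃ i : ℕ × (J → ℤ), {z | z ∈ cellNbd w 1 i.1 i.2 ∧ IsMaxCell w P i.1 i.2} := by
    intro z hz
    obtain ⟨k, hk⟩ := (lt_cellMax_iff w F z t).1 hz
    obtain ⟨c', hc', hlt⟩ := exists_cell_of_lt w F t k _ hk
    have hne : ∃ y, cellIdx w k y = c' := by
      refine ⟨fun j => c' j * 2 ^ (w j * k), funext fun j => ?_⟩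
      simp [cellIdx]
    obtain ⟨y, rfl⟩ := hne
    have : y ∈ ⋃ i, maxCell w P i := by rw [← hunion]; exact ⟨k, hlt⟩
    obtain ⟨i, hi⟩ := mem_iUnion.1 this
    refine mem_iUnion.2 ⟨i, ?_, hi.2⟩
    have hki : k ≤ i.1 := by
      by_contra! h
      exact hi.2.2 k h y hi.1 hlt
    have : z ∈ cellNbd w 1 k (cellIdx w k y) := fun j => by rw [abs_sub_comm]; exact hc' j
    have := cellNbd_one_mono w hki y this
    rwa [hi.1] at this
  have hi : ∀ i : ℕ × (J → ℤ), t * Measure.count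
      {z | z ∈ cellNbd w 1 i.1 i.2 ∧ IsMaxCell w P i.1 i.2} ≤
      3 ^ (Fintype.card J) * ∫⁻ y in maxCell w P i, F y ∂Measure.count := by
    intro i
    by_cases hm : IsMaxCell w P i.1 i.2
    · have e1 : {z | z ∈ cellNbd w 1 i.1 i.2 ∧ IsMaxCell w P i.1 i.2} = cellNbd w 1 i.1 i.2 := by
        ext z; simp [hm]
      have e2 : maxCell w P i = cellNbd w 0 i.1 i.2 := by
        rw [cellNbd_zero]; ext z; simp [maxCell, hm]
      have e3 := count_cellNbd w 1 i.1 i.2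
      norm_num at e3
      rw [e1, e2, e3, mul_left_comm]
      gcongr
      exact hm.1.le
    · simp [hm]
  calc t * Measure.count {z | t < cellMax w F z}
      ≤ t * ∑' i : ℕ × (J → ℤ), Measure.count
          {z | z ∈ cellNbd w 1 i.1 i.2 ∧ IsMaxCell w P i.1 i.2} := by
        gcongr
        exact (measure_mono hsub).trans (measure_iUnion_le _)
    _ ≤ ∑' i : ℕ × (J → ℤ), 3 ^ (Fintype.card J) *
          ∫⁻ y in maxCell w P i, F y ∂Measure.count := by
        rw [← ENNReal.tsum_mul_left]
        exact ENNReal.tsum_le_tsum hi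
    _ = 3 ^ (Fintype.card J) * ∫⁻ y in ⋃ i, maxCell w P i, F y ∂Measure.count := by
        rw [ENNReal.tsum_mul_left, lintegral_iUnion (fun _ => MeasurableSet.of_discrete)
          (maxCell_pairwise_disjoint w P)]
    _ ≤ _ := by
        exact mul_le_mul' le_rfl (setLIntegral_le_lintegral _ _)

end Dyadic

section Strong

variable {J : Type*} [Fintype J]

lemma lintegral_rpow_eq_layercake {X : Type*} [MeasurableSpace X] [DiscreteMeasurableSpace X]
    (μ : Measure X) (G : X → ℝ≥0∞) (hG : ∀ z, G z ≠ ∞) {q : ℝ} (hq : 0 < q) :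
    ∫⁻ z, G z ^ q ∂μ = ENNReal.ofReal q *
      ∫⁻ t in Ioi (0 : ℝ), μ {z | ENNReal.ofReal t < G z} * ENNReal.ofReal (t ^ (q - 1)) := by
  have h := lintegral_rpow_eq_lintegral_meas_lt_mul (μ := μ) (f := fun z => (G z).toReal)
    (Filter.Eventually.of_forall fun z => ENNReal.toReal_nonneg)
    (Measurable.of_discrete).aemeasurable hq
  have e1 : ∀ z, ENNReal.ofReal ((G z).toReal ^ q) = G z ^ q := fun z => by
    rw [← ENNReal.ofReal_rpow_of_nonneg ENNReal.toReal_nonneg hq.le, ENNReal.ofReal_toReal (hG z)]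
  simp only [e1] at h
  rw [h]
  congr 1
  refine setLIntegral_congr_fun measurableSet_Ioi fun t ht => ?_
  have : {z | t < (G z).toReal} = {z | ENNReal.ofReal t < G z} := by
    ext z
    exact (ENNReal.ofReal_lt_iff_lt_toReal (le_of_lt ht) (hG z)).symm
  simp only [this]

lemma count_cellNbd_one (w : J → ℕ) (k : ℕ) (c : J → ℤ) :
    Measure.count (cellNbd w 1 k c) = 3 ^ (Fintype.card J) * cellVol w k := by
  have e3 := count_cellNbd w 1 k c
  norm_num at e3
  exact e3

lemma one_le_cellVol (w : J → ℕ) (k : ℕ) : 1 ≤ cellVol w k := by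
  unfold cellVol; exact one_le_pow₀ (by norm_num)

lemma cellMax_le_lintegral (w : J → ℕ) (F : (J → ℤ) → ℝ≥0∞) (z : J → ℤ) :
    cellMax w F z ≤ ∫⁻ y, F y ∂Measure.count := by
  refine iSup_le fun k => ?_
  refine (ENNReal.div_le_of_le_mul ?_).trans (setLIntegral_le_lintegral
    (cellNbd w 1 k (cellIdx w k z)) _)
  refine le_mul_of_one_le_right zero_le (one_le_mul (one_le_pow₀ (by norm_num)) (one_le_cellVol w k))

lemma le_cellMax (w : J → ℕ) (F : (J → ℤ) → ℝ≥0∞) (z : J → ℤ) :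
    F z ≤ 3 ^ (Fintype.card J) * cellMax w F z := by
  have h := setLIntegral_le_of_cellMax_le w F z _ le_rfl 0
  have h2 : F z ≤ ∫⁻ y in cellNbd w 1 0 (cellIdx w 0 z), F y ∂Measure.count := by
    calc F z = ∫⁻ y in {z}, F y ∂Measure.count := by simp
      _ ≤ _ := lintegral_mono_set (by
        rw [singleton_subset_iff]; exact mem_cellNbd_self w 1 0 z)
  refine h2.trans (h.trans (le_of_eq ?_))
  simp [cellVol, mul_comm]

lemma cellMax_le_add (w : J → ℕ) (F : (J → ℤ) → ℝ≥0∞) (s : ℝ≥0∞) (z : J → ℤ) :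
    cellMax w F z ≤ cellMax w ({y | s < F y}.indicator F) z + s := by
  refine iSup_le fun k => ?_
  refine ENNReal.div_le_of_le_mul ?_
  set S := cellNbd w 1 k (cellIdx w k z)
  calc ∫⁻ y in S, F y ∂Measure.count
      ≤ ∫⁻ y in S, ({y | s < F y}.indicator F y + s) ∂Measure.count := by
        refine lintegral_mono fun y => ?_
        by_cases h : s < F y
        · simp [indicator, h]
        · simp only [indicator, mem_ofPred_eq, h, if_false, zero_add]; exact not_lt.1 h
    _ = ∫⁻ y in S, {y | s < F y}.indicator F y ∂Measure.count + s * Measure.count S := by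
        rw [lintegral_add_right _ measurable_const, setLIntegral_const]
    _ ≤ cellMax w ({y | s < F y}.indicator F) z * (3 ^ (Fintype.card J) * cellVol w k)
        + s * (3 ^ (Fintype.card J) * cellVol w k) := by
        refine add_le_add (setLIntegral_le_of_cellMax_le w _ z _ le_rfl k) ?_
        rw [count_cellNbd_one]
    _ = _ := by ring

/-- `L^q` bound of the dyadic maximal function, `q > 1`. -/
lemma lintegral_cellMax_rpow_le [Nonempty J] (w : J → ℕ) (hw : ∀ j, 1 ≤ w j) {q : ℝ} (hq : 1 < q)
    (F : (J → ℤ) → ℝ≥0∞) (hF : ∫⁻ y, F y ∂Measure.count ≠ ∞) :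
    ∫⁻ z, cellMax w F z ^ q ∂Measure.count ≤
      ENNReal.ofReal (2 * 3 ^ (Fintype.card J) * q / (q - 1) * 2 ^ (q - 1)) *
        ∫⁻ z, F z ^ q ∂Measure.count := by
  have hfin : ∀ z, F z ≠ ∞ := fun z => by
    have : F z ≤ ∫⁻ y, F y ∂Measure.count := by
      rw [lintegral_count]; exact ENNReal.le_tsum z
    exact ne_top_of_le_ne_top hF this
  set ν := (Measure.count : Measure (J → ℤ)).withDensity F with hν
  have hwk : ∀ t : ℝ, 0 < t → Measure.count {z | ENNReal.ofReal t < cellMax w F z} ≤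
      ENNReal.ofReal (2 * 3 ^ (Fintype.card J) / t) * ν {z | ENNReal.ofReal t < 2 * F z} := by
    intro t ht
    set s := ENNReal.ofReal (t / 2) with hs
    have hts : ENNReal.ofReal t = s + s := by
      rw [hs, ← ENNReal.ofReal_add (by positivity) (by positivity)]; congr 1; ring
    set F' := {y | s < F y}.indicator F with hF'
    have hF'i : ∫⁻ y, F' y ∂Measure.count = ν {z | ENNReal.ofReal t < 2 * F z} := by
      have : {z | ENNReal.ofReal t < 2 * F z} = {z | s < F z} := by
        ext z
        simp only [mem_ofPred_eq]
        rw [hts, ← two_mul, ENNReal.mul_lt_mul_iff_right (by norm_num) (by norm_num)]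
      rw [this, hν, withDensity_apply _ MeasurableSet.of_discrete, hF',
        lintegral_indicator MeasurableSet.of_discrete]
    have hF'fin : ∫⁻ y, F' y ∂Measure.count ≠ ∞ :=
      ne_top_of_le_ne_top hF (lintegral_mono (indicator_le_self _ _))
    have hs0 : s ≠ 0 := by simp [hs, ht]
    have hsub : {z | ENNReal.ofReal t < cellMax w F z} ⊆ {z | s < cellMax w F' z} := by
      intro z hz
      have h1 := lt_of_lt_of_le hz (cellMax_le_add w F s z)
      rw [hts] at h1
      exact lt_of_add_lt_add_right h1
    have h := count_lt_cellMax_le w hw F' hF'fin s hs0 ENNReal.ofReal_ne_top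
    rw [hF'i] at h
    have h2 : Measure.count {z | s < cellMax w F' z} ≤
        (3 ^ (Fintype.card J) * ν {z | ENNReal.ofReal t < 2 * F z}) / s := by
      rw [ENNReal.le_div_iff_mul_le (Or.inl hs0) (Or.inl ENNReal.ofReal_ne_top), mul_comm]
      exact h
    refine (measure_mono hsub).trans (h2.trans (le_of_eq ?_))
    rw [ENNReal.div_eq_inv_mul, ← mul_assoc]
    congr 1
    rw [hs, ← ENNReal.ofReal_inv_of_pos (by positivity),
      show (3 : ℝ≥0∞) ^ (Fintype.card J) = ENNReal.ofReal (3 ^ (Fintype.card J)) by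
        rw [ENNReal.ofReal_pow (by norm_num)]; norm_num, ← ENNReal.ofReal_mul (by positivity)]
    congr 1
    field_simp
  rw [lintegral_rpow_eq_layercake _ _
    (fun z => ne_top_of_le_ne_top hF (cellMax_le_lintegral w F z)) (by linarith : 0 < q)]
  have hq1 : 0 < q - 1 := by linarith
  have h2 := lintegral_rpow_eq_layercake ν (fun z => 2 * F z)
    (fun z => ENNReal.mul_ne_top (by simp) (hfin z)) hq1
  have h3 : ∫⁻ z, (2 * F z) ^ (q - 1) ∂ν =
      ENNReal.ofReal (2 ^ (q - 1)) * ∫⁻ z, F z ^ q ∂Measure.count := by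
    rw [hν, lintegral_withDensity_eq_lintegral_mul _ Measurable.of_discrete Measurable.of_discrete,
      ← lintegral_const_mul _ Measurable.of_discrete]
    refine lintegral_congr fun z => ?_
    simp only [Pi.mul_apply]
    rw [ENNReal.mul_rpow_of_nonneg _ _ hq1.le, mul_left_comm]
    congr 1
    · rw [← ENNReal.ofReal_rpow_of_pos (by norm_num)]; norm_num
    · by_cases h0 : F z = 0
      · simp [h0, hq1, (by linarith : 0 < q)]
      · nth_rewrite 1 [← ENNReal.rpow_one (F z)]
        rw [← ENNReal.rpow_add _ _ h0 (hfin z)]; congr 1; ring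
  have hb : ∫⁻ t in Ioi (0 : ℝ), Measure.count {z | ENNReal.ofReal t < cellMax w F z} *
      ENNReal.ofReal (t ^ (q - 1)) ≤ ENNReal.ofReal (2 * 3 ^ (Fintype.card J)) *
      ∫⁻ t in Ioi (0 : ℝ), ν {z | ENNReal.ofReal t < 2 * F z} *
        ENNReal.ofReal (t ^ (q - 1 - 1)) := by
    rw [← lintegral_const_mul' _ _ ENNReal.ofReal_ne_top]
    refine setLIntegral_mono' measurableSet_Ioi fun t ht => ?_
    refine (mul_le_mul' (hwk t ht) le_rfl).trans (le_of_eq ?_)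
    rw [mul_right_comm, ← ENNReal.ofReal_mul (by have := (mem_Ioi.1 ht).le; positivity), mul_comm (ν _),
      ← mul_assoc, ← ENNReal.ofReal_mul (by positivity)]
    congr 2
    have ht' : (0 : ℝ) < t := ht
    rw [Real.rpow_sub_one ht'.ne' (q - 1)]
    field_simp
  rw [h3] at h2
  have hq1' : ENNReal.ofReal (q - 1) ≠ 0 := by simpa using hq
  refine (mul_le_mul' le_rfl hb).trans (le_of_eq ?_)
  have e : ENNReal.ofReal (2 * 3 ^ Fintype.card J * q / (q - 1) * 2 ^ (q - 1)) =
      ENNReal.ofReal q * ENNReal.ofReal (2 * 3 ^ Fintype.card J) *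
      (ENNReal.ofReal (q - 1))⁻¹ * ENNReal.ofReal (2 ^ (q - 1)) := by
    rw [← ENNReal.ofReal_inv_of_pos hq1, ← ENNReal.ofReal_mul (by linarith),
      ← ENNReal.ofReal_mul (by positivity), ← ENNReal.ofReal_mul (by positivity)]
    congr 1
    field_simp
  rw [e, mul_assoc _ (ENNReal.ofReal (2 ^ (q - 1))), h2, ← mul_assoc, mul_assoc _ (_)⁻¹,
    ← mul_assoc (_)⁻¹, ENNReal.inv_mul_cancel hq1' ENNReal.ofReal_ne_top, one_mul]

end Strong

section Extrapolation

variable {J : Type*} [Fintype J]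

lemma enorm_add_sq_le (a b : ℝ) : ‖a + b‖ₑ ^ 2 ≤ 2 * ‖a‖ₑ ^ 2 + 2 * ‖b‖ₑ ^ 2 := by
  rw [← ofReal_norm, ← ofReal_norm, ← ofReal_norm]
  simp only [Real.norm_eq_abs]
  rw [← ENNReal.ofReal_pow (abs_nonneg _), ← ENNReal.ofReal_pow (abs_nonneg _),
    ← ENNReal.ofReal_pow (abs_nonneg _), sq_abs, sq_abs, sq_abs,
    show (2 : ℝ≥0∞) = ENNReal.ofReal 2 by norm_num, ← ENNReal.ofReal_mul (by norm_num),
    ← ENNReal.ofReal_mul (by norm_num), ← ENNReal.ofReal_add (by positivity) (by positivity)]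
  exact ENNReal.ofReal_le_ofReal (by nlinarith [sq_nonneg (a - b)])

lemma count_cellMax_inter_maxCell_le [Nonempty J] (w : J → ℕ) (hw : ∀ j, 1 ≤ w j)
    (C₁ C₂ γ : ℝ≥0∞) (hγ : γ ≤ 1) (hC₁ : C₁ ≠ ∞) (hC₂ : C₂ ≠ ∞)
    (T : ((J → ℤ) → ℝ) → (J → ℤ) → ℝ)
    (hadd : ∀ f g : (J → ℤ) → ℝ, f.support.Finite → g.support.Finite → T (f + g) = T f + T g)
    (h1 : ∀ f : (J → ℤ) → ℝ, f.support.Finite →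
      ∫⁻ z, ‖T f z‖ₑ ^ 2 ∂Measure.count ≤ C₁ * ∫⁻ z, ‖f z‖ₑ ^ 2 ∂Measure.count)
    (h2 : ∀ f : (J → ℤ) → ℝ, f.support.Finite → ∀ k z₀,
      (∀ z ∈ cellNbd w 2 k (cellIdx w k z₀), f z = 0) →
      ∀ z ∈ cellNbd w 1 k (cellIdx w k z₀), ‖T f z‖ₑ ^ 2 * cellVol w k ≤
        C₂ * ∫⁻ y in cellNbd w 2 k (cellIdx w k z₀), ‖T f y‖ₑ ^ 2 ∂Measure.count)
    (f : (J → ℤ) → ℝ) (hf : f.support.Finite)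
    (hF : ∫⁻ z, ‖f z‖ₑ ^ 2 ∂Measure.count ≠ ∞)
    (t : ℝ≥0∞) (ht : t ≠ 0) (ht' : t ≠ ∞) (i : ℕ × (J → ℤ)) :
    Measure.count ({z | (1 + 4 * C₂ * (3 ^ (Fintype.card J) * 2 ^ (∑ j, w j)) * (1 + C₁)) * t <
        cellMax w (fun z => ‖T f z‖ₑ ^ 2) z ∧ cellMax w (fun z => ‖f z‖ₑ ^ 2) z ≤ γ * t} ∩
        maxCell w (fun k c => t * (3 ^ (Fintype.card J) * cellVol w k) <
          ∫⁻ y in cellNbd w 1 k c, ‖T f y‖ₑ ^ 2 ∂Measure.count) i) ≤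
      2 * 3 ^ (Fintype.card J) * C₁ * (3 ^ (Fintype.card J) * 2 ^ (∑ j, w j)) * γ *
      Measure.count (maxCell w (fun k c => t * (3 ^ (Fintype.card J) * cellVol w k) <
          ∫⁻ y in cellNbd w 1 k c, ‖T f y‖ₑ ^ 2 ∂Measure.count) i) := by
  classical
  set n3 : ℝ≥0∞ := 3 ^ (Fintype.card J) with hn3
  set D : ℝ≥0∞ := n3 * 2 ^ (∑ j, w j) with hD
  set P : ℕ → (J → ℤ) → Prop := fun k c => t * (n3 * cellVol w k) <
          ∫⁻ y in cellNbd w 1 k c, ‖T f y‖ₑ ^ 2 ∂Measure.count with hP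
  set K := 1 + 4 * C₂ * D * (1 + C₁) with hK
  set A := {z | K * t < cellMax w (fun z => ‖T f z‖ₑ ^ 2) z ∧
    cellMax w (fun z => ‖f z‖ₑ ^ 2) z ≤ γ * t} with hA
  have hn3t : n3 ≠ ∞ := ENNReal.pow_ne_top (by simp)
  have hDt : D ≠ ∞ := ENNReal.mul_ne_top hn3t (ENNReal.pow_ne_top (by simp))
  rcases (A ∩ maxCell w P i).eq_empty_or_nonempty with he | ⟨z₀, hz₀A, hz₀⟩
  · rw [he]; simp
  obtain ⟨k, c⟩ := i
  have hc : cellIdx w k z₀ = c := hz₀.1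
  have hmax : IsMaxCell w P k c := hz₀.2
  have hmc : maxCell w P (k, c) = cellNbd w 0 k c := by
    rw [cellNbd_zero]; ext z; simp [maxCell, hmax]
  have hV : Measure.count (maxCell w P (k, c)) = cellVol w k := by
    rw [hmc]; simpa using count_cellNbd w 0 k c
  rw [hV]
  set V := cellVol w k with hVdef
  have hVt : V ≠ ∞ := cellVol_ne_top w k
  set B2 := cellNbd w 2 k c with hB2
  have hB2sub : B2 ⊆ cellNbd w 1 (k + 1) (cellIdx w (k + 1) z₀) := by
    rw [hB2, ← hc]; exact cellNbd_two_subset w hw k z₀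
  have hV1 : n3 * cellVol w (k + 1) = D * V := by
    rw [cellVol_succ, hD]; ring
  have hFB : ∫⁻ y in B2, ‖T f y‖ₑ ^ 2 ∂Measure.count ≤ t * (D * V) := by
    have := hmax.2 (k + 1) (Nat.lt_succ_self k) z₀ hc
    rw [hP] at this
    rw [← hV1]
    exact (lintegral_mono_set hB2sub).trans (not_lt.1 this)
  have hgB : ∫⁻ y in B2, ‖f y‖ₑ ^ 2 ∂Measure.count ≤ γ * t * (D * V) := by
    rw [← hV1]
    exact (lintegral_mono_set hB2sub).trans
      (setLIntegral_le_of_cellMax_le w _ z₀ _ hz₀A.2 (k + 1))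
  set f1 := B2.indicator f with hf1
  set f2 := B2ᶜ.indicator f with hf2
  have hf1s : f1.support.Finite := hf.subset (by rw [hf1, support_indicator]; exact inter_subset_right)
  have hf2s : f2.support.Finite := hf.subset (by rw [hf2, support_indicator]; exact inter_subset_right)
  have hTf : T f = T f1 + T f2 := by
    rw [← hadd f1 f2 hf1s hf2s, hf1, hf2, indicator_self_add_compl]
  have hTf2 : T f2 = T f + T (-f1) := by
    have hneg : T f1 + T (-f1) = T 0 := by
      rw [← hadd _ _ hf1s (by rwa [Function.support_neg]), add_neg_cancel]
    have h0 : T 0 = 0 := by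
      have := hadd 0 0 (by simp) (by simp)
      simpa using this
    rw [hTf, add_right_comm, hneg, h0, zero_add]
  have hneg1 : ∀ z, ‖T (-f1) z‖ₑ = ‖T f1 z‖ₑ := by
    intro z
    have hneg : T f1 + T (-f1) = T 0 := by
      rw [← hadd _ _ hf1s (by rwa [Function.support_neg]), add_neg_cancel]
    have h0 : T 0 = 0 := by
      have := hadd 0 0 (by simp) (by simp)
      simpa using this
    have := congrFun (hneg.trans h0) z
    simp only [Pi.add_apply, Pi.zero_apply] at this
    rw [← enorm_neg, eq_neg_of_add_eq_zero_right this, neg_neg]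
  have hF1 : ∫⁻ z, ‖T f1 z‖ₑ ^ 2 ∂Measure.count ≤ C₁ * (γ * t * (D * V)) := by
    refine (h1 f1 hf1s).trans (mul_le_mul' le_rfl ?_)
    refine le_trans (le_of_eq ?_) hgB
    rw [← lintegral_indicator MeasurableSet.of_discrete]
    refine lintegral_congr fun z => ?_
    by_cases h : z ∈ B2 <;> simp [hf1, h]
  have hF1t : ∫⁻ z, ‖T f1 z‖ₑ ^ 2 ∂Measure.count ≠ ∞ := by
    refine ne_top_of_le_ne_top ?_ hF1
    exact ENNReal.mul_ne_top hC₁ (ENNReal.mul_ne_top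
      (ENNReal.mul_ne_top (ne_top_of_le_ne_top (by simp) hγ) ht') (ENNReal.mul_ne_top hDt hVt))
  have hF2 : ∫⁻ z in B2, ‖T f2 z‖ₑ ^ 2 ∂Measure.count ≤ 2 * (t * (D * V)) * (1 + C₁) := by
    calc ∫⁻ z in B2, ‖T f2 z‖ₑ ^ 2 ∂Measure.count
        ≤ ∫⁻ z in B2, (2 * ‖T f z‖ₑ ^ 2 + 2 * ‖T f1 z‖ₑ ^ 2) ∂Measure.count := by
          refine lintegral_mono fun z => ?_
          rw [hTf2, Pi.add_apply, ← hneg1 z]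
          exact enorm_add_sq_le _ _
      _ = 2 * ∫⁻ z in B2, ‖T f z‖ₑ ^ 2 ∂Measure.count +
          2 * ∫⁻ z in B2, ‖T f1 z‖ₑ ^ 2 ∂Measure.count := by
          rw [lintegral_add_left Measurable.of_discrete, lintegral_const_mul _ Measurable.of_discrete,
            lintegral_const_mul _ Measurable.of_discrete]
      _ ≤ 2 * (t * (D * V)) + 2 * (C₁ * (1 * t * (D * V))) := by
          gcongr
          refine (setLIntegral_le_lintegral _ _).trans (hF1.trans ?_)
          gcongr
      _ = _ := by ring
  have hF2p : ∀ z ∈ cellNbd w 1 k c, ‖T f2 z‖ₑ ^ 2 ≤ C₂ * (2 * (t * D) * (1 + C₁)) := by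
    intro z hz
    have := h2 f2 hf2s k z₀ (fun y hy => by rw [hc] at hy; simp [hf2, hB2, hy]) z (by rwa [hc])
    rw [hc] at this
    have h3 := this.trans (mul_le_mul' le_rfl hF2)
    rw [show C₂ * (2 * (t * (D * V)) * (1 + C₁)) = C₂ * (2 * (t * D) * (1 + C₁)) * V by ring] at h3
    exact (ENNReal.mul_le_mul_iff_left (cellVol_ne_zero w k) hVt).1 h3
  have hsub : A ∩ maxCell w P (k, c) ⊆ {z | t / 2 < cellMax w (fun z => ‖T f1 z‖ₑ ^ 2) z} := by
    rintro z ⟨hzA, hzQ⟩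
    obtain ⟨j, hj⟩ := (lt_cellMax_iff w _ z _).1 hzA.1
    have hjk : j ≤ k := by
      by_contra! h
      have h3 := hmax.2 j h z hzQ.1
      refine h3 (lt_of_le_of_lt ?_ hj)
      rw [hK, mul_assoc]
      exact le_mul_of_one_le_left zero_le le_self_add
    have hns : cellNbd w 1 j (cellIdx w j z) ⊆ cellNbd w 1 k c := by
      have := cellNbd_one_mono w hjk z
      rwa [show cellIdx w k z = c from hzQ.1] at this
    rw [mem_ofPred_eq, lt_cellMax_iff]
    refine ⟨j, ?_⟩
    set S := cellNbd w 1 j (cellIdx w j z) with hS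
    set U := n3 * cellVol w j with hU
    have hUt : U ≠ ∞ := tripleVol_ne_top w j
    have h5 : K * t * U < 2 * ∫⁻ y in S, ‖T f1 y‖ₑ ^ 2 ∂Measure.count +
        2 * (C₂ * (2 * (t * D) * (1 + C₁))) * U := by
      refine hj.trans_le ?_
      calc ∫⁻ y in S, ‖T f y‖ₑ ^ 2 ∂Measure.count
          ≤ ∫⁻ y in S, (2 * ‖T f1 y‖ₑ ^ 2 + 2 * (C₂ * (2 * (t * D) * (1 + C₁)))) ∂Measure.count := by
            refine setLIntegral_mono' MeasurableSet.of_discrete fun y hy => ?_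
            rw [hTf, Pi.add_apply]
            exact (enorm_add_sq_le _ _).trans (add_le_add le_rfl
              (mul_le_mul' le_rfl (hF2p y (hns hy))))
        _ = _ := by
            rw [lintegral_add_right _ measurable_const, setLIntegral_const,
              lintegral_const_mul _ Measurable.of_discrete, hS, count_cellNbd_one]
    have h6 : K * t * U = t * U + 2 * (C₂ * (2 * (t * D) * (1 + C₁))) * U := by rw [hK]; ring
    rw [h6] at h5
    have h7 := lt_of_add_lt_add_right h5
    have h8 : t * U = 2 * (t / 2 * U) := by
      rw [← mul_assoc 2 (t / 2) U, ENNReal.mul_div_cancel (by norm_num) (by norm_num)]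
    rw [h8] at h7
    exact (ENNReal.mul_lt_mul_iff_right (by norm_num) (by norm_num)).1 h7
  have ht2 : t / 2 ≠ 0 := by simp [ht]
  have ht2' : t / 2 ≠ ∞ := ENNReal.div_ne_top ht' (by norm_num)
  have h9 := count_lt_cellMax_le w hw _ hF1t (t / 2) ht2 ht2'
  have h10 : t / 2 * Measure.count (A ∩ maxCell w P (k, c)) ≤
      t / 2 * (2 * n3 * C₁ * D * γ * V) := by
    calc _ ≤ _ := mul_le_mul' le_rfl (measure_mono hsub)
      _ ≤ _ := h9
      _ ≤ n3 * (C₁ * (γ * t * (D * V))) := by gcongr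
      _ = n3 * (C₁ * (γ * (2 * (t / 2)) * (D * V))) := by
          rw [ENNReal.mul_div_cancel (by norm_num) (by norm_num)]
      _ = _ := by ring
  exact (ENNReal.mul_le_mul_iff_right ht2 ht2').1 h10

/-- Extrapolation of an `L²` bound to `L^{2q}`, `q > 1`, for an operator whose values are
controlled on a cell by their local `L²` average as soon as the datum vanishes nearby. -/
theorem extrapolation [Nonempty J] (w : J → ℕ) (hw : ∀ j, 1 ≤ w j)
    (C₁ C₂ : ℝ≥0∞) (hC₁ : C₁ ≠ ∞) (hC₂ : C₂ ≠ ∞) {q : ℝ} (hq : 1 < q) :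
    ∃ C : ℝ≥0∞, C ≠ ∞ ∧ ∀ T : ((J → ℤ) → ℝ) → (J → ℤ) → ℝ,
    (∀ f g : (J → ℤ) → ℝ, f.support.Finite → g.support.Finite → T (f + g) = T f + T g) →
    (∀ f : (J → ℤ) → ℝ, f.support.Finite →
      ∫⁻ z, ‖T f z‖ₑ ^ 2 ∂Measure.count ≤ C₁ * ∫⁻ z, ‖f z‖ₑ ^ 2 ∂Measure.count) →
    (∀ f : (J → ℤ) → ℝ, f.support.Finite → ∀ k z₀,
      (∀ z ∈ cellNbd w 2 k (cellIdx w k z₀), f z = 0) →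
      ∀ z ∈ cellNbd w 1 k (cellIdx w k z₀), ‖T f z‖ₑ ^ 2 * cellVol w k ≤
        C₂ * ∫⁻ y in cellNbd w 2 k (cellIdx w k z₀), ‖T f y‖ₑ ^ 2 ∂Measure.count) →
    ∀ f : (J → ℤ) → ℝ, f.support.Finite →
      ∫⁻ z, (‖T f z‖ₑ ^ 2) ^ q ∂Measure.count ≤ C * ∫⁻ z, (‖f z‖ₑ ^ 2) ^ q ∂Measure.count := by
  have hq0 : 0 < q := by linarith
  set n3 : ℝ≥0∞ := 3 ^ (Fintype.card J) with hn3
  set D : ℝ≥0∞ := n3 * 2 ^ (∑ j, w j) with hD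
  set K := 1 + 4 * C₂ * D * (1 + C₁) with hK
  have hn3t : n3 ≠ ∞ := ENNReal.pow_ne_top (by simp)
  have hDt : D ≠ ∞ := ENNReal.mul_ne_top hn3t (ENNReal.pow_ne_top (by simp))
  have hKt : K ≠ ∞ := by
    refine ENNReal.add_ne_top.2 ⟨by simp, ENNReal.mul_ne_top (ENNReal.mul_ne_top
      (ENNReal.mul_ne_top (by simp) hC₂) hDt) (ENNReal.add_ne_top.2 ⟨by simp, hC₁⟩)⟩
  have hK1 : 1 ≤ K := le_self_add
  have hKq1 : 1 ≤ K ^ q := ENNReal.one_le_rpow hK1 hq0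
  have hKqt : K ^ q ≠ ∞ := ENNReal.rpow_ne_top_of_nonneg hq0.le hKt
  set E := 2 * n3 * C₁ * D + 1 with hE
  have hEt : E ≠ ∞ := ENNReal.add_ne_top.2 ⟨ENNReal.mul_ne_top (ENNReal.mul_ne_top
      (ENNReal.mul_ne_top (by simp) hn3t) hC₁) hDt, by simp⟩
  have hE1 : 1 ≤ E := le_add_self
  set γ := (2 * K ^ q * E)⁻¹ with hγdef
  have hγ1 : γ ≤ 1 := by
    rw [hγdef, ENNReal.inv_le_one]
    exact one_le_mul (one_le_mul (by norm_num) hKq1) hE1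
  have hγt : γ ≠ ∞ := ne_top_of_le_ne_top (by simp) hγ1
  have hγ0 : γ ≠ 0 := by
    rw [hγdef, ENNReal.inv_ne_zero]
    exact ENNReal.mul_ne_top (ENNReal.mul_ne_top (by simp) hKqt) hEt
  have hε : E * γ = (2 * K ^ q)⁻¹ := by
    rw [hγdef, ENNReal.mul_inv (Or.inr hEt) (Or.inr (by positivity)), mul_comm, mul_assoc,
      ENNReal.inv_mul_cancel (by positivity) hEt, mul_one]
  set Cq := ENNReal.ofReal (2 * 3 ^ (Fintype.card J) * q / (q - 1) * 2 ^ (q - 1)) with hCq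
  refine ⟨n3 ^ q * (2 * K ^ q * ((γ⁻¹) ^ q * Cq)), ?_, ?_⟩
  · refine ENNReal.mul_ne_top (ENNReal.rpow_ne_top_of_nonneg hq0.le hn3t) (ENNReal.mul_ne_top
      (ENNReal.mul_ne_top (by simp) hKqt) (ENNReal.mul_ne_top
      (ENNReal.rpow_ne_top_of_nonneg hq0.le (by simpa using hγ0)) ENNReal.ofReal_ne_top))
  intro T hadd h1 h2 f hf
  set F : (J → ℤ) → ℝ≥0∞ := fun z => ‖T f z‖ₑ ^ 2 with hFdef
  set g : (J → ℤ) → ℝ≥0∞ := fun z => ‖f z‖ₑ ^ 2 with hgdef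
  have hg : ∫⁻ z, g z ∂Measure.count ≠ ∞ := by
    rw [lintegral_count, tsum_eq_sum (s := hf.toFinset)]
    · exact ENNReal.sum_ne_top.2 fun z _ => by simp [hgdef]
    · intro z hz
      have : f z = 0 := by simpa using hz
      simp [hgdef, this]
  have hF : ∫⁻ z, F z ∂Measure.count ≠ ∞ :=
    ne_top_of_le_ne_top (ENNReal.mul_ne_top hC₁ hg) (h1 f hf)
  have hgl : ∀ t : ℝ≥0∞, t ≠ 0 → t ≠ ∞ →
      Measure.count {z | t < K⁻¹ * cellMax w F z} ≤
      E * γ * Measure.count {z | t < cellMax w F z} +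
        Measure.count {z | t < γ⁻¹ * cellMax w g z} := by
    intro t ht ht'
    set P : ℕ → (J → ℤ) → Prop := fun k c => t * (n3 * cellVol w k) <
          ∫⁻ y in cellNbd w 1 k c, F y ∂Measure.count with hP
    set A := {z | K * t < cellMax w F z ∧ cellMax w g z ≤ γ * t} with hA
    have hsub : {z | t < K⁻¹ * cellMax w F z} ⊆ A ∪ {z | t < γ⁻¹ * cellMax w g z} := by
      intro z hz
      rw [mem_ofPred_eq, ← ENNReal.div_eq_inv_mul,
        ENNReal.lt_div_iff_mul_lt (Or.inl (by positivity)) (Or.inl hKt), mul_comm] at hz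
      by_cases h : cellMax w g z ≤ γ * t
      · exact Or.inl ⟨hz, h⟩
      · right
        rw [not_le, mul_comm] at h
        rw [mem_ofPred_eq, ← ENNReal.div_eq_inv_mul, ENNReal.lt_div_iff_mul_lt (Or.inl hγ0)
          (Or.inl hγt)]
        exact h
    obtain ⟨B, hB⟩ := exists_bound_cellVol w hw t ht _ hF
    have hun : {z | t < cellMax w F z} = ⋃ i, maxCell w P i := by
      rw [← iUnion_maxCell w P B (fun k c h => hB k ?_)]
      · ext z; exact lt_cellMax_iff w F z t
      · refine lt_of_le_of_lt ?_ (h.trans_le (setLIntegral_le_lintegral _ _))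
        gcongr
        exact le_mul_of_one_le_left zero_le (one_le_pow₀ (by norm_num))
    have hAs : A ⊆ ⋃ i, A ∩ maxCell w P i := by
      rw [← inter_iUnion, ← hun]
      refine fun z hz => ⟨hz, lt_of_le_of_lt ?_ hz.1⟩
      exact le_mul_of_one_le_left zero_le hK1
    calc _ ≤ Measure.count A + Measure.count {z | t < γ⁻¹ * cellMax w g z} :=
          (measure_mono hsub).trans (measure_union_le _ _)
      _ ≤ _ := by
        gcongr
        calc Measure.count A ≤ ∑' i, Measure.count (A ∩ maxCell w P i) :=
              (measure_mono hAs).trans (measure_iUnion_le _)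
          _ ≤ ∑' i, E * γ * Measure.count (maxCell w P i) := by
              refine ENNReal.tsum_le_tsum fun i => ?_
              refine (count_cellMax_inter_maxCell_le w hw C₁ C₂ γ hγ1 hC₁ hC₂ T hadd h1 h2 f hf hg
                t ht ht' i).trans ?_
              gcongr
              exact le_self_add
          _ = _ := by
              rw [ENNReal.tsum_mul_left, hun, measure_iUnion (maxCell_pairwise_disjoint w P)
                (fun _ => MeasurableSet.of_discrete)]
  have hMFt : ∀ z, cellMax w F z ≠ ∞ := fun z =>
    ne_top_of_le_ne_top hF (cellMax_le_lintegral w F z)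
  have hMgt : ∀ z, cellMax w g z ≠ ∞ := fun z =>
    ne_top_of_le_ne_top hg (cellMax_le_lintegral w g z)
  have hKi : K⁻¹ ≠ ∞ := by rw [ENNReal.inv_ne_top]; positivity
  have hγi : γ⁻¹ ≠ ∞ := by simpa using hγ0
  set X := ∫⁻ z, cellMax w F z ^ q ∂Measure.count with hX
  set Y := ∫⁻ z, cellMax w g z ^ q ∂Measure.count with hY
  have hmain : (K ^ q)⁻¹ * X ≤ (2 * K ^ q)⁻¹ * X + γ⁻¹ ^ q * Y := by
    have e1 := lintegral_rpow_eq_layercake Measure.count (fun z => K⁻¹ * cellMax w F z)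
      (fun z => ENNReal.mul_ne_top hKi (hMFt z)) hq0
    have e2 := lintegral_rpow_eq_layercake Measure.count (fun z => cellMax w F z) hMFt hq0
    have e3 := lintegral_rpow_eq_layercake Measure.count (fun z => γ⁻¹ * cellMax w g z)
      (fun z => ENNReal.mul_ne_top hγi (hMgt z)) hq0
    simp only [ENNReal.mul_rpow_of_nonneg _ _ hq0.le] at e1 e3
    rw [lintegral_const_mul _ Measurable.of_discrete] at e1 e3
    rw [ENNReal.inv_rpow] at e1
    rw [e1, hX, hY, e3, e2, mul_left_comm, ← mul_add]
    refine mul_le_mul' le_rfl ?_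
    rw [← hε, ← lintegral_const_mul' _ _ (ENNReal.mul_ne_top hEt hγt), ]
    have hmeas : Measurable fun t : ℝ => Measure.count {z | ENNReal.ofReal t < γ⁻¹ * cellMax w g z} *
        ENNReal.ofReal (t ^ (q - 1)) := by
      refine Measurable.mul ?_ (by fun_prop)
      have hanti : Antitone fun t : ℝ =>
          Measure.count {z | ENNReal.ofReal t < γ⁻¹ * cellMax w g z} := fun a b hab =>
        measure_mono fun z (hz : _ < _) => lt_of_le_of_lt (ENNReal.ofReal_le_ofReal hab) hz
      exact hanti.measurable
    rw [← lintegral_add_right _ hmeas]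
    refine setLIntegral_mono' measurableSet_Ioi fun t ht => ?_
    rw [← mul_assoc, ← add_mul]
    exact mul_le_mul' (hgl _ (by simpa using ht) ENNReal.ofReal_ne_top) le_rfl
  have hXt : X ≠ ∞ := by
    refine ne_top_of_le_ne_top (ENNReal.mul_ne_top ENNReal.ofReal_ne_top ?_)
      (lintegral_cellMax_rpow_le w hw hq F hF)
    refine ne_top_of_le_ne_top (ENNReal.mul_ne_top (ENNReal.rpow_ne_top_of_nonneg
      (by linarith : 0 ≤ q - 1) hF) hF) ?_
    · rw [← lintegral_const_mul _ Measurable.of_discrete]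
      refine lintegral_mono fun z => ?_
      have hz : F z ≤ ∫⁻ y, F y ∂Measure.count := by
        rw [lintegral_count]; exact ENNReal.le_tsum z
      calc F z ^ q = F z ^ (q - 1) * F z := by
            by_cases h0 : F z = 0
            · simp [h0, hq0]
            · nth_rewrite 3 [← ENNReal.rpow_one (F z)]
              rw [← ENNReal.rpow_add _ _ h0 (ne_top_of_le_ne_top hF hz)]; congr 1; ring
        _ ≤ _ := by gcongr
  have hX2 : X ≤ 2 * K ^ q * (γ⁻¹ ^ q * Y) := by
    have h2Kt : 2 * K ^ q ≠ ∞ := ENNReal.mul_ne_top (by simp) hKqt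
    have h := mul_le_mul' (le_refl (2 * K ^ q)) hmain
    rw [mul_add, ← mul_assoc, ← mul_assoc, ENNReal.mul_inv_cancel (by positivity) h2Kt,
      mul_assoc 2, ENNReal.mul_inv_cancel (by positivity) hKqt, mul_one, one_mul, two_mul] at h
    exact (ENNReal.add_le_add_iff_left hXt).1 h
  calc ∫⁻ z, F z ^ q ∂Measure.count
      ≤ ∫⁻ z, n3 ^ q * cellMax w F z ^ q ∂Measure.count := by
        refine lintegral_mono fun z => ?_
        rw [← ENNReal.mul_rpow_of_nonneg _ _ hq0.le]
        exact ENNReal.rpow_le_rpow (le_cellMax w F z) hq0.le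
    _ = n3 ^ q * X := lintegral_const_mul _ Measurable.of_discrete
    _ ≤ n3 ^ q * (2 * K ^ q * (γ⁻¹ ^ q * (Cq * ∫⁻ z, g z ^ q ∂Measure.count))) := by
        refine mul_le_mul' le_rfl (hX2.trans ?_)
        exact mul_le_mul' le_rfl (mul_le_mul' le_rfl (lintegral_cellMax_rpow_le w hw hq g hg))
    _ = _ := by ring

end Extrapolation

section FiniteSums

open Function

attribute [fun_prop] Function.Injective

@[fun_prop]
lemma injective_fun_add {G : Type*} [AddGroup G] {g : G → G} (hg : Injective g) (v : G) :
    Injective (fun z : G => g z + v) := (add_left_injective v).comp hg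

@[fun_prop]
lemma injective_fun_sub {G : Type*} [AddGroup G] {g : G → G} (hg : Injective g) (v : G) :
    Injective (fun z : G => g z - v) := (sub_left_injective (b := v)).comp hg

@[fun_prop]
lemma injective_fun_id {G : Type*} : Injective (fun z : G => z) := injective_id

@[fun_prop]
lemma hasFiniteSupport_abs {G : Type*} {f : G → ℝ} (hf : f.HasFiniteSupport) :
    (fun z => |f z|).HasFiniteSupport :=
  Set.Finite.subset hf fun x => by simp

@[fun_prop]
lemma hasFiniteSupport_sum {G κ : Type*} (s : Finset κ) {f : κ → G → ℝ}
    (hf : ∀ i, (f i).HasFiniteSupport) : (fun z => ∑ i ∈ s, f i z).HasFiniteSupport := by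
  classical
  induction s using Finset.induction_on with
  | empty => simp only [Finset.sum_empty]; fun_prop
  | insert a s h ih => simp only [Finset.sum_insert h]; fun_prop

@[fun_prop]
lemma hasFiniteSupport_pow {G : Type*} {f : G → ℝ} (hf : f.HasFiniteSupport) (n : ℕ) [NeZero n] :
    (fun z => f z ^ n).HasFiniteSupport :=
  Set.Finite.subset hf fun x => by simp [NeZero.ne n]

@[fun_prop]
lemma hasFiniteSupport_mul_left {G : Type*} {f : G → ℝ} (hf : f.HasFiniteSupport) (g : G → ℝ) :
    (fun z => g z * f z).HasFiniteSupport :=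
  Set.Finite.subset hf fun x => by simp

@[fun_prop]
lemma hasFiniteSupport_mul_right {G : Type*} {f : G → ℝ} (hf : f.HasFiniteSupport) (g : G → ℝ) :
    (fun z => f z * g z).HasFiniteSupport :=
  Set.Finite.subset hf fun x => by simp; tauto

lemma summable_fs {G : Type*} {f : G → ℝ} (hf : f.HasFiniteSupport) : Summable f :=
  summable_of_hasFiniteSupport hf

lemma tsum_shift {G : Type*} [AddGroup G] (f : G → ℝ) (v : G) :
    ∑' z, f (z + v) = ∑' z, f z := (Equiv.addRight v).tsum_eq f

lemma tsum_shift' {G : Type*} [AddGroup G] (f : G → ℝ) (v : G) :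
    ∑' z, f (z - v) = ∑' z, f z := (Equiv.subRight v).tsum_eq f

lemma tsum_add_fs {G : Type*} {f g : G → ℝ} (hf : f.HasFiniteSupport) (hg : g.HasFiniteSupport) :
    ∑' z, (f z + g z) = ∑' z, f z + ∑' z, g z :=
  (summable_fs hf).tsum_add (summable_fs hg)

lemma tsum_sub_fs {G : Type*} {f g : G → ℝ} (hf : f.HasFiniteSupport) (hg : g.HasFiniteSupport) :
    ∑' z, (f z - g z) = ∑' z, f z - ∑' z, g z :=
  (summable_fs hf).tsum_sub (summable_fs hg)

lemma tsum_sum_fs {G κ : Type*} {s : Finset κ} {f : κ → G → ℝ}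
    (hf : ∀ i, (f i).HasFiniteSupport) :
    ∑' z, ∑ i ∈ s, f i z = ∑ i ∈ s, ∑' z, f i z :=
  Summable.tsum_finsetSum fun i _ => summable_fs (hf i)

lemma tsum_le_fs {G : Type*} {f g : G → ℝ} (h : ∀ z, f z ≤ g z)
    (hf : f.HasFiniteSupport) (hg : g.HasFiniteSupport) : ∑' z, f z ≤ ∑' z, g z :=
  (summable_fs hf).tsum_le_tsum h (summable_fs hg)

lemma tsum_telescope {G : Type*} [AddGroup G] {H : G → ℝ} (hH : H.HasFiniteSupport) (v : G) :
    ∑' z, (H z - H (z - v)) = 0 := by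
  rw [tsum_sub_fs hH (by fun_prop), tsum_shift', sub_self]

end FiniteSums

abbrev Grd (ι : Type*) := Option ι → ℤ

section Operator

variable {ι : Type*}

/-- Unit vector of the lattice. -/
def ev (j : Option ι) : Grd ι := by classical exact Pi.single j 1

/-- Forward difference. -/
def dp (j : Option ι) (f : Grd ι → ℝ) (z : Grd ι) : ℝ := f (z + ev j) - f z

@[fun_prop]
lemma hasFiniteSupport_dp (j : Option ι) {f : Grd ι → ℝ} (hf : f.HasFiniteSupport) :
    (fun z => dp j f z).HasFiniteSupport := by
  unfold dp; fun_prop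

/-- Discrete parabolic operator in divergence form. -/
structure LOp (ι : Type*) where
  A : Grd ι → ℝ
  C : Grd ι → ℝ
  a : ι → ι → Grd ι → ℝ
  lam : ℝ
  τ : Grd ι

variable [Fintype ι]

def LOp.app (L : LOp ι) (u : Grd ι → ℝ) (z : Grd ι) : ℝ :=
  L.A z * (u z - u (z - L.τ)) + L.lam * L.C z * u z -
    ∑ i, (∑ j, L.a i j z * dp (some j) u z -
      ∑ j, L.a i j (z - ev (some i)) * dp (some j) u (z - ev (some i)))

/-- Ellipticity, boundedness and invariance in the directions of `S`. -/
structure LOp.OK (L : LOp ι) (ν : ℝ) (S : Set (Option ι)) : Prop where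
  A_lo : ∀ z, ν ≤ L.A z
  A_hi : ∀ z, L.A z ≤ ν⁻¹
  C_lo : ∀ z, ν ≤ L.C z
  C_hi : ∀ z, L.C z ≤ ν⁻¹
  a_hi : ∀ i j z, |L.a i j z| ≤ ν⁻¹
  ell : ∀ z (ξ : ι → ℝ), ν * ∑ i, ξ i ^ 2 ≤ ∑ i, ∑ j, L.a i j z * ξ j * ξ i
  lam_pos : 0 < L.lam
  lam_le : L.lam ≤ 1
  tau : L.τ = ev none ∨ L.τ = -ev none
  A_inv : ∀ k ∈ S, ∀ z, L.A (z + ev k) = L.A z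
  C_inv : ∀ k ∈ S, ∀ z, L.C (z + ev k) = L.C z
  a_inv : ∀ k ∈ S, ∀ i j z, L.a i j (z + ev k) = L.a i j z
  none_mem : none ∈ S

lemma LOp.OK.A_tau {L : LOp ι} {ν : ℝ} {S : Set (Option ι)} (h : L.OK ν S) (z : Grd ι) :
    L.A (z + L.τ) = L.A z := by
  rcases h.tau with h1 | h1
  · rw [h1, h.A_inv _ h.none_mem]
  · rw [h1, ← h.A_inv _ h.none_mem (z + -ev none)]; simp

lemma LOp.OK.A_tau' {L : LOp ι} {ν : ℝ} {S : Set (Option ι)} (h : L.OK ν S) (z : Grd ι) :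
    L.A (z - L.τ) = L.A z := by
  rw [← h.A_tau (z - L.τ), sub_add_cancel]

lemma LOp.OK.C_tau {L : LOp ι} {ν : ℝ} {S : Set (Option ι)} (h : L.OK ν S) (z : Grd ι) :
    L.C (z + L.τ) = L.C z := by
  rcases h.tau with h1 | h1
  · rw [h1, h.C_inv _ h.none_mem]
  · rw [h1, ← h.C_inv _ h.none_mem (z + -ev none)]; simp

lemma LOp.OK.a_tau {L : LOp ι} {ν : ℝ} {S : Set (Option ι)} (h : L.OK ν S) (i j) (z : Grd ι) :
    L.a i j (z + L.τ) = L.a i j z := by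
  rcases h.tau with h1 | h1
  · rw [h1, h.a_inv _ h.none_mem]
  · rw [h1, ← h.a_inv _ h.none_mem _ _ (z + -ev none)]; simp

lemma LOp.app_pair (L : LOp ι) (u φ : Grd ι → ℝ) (hφ : φ.HasFiniteSupport) :
    ∑' z, L.app u z * φ z = ∑' z, (L.A z * (u z - u (z - L.τ)) * φ z + L.lam * L.C z * u z * φ z
      + ∑ i, ∑ j, L.a i j z * dp (some j) u z * dp (some i) φ z) := by
  have key : ∀ z, L.app u z * φ z = (L.A z * (u z - u (z - L.τ)) * φ z + L.lam * L.C z * u z * φ z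
      + ∑ i, ∑ j, L.a i j z * dp (some j) u z * dp (some i) φ z)
      - ∑ i, ((∑ j, L.a i j z * dp (some j) u z) * φ (z + ev (some i))
        - (∑ j, L.a i j (z - ev (some i)) * dp (some j) u (z - ev (some i))) *
          φ (z - ev (some i) + ev (some i))) := by
    intro z
    simp only [sub_add_cancel]
    have : (∑ i, (∑ j, L.a i j z * dp (some j) u z -
      ∑ j, L.a i j (z - ev (some i)) * dp (some j) u (z - ev (some i)))) * φ z =
      - (∑ i, ∑ j, L.a i j z * dp (some j) u z * dp (some i) φ z) +
      ∑ i, ((∑ j, L.a i j z * dp (some j) u z) * φ (z + ev (some i))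
        - (∑ j, L.a i j (z - ev (some i)) * dp (some j) u (z - ev (some i))) * φ z) := by
      rw [← Finset.sum_neg_distrib, ← Finset.sum_add_distrib, Finset.sum_mul]
      refine Finset.sum_congr rfl fun i _ => ?_
      rw [← Finset.sum_mul]
      simp only [dp]
      ring
    rw [LOp.app]
    linear_combination -this
  simp_rw [key]
  rw [tsum_sub_fs (by fun_prop) (by fun_prop), tsum_sum_fs (fun i => by fun_prop),
    sub_eq_self]
  refine Finset.sum_eq_zero fun i _ => ?_
  exact tsum_telescope (H := fun z => (∑ j, L.a i j z * dp (some j) u z) * φ (z + ev (some i)))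
    (by fun_prop) (ev (some i))

end Operator

section Caccioppoli

variable {ι : Type*} [Fintype ι]

lemma caccioppoli_cross (M θ a ψ δ w wi wj Q Qi Qj : ℝ) (hθ : 0 < θ) (ha : |a| ≤ M)
    (hQ : δ ^ 2 ≤ Q) (hQi : δ ^ 2 ≤ Qi) (hQj : δ ^ 2 ≤ Qj) :
    -(a * (wj - w) * ((2 * ψ * δ + δ ^ 2) * wi)) ≤
      M * (θ * (ψ ^ 2 * (wj - w) ^ 2)) +
        (M * (θ⁻¹ + 1) * (Qi * wi ^ 2) + M * (Qj * wj ^ 2) + M * (Q * w ^ 2)) := by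
  have hM : 0 ≤ M := (abs_nonneg a).trans ha
  set X := (wj - w) * ((2 * ψ * δ + δ ^ 2) * wi) with hX
  have h1 : |X| ≤ θ * (ψ ^ 2 * (wj - w) ^ 2) + ((θ⁻¹ + 1) * (Qi * wi ^ 2) + Qj * wj ^ 2
      + Q * w ^ 2) := by
    have e1 : θ⁻¹ * (δ ^ 2 * wi ^ 2) ≤ θ⁻¹ * (Qi * wi ^ 2) := by gcongr
    have e2 : δ ^ 2 * wi ^ 2 ≤ Qi * wi ^ 2 := by gcongr
    have e3 : δ ^ 2 * wj ^ 2 ≤ Qj * wj ^ 2 := by gcongr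
    have e4 : δ ^ 2 * w ^ 2 ≤ Q * w ^ 2 := by gcongr
    have e5 : |2 * (ψ * (wj - w)) * (δ * wi)| ≤ θ * (ψ ^ 2 * (wj - w) ^ 2) +
        θ⁻¹ * (δ ^ 2 * wi ^ 2) := by
      have hs : θ * (ψ * (wj - w)) ^ 2 + θ⁻¹ * (δ * wi) ^ 2
          - |2 * (ψ * (wj - w)) * (δ * wi)| =
          θ⁻¹ * (θ * |ψ * (wj - w)| - |δ * wi|) ^ 2 := by
        rw [← sq_abs (ψ * (wj - w)), ← sq_abs (δ * wi), abs_mul (2 * _), abs_mul 2, abs_two]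
        field_simp
        ring
      have : 0 ≤ θ⁻¹ * (θ * |ψ * (wj - w)| - |δ * wi|) ^ 2 := by positivity
      nlinarith
    have e6 : |δ ^ 2 * ((wj - w) * wi)| ≤ δ ^ 2 * (wi ^ 2 + wj ^ 2 + w ^ 2) := by
      rw [abs_mul, abs_of_nonneg (sq_nonneg δ)]
      gcongr
      rw [abs_le]
      constructor <;> nlinarith [sq_nonneg (wj - w - wi), sq_nonneg (wj - w + wi),
        sq_nonneg (wj + w)]
    have : X = 2 * (ψ * (wj - w)) * (δ * wi) + δ ^ 2 * ((wj - w) * wi) := by rw [hX]; ring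
    rw [this]
    refine (abs_add_le _ _).trans ?_
    linarith
  have h2 : -(a * (wj - w) * ((2 * ψ * δ + δ ^ 2) * wi)) ≤ M * |X| := by
    have : -(a * (wj - w) * ((2 * ψ * δ + δ ^ 2) * wi)) = -(a * X) := by rw [hX]; ring
    rw [this]
    refine (neg_le_abs _).trans ?_
    rw [abs_mul]
    gcongr
  refine h2.trans ((mul_le_mul_of_nonneg_left h1 hM).trans (le_of_eq (by ring)))

theorem caccioppoli (ν : ℝ) (hν : 0 < ν) : ∃ K : ℝ, 0 < K ∧ ∀ (L : LOp ι) (S : Set (Option ι)),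
    L.OK ν S → ∀ w ψ Q : Grd ι → ℝ, w.HasFiniteSupport →
    (∀ z, ψ z ≠ 0 → L.app w z = 0) →
    (∀ z i, dp (some i) ψ z ^ 2 ≤ Q z) →
    (∀ z i j, dp (some i) ψ z ^ 2 ≤ Q (z + ev (some j))) →
    (∀ z, |ψ (z + L.τ) ^ 2 - ψ z ^ 2| ≤ Q z) →
    ∑' z, ψ z ^ 2 * (∑ j, dp (some j) w z ^ 2 + L.lam * w z ^ 2) ≤ K * ∑' z, Q z * w z ^ 2 := by
  set n : ℝ := (Fintype.card ι : ℝ) with hn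
  have hn0 : 0 ≤ n := Nat.cast_nonneg _
  set M := ν⁻¹ with hM
  have hM0 : 0 < M := inv_pos.2 hν
  set θ := ν / (2 * M * (n + 1)) with hθ
  have hθ0 : 0 < θ := by positivity
  set K₀ := M / 2 + n * n * (M * (θ⁻¹ + 3)) with hK₀
  have hK₀0 : 0 < K₀ := by positivity
  refine ⟨2 * M * K₀, by positivity, ?_⟩
  intro L S hL w ψ Q hw hP hQ1 hQ2 hQ3
  have hQ0 : ∀ z, 0 ≤ Q z := fun z => (abs_nonneg _).trans (hQ3 z)
  have e0 := L.app_pair w (fun z => ψ z ^ 2 * w z) (by fun_prop)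
  have e1 : ∀ z, L.app w z * (ψ z ^ 2 * w z) = 0 := by
    intro z
    by_cases h : ψ z = 0
    · simp [h]
    · simp [hP z h]
  simp only [e1, tsum_zero] at e0
  set R : ι → ι → Grd ι → ℝ := fun i j z =>
    M * (θ⁻¹ + 1) * (Q (z + ev (some i)) * w (z + ev (some i)) ^ 2) +
    M * (Q (z + ev (some j)) * w (z + ev (some j)) ^ 2) + M * (Q z * w z ^ 2) with hR
  set G : Grd ι → ℝ := fun z => L.A z / 2 * ψ z ^ 2 * w (z - L.τ) ^ 2 with hG
  have hpt : ∀ z, ν / 2 * (ψ z ^ 2 * (∑ j, dp (some j) w z ^ 2 + L.lam * w z ^ 2)) ≤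
      ((L.A z * (w z - w (z - L.τ)) * (ψ z ^ 2 * w z) + L.lam * L.C z * w z * (ψ z ^ 2 * w z)
      + ∑ i, ∑ j, L.a i j z * dp (some j) w z * dp (some i) (fun z => ψ z ^ 2 * w z) z)
      + (M / 2 * (Q z * w z ^ 2) + ∑ i, ∑ j, R i j z)) - (G (z + L.τ) - G z) := by
    intro z
    have t1 : L.A z / 2 * ψ z ^ 2 * (w z ^ 2 - w (z - L.τ) ^ 2) ≤
        L.A z * (w z - w (z - L.τ)) * (ψ z ^ 2 * w z) := by
      have := mul_nonneg (mul_nonneg (hν.le.trans (hL.A_lo z)) (sq_nonneg (ψ z)))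
        (sq_nonneg (w z - w (z - L.τ)))
      nlinarith
    have t2 : -(M / 2 * (Q z * w z ^ 2)) + (G (z + L.τ) - G z) ≤
        L.A z / 2 * ψ z ^ 2 * (w z ^ 2 - w (z - L.τ) ^ 2) := by
      have e : L.A z / 2 * ψ z ^ 2 * (w z ^ 2 - w (z - L.τ) ^ 2) =
          -(L.A z / 2 * ((ψ (z + L.τ) ^ 2 - ψ z ^ 2) * w z ^ 2)) + (G (z + L.τ) - G z) := by
        simp only [hG, hL.A_tau, add_sub_cancel_right]
        ring
      rw [e]
      have h1 : (ψ (z + L.τ) ^ 2 - ψ z ^ 2) * w z ^ 2 ≤ Q z * w z ^ 2 := by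
        gcongr
        exact (le_abs_self _).trans (hQ3 z)
      have h2 : L.A z / 2 * ((ψ (z + L.τ) ^ 2 - ψ z ^ 2) * w z ^ 2) ≤ M / 2 * (Q z * w z ^ 2) := by
        have hA := hL.A_lo z
        refine (mul_le_mul_of_nonneg_left h1 (by linarith)).trans ?_
        refine mul_le_mul_of_nonneg_right ?_ (mul_nonneg (hQ0 z) (sq_nonneg _))
        linarith [hL.A_hi z]
      linarith
    have t3 : ν * (ψ z ^ 2 * (L.lam * w z ^ 2)) ≤ L.lam * L.C z * w z * (ψ z ^ 2 * w z) := by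
      have := mul_le_mul_of_nonneg_right (hL.C_lo z)
        (mul_nonneg (sq_nonneg (ψ z)) (mul_nonneg hL.lam_pos.le (sq_nonneg (w z))))
      linarith
    have t4 : ν * (ψ z ^ 2 * ∑ j, dp (some j) w z ^ 2) ≤
        ψ z ^ 2 * ∑ i, ∑ j, L.a i j z * dp (some j) w z * dp (some i) w z := by
      have := mul_le_mul_of_nonneg_left (hL.ell z fun j => dp (some j) w z) (sq_nonneg (ψ z))
      linarith
    have t5 : ∑ i, ∑ j, L.a i j z * dp (some j) w z * dp (some i) (fun z => ψ z ^ 2 * w z) z =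
        ψ z ^ 2 * ∑ i, ∑ j, L.a i j z * dp (some j) w z * dp (some i) w z +
        ∑ i, ∑ j, L.a i j z * (w (z + ev (some j)) - w z) *
          ((2 * ψ z * dp (some i) ψ z + dp (some i) ψ z ^ 2) * w (z + ev (some i))) := by
      simp only [Finset.mul_sum, ← Finset.sum_add_distrib]
      refine Finset.sum_congr rfl fun i _ => Finset.sum_congr rfl fun j _ => ?_
      simp only [dp]
      ring
    have t6 : -∑ i, ∑ j, L.a i j z * (w (z + ev (some j)) - w z) *
          ((2 * ψ z * dp (some i) ψ z + dp (some i) ψ z ^ 2) * w (z + ev (some i))) ≤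
        ν / 2 * (ψ z ^ 2 * ∑ j, dp (some j) w z ^ 2) + ∑ i, ∑ j, R i j z := by
      have : ∑ i : ι, ∑ j : ι, M * (θ * (ψ z ^ 2 * dp (some j) w z ^ 2)) ≤
          ν / 2 * (ψ z ^ 2 * ∑ j, dp (some j) w z ^ 2) := by
        rw [Finset.sum_const, Finset.card_univ, nsmul_eq_mul, ← hn, ← Finset.mul_sum,
          ← Finset.mul_sum, ← Finset.mul_sum, ← mul_assoc, ← mul_assoc]
        refine mul_le_mul_of_nonneg_right ?_ (by positivity)
        rw [hθ]
        have : n * M * (ν / (2 * M * (n + 1))) = ν / 2 * (n / (n + 1)) := by field_simp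
        rw [this]
        have : n / (n + 1) ≤ 1 := by rw [div_le_one (by positivity)]; linarith
        nlinarith
      refine le_trans ?_ (add_le_add_left this _)
      simp only [← Finset.sum_neg_distrib, ← Finset.sum_add_distrib]
      refine Finset.sum_le_sum fun i _ => Finset.sum_le_sum fun j _ => ?_
      exact caccioppoli_cross M θ _ _ _ _ _ _ _ _ _ hθ0 (hL.a_hi i j z) (hQ1 z i) (hQ2 z i i)
        (hQ2 z i j)
    have t7 : 0 ≤ ν / 2 * (ψ z ^ 2 * (L.lam * w z ^ 2)) := by
      have := hL.lam_pos
      positivity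
    rw [t5, mul_add (ψ z ^ 2), mul_add]
    linarith
  have hRs : ∑' z, ∑ i, ∑ j, R i j z = n * n * (M * (θ⁻¹ + 3)) * ∑' z, Q z * w z ^ 2 := by
    have : ∀ i j, ∑' z, R i j z = M * (θ⁻¹ + 3) * ∑' z, Q z * w z ^ 2 := by
      intro i j
      simp only [hR]
      rw [tsum_add_fs (by fun_prop) (by fun_prop), tsum_add_fs (by fun_prop) (by fun_prop),
        tsum_mul_left, tsum_mul_left, tsum_mul_left,
        tsum_shift (fun z => Q z * w z ^ 2), tsum_shift (fun z => Q z * w z ^ 2)]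
      ring
    rw [tsum_sum_fs (fun i => by fun_prop)]
    have h2 : ∀ i, ∑' z, ∑ j, R i j z = ∑ j, ∑' z, R i j z := fun i =>
      tsum_sum_fs (fun j => by fun_prop)
    simp_rw [h2, this]
    simp only [Finset.sum_const, Finset.card_univ, nsmul_eq_mul, ← hn]
    ring
  have hsum := tsum_le_fs hpt (by fun_prop) (by fun_prop)
  rw [tsum_mul_left, tsum_sub_fs (by fun_prop) (by fun_prop),
    tsum_add_fs (by fun_prop) (by fun_prop), ← e0, tsum_sub_fs (by fun_prop) (by fun_prop),
    tsum_shift G, sub_self, tsum_add_fs (by fun_prop) (by fun_prop), tsum_mul_left, hRs] at hsum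
  have h5 : ν / 2 * ∑' z, ψ z ^ 2 * (∑ j, dp (some j) w z ^ 2 + L.lam * w z ^ 2) ≤
      K₀ * ∑' z, Q z * w z ^ 2 := by
    rw [hK₀]; linarith
  have h6 := mul_le_mul_of_nonneg_left h5 (show 0 ≤ 2 * M by positivity)
  have h7 : 2 * M * (ν / 2) = 1 := by rw [hM]; field_simp
  rw [← mul_assoc, h7, one_mul, ← mul_assoc] at h6
  exact h6

end Caccioppoli

section TimeDerivative

variable {ι : Type*} [Fintype ι]

lemma two_mul_abs_le_weighted (θ x y : ℝ) (hθ : 0 < θ) :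
    2 * |x * y| ≤ θ * x ^ 2 + θ⁻¹ * y ^ 2 := by
  have hs : θ * x ^ 2 + θ⁻¹ * y ^ 2 - 2 * |x * y| = θ⁻¹ * (θ * |x| - |y|) ^ 2 := by
    rw [← sq_abs x, ← sq_abs y, abs_mul]
    field_simp
    ring
  have : 0 ≤ θ⁻¹ * (θ * |x| - |y|) ^ 2 := by positivity
  linarith

lemma abs_pow_sub_pow_le_of_abs_sub_le (n : ℕ) {x y s : ℝ} (hx : 0 ≤ x) (hy : 0 ≤ y)
    (hs : |y - x| ≤ s) : |y ^ n - x ^ n| ≤ n * s * (x + s) ^ (n - 1) := by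
  have h1 : y ≤ x + s := by linarith [le_abs_self (y - x)]
  have hs0 : 0 ≤ s := (abs_nonneg _).trans hs
  rcases n with _ | n
  · simp
  have hf : y ^ (n + 1) - x ^ (n + 1) = (∑ i ∈ Finset.range (n + 1), y ^ i * x ^ (n - i)) * (y - x) := by
    have := (Commute.all y x).geom_sum₂_mul (n + 1)
    simpa using this.symm
  rw [hf, abs_mul]
  have h2 : |∑ i ∈ Finset.range (n + 1), y ^ i * x ^ (n - i)| ≤ (n + 1 : ℕ) * (x + s) ^ n := by
    rw [abs_of_nonneg (Finset.sum_nonneg fun i _ => by positivity)]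
    have : ∀ i ∈ Finset.range (n + 1), y ^ i * x ^ (n - i) ≤ (x + s) ^ n := by
      intro i hi
      have hi' : i ≤ n := by simpa [Nat.lt_succ_iff] using hi
      calc y ^ i * x ^ (n - i) ≤ (x + s) ^ i * (x + s) ^ (n - i) := by
            gcongr
            linarith
        _ = (x + s) ^ n := by rw [← pow_add, Nat.add_sub_cancel' hi']
    refine (Finset.sum_le_sum this).trans ?_
    simp
  calc _ ≤ ((n + 1 : ℕ) * (x + s) ^ n) * s := by gcongr
    _ = _ := by simp; ring

lemma timeDerivative_cross (M θ κ a g η η' v v' : ℝ) (hθ : 0 < θ) (hκ : 0 < κ) (ha : |a| ≤ M)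
    (hη : 0 ≤ η) (hη' : 0 ≤ η') (hd : |η' - η| ≤ κ) :
    -(a * g * (η' ^ 4 * v' - η ^ 4 * v)) ≤
      M * θ * κ⁻¹ ^ 2 * (η ^ 6 * (v' - v) ^ 2) +
      (M * θ * (8 * (η' ^ 4 * v' ^ 2) + 128 * κ ^ 4 * v' ^ 2) +
      M * θ⁻¹ * (9 * κ ^ 2 * (η ^ 2 * g ^ 2) + 8 * κ ^ 4 * g ^ 2)) := by
  have hM : 0 ≤ M := (abs_nonneg a).trans ha
  have h1 := two_mul_abs_le_weighted θ (κ⁻¹ * (η ^ 3 * (v' - v))) (κ * (η * g)) hθ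
  have h2 := two_mul_abs_le_weighted θ ((η' + 2 * κ) ^ 2 * v') (2 * κ * ((η + κ) * g)) hθ
  have e1 : κ⁻¹ * (η ^ 3 * (v' - v)) * (κ * (η * g)) = η ^ 4 * (v' - v) * g := by
    field_simp
  rw [e1] at h1
  have h3 := abs_pow_sub_pow_le_of_abs_sub_le 4 hη hη' hd
  have h4 : |(η' ^ 4 - η ^ 4) * v' * g| ≤
      2 * |(η' + 2 * κ) ^ 2 * v' * (2 * κ * ((η + κ) * g))| := by
    have hle : η + κ ≤ η' + 2 * κ := by linarith [neg_le_abs (η' - η)]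
    have h5 : (η + κ) ^ 3 ≤ (η' + 2 * κ) ^ 2 * (η + κ) := by
      calc (η + κ) ^ 3 = (η + κ) ^ 2 * (η + κ) := by ring
        _ ≤ _ := by gcongr
    have e : 2 * |(η' + 2 * κ) ^ 2 * v' * (2 * κ * ((η + κ) * g))| =
        4 * κ * ((η' + 2 * κ) ^ 2 * (η + κ)) * |v' * g| := by
      rw [show (η' + 2 * κ) ^ 2 * v' * (2 * κ * ((η + κ) * g)) =
        (2 * κ * ((η' + 2 * κ) ^ 2 * (η + κ))) * (v' * g) by ring, abs_mul,
        abs_of_nonneg (show 0 ≤ 2 * κ * ((η' + 2 * κ) ^ 2 * (η + κ)) by positivity)]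
      ring
    rw [e, mul_assoc, abs_mul]
    refine mul_le_mul_of_nonneg_right ?_ (abs_nonneg _)
    refine h3.trans ?_
    have : (4 : ℝ) * κ * (η + κ) ^ 3 ≤ 4 * κ * ((η' + 2 * κ) ^ 2 * (η + κ)) := by gcongr
    simpa using this
  have h6 : (η' + 2 * κ) ^ 4 ≤ 8 * η' ^ 4 + 128 * κ ^ 4 := by
    have q1 : (η' + 2 * κ) ^ 2 ≤ 2 * η' ^ 2 + 8 * κ ^ 2 := by nlinarith [sq_nonneg (η' - 2 * κ)]
    have q2 : ((η' + 2 * κ) ^ 2) ^ 2 ≤ (2 * η' ^ 2 + 8 * κ ^ 2) ^ 2 := by gcongr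
    nlinarith [sq_nonneg (2 * η' ^ 2 - 8 * κ ^ 2)]
  have h7 : (η + κ) ^ 2 ≤ 2 * η ^ 2 + 2 * κ ^ 2 := by nlinarith [sq_nonneg (η - κ)]
  have h8 : |g * (η' ^ 4 * v' - η ^ 4 * v)| ≤ θ * κ⁻¹ ^ 2 * (η ^ 6 * (v' - v) ^ 2) +
      (θ * (8 * (η' ^ 4 * v' ^ 2) + 128 * κ ^ 4 * v' ^ 2) +
      θ⁻¹ * (9 * κ ^ 2 * (η ^ 2 * g ^ 2) + 8 * κ ^ 4 * g ^ 2)) := by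
    have e : g * (η' ^ 4 * v' - η ^ 4 * v) = η ^ 4 * (v' - v) * g + (η' ^ 4 - η ^ 4) * v' * g := by
      ring
    rw [e]
    refine (abs_add_le _ _).trans ?_
    have h9 : (η' + 2 * κ) ^ 4 * v' ^ 2 ≤ (8 * η' ^ 4 + 128 * κ ^ 4) * v' ^ 2 := by gcongr
    have h10 : (η + κ) ^ 2 * (κ ^ 2 * g ^ 2) ≤ (2 * η ^ 2 + 2 * κ ^ 2) * (κ ^ 2 * g ^ 2) := by
      gcongr
    have h11 := mul_le_mul_of_nonneg_left h9 hθ.le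
    have h12 := mul_le_mul_of_nonneg_left h10 (inv_pos.2 hθ).le
    have h13 := abs_nonneg (η ^ 4 * (v' - v) * g)
    have e2 : θ * (κ⁻¹ * (η ^ 3 * (v' - v))) ^ 2 = θ * κ⁻¹ ^ 2 * (η ^ 6 * (v' - v) ^ 2) := by ring
    rw [e2] at h1
    nlinarith
  have h9 : -(a * g * (η' ^ 4 * v' - η ^ 4 * v)) ≤ M * |g * (η' ^ 4 * v' - η ^ 4 * v)| := by
    rw [mul_assoc]
    refine (neg_le_abs _).trans ?_
    rw [abs_mul]
    gcongr
  refine h9.trans ((mul_le_mul_of_nonneg_left h8 hM).trans (le_of_eq (by ring)))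

lemma LOp.app_sub (L : LOp ι) (f g : Grd ι → ℝ) (z : Grd ι) :
    L.app (fun z => f z - g z) z = L.app f z - L.app g z := by
  have : ∀ j z, dp j (fun z => f z - g z) z = dp j f z - dp j g z := fun j z => by
    simp only [dp]; ring
  simp only [LOp.app, this, mul_sub, Finset.sum_sub_distrib]
  ring

lemma LOp.app_shift (L : LOp ι) (f : Grd ι → ℝ) (v z : Grd ι) (hA : ∀ z, L.A (z + v) = L.A z)
    (hC : ∀ z, L.C (z + v) = L.C z) (ha : ∀ i j z, L.a i j (z + v) = L.a i j z) :
    L.app (fun z => f (z + v)) z = L.app f (z + v) := by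
  have h1 : ∀ j z, dp j (fun z => f (z + v)) z = dp j f (z + v) := fun j z => by
    simp only [dp, add_right_comm _ v]
  have h2 : ∀ y, z + v - y = z - y + v := fun y => by abel
  simp only [LOp.app, h1, hA, hC, ha, h2]

lemma LOp.OK.app_dp {L : LOp ι} {ν : ℝ} {S : Set (Option ι)} (h : L.OK ν S) {k : Option ι}
    (hk : k ∈ S) (w : Grd ι → ℝ) (z : Grd ι) :
    L.app (dp k w) z = L.app w (z + ev k) - L.app w z := by
  rw [← L.app_shift w (ev k) z (h.A_inv k hk) (h.C_inv k hk) (h.a_inv k hk), ← LOp.app_sub]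
  rfl

lemma LOp.OK.app_sub_tau {L : LOp ι} {ν : ℝ} {S : Set (Option ι)} (h : L.OK ν S) (w : Grd ι → ℝ)
    (z : Grd ι) : L.app (fun z => w z - w (z - L.τ)) z = L.app w z - L.app w (z - L.τ) := by
  rw [LOp.app_sub]
  congr 1
  have := L.app_shift w (-L.τ) z (fun z => h.A_tau' z)
    (fun z => by rw [← sub_eq_add_neg, ← h.C_tau (z - L.τ), sub_add_cancel])
    (fun i j z => by rw [← sub_eq_add_neg, ← h.a_tau i j (z - L.τ), sub_add_cancel])
  simpa only [← sub_eq_add_neg] using this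

set_option maxHeartbeats 4000000 in
theorem timeDerivative_le (ν : ℝ) (hν : 0 < ν) : ∃ K : ℝ, 0 < K ∧ ∀ (L : LOp ι)
    (S : Set (Option ι)), L.OK ν S → ∀ (w η : Grd ι → ℝ) (κ : ℝ), w.HasFiniteSupport →
    0 < κ → κ ≤ 1 → (∀ z, 0 ≤ η z) → (∀ z, η z ≤ 1) →
    (∀ z, η z ≠ 0 → L.app w z = 0 ∧ L.app w (z - L.τ) = 0) →
    (∀ z i, |dp (some i) η z| ≤ κ) → (∀ z, |η (z + L.τ) - η z| ≤ κ ^ 2) →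
    ∑' z, η z ^ 4 * (w z - w (z - L.τ)) ^ 2 ≤ K * κ ^ 4 * ∑' z, w z ^ 2 := by
  obtain ⟨K₁, hK₁, hcacc⟩ := caccioppoli (ι := ι) ν hν
  set n : ℝ := (Fintype.card ι : ℝ) with hn
  have hn0 : 0 ≤ n := Nat.cast_nonneg _
  set M := ν⁻¹ with hM
  have hM0 : 0 < M := inv_pos.2 hν
  set B := 2 * K₁ with hB
  set c₁ := M * (n * (K₁ * 96) + n * n * 8) with hc₁
  have hc₁0 : 0 ≤ c₁ := by positivity
  set θ := ν / (2 * (c₁ + 1)) with hθ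
  have hθ0 : 0 < θ := by positivity
  set c₂ := M * (8 * B + 8) + M * θ * (n * (K₁ * 6144) + n * n * 512)
    + M * θ⁻¹ * (n * (9 * B + 32 * n)) with hc₂
  have hc₂0 : 0 < c₂ := by positivity
  refine ⟨2 * M * c₂, by positivity, ?_⟩
  intro L S hL w η κ hw hκ0 hκ1 hη0 hη1 hP hdx hdt
  have hκ2 : κ ^ 2 ≤ κ := by nlinarith
  set v : Grd ι → ℝ := fun z => w z - w (z - L.τ) with hv
  have hvf : v.HasFiniteSupport := by fun_prop
  set Y := ∑' z, w z ^ 2 with hY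
  set X := ∑' z, η z ^ 4 * v z ^ 2 with hX
  have hY0 : 0 ≤ Y := tsum_nonneg fun z => sq_nonneg _
  have hX0 : 0 ≤ X := tsum_nonneg fun z => by positivity
  have hVY : ∑' z, v z ^ 2 ≤ 4 * Y := by
    have : ∀ z, v z ^ 2 ≤ 2 * w z ^ 2 + 2 * w (z - L.τ) ^ 2 := fun z => by
      simp only [hv]; nlinarith [sq_nonneg (w z + w (z - L.τ))]
    refine (tsum_le_fs this (by fun_prop) (by fun_prop)).trans (le_of_eq ?_)
    rw [tsum_add_fs (by fun_prop) (by fun_prop), tsum_mul_left, tsum_mul_left,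
      tsum_shift' (fun z => w z ^ 2)]
    ring
  have hDY : ∀ j, ∑' z, dp (some j) w z ^ 2 ≤ 4 * Y := by
    intro j
    have : ∀ z, dp (some j) w z ^ 2 ≤ 2 * w z ^ 2 + 2 * w (z + ev (some j)) ^ 2 := fun z => by
      simp only [dp]; nlinarith [sq_nonneg (w z + w (z + ev (some j)))]
    refine (tsum_le_fs this (by fun_prop) (by fun_prop)).trans (le_of_eq ?_)
    rw [tsum_add_fs (by fun_prop) (by fun_prop), tsum_mul_left, tsum_mul_left,
      tsum_shift (fun z => w z ^ 2)]
    ring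
  -- first energy estimate
  have h1 : ∑' z, η z ^ 2 * (∑ j, dp (some j) w z ^ 2 + L.lam * w z ^ 2) ≤ B * κ ^ 2 * Y := by
    have := hcacc L S hL w η (fun _ => 2 * κ ^ 2) hw (fun z hz => (hP z hz).1)
      (fun z i => by
        have := sq_le_sq' (by linarith [(abs_le.1 (hdx z i)).1]) (abs_le.1 (hdx z i)).2
        nlinarith)
      (fun z i j => by
        have := sq_le_sq' (by linarith [(abs_le.1 (hdx z i)).1]) (abs_le.1 (hdx z i)).2
        nlinarith)
      (fun z => by
        have := abs_le.1 (hdt z)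
        have h0 := hη0 z
        have h1 := hη1 z
        have h2 := hη0 (z + L.τ)
        have h3 := hη1 (z + L.τ)
        rw [show η (z + L.τ) ^ 2 - η z ^ 2 = (η (z + L.τ) - η z) * (η (z + L.τ) + η z) by ring,
          abs_mul, abs_of_nonneg (show 0 ≤ η (z + L.τ) + η z by linarith), mul_comm 2]
        gcongr
        · exact hdt z
        · linarith)
    refine this.trans (le_of_eq ?_)
    rw [tsum_mul_left]; ring
  have h1G : ∑ j, ∑' z, η z ^ 2 * dp (some j) w z ^ 2 ≤ B * κ ^ 2 * Y := by
    rw [← tsum_sum_fs (fun j => by fun_prop)]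
    refine (tsum_le_fs (fun z => ?_) (by fun_prop) (by fun_prop)).trans h1
    rw [← Finset.mul_sum]
    have := hL.lam_pos
    gcongr
    exact le_add_of_nonneg_right (by positivity)
  have h1L : ∑' z, L.lam * (η z ^ 2 * w z ^ 2) ≤ B * κ ^ 2 * Y := by
    refine (tsum_le_fs (fun z => ?_) (by fun_prop) (by fun_prop)).trans h1
    have : 0 ≤ ∑ j, dp (some j) w z ^ 2 := Finset.sum_nonneg fun j _ => sq_nonneg _
    nlinarith [mul_nonneg (sq_nonneg (η z)) this]
  have hdd : ∀ z i x, η z + κ ≤ x → dp (some i) (fun z => η z ^ 3) z ^ 2 ≤ 12 * κ ^ 2 * x ^ 4 := by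
    intro z i x hx
    have h3 := abs_pow_sub_pow_le_of_abs_sub_le 3 (hη0 z) (hη0 (z + ev (some i))) (hdx z i)
    have h0 := hη0 z
    have h4 : |dp (some i) (fun z => η z ^ 3) z| ≤ 3 * κ * x ^ 2 := by
      refine h3.trans ?_
      push_cast
      gcongr
    rw [← sq_abs]
    calc _ ≤ (3 * κ * x ^ 2) ^ 2 := by gcongr
      _ ≤ _ := by
        have : 0 ≤ κ ^ 2 * x ^ 4 := by positivity
        nlinarith
  have h2 : ∑ i, ∑' z, η z ^ 6 * dp (some i) v z ^ 2 ≤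
      κ ^ 2 * (K₁ * 96 * X + K₁ * 6144 * κ ^ 4 * Y) := by
    have := hcacc L S hL v (fun z => η z ^ 3) (fun z => 12 * κ ^ 2 * (η z + 2 * κ) ^ 4) hvf
      (fun z hz => by
        have := hP z (by rintro h; simp [h] at hz)
        rw [hv, hL.app_sub_tau, this.1, this.2, sub_self])
      (fun z i => hdd z i _ (by linarith))
      (fun z i j => hdd z i _ (by
        have := hdx z j
        rw [dp, abs_le] at this
        linarith))
      (fun z => by
        have h3 := abs_pow_sub_pow_le_of_abs_sub_le 6 (hη0 z) (hη0 (z + L.τ)) (hdt z)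
        rw [← pow_mul, ← pow_mul]
        refine h3.trans ?_
        have h0 := hη0 z
        have h1 := hη1 z
        calc ((6 : ℕ) : ℝ) * κ ^ 2 * (η z + κ ^ 2) ^ 5
            = 6 * κ ^ 2 * (η z + κ ^ 2) ^ 4 * (η z + κ ^ 2) := by push_cast; ring
          _ ≤ 6 * κ ^ 2 * (η z + 2 * κ) ^ 4 * 2 := by
              gcongr
              · linarith
              · linarith
          _ = _ := by ring)
    have h5 : ∑ i, ∑' z, η z ^ 6 * dp (some i) v z ^ 2 ≤
        ∑' z, (η z ^ 3) ^ 2 * (∑ j, dp (some j) v z ^ 2 + L.lam * v z ^ 2) := by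
      rw [← tsum_sum_fs (fun j => by fun_prop)]
      refine tsum_le_fs (fun z => ?_) (by fun_prop) (by fun_prop)
      rw [← Finset.mul_sum, ← pow_mul]
      have := hL.lam_pos
      gcongr
      exact le_add_of_nonneg_right (by positivity)
    refine h5.trans (this.trans ?_)
    have h6 : ∀ z, 12 * κ ^ 2 * (η z + 2 * κ) ^ 4 * v z ^ 2 ≤
        κ ^ 2 * (96 * (η z ^ 4 * v z ^ 2) + 1536 * κ ^ 4 * v z ^ 2) := by
      intro z
      have q1 : (η z + 2 * κ) ^ 2 ≤ 2 * η z ^ 2 + 8 * κ ^ 2 := by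
        nlinarith [sq_nonneg (η z - 2 * κ)]
      have q2 : ((η z + 2 * κ) ^ 2) ^ 2 ≤ (2 * η z ^ 2 + 8 * κ ^ 2) ^ 2 := by gcongr
      have q3 : (η z + 2 * κ) ^ 4 ≤ 8 * η z ^ 4 + 128 * κ ^ 4 := by
        nlinarith [sq_nonneg (2 * η z ^ 2 - 8 * κ ^ 2)]
      calc 12 * κ ^ 2 * (η z + 2 * κ) ^ 4 * v z ^ 2
          ≤ 12 * κ ^ 2 * (8 * η z ^ 4 + 128 * κ ^ 4) * v z ^ 2 := by gcongr
        _ = _ := by ring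
    have h7 := tsum_le_fs h6 (by fun_prop) (by fun_prop)
    rw [tsum_mul_left, tsum_add_fs (by fun_prop) (by fun_prop), tsum_mul_left, tsum_mul_left] at h7
    have h8 := mul_le_mul_of_nonneg_left hVY (show 0 ≤ 1536 * κ ^ 4 by positivity)
    calc _ ≤ K₁ * (κ ^ 2 * (96 * X + 1536 * κ ^ 4 * ∑' z, v z ^ 2)) := by gcongr
      _ ≤ K₁ * (κ ^ 2 * (96 * X + 1536 * κ ^ 4 * (4 * Y))) := by gcongr
      _ = _ := by ring
  set R : ι → ι → Grd ι → ℝ := fun i j z => M * θ * κ⁻¹ ^ 2 * (η z ^ 6 * dp (some i) v z ^ 2) +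
      (M * θ * (8 * (η (z + ev (some i)) ^ 4 * v (z + ev (some i)) ^ 2)
        + 128 * κ ^ 4 * v (z + ev (some i)) ^ 2) +
      M * θ⁻¹ * (9 * κ ^ 2 * (η z ^ 2 * dp (some j) w z ^ 2) + 8 * κ ^ 4 * dp (some j) w z ^ 2))
    with hR
  have hRf : ∀ i j, (R i j).HasFiniteSupport := fun i j => by fun_prop
  set G : Grd ι → ℝ := fun z => L.lam * L.C z / 2 * η z ^ 4 * w (z - L.τ) ^ 2 with hG
  have e0 := L.app_pair w (fun z => η z ^ 4 * v z) (by fun_prop)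
  have e1 : ∀ z, L.app w z * (η z ^ 4 * v z) = 0 := by
    intro z
    by_cases h : η z = 0
    · simp [h]
    · simp [(hP z h).1]
  simp only [e1, tsum_zero] at e0
  have hpt : ∀ z, ν * (η z ^ 4 * v z ^ 2) ≤
      ((L.A z * (w z - w (z - L.τ)) * (η z ^ 4 * v z) + L.lam * L.C z * w z * (η z ^ 4 * v z)
      + ∑ i, ∑ j, L.a i j z * dp (some j) w z * dp (some i) (fun z => η z ^ 4 * v z) z)
      + (8 * M * κ ^ 2 * (L.lam * (η z ^ 2 * w z ^ 2)) + 8 * M * κ ^ 4 * w z ^ 2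
        + ∑ i, ∑ j, R i j z)) - (G (z + L.τ) - G z) := by
    intro z
    have t1 : ν * (η z ^ 4 * v z ^ 2) ≤ L.A z * (w z - w (z - L.τ)) * (η z ^ 4 * v z) := by
      have := mul_le_mul_of_nonneg_right (hL.A_lo z)
        (show 0 ≤ η z ^ 4 * v z ^ 2 by have := hη0 z; positivity)
      refine this.trans (le_of_eq ?_)
      simp only [hv]; ring
    have hCl := hL.C_lo z
    have hCh := hL.C_hi z
    have hl0 := hL.lam_pos
    have hl1 := hL.lam_le
    have t2 : -(8 * M * κ ^ 2 * (L.lam * (η z ^ 2 * w z ^ 2)) + 8 * M * κ ^ 4 * w z ^ 2)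
        + (G (z + L.τ) - G z) ≤ L.lam * L.C z * w z * (η z ^ 4 * v z) := by
      have h0 := hη0 z
      have h1 := hη1 z
      have q1 : L.lam * L.C z / 2 * η z ^ 4 * (w z ^ 2 - w (z - L.τ) ^ 2) ≤
          L.lam * L.C z * w z * (η z ^ 4 * v z) := by
        have : 0 ≤ L.lam * L.C z / 2 * η z ^ 4 * (w z - w (z - L.τ)) ^ 2 := by
          have : 0 ≤ L.C z := by linarith
          positivity
        simp only [hv]
        nlinarith
      have q2 : L.lam * L.C z / 2 * η z ^ 4 * (w z ^ 2 - w (z - L.τ) ^ 2) =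
          -(L.lam * L.C z / 2 * ((η (z + L.τ) ^ 4 - η z ^ 4) * w z ^ 2)) + (G (z + L.τ) - G z) := by
        simp only [hG, hL.C_tau, add_sub_cancel_right]
        ring
      have q3 : η (z + L.τ) ^ 4 - η z ^ 4 ≤ 16 * κ ^ 2 * η z ^ 2 + 16 * κ ^ 4 := by
        have h3 := abs_pow_sub_pow_le_of_abs_sub_le 4 (hη0 z) (hη0 (z + L.τ)) (hdt z)
        refine (le_abs_self _).trans (h3.trans ?_)
        calc ((4 : ℕ) : ℝ) * κ ^ 2 * (η z + κ ^ 2) ^ 3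
            = 4 * κ ^ 2 * ((η z + κ ^ 2) ^ 2 * (η z + κ ^ 2)) := by push_cast; ring
          _ ≤ 4 * κ ^ 2 * ((η z + κ) ^ 2 * 2) := by gcongr; linarith
          _ ≤ 4 * κ ^ 2 * ((2 * η z ^ 2 + 2 * κ ^ 2) * 2) := by
              gcongr; nlinarith [sq_nonneg (η z - κ)]
          _ = _ := by ring
      have q4 : L.lam * L.C z / 2 * ((η (z + L.τ) ^ 4 - η z ^ 4) * w z ^ 2) ≤
          8 * M * κ ^ 2 * (L.lam * (η z ^ 2 * w z ^ 2)) + 8 * M * κ ^ 4 * w z ^ 2 := by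
        calc _ ≤ L.lam * L.C z / 2 * ((16 * κ ^ 2 * η z ^ 2 + 16 * κ ^ 4) * w z ^ 2) := by
              have : 0 ≤ L.C z := by linarith
              gcongr
          _ ≤ L.lam * M / 2 * ((16 * κ ^ 2 * η z ^ 2 + 16 * κ ^ 4) * w z ^ 2) := by gcongr
          _ = 8 * M * κ ^ 2 * (L.lam * (η z ^ 2 * w z ^ 2)) + L.lam * (8 * M * κ ^ 4 * w z ^ 2) := by
              ring
          _ ≤ 8 * M * κ ^ 2 * (L.lam * (η z ^ 2 * w z ^ 2)) + 1 * (8 * M * κ ^ 4 * w z ^ 2) := by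
              gcongr
          _ = _ := by ring
      linarith
    have t3 : -∑ i, ∑ j, L.a i j z * dp (some j) w z * dp (some i) (fun z => η z ^ 4 * v z) z ≤
        ∑ i, ∑ j, R i j z := by
      simp only [← Finset.sum_neg_distrib]
      refine Finset.sum_le_sum fun i _ => Finset.sum_le_sum fun j _ => ?_
      exact timeDerivative_cross M θ κ _ _ _ _ _ _ hθ0 hκ0 (hL.a_hi i j z) (hη0 z) (hη0 _)
        (hdx z i)
    linarith
  have hRs : ∑' z, ∑ i, ∑ j, R i j z ≤ (c₁ * θ) * X +
      (M * θ * (n * (K₁ * 6144) + n * n * 512) + M * θ⁻¹ * (n * (9 * B + 32 * n))) * κ ^ 4 * Y := by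
    have hij : ∀ i j, ∑' z, R i j z ≤ M * θ * κ⁻¹ ^ 2 * ∑' z, η z ^ 6 * dp (some i) v z ^ 2 +
        (M * θ * (8 * X + 512 * κ ^ 4 * Y) +
        M * θ⁻¹ * (9 * κ ^ 2 * ∑' z, η z ^ 2 * dp (some j) w z ^ 2 + 32 * κ ^ 4 * Y)) := by
      intro i j
      simp only [hR]
      rw [tsum_add_fs (by fun_prop) (by fun_prop), tsum_add_fs (by fun_prop) (by fun_prop),
        tsum_mul_left, tsum_mul_left, tsum_mul_left, tsum_add_fs (by fun_prop) (by fun_prop),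
        tsum_add_fs (by fun_prop) (by fun_prop), tsum_mul_left, tsum_mul_left, tsum_mul_left,
        tsum_mul_left, tsum_shift (fun z => η z ^ 4 * v z ^ 2), tsum_shift (fun z => v z ^ 2)]
      have e1 := mul_le_mul_of_nonneg_left hVY (show 0 ≤ 128 * κ ^ 4 by positivity)
      have e2 := mul_le_mul_of_nonneg_left (hDY j) (show 0 ≤ 8 * κ ^ 4 by positivity)
      refine add_le_add le_rfl (add_le_add
        (mul_le_mul_of_nonneg_left (by linarith) (by positivity))
        (mul_le_mul_of_nonneg_left (by linarith) (by positivity)))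
    rw [tsum_sum_fs (fun i => by fun_prop)]
    have h2' : ∀ i, ∑' z, ∑ j, R i j z = ∑ j, ∑' z, R i j z := fun i =>
      tsum_sum_fs (fun j => hRf i j)
    simp_rw [h2']
    refine (Finset.sum_le_sum fun i _ => Finset.sum_le_sum fun j _ => hij i j).trans ?_
    simp only [Finset.sum_add_distrib, ← Finset.mul_sum, Finset.sum_const, Finset.card_univ,
      nsmul_eq_mul, ← hn]
    have f1 : κ⁻¹ ^ 2 * ∑ i, ∑' z, η z ^ 6 * dp (some i) v z ^ 2 ≤
        K₁ * 96 * X + K₁ * 6144 * κ ^ 4 * Y := by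
      have := mul_le_mul_of_nonneg_left h2 (show 0 ≤ κ⁻¹ ^ 2 by positivity)
      refine this.trans (le_of_eq ?_)
      field_simp
    have f2 := mul_le_mul_of_nonneg_left f1 (show 0 ≤ M * θ * n by positivity)
    have f3 := mul_le_mul_of_nonneg_left h1G (show 0 ≤ M * θ⁻¹ * n * (9 * κ ^ 2) by positivity)
    rw [hc₁]
    linarith
  have hsum := tsum_le_fs hpt (by fun_prop) (by fun_prop)
  rw [tsum_mul_left, tsum_sub_fs (by fun_prop) (by fun_prop),
    tsum_add_fs (by fun_prop) (by fun_prop), ← e0, tsum_sub_fs (by fun_prop) (by fun_prop),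
    tsum_shift G, sub_self, tsum_add_fs (by fun_prop) (by fun_prop),
    tsum_add_fs (by fun_prop) (by fun_prop)] at hsum
  simp only [tsum_mul_left] at hsum h1L
  simp only [← hX, ← hY] at hsum
  have h3 : c₁ * θ ≤ ν / 2 := by
    rw [hθ]
    have : c₁ * (ν / (2 * (c₁ + 1))) = ν / 2 * (c₁ / (c₁ + 1)) := by field_simp
    rw [this]
    have : c₁ / (c₁ + 1) ≤ 1 := by rw [div_le_one (by positivity)]; linarith
    nlinarith
  have h4 := mul_le_mul_of_nonneg_right h3 hX0
  have h5 := mul_le_mul_of_nonneg_left h1L (show 0 ≤ 8 * M * κ ^ 2 by positivity)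
  have h6 : ν / 2 * X ≤ c₂ * κ ^ 4 * Y := by
    rw [hc₂]
    linarith
  have h7 := mul_le_mul_of_nonneg_left h6 (show 0 ≤ 2 * M by positivity)
  have h8 : 2 * M * (ν / 2) = 1 := by rw [hM]; field_simp
  rw [← mul_assoc, h8, one_mul] at h7
  linarith

end TimeDerivative

section LocalEstimates

variable {ι : Type*}

/-- Parabolic weights: time counts twice. -/
def wt : Option ι → ℕ
  | none => 2
  | some _ => 1

lemma one_le_wt (j : Option ι) : 1 ≤ wt j := by cases j <;> simp [wt]

lemma mul_sq_zero_le_sum (a : ℕ → ℝ) (m : ℕ) :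
    m * a 0 ^ 2 ≤ 2 * ∑ s ∈ Finset.range m, a s ^ 2 +
      2 * (m : ℝ) ^ 2 * ∑ s ∈ Finset.range m, (a (s + 1) - a s) ^ 2 := by
  have h : ∀ s ∈ Finset.range m, a 0 ^ 2 ≤ 2 * a s ^ 2 +
      2 * (m * ∑ s ∈ Finset.range m, (a (s + 1) - a s) ^ 2) := by
    intro s hs
    have hs' := (Finset.mem_range.1 hs).le
    have h1 : a s - a 0 = ∑ r ∈ Finset.range s, (a (r + 1) - a r) := (Finset.sum_range_sub a s).symm
    have h2 : (a s - a 0) ^ 2 ≤ m * ∑ s ∈ Finset.range m, (a (s + 1) - a s) ^ 2 := by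
      rw [h1]
      refine (sq_sum_le_card_mul_sum_sq).trans ?_
      rw [Finset.card_range]
      gcongr
    nlinarith [sq_nonneg (a s + (a s - a 0)), sq_nonneg (2 * a s - a 0)]
  have := Finset.sum_le_sum h
  rw [Finset.sum_const, Finset.card_range, nsmul_eq_mul, Finset.sum_add_distrib, Finset.sum_const,
    Finset.card_range, nsmul_eq_mul, ← Finset.mul_sum] at this
  refine this.trans (le_of_eq (by ring))

lemma ev_same (j : Option ι) : (ev j : Grd ι) j = 1 := by
  classical
  simp [ev]

lemma ev_ne {i j : Option ι} (h : i ≠ j) : (ev j : Grd ι) i = 0 := by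
  classical
  simp [ev, h]

variable [Fintype ι]

/-- The face of the parabolic box at `z₀` on which the coordinates in `T` are frozen. -/
def face (ρ : ℕ) (z₀ : Grd ι) (T : Finset (Option ι)) : Finset (Grd ι) := by
  classical
  exact Fintype.piFinset fun j =>
    if j ∈ T then {z₀ j} else Finset.Ico (z₀ j) (z₀ j + (ρ ^ wt j : ℕ))

lemma mem_face {ρ : ℕ} {z₀ : Grd ι} {T : Finset (Option ι)} {y : Grd ι} :
    y ∈ face ρ z₀ T ↔ ∀ j, (j ∈ T → y j = z₀ j) ∧
      (j ∉ T → z₀ j ≤ y j ∧ y j < z₀ j + (ρ ^ wt j : ℕ)) := by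
  classical
  simp only [face, Fintype.mem_piFinset]
  refine forall_congr' fun j => ?_
  by_cases h : j ∈ T <;> simp [h]

lemma sum_face [DecidableEq ι] (ρ : ℕ) (z₀ : Grd ι) (T : Finset (Option ι)) (j : Option ι)
    (hj : j ∉ T) (h : Grd ι → ℝ) :
    ∑ y ∈ face ρ z₀ T, h y =
      ∑ x ∈ face ρ z₀ (insert j T), ∑ s ∈ Finset.range (ρ ^ wt j), h (x + (s : ℤ) • ev j) := by
  rw [← Finset.sum_product']
  symm
  refine Finset.sum_bij' (fun q _ => q.1 + (q.2 : ℤ) • ev j)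
    (fun y _ => (y - (y j - z₀ j) • ev j, (y j - z₀ j).toNat)) ?_ ?_ ?_ ?_ ?_
  · rintro ⟨x, s⟩ hq
    simp only [Finset.mem_product, mem_face, Finset.mem_range] at hq ⊢
    intro i
    by_cases hij : i = j
    · subst hij
      have := (hq.1 i).1 (by simp)
      simp only [hj, false_imp_iff, true_and, not_false_eq_true, true_imp_iff, Pi.add_apply,
        Pi.smul_apply, ev_same, this, smul_eq_mul, mul_one]
      constructor
      · omega
      · have := hq.2
        omega
    · have := hq.1 i
      simp only [Finset.mem_insert, hij, false_or] at this
      simpa [ev_ne hij] using this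
  · intro y hy
    simp only [Finset.mem_product, mem_face, Finset.mem_range] at hy ⊢
    have hyj := (hy j).2 hj
    refine ⟨fun i => ?_, by omega⟩
    by_cases hij : i = j
    · subst hij
      simp [ev_same]
    · have := hy i
      simp only [Finset.mem_insert, hij, false_or]
      simpa [ev_ne hij] using this
  · rintro ⟨x, s⟩ hq
    simp only [Finset.mem_product, mem_face, Finset.mem_range] at hq
    have := (hq.1 j).1 (by simp)
    simp [ev_same, this]
  · intro y hy
    simp only [mem_face] at hy
    have hyj := (hy j).2 hj
    simp only
    rw [Int.toNat_of_nonneg (by omega), sub_add_cancel]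
  · intro _ _
    rfl

lemma face_sobolev [DecidableEq ι] (ρ : ℕ) (z₀ : Grd ι) (T : Finset (Option ι)) (j : Option ι)
    (hj : j ∉ T) (g : Grd ι → ℝ) :
    (ρ ^ wt j : ℕ) * ∑ y ∈ face ρ z₀ (insert j T), g y ^ 2 ≤
      2 * ∑ y ∈ face ρ z₀ T, g y ^ 2 +
        2 * ((ρ ^ wt j : ℕ) : ℝ) ^ 2 * ∑ y ∈ face ρ z₀ T, dp j g y ^ 2 := by
  rw [sum_face ρ z₀ T j hj, sum_face ρ z₀ T j hj, Finset.mul_sum, Finset.mul_sum, Finset.mul_sum,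
    ← Finset.sum_add_distrib]
  refine Finset.sum_le_sum fun x _ => ?_
  have := mul_sq_zero_le_sum (fun s => g (x + (s : ℤ) • ev j)) (ρ ^ wt j)
  simp only [Nat.cast_zero, zero_smul, add_zero] at this
  refine this.trans (le_of_eq ?_)
  simp only [dp, Nat.cast_add, Nat.cast_one, add_smul, one_smul, add_assoc]

/-- Parabolic distance to `z₀` in units of `ρ`. -/
def sd (ρ : ℝ) (z₀ z : Grd ι) : ℝ := ‖fun j => ((z j - z₀ j : ℤ) : ℝ) / ρ ^ wt j‖

lemma sd_le_iff {ρ : ℝ} (hρ : 0 < ρ) {z₀ z : Grd ι} {R : ℝ} (hR : 0 ≤ R) :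
    sd ρ z₀ z ≤ R ↔ ∀ j, |((z j - z₀ j : ℤ) : ℝ)| ≤ R * ρ ^ wt j := by
  rw [sd, pi_norm_le_iff_of_nonneg hR]
  refine forall_congr' fun j => ?_
  rw [Real.norm_eq_abs, abs_div, abs_of_pos (pow_pos hρ _), div_le_iff₀ (pow_pos hρ _)]

lemma abs_sd_add_sub_le {ρ : ℝ} (hρ : 0 < ρ) (z₀ z : Grd ι) (j : Option ι) (c : ℤ) :
    |sd ρ z₀ (z + c • ev j) - sd ρ z₀ z| ≤ |(c : ℝ)| * (ρ ^ wt j)⁻¹ := by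
  refine (abs_norm_sub_norm_le _ _).trans ?_
  rw [pi_norm_le_iff_of_nonneg (by positivity)]
  intro i
  by_cases hij : i = j
  · subst hij
    simp only [Pi.sub_apply, Pi.add_apply, Pi.smul_apply, ev_same, smul_eq_mul, mul_one]
    rw [← sub_div, ← Int.cast_sub, show z i + c - z₀ i - (z i - z₀ i) = c by ring,
      Real.norm_eq_abs, abs_div, abs_of_pos (pow_pos hρ _), div_eq_mul_inv]
  · simp only [Pi.sub_apply, Pi.add_apply, Pi.smul_apply, ev_ne hij, smul_zero, add_zero, sub_self,
      norm_zero]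
    positivity

/-- Cutoff equal to `1` where `sd ≤ R` and vanishing where `sd ≥ R + 1`. -/
def cut (ρ : ℝ) (z₀ : Grd ι) (R : ℝ) (z : Grd ι) : ℝ := max 0 (min 1 (R + 1 - sd ρ z₀ z))

lemma cut_nonneg (ρ : ℝ) (z₀ : Grd ι) (R : ℝ) (z : Grd ι) : 0 ≤ cut ρ z₀ R z := le_max_left _ _

lemma cut_le_one (ρ : ℝ) (z₀ : Grd ι) (R : ℝ) (z : Grd ι) : cut ρ z₀ R z ≤ 1 :=
  max_le zero_le_one (min_le_left _ _)

lemma cut_eq_one {ρ : ℝ} {z₀ : Grd ι} {R : ℝ} {z : Grd ι} (h : sd ρ z₀ z ≤ R) :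
    cut ρ z₀ R z = 1 := by
  rw [cut, min_eq_left (by linarith), max_eq_right zero_le_one]

lemma sd_lt_of_cut_ne_zero {ρ : ℝ} {z₀ : Grd ι} {R : ℝ} {z : Grd ι} (h : cut ρ z₀ R z ≠ 0) :
    sd ρ z₀ z < R + 1 := by
  by_contra! h'
  exact h (by rw [cut, max_eq_left]; exact (min_le_right _ _).trans (by linarith))

lemma abs_cut_sub_cut_le (ρ : ℝ) (z₀ : Grd ι) (R : ℝ) (z y : Grd ι) :
    |cut ρ z₀ R y - cut ρ z₀ R z| ≤ |sd ρ z₀ y - sd ρ z₀ z| := by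
  unfold cut
  refine (abs_max_sub_max_le_max _ _ _ _).trans ?_
  simp only [sub_self, abs_zero]
  refine max_le (abs_nonneg _) ((abs_min_sub_min_le_max _ _ _ _).trans ?_)
  simp only [sub_self, abs_zero]
  refine max_le (abs_nonneg _) ?_
  rw [abs_sub_comm (sd ρ z₀ y)]
  exact le_of_eq (congrArg _ (by ring))

lemma LOp.OK.tau_eq {L : LOp ι} {ν : ℝ} {S : Set (Option ι)} (h : L.OK ν S) :
    ∃ c : ℤ, |(c : ℝ)| = 1 ∧ L.τ = c • ev none := by
  rcases h.tau with h | h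
  · exact ⟨1, by simp, by simp [h]⟩
  · exact ⟨-1, by simp, by simp [h]⟩

/-- Interior estimate for differences of solutions. -/
theorem local_dp_le (ν : ℝ) (hν : 0 < ν) : ∃ K : ℝ, 0 < K ∧ ∀ (L : LOp ι)
    (S : Set (Option ι)), L.OK ν S → ∀ (w : Grd ι → ℝ) (ρ : ℝ) (z₀ : Grd ι) (R : ℝ),
    w.HasFiniteSupport → 1 ≤ ρ → (∀ z, sd ρ z₀ z ≤ R + 3 → L.app w z = 0) → ∀ (j : Option ι)
    (g : Grd ι → ℝ), (∀ z, sd ρ z₀ z ≤ R → |g z| ≤ |dp j w z|) → (∀ z, R < sd ρ z₀ z → g z = 0) →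
    (ρ ^ wt j) ^ 2 * ∑' z, g z ^ 2 ≤ K * ∑' z, w z ^ 2 := by
  obtain ⟨K₁, hK₁, hcacc⟩ := caccioppoli (ι := ι) ν hν
  obtain ⟨K₂, hK₂, htd⟩ := timeDerivative_le (ι := ι) ν hν
  refine ⟨2 * K₁ + K₂, by positivity, ?_⟩
  intro L S hL w ρ z₀ R hw hρ hP j g hg hg0
  have hρ0 : 0 < ρ := by linarith
  have hκ1 : ρ⁻¹ ≤ 1 := inv_le_one_of_one_le₀ hρ
  have hY : 0 ≤ ∑' z, w z ^ 2 := tsum_nonneg fun z => sq_nonneg _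
  obtain ⟨c, hc, hτ⟩ := hL.tau_eq
  have hdx : ∀ R z i, |dp (some i) (cut ρ z₀ R) z| ≤ ρ⁻¹ := by
    intro R z i
    refine (abs_cut_sub_cut_le _ _ _ _ _).trans ?_
    simpa [wt] using abs_sd_add_sub_le hρ0 z₀ z (some i) 1
  have hsdt : ∀ z, |sd ρ z₀ (z + L.τ) - sd ρ z₀ z| ≤ ρ⁻¹ ^ 2 := by
    intro z
    rw [hτ]
    simpa [wt, hc] using abs_sd_add_sub_le hρ0 z₀ z none c
  have hdt : ∀ R z, |cut ρ z₀ R (z + L.τ) - cut ρ z₀ R z| ≤ ρ⁻¹ ^ 2 := fun R z =>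
    (abs_cut_sub_cut_le _ _ _ _ _).trans (hsdt z)
  have hκ2 : ρ⁻¹ ^ 2 ≤ 1 := pow_le_one₀ (by positivity) hκ1
  have hgdp : ∀ z, g z ^ 2 ≤ dp j w z ^ 2 := by
    intro z
    rcases le_or_gt (sd ρ z₀ z) R with h | h
    · exact sq_le_sq.2 (hg z h)
    · rw [hg0 z h, zero_pow two_ne_zero]; exact sq_nonneg _
  have hgf : g.HasFiniteSupport := by
    refine Set.Finite.subset (hasFiniteSupport_dp j hw) fun z hz => ?_
    simp only [Function.mem_support] at hz ⊢
    intro h0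
    have := hgdp z
    rw [h0] at this
    exact hz (by nlinarith)
  rcases j with _ | i
  · have h := htd L S hL w (cut ρ z₀ (R + 1)) ρ⁻¹ hw (by positivity) hκ1
      (cut_nonneg _ _ _) (cut_le_one _ _ _) (fun z hz => by
        have := sd_lt_of_cut_ne_zero hz
        have h2 := hsdt (z - L.τ)
        rw [sub_add_cancel, abs_le] at h2
        exact ⟨hP z (by linarith), hP _ (by linarith)⟩) (hdx _) (hdt _)
    obtain ⟨y, hy, hyd⟩ : ∃ y : Grd ι, (∀ z, |sd ρ z₀ (z + y) - sd ρ z₀ z| ≤ 1) ∧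
        ∀ z, dp none w z ^ 2 = (w (z + y) - w (z + y - L.τ)) ^ 2 := by
      rcases hL.tau with h1 | h1
      · refine ⟨ev none, fun z => ?_, fun z => ?_⟩
        · rw [← h1]; exact (hsdt z).trans hκ2
        · rw [h1]; simp [dp]
      · refine ⟨0, fun z => by simp, fun z => ?_⟩
        rw [h1]
        simp only [dp, add_zero, sub_neg_eq_add]
        ring
    have h3 : ∑' z, g z ^ 2 ≤ ∑' z, cut ρ z₀ (R + 1) z ^ 4 * (w z - w (z - L.τ)) ^ 2 := by
      rw [← tsum_shift (fun z => cut ρ z₀ (R + 1) z ^ 4 * (w z - w (z - L.τ)) ^ 2) y]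
      refine tsum_le_fs (fun z => ?_) (by fun_prop) (by fun_prop)
      rcases le_or_gt (sd ρ z₀ z) R with h | h
      · rw [cut_eq_one (by linarith [(abs_le.1 (hy z)).2]), one_pow, one_mul, ← hyd]
        exact hgdp z
      · rw [hg0 z h, zero_pow two_ne_zero]
        positivity
    have h4 := mul_le_mul_of_nonneg_left (h3.trans h) (show 0 ≤ (ρ ^ wt (none : Option ι)) ^ 2 by positivity)
    refine h4.trans ?_
    have : (ρ ^ wt (none : Option ι)) ^ 2 * (K₂ * ρ⁻¹ ^ 4 * ∑' z, w z ^ 2) = K₂ * ∑' z, w z ^ 2 := by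
      simp only [wt]; field_simp
    rw [this]
    nlinarith
  · have h := hcacc L S hL w (cut ρ z₀ R) (fun _ => 2 * ρ⁻¹ ^ 2) hw (fun z hz =>
        hP z (by linarith [sd_lt_of_cut_ne_zero hz])) (fun z i => by
        have := hdx R z i
        have := sq_le_sq' (by linarith [(abs_le.1 this).1]) (abs_le.1 this).2
        nlinarith)
      (fun z i j => by
        have := hdx R z i
        have := sq_le_sq' (by linarith [(abs_le.1 this).1]) (abs_le.1 this).2
        nlinarith)
      (fun z => by
        have := abs_le.1 (hdt R z)
        have h0 := cut_nonneg ρ z₀ R z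
        have h1 := cut_le_one ρ z₀ R z
        have h2 := cut_nonneg ρ z₀ R (z + L.τ)
        have h3 := cut_le_one ρ z₀ R (z + L.τ)
        rw [sq_sub_sq, abs_mul, abs_of_nonneg (by linarith)]
        gcongr
        · linarith
        · exact hdt R z)
    rw [tsum_mul_left] at h
    have h3 : ∑' z, g z ^ 2 ≤ ∑' z, cut ρ z₀ R z ^ 2 * (∑ j, dp (some j) w z ^ 2 + L.lam * w z ^ 2) := by
      refine tsum_le_fs (fun z => ?_) (by fun_prop) (by fun_prop)
      have hl := hL.lam_pos
      rcases le_or_gt (sd ρ z₀ z) R with h | h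
      · rw [cut_eq_one h, one_pow, one_mul]
        have := Finset.single_le_sum (f := fun j => dp (some j) w z ^ 2) (fun _ _ => sq_nonneg _) (Finset.mem_univ i)
        have h5 := hgdp z
        have : 0 ≤ L.lam * w z ^ 2 := by positivity
        beta_reduce at *
        linarith
      · rw [hg0 z h, zero_pow two_ne_zero]
        have : 0 ≤ ∑ j, dp (some j) w z ^ 2 := Finset.sum_nonneg fun _ _ => sq_nonneg _
        positivity
    have h4 := mul_le_mul_of_nonneg_left (h3.trans h) (show 0 ≤ (ρ ^ wt (some i)) ^ 2 by positivity)
    refine h4.trans ?_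
    have : (ρ ^ wt (some i)) ^ 2 * (K₁ * (2 * ρ⁻¹ ^ 2 * ∑' z, w z ^ 2)) = 2 * K₁ * ∑' z, w z ^ 2 := by
      simp only [wt]; field_simp
    rw [this]
    nlinarith

end LocalEstimates

section SupBound

variable {ι : Type*} [Fintype ι]

lemma LOp.app_congr (L : LOp ι) (u v : Grd ι → ℝ) (z : Grd ι) (h0 : u z = v z)
    (hτ : u (z - L.τ) = v (z - L.τ)) (hj : ∀ j, u (z + ev j) = v (z + ev j))
    (hi : ∀ i, u (z - ev i) = v (z - ev i))
    (hij : ∀ i j, u (z - ev i + ev j) = v (z - ev i + ev j)) : L.app u z = L.app v z := by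
  simp only [LOp.app, dp, h0, hτ, hj, hi, hij]

lemma sd_add_le {ρ : ℝ} (hρ : 1 ≤ ρ) (z₀ z : Grd ι) (j : Option ι) (c : ℤ) :
    sd ρ z₀ (z + c • ev j) ≤ sd ρ z₀ z + |(c : ℝ)| := by
  have h1 := (abs_le.1 (abs_sd_add_sub_le (by linarith) z₀ z j c)).2
  have : (ρ ^ wt j)⁻¹ ≤ 1 := inv_le_one_of_one_le₀ (one_le_pow₀ hρ)
  nlinarith [abs_nonneg (c : ℝ)]

lemma LOp.OK.app_congr_sd {L : LOp ι} {ν : ℝ} {S : Set (Option ι)} (hL : L.OK ν S) {ρ : ℝ}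
    (hρ : 1 ≤ ρ) (z₀ : Grd ι) {R : ℝ} {u v : Grd ι → ℝ}
    (huv : ∀ y, sd ρ z₀ y ≤ R + 2 → u y = v y) {z : Grd ι} (hz : sd ρ z₀ z ≤ R) :
    L.app u z = L.app v z := by
  have hp : ∀ y j, sd ρ z₀ (y + ev j) ≤ sd ρ z₀ y + 1 := fun y j => by
    simpa using sd_add_le hρ z₀ y j 1
  have hm : ∀ y j, sd ρ z₀ (y - ev j) ≤ sd ρ z₀ y + 1 := fun y j => by
    simpa [sub_eq_add_neg] using sd_add_le hρ z₀ y j (-1)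
  refine L.app_congr u v z (huv _ (by linarith)) (huv _ ?_) (fun j => huv _ ?_) (fun j => huv _ ?_)
    fun i j => huv _ ?_
  · obtain ⟨c, hc, hτ⟩ := hL.tau_eq
    have := sd_add_le hρ z₀ z none (-c)
    rw [neg_smul, ← sub_eq_add_neg, ← hτ, Int.cast_neg, abs_neg, hc] at this
    linarith
  · linarith [hp z j]
  · linarith [hm z j]
  · linarith [hm z i, hp (z - ev i) j]

lemma sd_le_one_of_mem_face {ρ : ℕ} (hρ : 1 ≤ ρ) {z₀ : Grd ι} {T : Finset (Option ι)} {y : Grd ι}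
    (hy : y ∈ face ρ z₀ T) : sd ρ z₀ y ≤ 1 := by
  have hρ' : (0 : ℝ) < ρ := by exact_mod_cast hρ
  rw [sd_le_iff hρ' zero_le_one]
  intro j
  have h := mem_face.1 hy j
  rw [one_mul, abs_le]
  by_cases hj : j ∈ T
  · rw [h.1 hj]
    simp
  · obtain ⟨h1, h2⟩ := h.2 hj
    have h3 : (0 : ℝ) ≤ ((y j - z₀ j : ℤ) : ℝ) := by exact_mod_cast (by omega : 0 ≤ y j - z₀ j)
    have h4 : ((y j - z₀ j : ℤ) : ℝ) ≤ ((ρ ^ wt j : ℕ) : ℤ) := by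
      exact_mod_cast (by omega : y j - z₀ j ≤ ((ρ ^ wt j : ℕ) : ℤ))
    push_cast at h3 h4 ⊢
    exact ⟨by nlinarith [pow_pos hρ' (wt j)], h4⟩

lemma face_sum_le_tsum {ρ : ℕ} (z₀ : Grd ι) (T : Finset (Option ι))
    {w : Grd ι → ℝ} (hw : w.HasFiniteSupport) :
    ∑ y ∈ face ρ z₀ T, w y ^ 2 ≤ ∑' y, w y ^ 2 :=
  (summable_fs (f := fun y => w y ^ 2) (by fun_prop)).sum_le_tsum _ fun _ _ => sq_nonneg _

open Classical in
/-- Truncation of `w` to the parabolic ball of radius `R`. -/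
def trunc (ρ : ℝ) (z₀ : Grd ι) (R : ℝ) (w : Grd ι → ℝ) (z : Grd ι) : ℝ :=
  if sd ρ z₀ z ≤ R then w z else 0

lemma trunc_of_le {ρ : ℝ} {z₀ : Grd ι} {R : ℝ} {w : Grd ι → ℝ} {z : Grd ι} (h : sd ρ z₀ z ≤ R) :
    trunc ρ z₀ R w z = w z := if_pos h

lemma trunc_of_gt {ρ : ℝ} {z₀ : Grd ι} {R : ℝ} {w : Grd ι → ℝ} {z : Grd ι} (h : R < sd ρ z₀ z) :
    trunc ρ z₀ R w z = 0 := if_neg h.not_ge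

lemma hasFiniteSupport_trunc {ρ : ℝ} {z₀ : Grd ι} {R : ℝ} {w : Grd ι → ℝ}
    (hw : w.HasFiniteSupport) : (trunc ρ z₀ R w).HasFiniteSupport := by
  refine Set.Finite.subset hw fun z hz => ?_
  by_contra h
  simp only [Function.mem_support, not_not] at h
  exact hz (by unfold trunc; split_ifs <;> simp [h])

lemma face_sum_le [DecidableEq ι] (ν : ℝ) (hν : 0 < ν) (ℓ : ι) (T : Finset (Option ι)) :
    some ℓ ∉ T → ∃ C R : ℝ, 0 < C ∧ 1 ≤ R ∧ ∀ (L : LOp ι) (S : Set (Option ι)), L.OK ν S →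
    (∀ k, k ≠ some ℓ → k ∈ S) → ∀ (w : Grd ι → ℝ) (ρ : ℕ) (z₀ : Grd ι), w.HasFiniteSupport →
    1 ≤ ρ → (∀ z, sd ρ z₀ z ≤ R → L.app w z = 0) →
    (∏ j ∈ insert (some ℓ) T, (ρ : ℝ) ^ wt j) * ∑ y ∈ face ρ z₀ (insert (some ℓ) T), w y ^ 2 ≤
      C * ∑' y, w y ^ 2 := by
  obtain ⟨K, hK, hloc⟩ := local_dp_le (ι := ι) ν hν
  induction T using Finset.induction_on with
  | empty =>
    intro _
    refine ⟨2 + 2 * K, 4, by positivity, by norm_num, ?_⟩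
    intro L S hL hS w ρ z₀ hw hρ hP
    have hρ1 : (1 : ℝ) ≤ ρ := by exact_mod_cast hρ
    rw [insert_empty_eq, Finset.prod_singleton]
    have h1 := face_sobolev ρ z₀ ∅ (some ℓ) (by simp) w
    rw [insert_empty_eq] at h1
    push_cast at h1
    refine h1.trans ?_
    have h2 := face_sum_le_tsum (ρ := ρ) z₀ ∅ hw
    have h3 := hloc L S hL w ρ z₀ 1 hw hρ1 (fun z hz => hP z (by linarith)) (some ℓ)
      (trunc ρ z₀ 1 (dp (some ℓ) w)) (fun z hz => by rw [trunc_of_le hz]) fun z hz => trunc_of_gt hz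
    have h4 := face_sum_le_tsum (ρ := ρ) z₀ ∅
      (hasFiniteSupport_trunc (ρ := ρ) (z₀ := z₀) (R := 1) (hasFiniteSupport_dp (some ℓ) hw))
    have h5 : ∑ y ∈ face ρ z₀ ∅, dp (some ℓ) w y ^ 2 =
        ∑ y ∈ face ρ z₀ ∅, trunc ρ z₀ 1 (dp (some ℓ) w) y ^ 2 :=
      Finset.sum_congr rfl fun y hy => by rw [trunc_of_le (sd_le_one_of_mem_face hρ hy)]
    rw [h5]
    have h6 : ((ρ : ℝ) ^ wt (some ℓ)) ^ 2 * ∑ y ∈ face ρ z₀ ∅, trunc ρ z₀ 1 (dp (some ℓ) w) y ^ 2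
      ≤ K * ∑' y, w y ^ 2 := (mul_le_mul_of_nonneg_left h4 (by positivity)).trans h3
    linarith
  | insert j T hj ih =>
    intro hℓ
    obtain ⟨hℓj, hℓT⟩ : some ℓ ≠ j ∧ some ℓ ∉ T := by simpa using hℓ
    obtain ⟨C, R, hC, hR, hT⟩ := ih hℓT
    refine ⟨2 * C + 2 * C * K, R + 5, by positivity, by linarith, ?_⟩
    intro L S hL hS w ρ z₀ hw hρ hP
    have hρ1 : (1 : ℝ) ≤ ρ := by exact_mod_cast hρ
    have hjT : j ∉ insert (some ℓ) T := by simp [hj, Ne.symm hℓj]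
    rw [Finset.insert_comm, Finset.prod_insert hjT]
    have h1 := face_sobolev ρ z₀ (insert (some ℓ) T) j hjT w
    push_cast at h1
    set Θ := ∏ j ∈ insert (some ℓ) T, (ρ : ℝ) ^ wt j with hΘ
    have hΘ0 : 0 ≤ Θ := Finset.prod_nonneg fun _ _ => by positivity
    have h2 := hT L S hL hS w ρ z₀ hw hρ fun z hz => hP z (by linarith)
    have h3 := hloc L S hL w ρ z₀ (R + 2) hw hρ1 (fun z hz => hP z (by linarith)) j
      (trunc ρ z₀ (R + 2) (dp j w)) (fun z hz => by rw [trunc_of_le hz]) fun z hz => trunc_of_gt hz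
    have h4 := hT L S hL hS (trunc ρ z₀ (R + 2) (dp j w)) ρ z₀
      (hasFiniteSupport_trunc (hasFiniteSupport_dp j hw)) hρ fun z hz => by
        rw [hL.app_congr_sd hρ1 z₀ (fun y hy => trunc_of_le hy) hz,
          hL.app_dp (hS j (Ne.symm hℓj)), hP z (by linarith), hP _ ?_, sub_zero]
        have := sd_add_le hρ1 z₀ z j 1
        rw [one_smul, Int.cast_one, abs_one] at this
        linarith
    have h5 : ∑ y ∈ face ρ z₀ (insert (some ℓ) T), dp j w y ^ 2 =
        ∑ y ∈ face ρ z₀ (insert (some ℓ) T), trunc ρ z₀ (R + 2) (dp j w) y ^ 2 :=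
      Finset.sum_congr rfl fun y hy => by
        rw [trunc_of_le ((sd_le_one_of_mem_face hρ hy).trans (by linarith))]
    rw [h5] at h1
    set X := ∑ y ∈ face ρ z₀ (insert (some ℓ) T), trunc ρ z₀ (R + 2) (dp j w) y ^ 2
    set Y := ∑' y, trunc ρ z₀ (R + 2) (dp j w) y ^ 2
    set W := ∑' y, w y ^ 2
    have h6 := mul_le_mul_of_nonneg_left h1 hΘ0
    have h7 := mul_le_mul_of_nonneg_left h4 (sq_nonneg ((ρ : ℝ) ^ wt j))
    have h8 := mul_le_mul_of_nonneg_left h3 hC.le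
    calc _ = Θ * ((ρ : ℝ) ^ wt j * ∑ y ∈ face ρ z₀ (insert j (insert (some ℓ) T)), w y ^ 2) := by
          ring
      _ ≤ _ := by linarith

/-- Interior pointwise bound on dyadic parabolic cells. -/
theorem cell_sup_bound (ν : ℝ) (hν : 0 < ν) (ℓ : ι) : ∃ C : ℝ≥0∞, C ≠ ∞ ∧
    ∀ (L : LOp ι) (S : Set (Option ι)), L.OK ν S → (∀ k, k ≠ some ℓ → k ∈ S) →
    ∀ (W : Grd ι → ℝ) (k : ℕ) (c : Grd ι),
    (∀ y, (∀ y' : Grd ι, (∀ j, |y' j - y j| ≤ 2) → y' ∈ cellNbd wt 2 k c) → L.app W y = 0) →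
    ∀ z ∈ cellNbd wt 1 k c, ‖W z‖ₑ ^ 2 * cellVol (wt (ι := ι)) k ≤
      C * ∫⁻ y in cellNbd wt 2 k c, ‖W y‖ₑ ^ 2 ∂Measure.count := by
  classical
  obtain ⟨C, R, hC, hR, hface⟩ := face_sum_le ν hν ℓ (Finset.univ.erase (some ℓ)) (by simp)
  obtain ⟨m, hm⟩ : ∃ m : ℕ, R + 2 ≤ 2 ^ m := pow_unbounded_of_one_lt (R + 2) one_lt_two |>.imp
    fun _ h => h.le
  refine ⟨cellVol (wt (ι := ι)) m * (1 + ENNReal.ofReal C), ENNReal.mul_ne_top (cellVol_ne_top _ _)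
    (by simp), ?_⟩
  intro L S hL hS W k c hW z hz
  have hz2 : z ∈ cellNbd wt 2 k c := fun j => (hz j).trans (by norm_num)
  have hmeas : ∀ s : Set (Grd ι), MeasurableSet s := fun s => s.to_countable.measurableSet
  have hpt : ‖W z‖ₑ ^ 2 ≤ ∫⁻ y in cellNbd wt 2 k c, ‖W y‖ₑ ^ 2 ∂Measure.count := by
    rw [← lintegral_indicator (hmeas _), lintegral_count]
    refine le_trans ?_ (ENNReal.le_tsum z)
    rw [Set.indicator_of_mem hz2]
  rcases lt_or_ge k m with hkm | hkm
  · calc ‖W z‖ₑ ^ 2 * cellVol (wt (ι := ι)) k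
        ≤ (∫⁻ y in cellNbd wt 2 k c, ‖W y‖ₑ ^ 2 ∂Measure.count) * cellVol (wt (ι := ι)) m := by
          gcongr
          unfold cellVol
          gcongr
          norm_num
      _ = cellVol (wt (ι := ι)) m * 1 * (∫⁻ y in cellNbd wt 2 k c, ‖W y‖ₑ ^ 2 ∂Measure.count) := by ring
      _ ≤ _ := by gcongr; exact le_self_add
  obtain ⟨r, rfl⟩ : ∃ r, k = m + r := ⟨k - m, by omega⟩
  have hρ1 : 1 ≤ 2 ^ r := Nat.one_le_two_pow
  have hρ1' : (1 : ℝ) ≤ ((2 ^ r : ℕ) : ℝ) := by exact_mod_cast hρ1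
  have hnbd : ∀ y : Grd ι, sd ((2 ^ r : ℕ) : ℝ) z y ≤ R + 2 → y ∈ cellNbd wt 2 (m + r) c := by
    intro y hy
    rw [sd_le_iff (by linarith) (by linarith)] at hy
    rw [cellNbd_eq_Icc] at hz ⊢
    have key : ∀ j, |y j - z j| ≤ 2 ^ (wt j * (m + r)) := by
      intro j
      have h1 := hy j
      have h2 : (R + 2) * ((2 ^ r : ℕ) : ℝ) ^ wt j ≤ 2 ^ (wt j * (m + r)) := by
        calc (R + 2) * ((2 ^ r : ℕ) : ℝ) ^ wt j ≤ 2 ^ m * ((2 ^ r : ℕ) : ℝ) ^ wt j := by gcongr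
          _ ≤ 2 ^ (wt j * m) * ((2 ^ r : ℕ) : ℝ) ^ wt j := by
            gcongr
            · norm_num
            · exact Nat.le_mul_of_pos_left m (one_le_wt j)
          _ = _ := by push_cast; rw [← pow_mul, ← pow_add]; congr 1; ring
      have h3 := h1.trans h2
      exact_mod_cast h3
    have key1 := fun j => abs_le.1 (key j)
    simp only [mem_Icc, Pi.le_def] at hz ⊢
    refine ⟨fun j => ?_, fun j => ?_⟩
    · have h1 := hz.1 j
      have h2 := (key1 j).1
      linarith
    · have h1 := hz.2 j
      have h2 := (key1 j).2
      linarith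
  have hfin : (cellNbd wt 2 (m + r) c).Finite := by
    rw [cellNbd_eq_Icc]; exact Set.finite_Icc _ _
  set w : Grd ι → ℝ := (cellNbd wt 2 (m + r) c).indicator W with hw
  have hwf : w.HasFiniteSupport := hfin.subset (by rw [hw]; exact Set.support_indicator_subset)
  have happ : ∀ y, sd ((2 ^ r : ℕ) : ℝ) z y ≤ R → L.app w y = 0 := by
    intro y hy
    rw [hL.app_congr_sd hρ1' z (v := W)
      (fun y' hy' => by rw [hw, Set.indicator_of_mem (hnbd y' hy')]) hy]
    refine hW y fun y' hy' => hnbd y' ?_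
    rw [sd_le_iff (by linarith) (by linarith)] at hy ⊢
    intro j
    have h1 := hy j
    have h2 : |((y' j - y j : ℤ) : ℝ)| ≤ 2 := by exact_mod_cast hy' j
    have h3 : ((y' j - z j : ℤ) : ℝ) = ((y' j - y j : ℤ) : ℝ) + ((y j - z j : ℤ) : ℝ) := by
      push_cast; ring
    have h4 : (1 : ℝ) ≤ ((2 ^ r : ℕ) : ℝ) ^ wt j := one_le_pow₀ hρ1'
    rw [h3]
    refine (abs_add_le _ _).trans ?_
    nlinarith
  have h := hface L S hL hS w (2 ^ r) z hwf hρ1 happ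
  rw [Finset.insert_erase (Finset.mem_univ _)] at h
  have hfz : face (2 ^ r) z (Finset.univ : Finset (Option ι)) = {z} := by
    ext y
    simp [mem_face, funext_iff]
  rw [hfz, Finset.sum_singleton, Finset.prod_pow_eq_pow_sum, hw, Set.indicator_of_mem hz2] at h
  have hint : ∫⁻ y in cellNbd wt 2 (m + r) c, ‖W y‖ₑ ^ 2 ∂Measure.count =
      ENNReal.ofReal (∑' y, w y ^ 2) := by
    rw [← lintegral_indicator (hmeas _), lintegral_count,
      ENNReal.ofReal_tsum_of_nonneg (fun _ => sq_nonneg _)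
        (summable_fs (f := fun y => w y ^ 2) (by fun_prop))]
    refine tsum_congr fun y => ?_
    by_cases hy : y ∈ cellNbd wt 2 (m + r) c
    · rw [hw, Set.indicator_of_mem hy, Set.indicator_of_mem hy, Real.enorm_eq_ofReal_abs,
        ← ENNReal.ofReal_pow (abs_nonneg _), sq_abs]
    · rw [hw, Set.indicator_of_notMem hy, Set.indicator_of_notMem hy]
      simp
  rw [hint]
  have hvol : cellVol (wt (ι := ι)) (m + r) = cellVol (wt (ι := ι)) m *
      ENNReal.ofReal (((2 ^ r : ℕ) : ℝ) ^ (∑ j, wt (ι := ι) j)) := by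
    unfold cellVol
    rw [add_mul, pow_add, ENNReal.ofReal_pow (by positivity), ENNReal.ofReal_natCast, pow_mul]
    push_cast
    rw [pow_mul]
  rw [hvol, Real.enorm_eq_ofReal_abs, ← ENNReal.ofReal_pow (abs_nonneg _), sq_abs]
  calc _ = cellVol (wt (ι := ι)) m *
        ENNReal.ofReal (((2 ^ r : ℕ) : ℝ) ^ (∑ j, wt (ι := ι) j) * W z ^ 2) := by
        rw [ENNReal.ofReal_mul (by positivity)]; ring
    _ ≤ cellVol (wt (ι := ι)) m * ENNReal.ofReal (C * ∑' y, w y ^ 2) := by gcongr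
    _ = cellVol (wt (ι := ι)) m * ENNReal.ofReal C * ENNReal.ofReal (∑' y, w y ^ 2) := by
        rw [ENNReal.ofReal_mul hC.le]; ring
    _ ≤ _ := by gcongr; exact le_add_self

end SupBound

section GlobalEnergy

variable {ι : Type*} [Fintype ι]

@[fun_prop]
lemma LOp.hasFiniteSupport_app (L : LOp ι) {u : Grd ι → ℝ} (hu : u.HasFiniteSupport) :
    (fun z => L.app u z).HasFiniteSupport := by
  unfold LOp.app; fun_prop

lemma abs_tsum_mul_mul_le {G : Type*} {M ε : ℝ} (hε : 0 < ε) {a f g : G → ℝ}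
    (ha : ∀ z, |a z| ≤ M) (hf : f.HasFiniteSupport) (hg : g.HasFiniteSupport) :
    |∑' z, a z * (f z * g z)| ≤ ε * ∑' z, g z ^ 2 + M ^ 2 / (4 * ε) * ∑' z, f z ^ 2 := by
  have key : ∀ z, |a z * (f z * g z)| ≤ ε * g z ^ 2 + M ^ 2 / (4 * ε) * f z ^ 2 := by
    intro z
    have hM : 0 ≤ M := (abs_nonneg _).trans (ha z)
    rw [abs_mul, abs_mul, ← sq_abs (g z), ← sq_abs (f z)]
    have h1 : |a z| * (|f z| * |g z|) ≤ M * (|f z| * |g z|) := by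
      gcongr
      exact ha z
    have h2 : ε * |g z| ^ 2 + M ^ 2 / (4 * ε) * |f z| ^ 2 - M * (|f z| * |g z|) =
        ε * (|g z| - M / (2 * ε) * |f z|) ^ 2 := by
      field_simp
      ring
    have : 0 ≤ ε * (|g z| - M / (2 * ε) * |f z|) ^ 2 := by positivity
    linarith
  rw [← tsum_mul_left, ← tsum_mul_left, ← tsum_add_fs (by fun_prop) (by fun_prop), abs_le, ← tsum_neg]
  exact ⟨tsum_le_fs (fun z => neg_le_of_abs_le (key z)) (by fun_prop) (by fun_prop),
    tsum_le_fs (fun z => le_of_abs_le (key z)) (by fun_prop) (by fun_prop)⟩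

variable {L : LOp ι} {ν : ℝ} {S : Set (Option ι)}

lemma LOp.OK.tsum_mul_sub_nonneg (hL : L.OK ν S) {b g : Grd ι → ℝ} (hb : ∀ z, 0 ≤ b z)
    (hbτ : ∀ z, b (z - L.τ) = b z) (hg : g.HasFiniteSupport) :
    0 ≤ ∑' z, b z * (g z * (g z - g (z - L.τ))) := by
  have h := tsum_telescope (H := fun z => 1 / 2 * (b z * g z ^ 2)) (by fun_prop) L.τ
  rw [← h]
  refine tsum_le_fs (fun z => ?_) (by fun_prop) (by fun_prop)
  rw [hbτ]
  nlinarith [mul_nonneg (hb z) (sq_nonneg (g z - g (z - L.τ)))]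

lemma LOp.OK.energy_le (hL : L.OK ν S) (hν : 0 < ν) {u : Grd ι → ℝ} (hu : u.HasFiniteSupport) :
    ν * ∑' z, ∑ k, dp (some k) u z ^ 2 + L.lam * ν * ∑' z, u z ^ 2 ≤ ∑' z, L.app u z * u z := by
  have h0 := hL.tsum_mul_sub_nonneg (b := L.A) (fun z => hν.le.trans (hL.A_lo z)) hL.A_tau' hu
  have h1 : ∀ z, ν * ∑ k, dp (some k) u z ^ 2 + L.lam * ν * u z ^ 2 +
      L.A z * (u z * (u z - u (z - L.τ))) ≤ L.A z * (u z - u (z - L.τ)) * u z +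
      L.lam * L.C z * u z * u z + ∑ i, ∑ j, L.a i j z * dp (some j) u z * dp (some i) u z := by
    intro z
    have := hL.ell z (fun k => dp (some k) u z)
    have h2 : L.lam * ν * u z ^ 2 ≤ L.lam * L.C z * u z * u z := by
      have := mul_le_mul_of_nonneg_left (hL.C_lo z) (mul_nonneg hL.lam_pos.le (sq_nonneg (u z)))
      nlinarith
    nlinarith
  rw [L.app_pair u u hu, ← tsum_mul_left, ← tsum_mul_left,
    ← tsum_add_fs (by fun_prop) (by fun_prop)]
  have h3 := tsum_le_fs h1 (by fun_prop) (by fun_prop)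
  rw [tsum_add_fs (by fun_prop) (by fun_prop)] at h3
  linarith

lemma LOp.OK.lam_sq_le (hL : L.OK ν S) (hν : 0 < ν) {u : Grd ι → ℝ} (hu : u.HasFiniteSupport) :
    ∑' z, (L.lam * u z) ^ 2 ≤ (ν⁻¹) ^ 2 * ∑' z, L.app u z ^ 2 := by
  have hl := hL.lam_pos
  have h := hL.energy_le hν hu
  have h1 : 0 ≤ ∑' z, ∑ k, dp (some k) u z ^ 2 :=
    tsum_nonneg fun _ => Finset.sum_nonneg fun _ _ => sq_nonneg _
  have h2 := (abs_le.1 (abs_tsum_mul_mul_le (M := 1) (a := fun _ => 1) (f := L.app u) (g := u)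
    (show 0 < L.lam * ν / 2 by positivity) (by simp) (by fun_prop) hu)).2
  simp only [one_mul] at h2
  simp_rw [mul_pow]
  rw [tsum_mul_left]
  set X := ∑' z, u z ^ 2
  set Y := ∑' z, L.app u z ^ 2
  have h3 : L.lam * ν / 2 * X ≤ 1 ^ 2 / (4 * (L.lam * ν / 2)) * Y := by nlinarith
  have h4 := mul_le_mul_of_nonneg_left h3 (show 0 ≤ 2 * L.lam / ν by positivity)
  calc L.lam ^ 2 * X = 2 * L.lam / ν * (L.lam * ν / 2 * X) := by field_simp
    _ ≤ _ := h4
    _ = _ := by field_simp; ring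

lemma LOp.OK.dp_dp_sq_le (hL : L.OK ν S) (hν : 0 < ν) {u : Grd ι → ℝ} (hu : u.HasFiniteSupport)
    {i : ι} (hi : some i ∈ S) (k : ι) :
    ∑' z, dp (some k) (dp (some i) u) z ^ 2 ≤ (ν⁻¹) ^ 2 * ∑' z, L.app u z ^ 2 := by
  have hl := hL.lam_pos
  set g := dp (some i) u with hg
  have hgf : g.HasFiniteSupport := hasFiniteSupport_dp _ hu
  have h := hL.energy_le hν hgf
  have h1 : ∑' z, L.app g z * g z = -∑' z, (1 : ℝ) * (L.app u z * dp (some i) g (z - ev (some i))) := by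
    have ht := tsum_telescope (H := fun z => L.app u (z + ev (some i)) * g z) (by fun_prop)
      (ev (some i))
    rw [← tsum_neg, ← sub_eq_zero, ← tsum_sub_fs (by fun_prop) (by fun_prop), ← ht]
    refine tsum_congr fun z => ?_
    rw [hg, hL.app_dp hi]
    simp only [dp, sub_add_cancel]
    ring
  have h2 := (abs_le.1 (abs_tsum_mul_mul_le (M := 1) (a := fun _ => 1) (f := L.app u)
    (g := fun z => dp (some i) g (z - ev (some i)))
    (show 0 < ν / 2 by positivity) (by simp) (by fun_prop) (by fun_prop))).1
  rw [tsum_shift' (fun z => dp (some i) g z ^ 2)] at h2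
  have h3 : 0 ≤ ∑' z, g z ^ 2 := tsum_nonneg fun _ => sq_nonneg _
  rw [tsum_sum_fs (fun i => by fun_prop)] at h
  have h4 : ∀ k, ∑' z, dp (some k) g z ^ 2 ≤ ∑ k, ∑' z, dp (some k) g z ^ 2 := fun k =>
    Finset.single_le_sum (f := fun k => ∑' z, dp (some k) g z ^ 2)
      (fun _ _ => tsum_nonneg fun _ => sq_nonneg _) (Finset.mem_univ k)
  set Y := ∑' z, L.app u z ^ 2
  set X := ∑ k, ∑' z, dp (some k) g z ^ 2
  have h5 : ν / 2 * X ≤ 1 ^ 2 / (4 * (ν / 2)) * Y := by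
    have := mul_le_mul_of_nonneg_left (h4 i) hν.le
    have : 0 ≤ L.lam * ν * ∑' z, g z ^ 2 := by positivity
    linarith
  have h6 := mul_le_mul_of_nonneg_left h5 (show 0 ≤ 2 / ν by positivity)
  refine (h4 k).trans ?_
  calc X = 2 / ν * (ν / 2 * X) := by field_simp
    _ ≤ _ := h6
    _ = _ := by field_simp; ring

lemma dp_comm (i k : Option ι) (u : Grd ι → ℝ) (z : Grd ι) : dp i (dp k u) z = dp k (dp i u) z := by
  simp only [dp]
  rw [add_right_comm z (ev i) (ev k)]
  ring

lemma LOp.OK.a_sub (hL : L.OK ν S) {k : Option ι} (hk : k ∈ S) (i j : ι) (z : Grd ι) :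
    L.a i j (z - ev k) = L.a i j z := by
  rw [← hL.a_inv k hk i j (z - ev k), sub_add_cancel]

lemma LOp.OK.a_tau' (hL : L.OK ν S) (i j : ι) (z : Grd ι) :
    L.a i j (z - L.τ) = L.a i j z := by
  rw [← hL.a_tau i j (z - L.τ), sub_add_cancel]

/-- Time-derivative terms of the bilinear form, for `i` a direction of invariance. -/
lemma LOp.OK.cross_eq_of_mem (hL : L.OK ν S) {u v : Grd ι → ℝ}
    (hv : v.HasFiniteSupport) {i : ι} (hi : some i ∈ S) (j : ι) :
    ∑' z, L.a i j z * dp (some j) u z * dp (some i) v z =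
      -∑' z, L.a i j z * (dp (some i) (dp (some j) u) (z - ev (some i)) * v z) := by
  have ht := tsum_telescope (H := fun z => L.a i j z * dp (some j) u z * v (z + ev (some i)))
    (by fun_prop) (ev (some i))
  rw [← tsum_neg, ← sub_eq_zero, ← tsum_sub_fs (by fun_prop) (by fun_prop), ← ht]
  refine tsum_congr fun z => ?_
  rw [hL.a_sub hi]
  simp only [dp, sub_add_cancel]
  ring

lemma LOp.OK.cross_eq_of_mem' (hL : L.OK ν S) {u : Grd ι → ℝ}
    (hu : u.HasFiniteSupport) {j : ι} (hj : some j ∈ S) (i : ι) :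
    ∑' z, L.a i j z * dp (some j) u z * dp (some i) (fun z => u z - u (z - L.τ)) z =
      ∑' z, L.a i j z * (dp (some j) (dp (some i) u) (z - ev (some j)) *
        (u (z + L.τ) - u z)) := by
  have ht := tsum_telescope (H := fun z => L.a i j z * dp (some i) u z *
    (u (z + ev (some j) + L.τ) - u (z + ev (some j)))) (by fun_prop) (ev (some j))
  have ht2 := tsum_telescope (H := fun z => L.a i j z * dp (some j) u (z + L.τ) * dp (some i) u z)
    (by fun_prop) L.τ
  rw [← sub_eq_zero, ← tsum_sub_fs (by fun_prop) (by fun_prop)]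
  have : ∀ z, L.a i j z * dp (some j) u z * dp (some i) (fun z => u z - u (z - L.τ)) z -
      L.a i j z * (dp (some j) (dp (some i) u) (z - ev (some j)) * (u (z + L.τ) - u z)) =
      ((L.a i j z * dp (some j) u (z + L.τ) * dp (some i) u z) -
        (L.a i j (z - L.τ) * dp (some j) u (z - L.τ + L.τ) * dp (some i) u (z - L.τ))) -
      (L.a i j z * dp (some i) u z * (u (z + ev (some j) + L.τ) - u (z + ev (some j))) -
        L.a i j (z - ev (some j)) * dp (some i) u (z - ev (some j)) *
        (u (z - ev (some j) + ev (some j) + L.τ) - u (z - ev (some j) + ev (some j)))) := by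
    intro z
    rw [hL.a_sub hj, hL.a_tau']
    simp only [dp, sub_add_cancel]
    rw [add_right_comm z L.τ (ev (some j)), sub_add_eq_add_sub z L.τ (ev (some i))]
    ring
  simp_rw [this]
  rw [tsum_sub_fs (by fun_prop) (by fun_prop), ht, ht2, sub_zero]

theorem time_sq_le (ν : ℝ) (hν : 0 < ν) (ℓ : ι) : ∃ K : ℝ, 0 < K ∧ ∀ (L : LOp ι)
    (S : Set (Option ι)), L.OK ν S → (∀ k, k ≠ some ℓ → k ∈ S) → ∀ u : Grd ι → ℝ,
    u.HasFiniteSupport → ∑' z, (u z - u (z - L.τ)) ^ 2 ≤ K * ∑' z, L.app u z ^ 2 := by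
  set n : ℝ := (Fintype.card ι : ℝ) with hn
  set M := ν⁻¹ with hM
  have hM0 : 0 < M := inv_pos.2 hν
  set ε := ν / (4 * (n ^ 2 + 1)) with hε
  have hε0 : 0 < ε := by positivity
  set B := M ^ 2 / (4 * ε) * M ^ 2 with hB
  refine ⟨2 * M * (n ^ 2 * B + M), by positivity, ?_⟩
  intro L S hL hS u hu
  have hl := hL.lam_pos
  set v : Grd ι → ℝ := fun z => u z - u (z - L.τ) with hv
  have hvf : v.HasFiniteSupport := by rw [hv]; fun_prop
  set Y := ∑' z, L.app u z ^ 2 with hY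
  have hY0 : 0 ≤ Y := tsum_nonneg fun _ => sq_nonneg _
  set V := ∑' z, v z ^ 2 with hV
  have hV0 : 0 ≤ V := tsum_nonneg fun _ => sq_nonneg _
  have hpair := L.app_pair u v hvf
  rw [tsum_add_fs (by fun_prop) (by fun_prop), tsum_add_fs (by fun_prop) (by fun_prop),
    tsum_sum_fs (fun i => by fun_prop)] at hpair
  have h1 : ν * V ≤ ∑' z, L.A z * (u z - u (z - L.τ)) * v z := by
    rw [hV, ← tsum_mul_left]
    refine tsum_le_fs (fun z => ?_) (by fun_prop) (by fun_prop)
    have := mul_le_mul_of_nonneg_right (hL.A_lo z) (sq_nonneg (v z))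
    simp only [hv] at this ⊢
    nlinarith
  have h2 : 0 ≤ ∑' z, L.lam * L.C z * u z * v z := by
    have := hL.tsum_mul_sub_nonneg (b := fun z => L.lam * L.C z)
      (fun z => mul_nonneg hl.le (hν.le.trans (hL.C_lo z)))
      (fun z => by rw [← hL.C_tau (z - L.τ), sub_add_cancel]) hu
    simpa only [mul_assoc] using this
  have h3 : ∀ i j, -(ε * V + B * Y) ≤ ∑' z, L.a i j z * dp (some j) u z * dp (some i) v z := by
    intro i j
    by_cases hi : some i ∈ S
    · rw [hL.cross_eq_of_mem hvf hi]
      have e1 := (abs_le.1 (abs_tsum_mul_mul_le (M := M) (a := L.a i j)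
        (f := fun z => dp (some i) (dp (some j) u) (z - ev (some i))) (g := v) hε0
        (hL.a_hi i j) (by fun_prop) hvf)).2
      rw [tsum_shift' (fun z => dp (some i) (dp (some j) u) z ^ 2)] at e1
      simp_rw [dp_comm (some i) (some j)] at e1 ⊢
      have e2 := hL.dp_dp_sq_le hν hu hi j
      have e3 := mul_le_mul_of_nonneg_left e2 (show 0 ≤ M ^ 2 / (4 * ε) by positivity)
      rw [← mul_assoc] at e3
      linarith
    by_cases hj : some j ∈ S
    · rw [hL.cross_eq_of_mem' hu hj]
      have e1 := (abs_le.1 (abs_tsum_mul_mul_le (M := M) (a := L.a i j)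
        (f := fun z => dp (some j) (dp (some i) u) (z - ev (some j)))
        (g := fun z => u (z + L.τ) - u z) hε0
        (hL.a_hi i j) (by fun_prop) (by fun_prop))).1
      rw [tsum_shift' (fun z => dp (some j) (dp (some i) u) z ^ 2)] at e1
      have e4 : ∑' z, (u (z + L.τ) - u z) ^ 2 = V := by
        rw [hV, ← tsum_shift (fun z => v z ^ 2) L.τ]
        simp only [hv, add_sub_cancel_right]
      simp_rw [dp_comm (some j) (some i)] at e1 ⊢
      have e2 := hL.dp_dp_sq_le hν hu hj i
      have e3 := mul_le_mul_of_nonneg_left e2 (show 0 ≤ M ^ 2 / (4 * ε) by positivity)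
      rw [← mul_assoc] at e3
      rw [e4] at e1
      linarith
    · have hi' : i = ℓ := by
        by_contra h; exact hi (hS _ (by simpa using h))
      have hj' : j = ℓ := by
        by_contra h; exact hj (hS _ (by simpa using h))
      subst hi' hj'
      have := hL.tsum_mul_sub_nonneg (b := L.a j j) (g := dp (some j) u) (fun z => ?_)
        (fun z => hL.a_tau' _ _ _) (by fun_prop)
      · have e : ∀ z, L.a j j z * dp (some j) u z * dp (some j) v z = L.a j j z *
          (dp (some j) u z * (dp (some j) u z - dp (some j) u (z - L.τ))) := by
          intro z
          simp only [hv, dp]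
          rw [sub_add_eq_add_sub z L.τ]
          ring
        simp_rw [e]
        refine le_trans ?_ this
        have : 0 ≤ B := by positivity
        have : 0 ≤ ε * V + B * Y := by positivity
        linarith
      · classical
        have : ν ≤ L.a j j z := by
          simpa [Pi.single_apply, Finset.sum_ite_irrel] using hL.ell z (Pi.single j 1)
        linarith
  have h4 : -(n ^ 2 * (ε * V + B * Y)) ≤
      ∑ i, ∑' z, ∑ j, L.a i j z * dp (some j) u z * dp (some i) v z := by
    have e : -(n ^ 2 * (ε * V + B * Y)) = ∑ _i : ι, ∑ _j : ι, -(ε * V + B * Y) := by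
      simp only [Finset.sum_const, Finset.card_univ, nsmul_eq_mul, hn]; ring
    rw [e]
    refine Finset.sum_le_sum fun i _ => ?_
    rw [tsum_sum_fs (fun i => by fun_prop)]
    exact Finset.sum_le_sum fun j _ => h3 i j
  have h5 := (abs_le.1 (abs_tsum_mul_mul_le (M := 1) (a := fun _ => 1) (f := L.app u) (g := v)
    (show 0 < ν / 4 by positivity) (by simp) (by fun_prop) hvf)).2
  simp only [one_mul] at h5
  have h6 : (1 : ℝ) ^ 2 / (4 * (ν / 4)) = M := by rw [hM]; field_simp
  rw [h6] at h5
  have h7 : n ^ 2 * ε ≤ ν / 4 := by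
    rw [hε, mul_div_assoc', div_le_div_iff₀ (by positivity) (by norm_num)]
    nlinarith [sq_nonneg n]
  have h8 : n ^ 2 * ε * V ≤ ν / 4 * V := by gcongr
  have h9 : ν / 2 * V ≤ (n ^ 2 * B + M) * Y := by nlinarith
  calc V = 2 * M * (ν / 2 * V) := by rw [hM]; field_simp
    _ ≤ 2 * M * ((n ^ 2 * B + M) * Y) := by gcongr
    _ = _ := by ring

end GlobalEnergy

section Inverse

/-- Square-summable real families. -/
abbrev Sq (G : Type*) := lp (fun _ : G => ℝ) 2

lemma memℓp_two_iff {G : Type*} {f : G → ℝ} : Memℓp f 2 ↔ Summable fun z => f z ^ 2 := by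
  rw [memℓp_gen_iff (by simp)]
  simp

lemma Sq.norm_sq {G : Type*} (f : Sq G) : ‖f‖ ^ 2 = ∑' z, f z ^ 2 := by
  have := lp.norm_rpow_eq_tsum (p := 2) (by simp) f
  simpa using this

lemma Sq.summable {G : Type*} (f : Sq G) : Summable fun z => f z ^ 2 :=
  memℓp_two_iff.1 f.2

lemma Function.HasFiniteSupport.memℓp {G : Type*} {f : G → ℝ} (hf : f.HasFiniteSupport) :
    Memℓp f 2 :=
  memℓp_two_iff.2 (summable_fs (by fun_prop))

/-- The operator `Φ` acts boundedly on `ℓ²`. -/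
def SqBdd {G : Type*} (Φ : (G → ℝ) → G → ℝ) : Prop :=
  ∃ Q : Sq G →L[ℝ] Sq G, ∀ (u : Sq G) z, Q u z = Φ u z

lemma SqBdd.id {G : Type*} : SqBdd (G := G) fun u => u := ⟨ContinuousLinearMap.id ℝ _, fun _ _ => rfl⟩

lemma SqBdd.add {G : Type*} {Φ Ψ : (G → ℝ) → G → ℝ} (h : SqBdd Φ) (h' : SqBdd Ψ) :
    SqBdd fun u z => Φ u z + Ψ u z := by
  obtain ⟨Q, hQ⟩ := h
  obtain ⟨Q', hQ'⟩ := h'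
  exact ⟨Q + Q', fun u z => by simp [hQ, hQ']⟩

lemma SqBdd.sub {G : Type*} {Φ Ψ : (G → ℝ) → G → ℝ} (h : SqBdd Φ) (h' : SqBdd Ψ) :
    SqBdd fun u z => Φ u z - Ψ u z := by
  obtain ⟨Q, hQ⟩ := h
  obtain ⟨Q', hQ'⟩ := h'
  exact ⟨Q - Q', fun u z => by simp [hQ, hQ']⟩

lemma SqBdd.sum {G κ : Type*} (s : Finset κ) {Φ : κ → (G → ℝ) → G → ℝ} (h : ∀ i, SqBdd (Φ i)) :
    SqBdd fun u z => ∑ i ∈ s, Φ i u z := by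
  choose Q hQ using h
  exact ⟨∑ i ∈ s, Q i, fun u z => by
    rw [ContinuousLinearMap.sum_apply, lp.coeFn_sum, Finset.sum_apply]
    exact Finset.sum_congr rfl fun i _ => hQ i u z⟩

lemma SqBdd.comp {G : Type*} {Φ Ψ : (G → ℝ) → G → ℝ} (h : SqBdd Φ) (h' : SqBdd Ψ) :
    SqBdd fun u => Φ (Ψ u) := by
  obtain ⟨Q, hQ⟩ := h
  obtain ⟨Q', hQ'⟩ := h'
  refine ⟨Q.comp Q', fun u z => ?_⟩
  rw [ContinuousLinearMap.comp_apply, hQ]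
  have : (Q' u : G → ℝ) = Ψ u := funext (hQ' u)
  rw [this]

lemma SqBdd.mul {G : Type*} (b : G → ℝ) {M : ℝ} (hb : ∀ z, |b z| ≤ M) :
    SqBdd fun u z => b z * u z := by
  have key : ∀ (u : G → ℝ) z, (b z * u z) ^ 2 ≤ M ^ 2 * u z ^ 2 := fun u z => by
    rw [mul_pow, ← sq_abs (b z)]
    gcongr
    exact hb z
  have hs : ∀ u : Sq G, Summable fun z => (b z * u z) ^ 2 := fun u =>
    Summable.of_nonneg_of_le (fun _ => sq_nonneg _) (key u) ((Sq.summable u).mul_left _)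
  refine ⟨LinearMap.mkContinuous
    { toFun := fun u => ⟨fun z => b z * u z, memℓp_two_iff.2 (hs u)⟩
      map_add' := fun u v => by
        ext z
        simp [mul_add, Pi.add_apply]
        rfl
      map_smul' := fun c u => by
        ext z
        simp
        ring } |M| fun u => ?_, fun u z => rfl⟩
  rw [← abs_of_nonneg (norm_nonneg u), ← abs_mul]
  refine le_trans (le_abs_self _) (sq_le_sq.1 ?_)
  rw [Sq.norm_sq, mul_pow, Sq.norm_sq, ← tsum_mul_left]
  exact (hs u).tsum_le_tsum (key u) ((Sq.summable u).mul_left _)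

lemma SqBdd.shift {G : Type*} [AddGroup G] (v : G) : SqBdd fun (u : G → ℝ) z => u (z + v) := by
  have hs : ∀ u : Sq G, Summable fun z => (u (z + v)) ^ 2 := fun u =>
    (Sq.summable u).comp_injective (add_left_injective v)
  refine ⟨LinearMap.mkContinuous
    { toFun := fun u => ⟨fun z => u (z + v), memℓp_two_iff.2 (hs u)⟩
      map_add' := fun u v => by
        ext z
        rfl
      map_smul' := fun c u => by
        ext z
        simp } 1 fun u => ?_, fun u z => rfl⟩
  rw [one_mul, ← abs_of_nonneg (norm_nonneg u)]
  refine le_trans (le_abs_self _) (sq_le_sq.1 ?_)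
  rw [Sq.norm_sq, Sq.norm_sq]
  exact (tsum_shift (fun z => u z ^ 2) v).le

lemma SqBdd.shift' {G : Type*} [AddGroup G] (v : G) : SqBdd fun (u : G → ℝ) z => u (z - v) := by
  simpa only [sub_eq_add_neg] using SqBdd.shift (-v)

lemma Sq.induction_fs {G : Type*} {p : Sq G → Prop} (hcl : IsClosed {u | p u})
    (h : ∀ u : Sq G, (u : G → ℝ).HasFiniteSupport → p u) (u : Sq G) : p u := by
  classical
  have hu := lp.hasSum_single (p := 2) (by simp) u
  refine hcl.mem_of_tendsto hu (Filter.Eventually.of_forall fun s => h _ ?_)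
  refine Set.Finite.subset s.finite_toSet fun z hz => ?_
  by_contra hzs
  refine hz ?_
  rw [lp.coeFn_sum, Finset.sum_apply]
  refine Finset.sum_eq_zero fun i hi => ?_
  rw [lp.single_apply, Pi.single_eq_of_ne]
  rintro rfl
  exact hzs hi

variable {ι : Type*} [Fintype ι]

lemma SqBdd.dp (j : Option ι) : SqBdd fun u => dp j u := (SqBdd.shift _).sub SqBdd.id

lemma LOp.OK.sqBdd_app {L : LOp ι} {ν : ℝ} {S : Set (Option ι)} (hL : L.OK ν S) (hν : 0 < ν) :
    SqBdd L.app := by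
  have hA : ∀ z, |L.A z| ≤ ν⁻¹ := fun z => by
    rw [abs_of_nonneg (hν.le.trans (hL.A_lo z))]; exact hL.A_hi z
  have hC : ∀ z, |L.lam * L.C z| ≤ L.lam * ν⁻¹ := fun z => by
    rw [abs_of_nonneg (mul_nonneg hL.lam_pos.le (hν.le.trans (hL.C_lo z)))]
    exact mul_le_mul_of_nonneg_left (hL.C_hi z) hL.lam_pos.le
  have ha : ∀ i j, SqBdd fun u z => L.a i j z * dp (some j) u z := fun i j =>
    (SqBdd.mul (L.a i j) (hL.a_hi i j)).comp (SqBdd.dp (some j))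
  exact (((SqBdd.mul L.A hA).comp (SqBdd.id.sub (SqBdd.shift' L.τ))).add (SqBdd.mul _ hC)).sub
    (SqBdd.sum _ fun i => (SqBdd.sum _ fun j => ha i j).sub
      ((SqBdd.shift' (ev (some i))).comp (SqBdd.sum _ fun j => ha i j)))

/-- Unique solvability in `ℓ²`. -/
lemma LOp.OK.exists_inverse {L : LOp ι} {ν : ℝ} {S : Set (Option ι)} (hL : L.OK ν S)
    (hν : 0 < ν) : ∃ R : Sq (Grd ι) →L[ℝ] Sq (Grd ι), (∀ f z, L.app (R f) z = f z) ∧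
    ∀ u f : Sq (Grd ι), (∀ z, L.app u z = f z) → R f = u := by
  obtain ⟨P, hP⟩ := hL.sqBdd_app hν
  have hcoer : ∀ u : Sq (Grd ι), L.lam * ν * ‖u‖ ^ 2 ≤ inner ℝ (P u) u := by
    refine Sq.induction_fs (isClosed_le (by fun_prop) (by fun_prop)) fun u hu => ?_
    have h := hL.energy_le hν hu
    have h1 : 0 ≤ ∑' z, ∑ k, dp (some k) u z ^ 2 :=
      tsum_nonneg fun _ => Finset.sum_nonneg fun _ _ => sq_nonneg _
    rw [Sq.norm_sq, lp.inner_eq_tsum]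
    have e : ∀ z, inner ℝ (P u z) (u z) = L.app u z * u z := fun z => by
      rw [hP]; simp [mul_comm]
    simp_rw [e]
    nlinarith [mul_nonneg hν.le h1]
  let B : Sq (Grd ι) →L[ℝ] Sq (Grd ι) →L[ℝ] ℝ := (innerSL ℝ).comp P
  have hB : IsCoercive B := by
    refine ⟨L.lam * ν, mul_pos hL.lam_pos hν, fun u => ?_⟩
    have := hcoer u
    simp only [B, ContinuousLinearMap.comp_apply, innerSL_apply_apply]
    linarith
  have hE : ∀ u, hB.continuousLinearEquivOfBilin u = P u := fun u => by
    refine ext_inner_right ℝ fun w => ?_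
    rw [hB.continuousLinearEquivOfBilin_apply]
    rfl
  refine ⟨hB.continuousLinearEquivOfBilin.symm, fun f z => ?_, fun u f hu => ?_⟩
  · rw [← hP, ContinuousLinearEquiv.coe_coe, ← hE, ContinuousLinearEquiv.apply_symm_apply]
  · rw [ContinuousLinearEquiv.coe_coe, ContinuousLinearEquiv.symm_apply_eq, hE]
    ext z
    rw [hP, hu]

/-- Difference operators `D` for which `L.app u ↦ D u` is a discrete singular integral. -/
structure LOp.Adm (L : LOp ι) (K : ℝ) (D : (Grd ι → ℝ) → Grd ι → ℝ) : Prop where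
  bdd : SqBdd D
  sq_le : ∀ u : Grd ι → ℝ, u.HasFiniteSupport → ∑' z, D u z ^ 2 ≤ K * ∑' z, L.app u z ^ 2
  sol : ∀ (u : Grd ι → ℝ) z, (∀ y : Grd ι, (∀ j, |y j - z j| ≤ 2) → L.app u y = 0) →
    L.app (D u) z = 0

lemma Sq.lintegral_enorm_sq {G : Type*} [MeasurableSpace G] [MeasurableSingletonClass G] (f : Sq G) :
    ∫⁻ z, ‖f z‖ₑ ^ 2 ∂Measure.count = ENNReal.ofReal (‖f‖ ^ 2) := by
  rw [lintegral_count, Sq.norm_sq, ENNReal.ofReal_tsum_of_nonneg (fun _ => sq_nonneg _) (Sq.summable f)]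
  refine tsum_congr fun z => ?_
  rw [Real.enorm_eq_ofReal_abs, ← ENNReal.ofReal_pow (abs_nonneg _), sq_abs]

theorem exists_solution_rpow_le (ν : ℝ) (hν : 0 < ν) (ℓ : ι) (K : ℝ) (hK : 0 < K) {q : ℝ}
    (hq : 1 < q) : ∃ C : ℝ≥0∞, C ≠ ∞ ∧ ∀ (L : LOp ι) (S : Set (Option ι)), L.OK ν S →
    (∀ k, k ≠ some ℓ → k ∈ S) → ∀ D, L.Adm K D → ∀ f : Grd ι → ℝ, f.HasFiniteSupport →
    ∃ v : Sq (Grd ι), (∀ z, L.app v z = f z) ∧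
      (∑' z, ‖D v z‖ₑ ^ 2 ≤ ENNReal.ofReal K * ∑' z, ‖f z‖ₑ ^ 2) ∧
      ∑' z, (‖D v z‖ₑ ^ 2) ^ q ≤ C * ∑' z, (‖f z‖ₑ ^ 2) ^ q := by
  obtain ⟨C₂, hC₂, hsup⟩ := cell_sup_bound ν hν ℓ
  obtain ⟨C, hC, hex⟩ := extrapolation (J := Option ι) wt one_le_wt (ENNReal.ofReal K) C₂
    ENNReal.ofReal_ne_top hC₂ hq
  refine ⟨C, hC, ?_⟩
  intro L S hL hS D hD f hf
  classical
  obtain ⟨R, hR, hR'⟩ := hL.exists_inverse hν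
  obtain ⟨P, hP⟩ := hL.sqBdd_app hν
  obtain ⟨Q, hQ⟩ := hD.bdd
  have hsq : ∀ u : Sq (Grd ι), ‖Q u‖ ^ 2 ≤ K * ‖P u‖ ^ 2 := by
    refine Sq.induction_fs (isClosed_le (by fun_prop) (by fun_prop)) fun u hu => ?_
    rw [Sq.norm_sq, Sq.norm_sq]
    simpa only [hQ, hP] using hD.sq_le u hu
  let emb : (Grd ι → ℝ) → Sq (Grd ι) := fun f => if h : f.HasFiniteSupport then ⟨f, h.memℓp⟩ else 0
  have hemb : ∀ f, f.HasFiniteSupport → ∀ z, emb f z = f z := fun f hf z => by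
    simp only [emb, dif_pos hf]
  have hadd : ∀ f g : Grd ι → ℝ, f.support.Finite → g.support.Finite →
      emb (f + g) = emb f + emb g := fun f g hf hg => by
    ext z
    have hfg : (f + g).HasFiniteSupport := (hf.union hg).subset (Function.support_add f g)
    rw [lp.coeFn_add, Pi.add_apply, hemb _ hf, hemb _ hg, hemb _ hfg, Pi.add_apply]
  have hL2 : ∀ f : Grd ι → ℝ, f.support.Finite → ∫⁻ z, ‖Q (R (emb f)) z‖ₑ ^ 2 ∂Measure.count ≤
      ENNReal.ofReal K * ∫⁻ z, ‖f z‖ₑ ^ 2 ∂Measure.count := by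
    intro f hf
    have h1 : P (R (emb f)) = emb f := by ext z; rw [hP, hR]
    have h2 : ∀ z, f z = emb f z := fun z => (hemb f hf z).symm
    simp_rw [h2]
    rw [Sq.lintegral_enorm_sq, Sq.lintegral_enorm_sq, ← ENNReal.ofReal_mul hK.le]
    refine ENNReal.ofReal_le_ofReal ?_
    have := hsq (R (emb f))
    rwa [h1] at this
  have := hex (fun f z => Q (R (emb f)) z)
    (fun f g hf hg => by
      funext z
      simp [hadd f g hf hg])
    hL2
    (fun f hf k z₀ hf0 z hz => by
      refine hsup L S hL hS _ k _ (fun y hy => ?_) z hz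
      have : (Q (R (emb f)) : Grd ι → ℝ) = D (R (emb f)) := funext (hQ _)
      rw [this]
      refine hD.sol _ y fun y' hy' => ?_
      rw [hR, hemb f hf]
      exact hf0 y' (hy y' hy')) f hf
  have h2 := hL2 f hf
  simp only [lintegral_count, hQ] at this h2
  exact ⟨R (emb f), fun z => by rw [hR, hemb f hf], h2, this⟩

end Inverse

section DiscreteLp

variable {ι : Type*} [Fintype ι] {L : LOp ι} {ν : ℝ} {S : Set (Option ι)}

lemma LOp.app_smul (L : LOp ι) (c : ℝ) (u : Grd ι → ℝ) (z : Grd ι) :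
    L.app (fun z => c * u z) z = c * L.app u z := by
  have h : ∀ j z, dp j (fun z => c * u z) z = c * dp j u z := fun j z => by simp only [dp]; ring
  simp only [LOp.app, h, mul_left_comm _ c, ← Finset.mul_sum, ← mul_sub]
  ring

lemma LOp.OK.adm_lam (hL : L.OK ν S) (hν : 0 < ν) {K : ℝ} (hK : ν⁻¹ ^ 2 ≤ K) :
    L.Adm K fun u z => L.lam * u z where
  bdd := SqBdd.mul (fun _ => L.lam) fun _ => le_rfl
  sq_le u hu := (hL.lam_sq_le hν hu).trans
    (mul_le_mul_of_nonneg_right hK (tsum_nonneg fun _ => sq_nonneg _))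
  sol u z h := by rw [LOp.app_smul, h z (by simp), mul_zero]

lemma abs_ev_le (i j : Option ι) : |(ev i : Grd ι) j| ≤ 1 := by
  by_cases h : j = i
  · subst h; simp [ev_same]
  · simp [ev_ne h]

lemma LOp.OK.adm_time (hL : L.OK ν S) {K : ℝ}
    (hK : ∀ u : Grd ι → ℝ, u.HasFiniteSupport →
      ∑' z, (u z - u (z - L.τ)) ^ 2 ≤ K * ∑' z, L.app u z ^ 2) :
    L.Adm K fun u z => u z - u (z - L.τ) where
  bdd := SqBdd.id.sub (SqBdd.shift' L.τ)
  sq_le := hK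
  sol u z h := by
    rw [hL.app_sub_tau, h z (by simp), h (z - L.τ), sub_self]
    intro j
    rw [Pi.sub_apply, sub_sub_cancel_left, abs_neg]
    refine le_trans ?_ one_le_two
    rcases hL.tau with h | h <;> rw [h]
    · exact abs_ev_le _ _
    · rw [Pi.neg_apply, abs_neg]; exact abs_ev_le _ _

lemma LOp.OK.adm_dp_dp (hL : L.OK ν S) (hν : 0 < ν) {K : ℝ} (hK : ν⁻¹ ^ 2 ≤ K) {i k : ι}
    (hi : some i ∈ S) (hk : some k ∈ S) :
    L.Adm K fun u => dp (some k) (dp (some i) u) where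
  bdd := (SqBdd.dp _).comp (SqBdd.dp _)
  sq_le u hu := (hL.dp_dp_sq_le hν hu hi k).trans
    (mul_le_mul_of_nonneg_right hK (tsum_nonneg fun _ => sq_nonneg _))
  sol u z h := by
    rw [hL.app_dp hk, hL.app_dp hi, hL.app_dp hi, h z (by simp), h (z + ev (some k)) (fun j => ?_),
      h (z + ev (some i)) (fun j => ?_), h (z + ev (some k) + ev (some i)) (fun j => ?_)]
    · ring
    · have h1 := abs_ev_le (some k) j
      have h2 := abs_ev_le (some i) j
      simp only [Pi.add_apply]
      rw [abs_le] at *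
      constructor <;> linarith
    · have h2 := abs_ev_le (some i) j
      simp only [Pi.add_apply]
      rw [abs_le] at *
      constructor <;> linarith
    · have h2 := abs_ev_le (some k) j
      simp only [Pi.add_apply]
      rw [abs_le] at *
      constructor <;> linarith

/-- Formal adjoint. -/
def LOp.adj (L : LOp ι) : LOp ι where
  A := L.A
  C := L.C
  a i j := L.a j i
  lam := L.lam
  τ := -L.τ

lemma LOp.OK.adj (hL : L.OK ν S) : L.adj.OK ν S where
  A_lo := hL.A_lo
  A_hi := hL.A_hi
  C_lo := hL.C_lo
  C_hi := hL.C_hi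
  a_hi i j := hL.a_hi j i
  ell z ξ := by
    refine (hL.ell z ξ).trans (le_of_eq ?_)
    rw [Finset.sum_comm]
    exact Finset.sum_congr rfl fun i _ => Finset.sum_congr rfl fun j _ => by
      simp only [LOp.adj]; ring
  lam_pos := hL.lam_pos
  lam_le := hL.lam_le
  tau := by
    rcases hL.tau with h | h
    · right; simp [LOp.adj, h]
    · left; simp [LOp.adj, h]
  A_inv := hL.A_inv
  C_inv := hL.C_inv
  a_inv k hk i j := hL.a_inv k hk j i
  none_mem := hL.none_mem

lemma LOp.OK.app_adj (hL : L.OK ν S) (u v : Grd ι → ℝ) (hu : u.HasFiniteSupport) :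
    ∑' z, L.app u z * v z = ∑' z, u z * L.adj.app v z := by
  have h := L.adj.app_pair v u hu
  simp_rw [mul_comm (L.adj.app v _) (u _)] at h
  rw [h, ← sub_eq_zero, ← tsum_sub_fs (by fun_prop) (by fun_prop)]
  have key : ∀ z, L.app u z * v z - (L.adj.A z * (v z - v (z - L.adj.τ)) * u z +
      L.adj.lam * L.adj.C z * v z * u z +
      ∑ i, ∑ j, L.adj.a i j z * dp (some j) v z * dp (some i) u z) =
      (L.A z * u z * v (z + L.τ) - L.A (z - L.τ) * u (z - L.τ) * v (z - L.τ + L.τ)) -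
      ∑ i, ((∑ j, L.a i j z * dp (some j) u z) * v (z + ev (some i))
        - (∑ j, L.a i j (z - ev (some i)) * dp (some j) u (z - ev (some i))) *
          v (z - ev (some i) + ev (some i))) := by
    intro z
    simp only [sub_add_cancel, hL.A_tau']
    have h1 : (∑ i, (∑ j, L.a i j z * dp (some j) u z -
      ∑ j, L.a i j (z - ev (some i)) * dp (some j) u (z - ev (some i)))) * v z =
      - (∑ i, ∑ j, L.a i j z * dp (some j) u z * dp (some i) v z) +
      ∑ i, ((∑ j, L.a i j z * dp (some j) u z) * v (z + ev (some i))
        - (∑ j, L.a i j (z - ev (some i)) * dp (some j) u (z - ev (some i))) * v z) := by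
      rw [← Finset.sum_neg_distrib, ← Finset.sum_add_distrib, Finset.sum_mul]
      refine Finset.sum_congr rfl fun i _ => ?_
      rw [← Finset.sum_mul]
      simp only [dp]
      ring
    have h2 : ∑ i, ∑ j, L.adj.a i j z * dp (some j) v z * dp (some i) u z =
        ∑ i, ∑ j, L.a i j z * dp (some j) u z * dp (some i) v z := by
      rw [Finset.sum_comm]
      exact Finset.sum_congr rfl fun i _ => Finset.sum_congr rfl fun j _ => by
        simp only [LOp.adj]; ring
    rw [h2, LOp.app]
    simp only [LOp.adj, sub_neg_eq_add]
    linear_combination -h1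
  simp_rw [key]
  rw [tsum_sub_fs (by fun_prop) (by fun_prop),
    tsum_telescope (H := fun z => L.A z * u z * v (z + L.τ)) (by fun_prop) L.τ,
    tsum_sum_fs (fun i => by fun_prop), zero_sub, neg_eq_zero]
  refine Finset.sum_eq_zero fun i _ => ?_
  exact tsum_telescope (H := fun z => (∑ j, L.a i j z * dp (some j) u z) * v (z + ev (some i)))
    (by fun_prop) (ev (some i))

/-- Data for estimating `D` by duality: `D` commutes with `L` and is dual, up to the shift `s`,
to `D'`, which is admissible for the adjoint. -/
structure LOp.Dual (L : LOp ι) (K : ℝ) (D D' : (Grd ι → ℝ) → Grd ι → ℝ) (s : Grd ι) : Prop where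
  adm : L.Adm K D
  adm' : L.adj.Adm K D'
  fs : ∀ u : Grd ι → ℝ, u.HasFiniteSupport → (D u).HasFiniteSupport
  comm : ∀ u : Grd ι → ℝ, u.HasFiniteSupport → ∀ z, L.app (D u) z = D (L.app u) z
  pair : ∀ u v : Grd ι → ℝ, u.HasFiniteSupport → ∑' z, D u z * v z = ∑' z, u (z + s) * D' v z

lemma LOp.OK.dual_lam (hL : L.OK ν S) (hν : 0 < ν) {K : ℝ} (hK : ν⁻¹ ^ 2 ≤ K) :
    L.Dual K (fun u z => L.lam * u z) (fun u z => L.lam * u z) 0 where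
  adm := hL.adm_lam hν hK
  adm' := hL.adj.adm_lam hν hK
  fs u hu := by fun_prop
  comm u hu z := L.app_smul _ _ _
  pair u v hu := tsum_congr fun z => by simp only [add_zero]; ring

lemma LOp.OK.dual_time (hL : L.OK ν S) {K : ℝ}
    (hK : ∀ u : Grd ι → ℝ, u.HasFiniteSupport →
      ∑' z, (u z - u (z - L.τ)) ^ 2 ≤ K * ∑' z, L.app u z ^ 2)
    (hK' : ∀ u : Grd ι → ℝ, u.HasFiniteSupport →
      ∑' z, (u z - u (z - L.adj.τ)) ^ 2 ≤ K * ∑' z, L.adj.app u z ^ 2) :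
    L.Dual K (fun u z => u z - u (z - L.τ)) (fun u z => u z - u (z - L.adj.τ)) 0 where
  adm := hL.adm_time hK
  adm' := hL.adj.adm_time hK'
  fs u hu := by fun_prop
  comm u hu z := hL.app_sub_tau u z
  pair u v hu := by
    have ht := tsum_telescope (H := fun z => u z * v (z + L.τ)) (by fun_prop) L.τ
    rw [← sub_eq_zero, ← tsum_sub_fs (by fun_prop) (by fun_prop), ← ht]
    refine tsum_congr fun z => ?_
    simp only [add_zero, LOp.adj, sub_neg_eq_add, sub_add_cancel]
    ring

lemma tsum_dp_mul (k : Option ι) (u v : Grd ι → ℝ) (hu : u.HasFiniteSupport) :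
    ∑' z, dp k u z * v z = -∑' z, u (z + ev k) * dp k v z := by
  have ht := tsum_telescope (H := fun z => u (z + ev k) * v (z + ev k)) (by fun_prop) (ev k)
  rw [← tsum_neg, ← sub_eq_zero, ← tsum_sub_fs (by fun_prop) (by fun_prop), ← ht]
  refine tsum_congr fun z => ?_
  simp only [dp, sub_add_cancel]
  ring

lemma LOp.OK.dual_dp_dp (hL : L.OK ν S) (hν : 0 < ν) {K : ℝ} (hK : ν⁻¹ ^ 2 ≤ K) {i k : ι}
    (hi : some i ∈ S) (hk : some k ∈ S) :
    L.Dual K (fun u => dp (some k) (dp (some i) u)) (fun u => dp (some k) (dp (some i) u))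
      (ev (some k) + ev (some i)) where
  adm := hL.adm_dp_dp hν hK hi hk
  adm' := hL.adj.adm_dp_dp hν hK hi hk
  fs u hu := hasFiniteSupport_dp _ (hasFiniteSupport_dp _ hu)
  comm u hu z := by
    rw [hL.app_dp hk, hL.app_dp hi, hL.app_dp hi]
    rfl
  pair u v hu := by
    rw [tsum_dp_mul _ _ _ (hasFiniteSupport_dp _ hu)]
    have : ∀ z, dp (some i) u (z + ev (some k)) * dp (some k) v z =
        dp (some i) (fun z => u (z + ev (some k))) z * dp (some k) v z := fun z => by
      simp only [dp, add_right_comm]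
    simp_rw [this]
    rw [tsum_dp_mul _ _ _ (by fun_prop), neg_neg]
    refine tsum_congr fun z => ?_
    rw [dp_comm, add_right_comm, add_assoc]

lemma tsum_enorm_rpow_ne_top {G : Type*} {f : G → ℝ} (hf : f.HasFiniteSupport) {p : ℝ}
    (hp : 0 < p) : ∑' z, ‖f z‖ₑ ^ p ≠ ∞ := by
  rw [tsum_eq_sum (s := Set.Finite.toFinset hf)]
  · exact ENNReal.sum_ne_top.2 fun z _ => ENNReal.rpow_ne_top_of_nonneg hp.le (by simp)
  · intro z hz
    have : f z = 0 := by
      by_contra h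
      exact hz ((Set.Finite.mem_toFinset hf).2 h)
    simp [this, hp]

lemma enorm_tsum_mul_le {G : Type*} (f g : G → ℝ) {p p' : ℝ} (hp : p.HolderConjugate p') :
    ‖∑' z, f z * g z‖ₑ ≤ (∑' z, ‖f z‖ₑ ^ p) ^ (1 / p) * (∑' z, ‖g z‖ₑ ^ p') ^ (1 / p') := by
  letI : MeasurableSpace G := ⊤
  have h := ENNReal.lintegral_mul_le_Lp_mul_Lq (Measure.count : Measure G) hp
    (f := fun z => ‖f z‖ₑ) (g := fun z => ‖g z‖ₑ) (measurable_from_top).aemeasurable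
      (measurable_from_top).aemeasurable
  simp only [lintegral_count, Pi.mul_apply] at h
  refine le_trans ?_ h
  by_cases hs : Summable fun z => f z * g z
  · have := enorm_tsum_le_tsum_enorm (f := fun z => f z * g z)
    simpa only [enorm_mul] using this
  · rw [tsum_eq_zero_of_not_summable hs]
    simp

lemma LOp.OK.eq_of_app_eq (hL : L.OK ν S) (hν : 0 < ν) (u v : Sq (Grd ι))
    (h : ∀ z, L.app u z = L.app v z) : u = v := by
  obtain ⟨R, hR, hR'⟩ := hL.exists_inverse hν
  obtain ⟨P, hP⟩ := hL.sqBdd_app hν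
  rw [← hR' u (P u) fun z => (hP u z).symm, ← hR' v (P u) fun z => by rw [hP, h]]

theorem dual_rpow_le (ν : ℝ) (hν : 0 < ν) (ℓ : ι) (K : ℝ) (hK : 0 < K) {p : ℝ}
    (hp : 1 < p) : ∃ C : ℝ≥0∞, C ≠ ∞ ∧ ∀ (L : LOp ι) (S : Set (Option ι)), L.OK ν S →
    (∀ k, k ≠ some ℓ → k ∈ S) → ∀ D D' s, L.Dual K D D' s → ∀ u : Grd ι → ℝ, u.HasFiniteSupport →
    ∑' z, ‖D u z‖ₑ ^ p ≤ C * ∑' z, ‖L.app u z‖ₑ ^ p := by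
  have hpow : ∀ (q : ℝ) (x : ℝ), (‖x‖ₑ ^ 2) ^ (q / 2) = ‖x‖ₑ ^ q := fun q x => by
    rw [← ENNReal.rpow_natCast, ← ENNReal.rpow_mul]
    congr 1
    push_cast
    ring
  rcases lt_trichotomy p 2 with hp2 | rfl | hp2
  · have hpp := Real.HolderConjugate.conjExponent hp
    set p' := p.conjExponent with hp'
    have hp'2 : 2 < p' := by
      rw [hp', Real.conjExponent, lt_div_iff₀ (by linarith)]
      linarith
    obtain ⟨C, hC, hex⟩ := exists_solution_rpow_le ν hν ℓ K hK (show 1 < p' / 2 by linarith)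
    refine ⟨C ^ (p - 1), ENNReal.rpow_ne_top_of_nonneg (by linarith) hC, ?_⟩
    intro L S hL hS D D' s hD u hu
    set w := D u with hw
    have hwf : w.HasFiniteSupport := hD.fs u hu
    set g : Grd ι → ℝ := fun z => SignType.sign (w z) * |w z| ^ (p - 1) with hg
    have hgf : g.HasFiniteSupport := hwf.subset fun z hz h0 => hz (by simp [hg, h0])
    have hwg : ∀ z, w z * g z = |w z| ^ p := by
      intro z
      rcases eq_or_ne (w z) 0 with h0 | h0
      · simp [h0, Real.zero_rpow (by linarith : p ≠ 0)]
      · have : |w z| ^ p = |w z| * |w z| ^ (p - 1) := by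
          rw [← Real.rpow_one_add' (abs_nonneg _) (by linarith)]; congr 1; ring
        rw [this]
        simp only [hg]
        rw [← mul_assoc, self_mul_sign]
    have hgp : ∀ z, ‖g z‖ₑ ^ p' = ‖w z‖ₑ ^ p := by
      intro z
      have : ‖g z‖ₑ = ‖w z‖ₑ ^ (p - 1) := by
        rcases eq_or_ne (w z) 0 with h0 | h0
        · simp [hg, h0, show 0 < p - 1 by linarith]
        · rw [Real.enorm_eq_ofReal_abs, Real.enorm_eq_ofReal_abs,
            ENNReal.ofReal_rpow_of_nonneg (abs_nonneg _) (by linarith)]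
          congr 1
          simp only [hg]
          rw [abs_mul, abs_of_nonneg (a := |w z| ^ (p - 1)) (by positivity)]
          rcases h0.lt_or_gt with h | h <;> simp [h]
      rw [this, ← ENNReal.rpow_mul]
      congr 1
      have : p - 1 ≠ 0 := by linarith
      rw [hp', Real.conjExponent]
      field_simp
    obtain ⟨v, hv, -, hvp⟩ := hex L.adj S hL.adj hS D' hD.adm' g hgf
    simp only [hpow, hgp] at hvp
    have e1 : ∑' z, w z * g z = ∑' z, L.app u (z + s) * D' v z := by
      rw [← hD.pair (L.app u) v (by fun_prop)]
      simp_rw [← hv, ← hD.comm u hu]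
      exact (hL.app_adj w v hwf).symm
    set X := ∑' z, ‖w z‖ₑ ^ p with hX
    set Y := ∑' z, ‖L.app u z‖ₑ ^ p with hY
    have hXt : X ≠ ∞ := tsum_enorm_rpow_ne_top hwf (by linarith)
    have e2 : X = ‖∑' z, w z * g z‖ₑ := by
      simp_rw [hwg]
      rw [Real.enorm_eq_ofReal_abs, abs_of_nonneg (tsum_nonneg fun z => by positivity),
        ENNReal.ofReal_tsum_of_nonneg (fun z => by positivity), hX]
      · refine tsum_congr fun z => ?_
        rw [Real.enorm_eq_ofReal_abs, ENNReal.ofReal_rpow_of_nonneg (abs_nonneg _) (by linarith)]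
      · exact summable_fs (hwf.subset fun z hz h0 => hz (by
          simp [h0, Real.zero_rpow (by linarith : p ≠ 0)]))
    have e3 : X ≤ Y ^ (1 / p) * (C * X) ^ (1 / p') := by
      rw [e1] at e2
      rw [e2]
      refine (enorm_tsum_mul_le _ _ hpp).trans ?_
      rw [← e2]
      have : ∑' z, ‖L.app u (z + s)‖ₑ ^ p = Y :=
        (Equiv.addRight s).tsum_eq fun z => ‖L.app u z‖ₑ ^ p
      rw [this]
      gcongr
    rcases eq_or_ne X 0 with hX0 | hX0
    · rw [hX0]; exact bot_le
    have hpos := hpp.pos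
    have hpos' := hpp.symm.pos
    have hsum : 1 / p + 1 / p' = 1 := by simpa using hpp.inv_add_inv_eq_one
    rw [ENNReal.mul_rpow_of_nonneg _ _ (by positivity), ← mul_assoc] at e3
    have e4 : X ^ (1 / p) * X ^ (1 / p') ≤ Y ^ (1 / p) * C ^ (1 / p') * X ^ (1 / p') := by
      rwa [← ENNReal.rpow_add _ _ hX0 hXt, hsum, ENNReal.rpow_one]
    have e5 := (ENNReal.mul_le_mul_iff_left (c := X ^ (1 / p')) (by simp [hX0, hXt])
      (ENNReal.rpow_ne_top_of_nonneg (by positivity) hXt)).1 e4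
    have e6 := ENNReal.rpow_le_rpow e5 hpos.le
    rw [ENNReal.mul_rpow_of_nonneg _ _ hpos.le, ← ENNReal.rpow_mul, ← ENNReal.rpow_mul,
      ← ENNReal.rpow_mul, one_div_mul_cancel hpos.ne', ENNReal.rpow_one, ENNReal.rpow_one] at e6
    have : 1 / p' * p = p - 1 := by
      rw [hp', Real.conjExponent]; field_simp
    rw [this] at e6
    rwa [mul_comm]
  · refine ⟨ENNReal.ofReal K, by simp, ?_⟩
    intro L S hL hS D D' s hD u hu
    have := hD.adm.sq_le u hu
    have h := ENNReal.ofReal_le_ofReal this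
    rw [ENNReal.ofReal_mul hK.le, ENNReal.ofReal_tsum_of_nonneg (fun _ => sq_nonneg _)
      (summable_fs (f := fun z => D u z ^ 2) (by have := hD.fs u hu; fun_prop)),
      ENNReal.ofReal_tsum_of_nonneg (fun _ => sq_nonneg _)
      (summable_fs (f := fun z => L.app u z ^ 2) (by fun_prop))] at h
    have e : ∀ x : ℝ, ‖x‖ₑ ^ (2 : ℝ) = ENNReal.ofReal (x ^ 2) := fun x => by
      rw [Real.enorm_eq_ofReal_abs, ENNReal.rpow_ofNat, ← ENNReal.ofReal_pow (abs_nonneg _), sq_abs]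
    simpa only [e] using h
  · obtain ⟨C, hC, hex⟩ := exists_solution_rpow_le ν hν ℓ K hK (show 1 < p / 2 by linarith)
    refine ⟨C, hC, ?_⟩
    intro L S hL hS D D' s hD u hu
    obtain ⟨v, hv, -, hvp⟩ := hex L S hL hS D hD.adm (L.app u) (by fun_prop)
    have : v = ⟨u, hu.memℓp⟩ := hL.eq_of_app_eq hν _ _ hv
    rw [this] at hvp
    simpa only [hpow] using hvp

/-- Discrete parabolic `ℓ^p` estimate for coefficients depending on one coordinate. -/
theorem discrete_rpow_le (ν : ℝ) (hν : 0 < ν) (ℓ : ι) {p : ℝ}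
    (hp : 1 < p) : ∃ C : ℝ≥0∞, C ≠ ∞ ∧ ∀ (L : LOp ι) (S : Set (Option ι)), L.OK ν S →
    (∀ k, k ≠ some ℓ → k ∈ S) → ∀ u : Grd ι → ℝ, u.HasFiniteSupport →
    ∑' z, ‖L.lam * u z‖ₑ ^ p ≤ C * ∑' z, ‖L.app u z‖ₑ ^ p ∧
    ∑' z, ‖u z - u (z - L.τ)‖ₑ ^ p ≤ C * ∑' z, ‖L.app u z‖ₑ ^ p ∧
    ∀ i k, some i ∈ S → some k ∈ S →
      ∑' z, ‖dp (some k) (dp (some i) u) z‖ₑ ^ p ≤ C * ∑' z, ‖L.app u z‖ₑ ^ p := by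
  obtain ⟨K, hK, htime⟩ := time_sq_le (ι := ι) ν hν ℓ
  obtain ⟨C, hC, h⟩ := dual_rpow_le (ι := ι) ν hν ℓ (K + ν⁻¹ ^ 2) (by positivity) hp
  refine ⟨C, hC, fun L S hL hS u hu => ?_⟩
  have hK1 : ν⁻¹ ^ 2 ≤ K + ν⁻¹ ^ 2 := by linarith
  have hle : ∀ y : ℝ, 0 ≤ y → K * y ≤ (K + ν⁻¹ ^ 2) * y := fun y hy => by gcongr; linarith [sq_nonneg ν⁻¹]
  refine ⟨h L S hL hS _ _ _ (hL.dual_lam hν hK1) u hu,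
    h L S hL hS _ _ _ (hL.dual_time
      (fun u hu => (htime L S hL hS u hu).trans (hle _ (tsum_nonneg fun _ => sq_nonneg _)))
      (fun u hu => (htime _ S hL.adj hS u hu).trans (hle _ (tsum_nonneg fun _ => sq_nonneg _))))
      u hu, fun i k hi hk => h L S hL hS _ _ _ (hL.dual_dp_dp hν hK1 hi hk) u hu⟩

end DiscreteLp

section Lattice

variable {κ M : Type*} [Fintype κ] [NormedAddCommGroup M] [NormedSpace ℝ M]

/-- The lattice embedding attached to a family of vectors. -/
def lat (e : κ → M) : (κ → ℤ) →+ M where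
  toFun z := ∑ k, (z k : ℝ) • e k
  map_zero' := by simp
  map_add' x y := by simp [add_smul, Finset.sum_add_distrib]

lemma lat_apply (e : κ → M) (z : κ → ℤ) : lat e z = ∑ k, (z k : ℝ) • e k := rfl

lemma repr_lat (e : Module.Basis κ ℝ M) (z : κ → ℤ) (k : κ) : e.repr (lat e z) k = z k := by
  rw [lat_apply, Module.Basis.repr_sum_self]

lemma lat_ev {ι : Type*} [Fintype ι] (e : Option ι → M) (k : Option ι) : lat e (ev k) = e k := by
  classical
  rw [lat_apply, Finset.sum_eq_single k]
  · simp [ev_same]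
  · intro j _ hj
    simp [ev_ne hj]
  · simp

variable [MeasurableSpace M] [BorelSpace M] [FiniteDimensional ℝ M]

lemma lintegral_fundamentalDomain_tsum (μ : Measure M) [μ.IsAddHaarMeasure]
    (e : Module.Basis κ ℝ M) {G : M → ℝ≥0∞} (hG : Measurable G) :
    ∫⁻ w in ZSpan.fundamentalDomain e, ∑' z : κ → ℤ, G (w + lat e z) ∂μ = ∫⁻ w, G w ∂μ := by
  have hD := ZSpan.fundamentalDomain_measurableSet e
  have hG' : ∀ z : κ → ℤ, Measurable fun w => G (w + lat e z) := fun z =>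
    hG.comp (measurable_add_const _)
  rw [lintegral_tsum fun z => (hG' z).aemeasurable]
  have h1 : ∀ z : κ → ℤ, ∫⁻ w in ZSpan.fundamentalDomain e, G (w + lat e z) ∂μ =
      ∫⁻ w, (ZSpan.fundamentalDomain e).indicator 1 (w - lat e z) * G w ∂μ := by
    intro z
    rw [← lintegral_indicator hD, ← lintegral_add_right_eq_self (μ := μ)
      (fun w => (ZSpan.fundamentalDomain e).indicator 1 (w - lat e z) * G w) (lat e z)]
    refine lintegral_congr fun w => ?_
    by_cases hw : w ∈ ZSpan.fundamentalDomain e <;> simp [hw]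
  simp_rw [h1]
  rw [← lintegral_tsum]
  · refine lintegral_congr fun w => ?_
    rw [ENNReal.tsum_mul_right, tsum_eq_single fun k => ⌊e.repr w k⌋]
    · rw [indicator_of_mem, Pi.one_apply, one_mul]
      rw [ZSpan.mem_fundamentalDomain]
      intro k
      rw [map_sub, Finsupp.sub_apply, repr_lat]
      exact ⟨sub_nonneg.2 (Int.floor_le _), by linarith [Int.lt_floor_add_one (e.repr w k)]⟩
    · intro z hz
      rw [indicator_of_notMem]
      intro h
      rw [ZSpan.mem_fundamentalDomain] at h
      apply hz
      funext k
      have := h k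
      rw [map_sub, Finsupp.sub_apply, repr_lat] at this
      symm
      rw [Int.floor_eq_iff]
      constructor <;> linarith [this.1, this.2]
  · intro z
    have : Measurable fun w => (ZSpan.fundamentalDomain e).indicator (1 : M → ℝ≥0∞) (w - lat e z) :=
      (measurable_one.indicator hD).comp (measurable_sub_const _)
    exact (this.mul hG).aemeasurable

lemma finiteSupport_lat (e : Module.Basis κ ℝ M) {v : M → ℝ} (hv : HasCompactSupport v) (w : M) :
    (fun z : κ → ℤ => v (w + lat e z)).HasFiniteSupport := by
  classical
  obtain ⟨R, hR⟩ := (hv.isCompact.image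
    (LinearMap.continuous_of_finiteDimensional (e.equivFun : M →ₗ[ℝ] κ → ℝ))).isBounded.subset_closedBall 0
  refine (Set.finite_Icc (fun k => ⌊-R - e.repr w k⌋) (fun k => ⌈R - e.repr w k⌉)).subset ?_
  intro z hz
  have h1 : w + lat e z ∈ tsupport v := subset_tsupport _ hz
  have h2 := hR ⟨_, h1, rfl⟩
  rw [mem_closedBall_zero_iff] at h2
  have h3 : ∀ k, |e.repr w k + z k| ≤ R := by
    intro k
    have := (norm_le_pi_norm _ k).trans h2
    rw [Real.norm_eq_abs] at this
    simpa [repr_lat] using this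
  refine ⟨fun k => ?_, fun k => ?_⟩
  · have := abs_le.1 (h3 k)
    exact Int.floor_le_iff.2 (by linarith [this.1])
  · have := abs_le.1 (h3 k)
    exact Int.le_ceil_iff.2 (by linarith [this.2])

end Lattice

section Differences

variable {M : Type*} [NormedAddCommGroup M] [NormedSpace ℝ M]

/-- Directional derivative. -/
def pd (b : M) (v : M → ℝ) (w : M) : ℝ := fderiv ℝ v w b

/-- Smooth functions of compact support. -/
structure Tst (v : M → ℝ) : Prop where
  smooth : ContDiff ℝ (⊤ : ℕ∞) v
  cpt : HasCompactSupport v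

lemma contDiff_pd {v : M → ℝ} (hv : ContDiff ℝ (⊤ : ℕ∞) v) (b : M) :
    ContDiff ℝ (⊤ : ℕ∞) (pd b v) :=
  (hv.fderiv_right (m := (⊤ : ℕ∞)) (by simp)).clm_apply contDiff_const

lemma Tst.pd {v : M → ℝ} (hv : Tst v) (b : M) : Tst (pd b v) :=
  ⟨contDiff_pd hv.smooth b, hv.cpt.fderiv_apply ℝ b⟩

lemma Tst.continuous {v : M → ℝ} (hv : Tst v) : Continuous v := hv.smooth.continuous

lemma Tst.differentiable {v : M → ℝ} (hv : Tst v) : Differentiable ℝ v :=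
  hv.smooth.differentiable (by simp)

lemma hasDerivAt_line {v : M → ℝ} (hv : Differentiable ℝ v) (w b : M) (s : ℝ) :
    HasDerivAt (fun s : ℝ => v (w + s • b)) (pd b v (w + s • b)) s := by
  have h1 : HasDerivAt (fun s : ℝ => w + s • b) b s := by
    simpa using ((hasDerivAt_id s).smul_const b).const_add w
  exact (hv _).hasFDerivAt.comp_hasDerivAt s h1

lemma exists_pd_eq {v : M → ℝ} (hv : Differentiable ℝ v) (w b : M) {h : ℝ} (hh : 0 < h) :
    ∃ θ ∈ Icc 0 h, v (w + h • b) - v w = h * pd b v (w + θ • b) := by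
  obtain ⟨θ, hθ, he⟩ := exists_hasDerivAt_eq_slope (fun s : ℝ => v (w + s • b))
    (fun s => pd b v (w + s • b)) hh
    (fun s _ => (hasDerivAt_line hv w b s).continuousAt.continuousWithinAt)
    (fun s _ => hasDerivAt_line hv w b s)
  refine ⟨θ, Ioo_subset_Icc_self hθ, ?_⟩
  rw [he, sub_zero]
  field_simp
  simp

lemma exists_pd_pd_eq {v : M → ℝ} (hv : Tst v) (w b c : M) {h : ℝ} (hh : 0 < h) :
    ∃ θ ∈ Icc 0 h, ∃ θ' ∈ Icc 0 h, v (w + h • b + h • c) - v (w + h • b) - (v (w + h • c) - v w) =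
      h ^ 2 * pd c (pd b v) (w + θ • b + θ' • c) := by
  have hd : Differentiable ℝ fun x => v (x + h • c) := hv.differentiable.comp (by fun_prop)
  have h1 : Differentiable ℝ fun x => v (x + h • c) - v x := hd.sub hv.differentiable
  obtain ⟨θ, hθ, he⟩ := exists_pd_eq h1 w b hh
  obtain ⟨θ', hθ', he'⟩ := exists_pd_eq (hv.pd b).differentiable (w + θ • b) c hh
  refine ⟨θ, hθ, θ', hθ', ?_⟩
  have : pd b (fun x => v (x + h • c) - v x) (w + θ • b) =
      pd b v (w + θ • b + h • c) - pd b v (w + θ • b) := by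
    simp only [pd]
    rw [fderiv_fun_sub (hd _) (hv.differentiable _), fderiv_comp_add_right]
    rfl
  rw [he, this, he']
  ring

end Differences

section Limits

open Filter Topology

variable {M : Type*} [NormedAddCommGroup M]

/-- Bounded convergence of functions with a common bounded support. -/
structure Cvg (g : ℕ → M → ℝ) (f : M → ℝ) : Prop where
  bdd : ∃ B, ∀ n w, |g n w| ≤ B
  supp : ∃ R, ∀ n w, R < ‖w‖ → g n w = 0
  lim : ∀ w, Tendsto (fun n => g n w) atTop (𝓝 (f w))

lemma Cvg.add {g₁ g₂ : ℕ → M → ℝ} {f₁ f₂ : M → ℝ} (h₁ : Cvg g₁ f₁) (h₂ : Cvg g₂ f₂) :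
    Cvg (fun n w => g₁ n w + g₂ n w) (fun w => f₁ w + f₂ w) := by
  obtain ⟨B₁, hB₁⟩ := h₁.bdd
  obtain ⟨B₂, hB₂⟩ := h₂.bdd
  obtain ⟨R₁, hR₁⟩ := h₁.supp
  obtain ⟨R₂, hR₂⟩ := h₂.supp
  refine ⟨⟨B₁ + B₂, fun n w => (abs_add_le _ _).trans (add_le_add (hB₁ n w) (hB₂ n w))⟩,
    ⟨max R₁ R₂, fun n w hw => ?_⟩, fun w => (h₁.lim w).add (h₂.lim w)⟩
  rw [hR₁ n w ((le_max_left _ _).trans_lt hw), hR₂ n w ((le_max_right _ _).trans_lt hw), add_zero]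

lemma Cvg.mul {g : ℕ → M → ℝ} {f : M → ℝ} (h : Cvg g f) {a : M → ℝ} {K : ℝ}
    (ha : ∀ w, |a w| ≤ K) : Cvg (fun n w => a w * g n w) (fun w => a w * f w) := by
  obtain ⟨B, hB⟩ := h.bdd
  obtain ⟨R, hR⟩ := h.supp
  refine ⟨⟨K * B, fun n w => ?_⟩, ⟨R, fun n w hw => by rw [hR n w hw, mul_zero]⟩,
    fun w => (h.lim w).const_mul _⟩
  rw [abs_mul]
  exact mul_le_mul (ha w) (hB n w) (abs_nonneg _) ((abs_nonneg _).trans (ha w))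

lemma Cvg.sum {κ : Type*} (s : Finset κ) {g : κ → ℕ → M → ℝ} {f : κ → M → ℝ}
    (h : ∀ k ∈ s, Cvg (g k) (f k)) :
    Cvg (fun n w => ∑ k ∈ s, g k n w) (fun w => ∑ k ∈ s, f k w) := by
  classical
  induction s using Finset.induction_on with
  | empty => exact ⟨⟨0, by simp⟩, ⟨0, by simp⟩, by simp⟩
  | insert k s hk ih =>
    simp only [Finset.sum_insert hk]
    exact (h k (by simp)).add (ih fun j hj => h j (by simp [hj]))

lemma Cvg.tendsto_lintegral [NormedSpace ℝ M] [FiniteDimensional ℝ M] [MeasurableSpace M]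
    [BorelSpace M] (μ : Measure M) [μ.IsAddHaarMeasure] {g : ℕ → M → ℝ} {f : M → ℝ}
    (h : Cvg g f) (hg : ∀ n, Measurable (g n)) {p : ℝ} (hp : 0 < p) :
    Tendsto (fun n => ∫⁻ w, ‖g n w‖ₑ ^ p ∂μ) atTop (𝓝 (∫⁻ w, ‖f w‖ₑ ^ p ∂μ)) := by
  obtain ⟨B, hB⟩ := h.bdd
  obtain ⟨R, hR⟩ := h.supp
  refine tendsto_lintegral_of_dominated_convergence
    ((Metric.closedBall (0 : M) R).indicator fun _ => ENNReal.ofReal B ^ p)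
    (fun n => (hg n).enorm.pow_const p) (fun n => .of_forall fun w => ?_) ?_
    (.of_forall fun w => ?_)
  · show ‖g n w‖ₑ ^ p ≤ _
    by_cases hw : w ∈ Metric.closedBall (0 : M) R
    · rw [indicator_of_mem hw, Real.enorm_eq_ofReal_abs]
      gcongr
      exact hB n w
    · rw [mem_closedBall_zero_iff, not_le] at hw
      simp [hR n w hw, hp]
  · rw [lintegral_indicator Metric.isClosed_closedBall.measurableSet, setLIntegral_const]
    exact ENNReal.mul_ne_top (ENNReal.rpow_ne_top_of_nonneg hp.le (by simp))
      (isCompact_closedBall _ _).measure_lt_top.ne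
  · exact (ENNReal.continuous_rpow_const.tendsto _).comp ((h.lim w).enorm)

variable [NormedSpace ℝ M]

lemma Tst.exists_bound {v : M → ℝ} (hv : Tst v) :
    ∃ B R : ℝ, 0 ≤ B ∧ (∀ w, |v w| ≤ B) ∧ ∀ w, R < ‖w‖ → v w = 0 := by
  obtain ⟨B, hB⟩ := hv.cpt.exists_bound_of_continuous hv.continuous
  obtain ⟨R, hR⟩ := hv.cpt.isCompact.isBounded.subset_closedBall 0
  refine ⟨B, R, (norm_nonneg _).trans (hB 0), hB, fun w hw => ?_⟩
  by_contra h
  have := hR (subset_tsupport _ h)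
  rw [mem_closedBall_zero_iff] at this
  linarith

/-- Second difference quotient. -/
def dq (h : ℝ) (b c : M) (v : M → ℝ) (w : M) : ℝ :=
  (v (w + h • b + h • c) - v (w + h • b) - (v (w + h • c) - v w)) / h ^ 2

lemma tendsto_of_bounded_smul {h θ : ℕ → ℝ} (hθ : ∀ n, θ n ∈ Icc 0 (h n))
    (hh : Tendsto h atTop (𝓝 0)) (b : M) : Tendsto (fun n => θ n • b) atTop (𝓝 0) := by
  have : Tendsto θ atTop (𝓝 0) := squeeze_zero (fun n => (hθ n).1) (fun n => (hθ n).2) hh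
  simpa using this.smul_const b

lemma cvg_dq {v : M → ℝ} (hv : Tst v) (b c : M) {h : ℕ → ℝ} (h0 : ∀ n, 0 < h n)
    (h1 : ∀ n, h n ≤ 1) (hh : Tendsto h atTop (𝓝 0)) {s : ℕ → M} {K : ℝ}
    (hs : Tendsto s atTop (𝓝 0)) (hK : ∀ n, ‖s n‖ ≤ K) :
    Cvg (fun n w => dq (h n) b c v (w + s n)) (pd c (pd b v)) := by
  have key : ∀ n w, ∃ x, ‖x‖ ≤ ‖b‖ + ‖c‖ ∧
      (∃ θ ∈ Icc 0 (h n), ∃ θ' ∈ Icc 0 (h n), x = θ • b + θ' • c) ∧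
      dq (h n) b c v (w + s n) = pd c (pd b v) (w + s n + x) := by
    intro n w
    obtain ⟨θ, hθ, θ', hθ', he⟩ := exists_pd_pd_eq hv (w + s n) b c (h0 n)
    refine ⟨θ • b + θ' • c, ?_, ⟨θ, hθ, θ', hθ', rfl⟩, ?_⟩
    · refine (norm_add_le _ _).trans (add_le_add ?_ ?_)
      · rw [norm_smul, Real.norm_of_nonneg hθ.1]
        exact mul_le_of_le_one_left (norm_nonneg _) (hθ.2.trans (h1 n))
      · rw [norm_smul, Real.norm_of_nonneg hθ'.1]
        exact mul_le_of_le_one_left (norm_nonneg _) (hθ'.2.trans (h1 n))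
    · rw [dq, he, ← add_assoc]
      have := (h0 n).ne'
      field_simp
  choose x hx hx' he using key
  obtain ⟨B, R, hB0, hB, hR⟩ := ((hv.pd b).pd c).exists_bound
  refine ⟨⟨B, fun n w => by rw [he]; exact hB _⟩, ⟨R + K + (‖b‖ + ‖c‖), fun n w hw => ?_⟩, ?_⟩
  · rw [he]
    apply hR
    have h2 : ‖w‖ ≤ ‖w + s n + x n w‖ + ‖s n‖ + ‖x n w‖ := by
      calc ‖w‖ = ‖(w + s n + x n w) - s n - x n w‖ := by congr 1; abel
        _ ≤ _ := (norm_sub_le _ _).trans (by gcongr; exact norm_sub_le _ _)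
    linarith [hK n, hx n w]
  · intro w
    simp_rw [he]
    choose θ hθ θ' hθ' hx2 using hx'
    have : Tendsto (fun n => w + s n + x n w) atTop (𝓝 w) := by
      have h3 := ((tendsto_const_nhds (x := w)).add hs).add
        ((tendsto_of_bounded_smul (fun n => hθ n w) hh b).add
          (tendsto_of_bounded_smul (fun n => hθ' n w) hh c))
      simpa [hx2] using h3
    exact (((hv.pd b).pd c).continuous.tendsto w).comp this

lemma cvg_sub {v : M → ℝ} (hv : Tst v) (b : M) {h : ℕ → ℝ} (h0 : ∀ n, 0 < h n)
    (h1 : ∀ n, h n ≤ 1) (hh : Tendsto h atTop (𝓝 0)) :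
    Cvg (fun n w => (v w - v (w - h n • b)) / h n) (pd b v) := by
  have key : ∀ n w, ∃ θ ∈ Icc 0 (h n),
      (v w - v (w - h n • b)) / h n = pd b v (w - θ • b) := by
    intro n w
    obtain ⟨θ, hθ, he⟩ := exists_pd_eq hv.differentiable (w - h n • b) b (h0 n)
    refine ⟨h n - θ, ⟨by linarith [hθ.2], by linarith [hθ.1]⟩, ?_⟩
    rw [sub_add_cancel] at he
    rw [he, sub_smul]
    have := (h0 n).ne'
    field_simp
    congr 1
    abel
  choose θ hθ he using key
  obtain ⟨B, R, hB0, hB, hR⟩ := (hv.pd b).exists_bound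
  refine ⟨⟨B, fun n w => by rw [he]; exact hB _⟩, ⟨R + ‖b‖, fun n w hw => ?_⟩, ?_⟩
  · rw [he]
    apply hR
    have h2 := norm_sub_norm_le w (θ n w • b)
    have h3 : ‖θ n w • b‖ ≤ ‖b‖ := by
      rw [norm_smul, Real.norm_of_nonneg (hθ n w).1]
      exact mul_le_of_le_one_left (norm_nonneg _) ((hθ n w).2.trans (h1 n))
    linarith
  · intro w
    simp_rw [he]
    have : Tendsto (fun n => w - θ n w • b) atTop (𝓝 w) := by
      have h3 := (tendsto_const_nhds (x := w)).sub (tendsto_of_bounded_smul (fun n => hθ n w) hh b)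
      simpa using h3
    exact ((hv.pd b).continuous.tendsto w).comp this

lemma cvg_const {v : M → ℝ} (hv : Tst v) : Cvg (fun _ => v) v := by
  obtain ⟨B, R, hB0, hB, hR⟩ := hv.exists_bound
  exact ⟨⟨B, fun _ => hB⟩, ⟨R, fun _ => hR⟩, fun w => tendsto_const_nhds⟩

end Limits

section Continuous

open Filter Topology

variable {ι M : Type*} [Fintype ι] [NormedAddCommGroup M]

/-- Coefficients of a parabolic operator on `M`. -/
structure COp (ι M : Type*) where
  A : M → ℝ
  C : M → ℝ
  a : ι → ι → M → ℝ
  lam : ℝ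

variable [NormedSpace ℝ M]

/-- The operator with time direction `b none` and space directions `b (some i)`. -/
def COp.app (P : COp ι M) (b : Option ι → M) (v : M → ℝ) (w : M) : ℝ :=
  P.A w * pd (b none) v w + P.lam * P.C w * v w -
    ∑ i, ∑ j, P.a i j w * pd (b (some j)) (pd (b (some i)) v) w

/-- Bounds, measurability, ellipticity and invariance. -/
structure COp.OK [MeasurableSpace M] (P : COp ι M) (b : Option ι → M) (ν : ℝ)
    (S : Set (Option ι)) : Prop where
  A_lo : ∀ z, ν ≤ P.A z
  A_hi : ∀ z, P.A z ≤ ν⁻¹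
  C_lo : ∀ z, ν ≤ P.C z
  C_hi : ∀ z, P.C z ≤ ν⁻¹
  a_hi : ∀ i j z, |P.a i j z| ≤ ν⁻¹
  ell : ∀ z (ξ : ι → ℝ), ν * ∑ i, ξ i ^ 2 ≤ ∑ i, ∑ j, P.a i j z * ξ j * ξ i
  lam_pos : 0 < P.lam
  A_meas : Measurable P.A
  C_meas : Measurable P.C
  a_meas : ∀ i j, Measurable (P.a i j)
  A_inv : ∀ k ∈ S, ∀ (r : ℝ) z, P.A (z + r • b k) = P.A z
  C_inv : ∀ k ∈ S, ∀ (r : ℝ) z, P.C (z + r • b k) = P.C z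
  a_inv : ∀ k ∈ S, ∀ i j (r : ℝ) z, P.a i j (z + r • b k) = P.a i j z
  a_self : ∀ i j (r : ℝ) z, P.a i j (z + r • b (some i)) = P.a i j z
  none_mem : none ∈ S

/-- Parabolically scaled directions. -/
def scl (h : ℝ) : Option ι → ℝ
  | none => h ^ 2
  | some _ => h

lemma scl_none (h : ℝ) : scl (ι := ι) h none = h ^ 2 := rfl

lemma scl_some (h : ℝ) (i : ι) : scl h (some i) = h := rfl

/-- The discretization of an operator at the base point `w`. -/
def COp.disc (P : COp ι M) (e : Option ι → M) (h : ℝ) (w : M) : LOp ι where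
  A z := P.A (w + lat e z)
  C z := P.C (w + lat e z)
  a i j z := P.a i j (w + lat e z)
  lam := h ^ 2 * P.lam
  τ := ev none

variable [MeasurableSpace M] {P : COp ι M} {b : Option ι → M} {ν : ℝ} {S : Set (Option ι)}

lemma COp.OK.disc (hP : P.OK b ν S) {h : ℝ} (h0 : 0 < h) (h1 : h ^ 2 * P.lam ≤ 1) (w : M) :
    (P.disc (fun k => scl h k • b k) h w).OK ν S where
  A_lo _ := hP.A_lo _
  A_hi _ := hP.A_hi _
  C_lo _ := hP.C_lo _
  C_hi _ := hP.C_hi _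
  a_hi _ _ _ := hP.a_hi _ _ _
  ell _ := hP.ell _
  lam_pos := mul_pos (by positivity) hP.lam_pos
  lam_le := h1
  tau := Or.inl rfl
  A_inv k hk z := by
    simp only [COp.disc, map_add, lat_ev, ← add_assoc, hP.A_inv k hk]
  C_inv k hk z := by
    simp only [COp.disc, map_add, lat_ev, ← add_assoc, hP.C_inv k hk]
  a_inv k hk i j z := by
    simp only [COp.disc, map_add, lat_ev, ← add_assoc, hP.a_inv k hk]
  none_mem := hP.none_mem

/-- The rescaled difference operator. -/
def COp.quot (P : COp ι M) (b : Option ι → M) (h : ℝ) (v : M → ℝ) (w : M) : ℝ :=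
  P.A w * ((v w - v (w - (h ^ 2) • b none)) / h ^ 2) + P.lam * P.C w * v w -
    ∑ i, ∑ j, P.a i j w * dq h (b (some i)) (b (some j)) v (w + (-h) • b (some i))

lemma dp_dp_lat (b : Option ι → M) {h : ℝ} (h0 : 0 < h) (v : M → ℝ) (w : M) (i k : ι)
    (z : Grd ι) :
    dp (some k) (dp (some i) fun z => v (w + lat (fun k => scl h k • b k) z)) z =
      h ^ 2 * dq h (b (some k)) (b (some i)) v (w + lat (fun k => scl h k • b k) z) := by
  simp only [dp, dq, map_add, lat_ev, scl_some, ← add_assoc]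
  field_simp

lemma COp.OK.disc_app (hP : P.OK b ν S) {h : ℝ} (h0 : 0 < h) (v : M → ℝ) (w : M)
    (z : Grd ι) : (P.disc (fun k => scl h k • b k) h w).app
      (fun z => v (w + lat (fun k => scl h k • b k) z)) z =
      h ^ 2 * P.quot b h v (w + lat (fun k => scl h k • b k) z) := by
  simp only [LOp.app, COp.disc, COp.quot, dp, dq, map_add, map_sub, lat_ev, scl_none, scl_some, ← add_assoc]
  generalize lat (fun k => scl h k • b k) z = y
  have hinv : ∀ i j, P.a i j (w + (y - h • b (some i))) = P.a i j (w + y) := by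
    intro i j
    have := hP.a_self i j (-h) (w + y)
    rw [← this]
    congr 1
    rw [neg_smul]
    abel
  have e1 : ∀ i j : ι, w + (y - h • b (some i) + h • b (some j)) =
      w + y + -h • b (some i) + h • b (some j) := fun i j => by rw [neg_smul]; abel
  have e2 : ∀ i : ι, w + (y - h • b (some i)) = w + y + -h • b (some i) := fun i => by
    rw [neg_smul]; abel
  have e3 : ∀ i : ι, w + y + -h • b (some i) + h • b (some i) = w + y := fun i => by
    rw [neg_smul]; abel
  simp only [hinv]
  simp only [e1, e2, e3, ← add_sub_assoc]
  simp only [mul_sub, mul_add, Finset.mul_sum, ← Finset.sum_sub_distrib]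
  have : h ≠ 0 := h0.ne'
  congr 1
  · field_simp
  · refine Finset.sum_congr rfl fun i _ => Finset.sum_congr rfl fun j _ => ?_
    field_simp

lemma COp.OK.cvg_quot [BorelSpace M] (hP : P.OK b ν S) (hν : 0 < ν) {v : M → ℝ} (hv : Tst v)
    {h : ℕ → ℝ} (h0 : ∀ n, 0 < h n) (h1 : ∀ n, h n ≤ 1) (hh : Tendsto h atTop (𝓝 0)) :
    Cvg (fun n => P.quot b (h n) v) (P.app b v) := by
  have hA : ∀ w, |P.A w| ≤ ν⁻¹ := fun w => abs_le.2
    ⟨by linarith [hP.A_lo w, inv_pos.2 hν], hP.A_hi w⟩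
  have hC : ∀ w, |P.lam * P.C w| ≤ P.lam * ν⁻¹ := fun w => by
    rw [abs_mul, abs_of_pos hP.lam_pos]
    exact mul_le_mul_of_nonneg_left (abs_le.2
      ⟨by linarith [hP.C_lo w, inv_pos.2 hν], hP.C_hi w⟩) hP.lam_pos.le
  have t := (cvg_sub hv (b none) (h := fun n => h n ^ 2) (fun n => by have := h0 n; positivity)
    (fun n => pow_le_one₀ (h0 n).le (h1 n)) (by simpa using hh.pow 2)).mul hA
  have l := (cvg_const hv).mul hC
  have s := Cvg.sum Finset.univ fun i _ => Cvg.sum Finset.univ fun j _ =>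
    (cvg_dq hv (b (some i)) (b (some j)) h0 h1 hh (s := fun n => (-h n) • b (some i))
      (K := ‖b (some i)‖) (by simpa using hh.neg.smul_const (b (some i))) (fun n => by
        rw [norm_smul, norm_neg, Real.norm_of_nonneg (h0 n).le]
        exact mul_le_of_le_one_left (norm_nonneg _) (h1 n))).mul
      (a := fun w => P.a i j w) (hP.a_hi i j)
  have := (t.add l).add (s.mul (a := fun _ => (-1 : ℝ)) (K := 1) (by simp))
  simp only [neg_one_mul, ← sub_eq_add_neg] at this
  exact this

lemma COp.OK.measurable_quot [BorelSpace M] (hP : P.OK b ν S) {v : M → ℝ} (hv : Continuous v)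
    (h : ℝ) : Measurable (P.quot b h v) := by
  have h1 : ∀ c : M, Measurable fun w => v (w - c) := fun c =>
    (hv.comp (continuous_id.sub continuous_const)).measurable
  have h2 : ∀ b c x : M, Measurable fun w => dq h b c v (w + x) := fun b c x => by
    refine Continuous.measurable ?_
    unfold dq
    fun_prop
  unfold COp.quot
  have := hP.A_meas
  have := hP.C_meas
  refine ((hP.A_meas.mul ((hv.measurable.sub (h1 _)).div_const _)).add
    ((hP.C_meas.const_mul _).mul hv.measurable)).sub ?_
  exact Finset.measurable_sum _ fun i _ => Finset.measurable_sum _ fun j _ =>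
    (hP.a_meas i j).mul (h2 _ _ _)

end Continuous

section ContinuousLp

open Filter Topology

variable {ι M : Type*} [Fintype ι] [NormedAddCommGroup M] [NormedSpace ℝ M]
  [FiniteDimensional ℝ M] [MeasurableSpace M] [BorelSpace M]

lemma scl_ne_zero {h : ℝ} (h0 : 0 < h) (k : Option ι) : scl h k ≠ 0 := by
  cases k
  · rw [scl_none]; positivity
  · rw [scl_some]; positivity

lemma lintegral_le_of_lattice_le (μ : Measure M) [μ.IsAddHaarMeasure]
    (b : Module.Basis (Option ι) ℝ M) {h : ℕ → ℝ} (h0 : ∀ n, 0 < h n) {D Q : ℕ → M → ℝ}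
    {D' Q' : M → ℝ} (hD : Cvg D D') (hQ : Cvg Q Q') (hDm : ∀ n, Measurable (D n))
    (hQm : ∀ n, Measurable (Q n)) {p : ℝ} (hp : 0 < p) {C : ℝ≥0∞} (hC : C ≠ ∞)
    (hle : ∀ n w, ∑' z, ‖h n ^ 2 * D n (w + lat (fun k => scl (h n) k • b k) z)‖ₑ ^ p ≤
      C * ∑' z, ‖h n ^ 2 * Q n (w + lat (fun k => scl (h n) k • b k) z)‖ₑ ^ p) :
    ∫⁻ w, ‖D' w‖ₑ ^ p ∂μ ≤ C * ∫⁻ w, ‖Q' w‖ₑ ^ p ∂μ := by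
  refine le_of_tendsto_of_tendsto' (hD.tendsto_lintegral μ hDm hp)
    (ENNReal.Tendsto.const_mul (hQ.tendsto_lintegral μ hQm hp) (Or.inr hC)) fun n => ?_
  set e : Module.Basis (Option ι) ℝ M :=
    b.isUnitSMul (w := scl (h n)) fun k => (scl_ne_zero (h0 n) k).isUnit with he
  have hee : (e : Option ι → M) = fun k => scl (h n) k • b k := by
    funext k
    rw [he, Module.Basis.isUnitSMul_apply]
  rw [← lintegral_fundamentalDomain_tsum μ e ((hDm n).enorm.pow_const p),
    ← lintegral_fundamentalDomain_tsum μ e ((hQm n).enorm.pow_const p),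
    ← lintegral_const_mul' _ _ hC]
  refine lintegral_mono fun w => ?_
  have := hle n w
  simp only [enorm_mul, ENNReal.mul_rpow_of_nonneg _ _ hp.le, ENNReal.tsum_mul_left] at this
  rw [mul_left_comm] at this
  have hpos : ‖h n ^ 2‖ₑ ^ p ≠ 0 := by
    have := (h0 n).ne'
    simp [this]
  rw [hee]
  exact (ENNReal.mul_le_mul_iff_right hpos (ENNReal.rpow_ne_top_of_nonneg hp.le (by simp))).1 this

/-- Parabolic `L^p` estimate for coefficients independent of the directions in `S`. -/
theorem COp.exists_rpow_le (μ : Measure M) [μ.IsAddHaarMeasure] (ν : ℝ) (hν : 0 < ν) (ℓ : ι)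
    {p : ℝ} (hp : 1 < p) : ∃ C : ℝ≥0∞, C ≠ ∞ ∧ ∀ (P : COp ι M)
    (b : Module.Basis (Option ι) ℝ M) (S : Set (Option ι)), P.OK b ν S →
    (∀ k, k ≠ some ℓ → k ∈ S) → ∀ v : M → ℝ, Tst v →
    ∫⁻ w, ‖P.lam * v w‖ₑ ^ p ∂μ ≤ C * ∫⁻ w, ‖P.app b v w‖ₑ ^ p ∂μ ∧
    ∫⁻ w, ‖pd (b none) v w‖ₑ ^ p ∂μ ≤ C * ∫⁻ w, ‖P.app b v w‖ₑ ^ p ∂μ ∧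
    ∀ i k, some i ∈ S → some k ∈ S →
      ∫⁻ w, ‖pd (b (some i)) (pd (b (some k)) v) w‖ₑ ^ p ∂μ ≤
        C * ∫⁻ w, ‖P.app b v w‖ₑ ^ p ∂μ := by
  obtain ⟨C, hC, hd⟩ := discrete_rpow_le ν hν ℓ hp
  refine ⟨C, hC, fun P b S hP hS v hv => ?_⟩
  have hp0 : 0 < p := by linarith
  set c : ℝ := 1 / (1 + P.lam) with hc
  have hlam := hP.lam_pos
  have hc0 : 0 < c := by positivity
  have hc1 : c ≤ 1 := by rw [hc, div_le_one (by positivity)]; linarith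
  have hcl : c * P.lam ≤ 1 := by
    rw [hc, div_mul_eq_mul_div, div_le_one (by positivity)]; linarith
  set h : ℕ → ℝ := fun n => c * (1 / ((n : ℝ) + 1)) with hh
  have hq : ∀ n : ℕ, 1 / ((n : ℝ) + 1) ≤ 1 := fun n => by
    rw [div_le_one (by positivity)]; linarith [Nat.cast_nonneg (α := ℝ) n]
  have h0 : ∀ n, 0 < h n := fun n => by positivity
  have hcn : ∀ n, h n ≤ c := fun n => mul_le_of_le_one_right hc0.le (hq n)
  have h1 : ∀ n, h n ≤ 1 := fun n => (hcn n).trans hc1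
  have ht : Tendsto h atTop (𝓝 0) := by
    have := (tendsto_one_div_add_atTop_nhds_zero_nat (𝕜 := ℝ)).const_mul c
    rwa [mul_zero] at this
  have hl : ∀ n, h n ^ 2 * P.lam ≤ 1 := fun n => by
    refine le_trans (mul_le_mul_of_nonneg_right ?_ hlam.le) hcl
    nlinarith [h0 n, h1 n, hcn n]
  have key := fun n w => hd _ S (hP.disc (h0 n) (hl n) w) hS _
    (by
      have := finiteSupport_lat (b.isUnitSMul (w := scl (h n))
        fun k => (scl_ne_zero (h0 n) k).isUnit) hv.cpt w
      have e : ((b.isUnitSMul (w := scl (h n)) fun k => (scl_ne_zero (h0 n) k).isUnit :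
          Module.Basis (Option ι) ℝ M) : Option ι → M) = fun k => scl (h n) k • b k := by
        funext k
        rw [Module.Basis.isUnitSMul_apply]
      rw [e] at this
      exact this)
  simp only [hP.disc_app (h0 _), dp_dp_lat b (h0 _)] at key
  have hQ := hP.cvg_quot hν hv h0 h1 ht
  have hQm := fun n => hP.measurable_quot hv.continuous (h n)
  refine ⟨?_, ?_, fun i k hi hk => ?_⟩
  · refine lintegral_le_of_lattice_le μ b h0 ((cvg_const hv).mul (a := fun _ => P.lam) fun _ => le_rfl)
      hQ (fun n => (hv.continuous.measurable.const_mul _)) hQm hp0 hC fun n w => ?_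
    refine le_of_eq_of_le (tsum_congr fun z => ?_) (key n w).1
    simp only [COp.disc, mul_assoc]
  · refine lintegral_le_of_lattice_le μ b h0 (cvg_sub hv (b none) (h := fun n => h n ^ 2)
      (fun n => by have := h0 n; positivity)
      (fun n => pow_le_one₀ (h0 n).le (h1 n)) (by simpa using ht.pow 2))
      hQ (fun n => ?_) hQm hp0 hC fun n w => ?_
    · refine Continuous.measurable ?_
      have := hv.continuous
      fun_prop
    refine le_of_eq_of_le (tsum_congr fun z => ?_) (key n w).2.1
    simp only [COp.disc, map_sub, lat_ev, scl_none]
    rw [mul_div_cancel₀ _ (by have := h0 n; positivity), add_sub_assoc]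
  · refine lintegral_le_of_lattice_le μ b h0
      (cvg_dq hv (b (some k)) (b (some i)) h0 h1 ht (s := fun _ => 0) (K := 0)
        tendsto_const_nhds (by simp))
      hQ (fun n => ?_) hQm hp0 hC fun n w => ?_
    · refine Continuous.measurable ?_
      have := hv.continuous
      unfold dq
      fun_prop
    simp only [add_zero]
    exact (key n w).2.2 i k hi hk

end ContinuousLp

section NormBounds

variable {α : Type*} [MeasurableSpace α] {μ : Measure α} {q : ℝ≥0∞} {f g : α → ℝ} {R S : ℝ}

/-- The `L^q` norm as a real number. -/
def nr (μ : Measure α) (q : ℝ≥0∞) (f : α → ℝ) : ℝ := (eLpNorm f q μ).toReal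

lemma nr_nonneg : 0 ≤ nr μ q f := ENNReal.toReal_nonneg

/-- `f` is measurable with `L^q` norm at most `R`. -/
structure Lb (μ : Measure α) (q : ℝ≥0∞) (f : α → ℝ) (R : ℝ) : Prop where
  meas : AEStronglyMeasurable f μ
  nonneg : 0 ≤ R
  le : eLpNorm f q μ ≤ ENNReal.ofReal R

lemma Lb.memLp (h : Lb μ q f R) : MemLp f q μ := ⟨h.meas, h.le.trans_lt ENNReal.ofReal_lt_top⟩

lemma Lb.nr_le (h : Lb μ q f R) : nr μ q f ≤ R := ENNReal.toReal_le_of_le_ofReal h.nonneg h.le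

lemma Lb.of_memLp (h : MemLp f q μ) : Lb μ q f (nr μ q f) :=
  ⟨h.1, nr_nonneg, (ENNReal.ofReal_toReal h.2.ne).ge⟩

lemma Lb.trans (h : Lb μ q f R) (hR : R ≤ S) : Lb μ q f S :=
  ⟨h.meas, h.nonneg.trans hR, h.le.trans (ENNReal.ofReal_le_ofReal hR)⟩

lemma Lb.of_nr_le (h : MemLp f q μ) (hR : nr μ q f ≤ R) : Lb μ q f R := (Lb.of_memLp h).trans hR

lemma Lb.mono (h : Lb μ q g R) (hf : AEStronglyMeasurable f μ) (hfg : ∀ᵐ x ∂μ, |f x| ≤ |g x|) :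
    Lb μ q f R :=
  ⟨hf, h.nonneg, (eLpNorm_mono_ae hfg).trans h.le⟩

lemma Lb.congr (h : Lb μ q g R) (hfg : ∀ᵐ x ∂μ, f x = g x) : Lb μ q f R :=
  ⟨h.meas.congr (hfg.mono fun _ hx => hx.symm), h.nonneg, (eLpNorm_congr_ae hfg).trans_le h.le⟩

lemma Lb.neg (h : Lb μ q f R) : Lb μ q (fun x => -f x) R :=
  h.mono h.meas.neg (.of_forall fun x => by rw [abs_neg])

lemma Lb.add (hq : 1 ≤ q) (h : Lb μ q f R) (h' : Lb μ q g S) :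
    Lb μ q (fun x => f x + g x) (R + S) :=
  ⟨h.meas.add h'.meas, add_nonneg h.nonneg h'.nonneg, (eLpNorm_add_le h.meas h'.meas hq).trans (by
    rw [ENNReal.ofReal_add h.nonneg h'.nonneg]; exact add_le_add h.le h'.le)⟩

lemma Lb.sub (hq : 1 ≤ q) (h : Lb μ q f R) (h' : Lb μ q g S) :
    Lb μ q (fun x => f x - g x) (R + S) := by
  simpa only [sub_eq_add_neg] using h.add hq h'.neg

lemma Lb.zero : Lb μ q (fun _ => (0 : ℝ)) 0 :=
  ⟨aestronglyMeasurable_const, le_rfl, by simp⟩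

lemma Lb.sum (hq : 1 ≤ q) {κ : Type*} (s : Finset κ) {f : κ → α → ℝ} {R : κ → ℝ}
    (h : ∀ k ∈ s, Lb μ q (f k) (R k)) : Lb μ q (fun x => ∑ k ∈ s, f k x) (∑ k ∈ s, R k) := by
  classical
  induction s using Finset.induction_on with
  | empty => simpa using Lb.zero
  | insert k s hk ih =>
    simp only [Finset.sum_insert hk]
    exact (h k (by simp)).add hq (ih fun j hj => h j (by simp [hj]))

lemma Lb.const_mul (h : Lb μ q f R) (c : ℝ) : Lb μ q (fun x => c * f x) (|c| * R) := by
  refine ⟨h.meas.const_mul c, mul_nonneg (abs_nonneg _) h.nonneg, ?_⟩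
  have : eLpNorm (fun x => c * f x) q μ = ‖c‖ₑ * eLpNorm f q μ := eLpNorm_const_smul c f q μ
  rw [this, Real.enorm_eq_ofReal_abs, ENNReal.ofReal_mul (abs_nonneg _)]
  gcongr
  exact h.le

lemma Lb.mul (h : Lb μ q f R) {a : α → ℝ} {K : ℝ} (ha : AEStronglyMeasurable a μ)
    (haK : ∀ᵐ x ∂μ, |a x| ≤ K) (hK : 0 ≤ K) : Lb μ q (fun x => a x * f x) (K * R) := by
  have := (h.const_mul K).mono (f := fun x => a x * f x) (ha.mul h.meas) (haK.mono fun x hx => by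
    rw [abs_mul, abs_mul, abs_of_nonneg hK]
    exact mul_le_mul_of_nonneg_right hx (abs_nonneg _))
  rwa [abs_of_nonneg hK] at this

lemma eLpNorm_eq_lintegral {p : ℝ} (hp : 0 < p) (f : α → ℝ) :
    eLpNorm f (ENNReal.ofReal p) μ = (∫⁻ x, ‖f x‖ₑ ^ p ∂μ) ^ (1 / p) := by
  rw [eLpNorm_eq_lintegral_rpow_enorm_toReal (by simpa using hp) (by simp),
    ENNReal.toReal_ofReal hp.le]

lemma Lb.of_lintegral_le {p : ℝ} (hp : 0 < p) {C : ℝ≥0∞} (hC : C ≠ ∞)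
    (hf : AEStronglyMeasurable f μ) (h : Lb μ (ENNReal.ofReal p) g R)
    (hle : ∫⁻ x, ‖f x‖ₑ ^ p ∂μ ≤ C * ∫⁻ x, ‖g x‖ₑ ^ p ∂μ) :
    Lb μ (ENNReal.ofReal p) f ((C ^ (1 / p)).toReal * R) := by
  have hC' : C ^ (1 / p) ≠ ∞ := ENNReal.rpow_ne_top_of_nonneg (by positivity) hC
  refine ⟨hf, mul_nonneg ENNReal.toReal_nonneg h.nonneg, ?_⟩
  rw [ENNReal.ofReal_mul ENNReal.toReal_nonneg, ENNReal.ofReal_toReal hC', eLpNorm_eq_lintegral hp]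
  refine (ENNReal.rpow_le_rpow hle (by positivity)).trans ?_
  rw [ENNReal.mul_rpow_of_nonneg _ _ (by positivity), ← eLpNorm_eq_lintegral hp]
  gcongr
  exact h.le

end NormBounds

section Mixed

open Filter Topology

variable {ι M : Type*} [Fintype ι] [NormedAddCommGroup M] [NormedSpace ℝ M]

lemma pd_comm {v : M → ℝ} (hv : ContDiff ℝ (⊤ : ℕ∞) v) (b c : M) : pd b (pd c v) = pd c (pd b v) := by
  have h2 : ∀ x y w : M, pd x (pd y v) w = fderiv ℝ (fderiv ℝ v) w x y := by
    intro x y w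
    have hd : DifferentiableAt ℝ (fderiv ℝ v) w :=
      (hv.fderiv_right (m := (⊤ : ℕ∞)) (by simp)).differentiable (by simp) w
    unfold pd
    rw [fderiv_clm_apply hd (differentiableAt_const _)]
    simp
  funext w
  rw [h2, h2]
  exact (hv.contDiffAt.isSymmSndFDerivAt (by
    rw [minSmoothness_of_isRCLikeNormedField]; exact WithTop.coe_le_coe.2 (le_top (a := (2 : ℕ∞))))) b c

lemma pd_smul (c : ℝ) (b : M) (v : M → ℝ) : pd (c • b) v = fun w => c * pd b v w := by
  funext w; simp [pd]

lemma pd_const_mul {v : M → ℝ} (hv : Differentiable ℝ v) (c : ℝ) (b : M) :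
    pd b (fun w => c * v w) = fun w => c * pd b v w := by
  funext w
  unfold pd
  rw [fderiv_const_mul (hv w)]
  simp

variable [FiniteDimensional ℝ M] [MeasurableSpace M] [BorelSpace M]

lemma Tst.memLp {v : M → ℝ} (hv : Tst v) (q : ℝ≥0∞) (μ : Measure M) [IsFiniteMeasureOnCompacts μ] :
    MemLp v q μ := hv.continuous.memLp_of_hasCompactSupport hv.cpt

lemma COp.OK.Lb_app {P : COp ι M} {b : Option ι → M} {ν : ℝ} {S : Set (Option ι)}
    (hP : P.OK b ν S) (hν : 0 < ν) {q : ℝ≥0∞} (hq : 1 ≤ q) (μ : Measure M)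
    [IsFiniteMeasureOnCompacts μ] {v : M → ℝ} (hv : Tst v) :
    Lb μ q (P.app b v) (nr μ q (P.app b v)) := by
  have hν' := (inv_pos.2 hν).le
  have hA : ∀ w, |P.A w| ≤ ν⁻¹ := fun w => abs_le.2 ⟨by linarith [hP.A_lo w], hP.A_hi w⟩
  have hC : ∀ w, |P.C w| ≤ ν⁻¹ := fun w => abs_le.2 ⟨by linarith [hP.C_lo w], hP.C_hi w⟩
  have h1 := ((Lb.of_memLp ((hv.pd (b none)).memLp q μ)).mul hP.A_meas.aestronglyMeasurable
    (.of_forall hA) hν').add hq (((Lb.of_memLp (hv.memLp q μ)).mul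
      hP.C_meas.aestronglyMeasurable (.of_forall hC) hν').const_mul P.lam)
  have h2 := Lb.sum hq Finset.univ fun i _ => Lb.sum hq Finset.univ fun j _ =>
    (Lb.of_memLp (((hv.pd (b (some i))).pd (b (some j))).memLp q μ)).mul
      (hP.a_meas i j).aestronglyMeasurable (.of_forall (hP.a_hi i j)) hν'
  have := (h1.sub hq h2).memLp
  simp only [← mul_assoc] at this
  exact Lb.of_memLp this

set_option maxHeartbeats 1000000 in
/-- Full parabolic `L^p` estimate for coefficients depending on one coordinate. -/
theorem COp.exists_full_le (μ : Measure M) [μ.IsAddHaarMeasure] (ν : ℝ) (hν : 0 < ν) (ℓ : ι)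
    {p : ℝ} (hp : 1 < p) : ∃ N : ℝ, 0 ≤ N ∧ ∀ (P : COp ι M)
    (b : Module.Basis (Option ι) ℝ M) (S : Set (Option ι)), P.OK b ν S →
    (∀ k, k ≠ some ℓ → k ∈ S) → (∀ w, P.a ℓ ℓ w = 1) → (∀ j, j ≠ ℓ → ∀ w, P.a ℓ j w = 0) →
    ∀ v : M → ℝ, Tst v → ∀ R, Lb μ (ENNReal.ofReal p) (P.app b v) R →
    Lb μ (ENNReal.ofReal p) (fun w => P.lam * v w) (N * R) ∧
    Lb μ (ENNReal.ofReal p) (pd (b none) v) (N * R) ∧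
    ∀ i k, Lb μ (ENNReal.ofReal p) (pd (b (some i)) (pd (b (some k)) v)) (N * R) := by
  classical
  set q := ENNReal.ofReal p with hqdef
  have hp0 : 0 < p := by linarith
  have hq : 1 ≤ q := by rw [hqdef, ← ENNReal.ofReal_one]; exact ENNReal.ofReal_le_ofReal hp.le
  obtain ⟨C, hC, hmain⟩ := COp.exists_rpow_le (ι := ι) μ ν hν ℓ hp
  obtain ⟨C', hC', hcst⟩ := COp.exists_rpow_le (ι := ι) μ 1 one_pos ℓ hp
  set c := (C ^ (1 / p)).toReal with hc
  set c' := (C' ^ (1 / p)).toReal with hc'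
  have hc0 : 0 ≤ c := ENNReal.toReal_nonneg
  have hc0' : 0 ≤ c' := ENNReal.toReal_nonneg
  set n : ℝ := (Fintype.card ι : ℝ) with hn
  have hn0 : 0 ≤ n := Nat.cast_nonneg _
  have hν' : 0 < ν⁻¹ := inv_pos.2 hν
  set σ : ℝ := 1 / (2 * (n * ν⁻¹ * c' + 1)) with hσ
  have hσ0 : 0 < σ := by positivity
  have hσ1 : n * ν⁻¹ * c' * σ ≤ 1 / 2 := by
    rw [hσ, mul_one_div, div_le_div_iff₀ (by positivity) (by positivity)]
    nlinarith [mul_nonneg (mul_nonneg hn0 hν'.le) hc0']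
  set B : ℝ := c' * (2 + n) * c / σ with hB
  set H : ℝ := 2 * (2 * ν⁻¹ * c + 1 + n * n * ν⁻¹ * c + n * ν⁻¹ * B) with hH
  have hB0 : 0 ≤ B := by positivity
  have hH0 : 0 ≤ H := by positivity
  refine ⟨c + H + (B + c' * σ * H), by positivity, ?_⟩
  intro P b S hP hS hℓℓ hℓj v hv R hR
  obtain ⟨m1, m2, m3⟩ := hmain P b S hP hS v hv
  have hR0 := hR.nonneg
  have l1 : Lb μ q (fun w => P.lam * v w) (c * R) :=
    Lb.of_lintegral_le hp0 hC (((hv.memLp q μ).const_mul _).1) hR m1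
  have l2 : Lb μ q (pd (b none) v) (c * R) :=
    Lb.of_lintegral_le hp0 hC (((hv.pd _).memLp q μ)).1 hR m2
  have l3 : ∀ i k, i ≠ ℓ → k ≠ ℓ → Lb μ q (pd (b (some i)) (pd (b (some k)) v)) (c * R) :=
    fun i k hi hk => Lb.of_lintegral_le hp0 hC (((hv.pd _).pd _).memLp q μ).1 hR
      (m3 i k (hS _ (by simpa using hi)) (hS _ (by simpa using hk)))
  set h := nr μ q (pd (b (some ℓ)) (pd (b (some ℓ)) v)) with hh
  have l4 : Lb μ q (pd (b (some ℓ)) (pd (b (some ℓ)) v)) h :=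
    Lb.of_memLp (((hv.pd _).pd _).memLp q μ)
  have hh0 : 0 ≤ h := nr_nonneg
  -- mixed derivatives from the anisotropic heat operator
  set s : Option ι → ℝ := fun k => if k = some ℓ then σ else 1 with hs
  have hs0 : ∀ k, s k ≠ 0 := fun k => by simp only [hs]; split_ifs <;> positivity
  set b' : Module.Basis (Option ι) ℝ M := b.isUnitSMul (w := s) fun k => (hs0 k).isUnit with hb'
  have hbb : ∀ k, b' k = s k • b k := fun k => by rw [hb', Module.Basis.isUnitSMul_apply]
  set P' : COp ι M := ⟨fun _ => 1, fun _ => 1, fun i j _ => if i = j then 1 else 0, P.lam⟩ with hP'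
  have hOK' : P'.OK b' 1 univ := by
    refine ⟨fun _ => le_rfl, fun _ => by simp [hP'], fun _ => le_rfl, fun _ => by simp [hP'],
      fun i j _ => ?_, fun z ξ => ?_, hP.lam_pos, measurable_const, measurable_const,
      fun i j => measurable_const, fun _ _ _ _ => rfl, fun _ _ _ _ => rfl,
      fun _ _ _ _ _ _ => rfl, fun _ _ _ _ => rfl, mem_univ _⟩
    · simp only [hP']; split_ifs <;> simp
    · simp [hP', sq]
  have hs1 : ∀ k, k ≠ some ℓ → s k = 1 := fun k hk => by simp [hs, hk]
  have hsℓ : s (some ℓ) = σ := by simp [hs]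
  have hpd : ∀ i j : Option ι, pd (b' i) (pd (b' j) v) = fun w => s i * s j * pd (b i) (pd (b j) v) w := by
    intro i j
    rw [hbb, hbb, pd_smul, pd_smul, pd_const_mul (hv.pd _).differentiable]
    funext w; ring
  have l5 : Lb μ q (P'.app b' v) ((2 + n) * c * R + σ ^ 2 * h) := by
    have e1 : Lb μ q (pd (b' none) v) (c * R) := by
      rw [hbb, hs1 _ (by simp), one_smul]; exact l2
    have e2 : ∀ i ∈ Finset.univ, Lb μ q (pd (b' (some i)) (pd (b' (some i)) v))
        (c * R + if i = ℓ then σ ^ 2 * h else 0) := by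
      intro i _
      rw [hpd]
      by_cases hi : i = ℓ
      · subst hi
        have := l4.const_mul (s (some i) * s (some i))
        rw [hsℓ, abs_of_nonneg (by positivity)] at this
        rw [hsℓ]
        refine this.trans ?_
        rw [if_pos rfl]
        nlinarith [mul_nonneg hc0 hR0]
      · rw [hs1 _ (by simpa using hi)]
        simpa [hi] using l3 i i hi hi
    have e3 := (e1.add hq l1).sub hq (Lb.sum hq Finset.univ e2)
    refine (e3.congr (.of_forall fun w => ?_)).trans (le_of_eq ?_)
    · simp only [COp.app, hP']
      simp
    · rw [Finset.sum_add_distrib]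
      simp only [Finset.sum_const, Finset.card_univ, nsmul_eq_mul, Finset.sum_ite_eq',
        Finset.mem_univ, if_true]
      ring
  have l6 : ∀ i, i ≠ ℓ → Lb μ q (pd (b (some i)) (pd (b (some ℓ)) v)) (B * R + c' * σ * h) := by
    intro i hi
    have := Lb.of_lintegral_le hp0 hC' (((hv.pd (b' (some ℓ))).pd (b' (some i))).memLp q μ).1 l5
      ((hcst P' b' univ hOK' (fun _ _ => mem_univ _) v hv).2.2 i ℓ (mem_univ _) (mem_univ _))
    rw [hpd, hs1 _ (by simpa using hi), hsℓ] at this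
    have h2 := this.const_mul σ⁻¹
    refine (h2.congr (.of_forall fun w => ?_)).trans (le_of_eq ?_)
    · field_simp
    · rw [abs_of_pos (by positivity), hB, ← hc']
      field_simp
  -- the second normal derivative from the equation
  have hA : ∀ w, |P.A w| ≤ ν⁻¹ := fun w => abs_le.2 ⟨by linarith [hP.A_lo w], hP.A_hi w⟩
  have hCb : ∀ w, |P.C w| ≤ ν⁻¹ := fun w => abs_le.2 ⟨by linarith [hP.C_lo w], hP.C_hi w⟩
  have l7 : Lb μ q (pd (b (some ℓ)) (pd (b (some ℓ)) v))
      (ν⁻¹ * (c * R) + ν⁻¹ * (c * R) + R + ∑ i : ι, ∑ j : ι, if i = ℓ then 0 else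
        (ν⁻¹ * (c * R) + if j = ℓ then ν⁻¹ * (B * R + c' * σ * h) else 0)) := by
    have e1 := ((l2.mul hP.A_meas.aestronglyMeasurable (.of_forall hA) hν'.le).add hq
      (l1.mul hP.C_meas.aestronglyMeasurable (.of_forall hCb) hν'.le)).sub hq hR
    have e2 : ∀ i ∈ Finset.univ, ∀ j ∈ Finset.univ, Lb μ q (fun w => (if i = ℓ then 0 else
        P.a i j w) * pd (b (some j)) (pd (b (some i)) v) w) (if i = ℓ then 0 else
        (ν⁻¹ * (c * R) + if j = ℓ then ν⁻¹ * (B * R + c' * σ * h) else 0)) := by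
      intro i _ j _
      by_cases hi : i = ℓ
      · simpa [hi] using Lb.zero
      · simp only [hi, if_false]
        by_cases hj : j = ℓ
        · subst hj
          rw [pd_comm hv.smooth]
          refine ((l6 i hi).mul (hP.a_meas i j).aestronglyMeasurable
            (.of_forall (hP.a_hi i j)) hν'.le).trans ?_
          simp only [if_true]
          have : 0 ≤ ν⁻¹ * (c * R) := by positivity
          linarith
        · simp only [hj, if_false, add_zero]
          exact (l3 j i hj hi).mul (hP.a_meas i j).aestronglyMeasurable
            (.of_forall (hP.a_hi i j)) hν'.le
    refine (e1.sub hq (Lb.sum hq _ fun i hi => Lb.sum hq _ (e2 i hi))).congr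
      (.of_forall fun w => ?_)
    have e3 : ∑ i, ∑ j, P.a i j w * pd (b (some j)) (pd (b (some i)) v) w =
        pd (b (some ℓ)) (pd (b (some ℓ)) v) w + ∑ i, ∑ j, (if i = ℓ then 0 else
        P.a i j w) * pd (b (some j)) (pd (b (some i)) v) w := by
      rw [← Finset.add_sum_erase _ _ (Finset.mem_univ ℓ),
        ← Finset.add_sum_erase (a := ℓ) Finset.univ (fun i => ∑ j, (if i = ℓ then 0 else
        P.a i j w) * pd (b (some j)) (pd (b (some i)) v) w) (Finset.mem_univ ℓ)]
      have e4 : ∑ j, (if ℓ = ℓ then 0 else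
          P.a ℓ j w) * pd (b (some j)) (pd (b (some ℓ)) v) w = 0 := by simp
      rw [e4, zero_add]
      congr 1
      · rw [Finset.sum_eq_single ℓ (fun j _ hj => by rw [hℓj j hj, zero_mul]) (by simp), hℓℓ,
          one_mul]
      · exact Finset.sum_congr rfl fun i hi => Finset.sum_congr rfl fun j _ => by
          rw [if_neg (Finset.ne_of_mem_erase hi)]
    simp only [COp.app]
    rw [e3]
    ring
  have hhle : h ≤ H * R := by
    have h1 := l7.nr_le
    rw [← hh] at h1
    have h2 : (∑ i : ι, ∑ j : ι, if i = ℓ then 0 else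
        (ν⁻¹ * (c * R) + if j = ℓ then ν⁻¹ * (B * R + c' * σ * h) else 0)) ≤
        n * (n * (ν⁻¹ * (c * R)) + ν⁻¹ * (B * R + c' * σ * h)) := by
      have hpos : 0 ≤ ν⁻¹ * (B * R + c' * σ * h) := by positivity
      have hpos' : 0 ≤ ν⁻¹ * (c * R) := by positivity
      calc _ ≤ ∑ i : ι, ∑ j : ι, (ν⁻¹ * (c * R) +
          if j = ℓ then ν⁻¹ * (B * R + c' * σ * h) else 0) := by
            refine Finset.sum_le_sum fun i _ => Finset.sum_le_sum fun j _ => ?_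
            split_ifs <;> linarith
        _ = _ := by
          simp only [Finset.sum_add_distrib, Finset.sum_const, Finset.card_univ, nsmul_eq_mul,
            Finset.sum_ite_eq', Finset.mem_univ, if_true]
          rw [← hn]; ring
    have h3 : n * ν⁻¹ * c' * σ * h ≤ 1 / 2 * h := mul_le_mul_of_nonneg_right hσ1 hh0
    rw [hH]
    nlinarith [h1, h2, h3]
  have hx1 : 0 ≤ c * R := by positivity
  have hx2 : 0 ≤ H * R := by positivity
  have hx3 : 0 ≤ B * R := by positivity
  have hx4 : 0 ≤ c' * σ * H * R := by positivity
  have hx5 : c' * σ * h ≤ c' * σ * H * R := by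
    rw [mul_assoc (c' * σ) H]; gcongr
  refine ⟨l1.trans (by linarith), l2.trans (by linarith), fun i k => ?_⟩
  by_cases hi : i = ℓ
  · by_cases hk : k = ℓ
    · rw [hi, hk]
      exact l4.trans (by linarith)
    · rw [hi, pd_comm hv.smooth]
      exact (l6 k hk).trans (by linarith)
  · by_cases hk : k = ℓ
    · rw [hk]
      exact (l6 i hi).trans (by linarith)
    · exact (l3 i k hi hk).trans (by linarith)

end Mixed

section Interpolation

open Filter Topology

variable {M : Type*} [NormedAddCommGroup M] [NormedSpace ℝ M]
  [FiniteDimensional ℝ M] [MeasurableSpace M] [BorelSpace M]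

lemma Lb.translate {μ : Measure M} [μ.IsAddHaarMeasure] {q : ℝ≥0∞} {f : M → ℝ} {R : ℝ}
    (h : Lb μ q f R) (c : M) : Lb μ q (fun w => f (w + c)) R := by
  have hm := measurePreserving_add_right μ c
  exact ⟨h.meas.comp_measurePreserving hm, h.nonneg,
    (eLpNorm_comp_measurePreserving h.meas hm).trans_le h.le⟩

lemma Cvg.tendsto_nr (μ : Measure M) [μ.IsAddHaarMeasure] {g : ℕ → M → ℝ} {f : M → ℝ}
    (h : Cvg g f) (hg : ∀ n, Measurable (g n)) {p : ℝ} (hp : 0 < p)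
    (hf : MemLp f (ENNReal.ofReal p) μ) :
    Tendsto (fun n => nr μ (ENNReal.ofReal p) (g n)) atTop (𝓝 (nr μ (ENNReal.ofReal p) f)) := by
  have h1 := hf.2.ne
  rw [eLpNorm_eq_lintegral hp] at h1
  simp only [nr, eLpNorm_eq_lintegral hp]
  exact (ENNReal.tendsto_toReal h1).comp
    ((ENNReal.continuous_rpow_const.tendsto _).comp (h.tendsto_lintegral μ hg hp))

/-- Interpolation between a function and its second derivative. -/
lemma Lb_pd (μ : Measure M) [μ.IsAddHaarMeasure] {p : ℝ} (hp : 1 ≤ p) {v : M → ℝ} (hv : Tst v)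
    (b : M) {h : ℝ} (hh : 0 < h) {R S : ℝ} (hR : Lb μ (ENNReal.ofReal p) v R)
    (hS : Lb μ (ENNReal.ofReal p) (pd b (pd b v)) S) :
    Lb μ (ENNReal.ofReal p) (pd b v) (2 / h * R + h * S) := by
  have hp0 : 0 < p := by linarith
  set q := ENNReal.ofReal p with hqdef
  have hq : 1 ≤ q := by rw [hqdef, ← ENNReal.ofReal_one]; exact ENNReal.ofReal_le_ofReal hp
  obtain ⟨m, hm⟩ := exists_nat_gt h
  have hmpos : 0 < (m : ℝ) := hh.trans hm
  set δ : ℕ → ℝ := fun n => h / (m * ((n : ℝ) + 1)) with hδ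
  have hδ0 : ∀ n, 0 < δ n := fun n => by positivity
  have hδ1 : ∀ n, δ n ≤ 1 := fun n => by
    rw [hδ, div_le_one (by positivity)]
    nlinarith [Nat.cast_nonneg (α := ℝ) n]
  have hδt : Tendsto δ atTop (𝓝 0) := by
    have := (tendsto_one_div_add_atTop_nhds_zero_nat (𝕜 := ℝ)).const_mul (h / m)
    rw [mul_zero] at this
    refine this.congr fun n => ?_
    simp only [hδ]
    field_simp
  have c1 := cvg_sub hv b hδ0 hδ1 hδt
  have c2 := cvg_dq hv b b hδ0 hδ1 hδt (s := fun n => (-δ n) • b)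
    (K := ‖b‖) (by simpa using hδt.neg.smul_const b) (fun n => by
      rw [norm_smul, norm_neg, Real.norm_of_nonneg (hδ0 n).le]
      exact mul_le_of_le_one_left (norm_nonneg _) (hδ1 n))
  have hcont := hv.continuous
  have t1 := c1.tendsto_nr μ (fun n => (by fun_prop : Continuous _).measurable) hp0
    ((hv.pd b).memLp _ μ)
  have t2 := c2.tendsto_nr μ (fun n => (by unfold dq; fun_prop : Continuous _).measurable) hp0
    (((hv.pd b).pd b).memLp _ μ)
  have key : ∀ n, nr μ q (fun w => (v w - v (w - δ n • b)) / δ n) ≤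
      2 / h * R + h * nr μ q (fun w => dq (δ n) b b v (w + (-δ n) • b)) := by
    intro n
    set D := nr μ q (fun w => dq (δ n) b b v (w + (-δ n) • b)) with hD
    have hδn := hδ0 n
    set e := δ n with he
    have hDm : MemLp (fun w => dq e b b v (w + (-e) • b)) q μ := by
      have h1 : ∀ x : M, MemLp (fun w => v (w + x)) q μ := fun x =>
        ((Lb.of_memLp (hv.memLp q μ)).translate x).memLp
      have h2 := (((h1 (-e • b + e • b + e • b)).sub (h1 (-e • b + e • b))).sub
        ((h1 (-e • b + e • b)).sub (h1 (-e • b)))).const_mul (1 / e ^ 2)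
      refine h2.congr_norm (Continuous.aestronglyMeasurable (by unfold dq; fun_prop))
        (.of_forall fun w => ?_)
      simp only [dq, Pi.sub_apply, ← add_assoc]
      rw [one_div, div_eq_inv_mul]
    have d0 : Lb μ q (fun w => e ^ 2 * dq e b b v (w + (-e) • b)) (e ^ 2 * D) := by
      have := (Lb.of_memLp hDm).const_mul (e ^ 2)
      rwa [abs_of_pos (by positivity)] at this
    set d : M → ℝ := fun w => v w - v (w - e • b) with hd
    have hstep : ∀ w, d (w + e • b) - d w = e ^ 2 * dq e b b v (w + (-e) • b) := by
      intro w
      simp only [hd, dq]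
      rw [mul_div_cancel₀ _ (by positivity), neg_smul, neg_add_cancel_right, add_sub_cancel_right,
        ← sub_eq_add_neg]
    have i1 : ∀ k : ℕ, Lb μ q (fun w => d (w + (k * e) • b) - d w) (k * (e ^ 2 * D)) := by
      intro k
      induction k with
      | zero => simpa using Lb.zero
      | succ k ih =>
        refine ((ih.add hq (d0.translate ((k * e) • b))).congr (.of_forall fun w => ?_)).trans
          (le_of_eq (by push_cast; ring))
        rw [← hstep]
        push_cast
        rw [add_mul, one_mul, add_smul, ← add_assoc]
        ring
    have i2 : ∀ k : ℕ, Lb μ q (fun w => v (w + (k * e) • b - e • b) - v (w - e • b) - k * d w)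
        (k ^ 2 * (e ^ 2 * D)) := by
      intro k
      have hD0 : 0 ≤ D := nr_nonneg
      induction k with
      | zero => simpa using Lb.zero
      | succ k ih =>
        refine ((ih.add hq (i1 k)).congr (.of_forall fun w => ?_)).trans ?_
        · simp only [hd]
          push_cast
          rw [add_mul, one_mul, add_smul, ← add_assoc, add_sub_cancel_right]
          ring
        · push_cast
          have : 0 ≤ e ^ 2 * D := by positivity
          nlinarith [Nat.cast_nonneg (α := ℝ) k]
    set k : ℕ := m * (n + 1) with hk
    have hke : (k : ℝ) * e = h := by
      rw [he, hk]
      simp only [hδ]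
      push_cast
      field_simp
    have i3 := ((hR.translate (h • b - e • b)).sub hq (hR.translate (-(e • b)))).sub hq (i2 k)
    have i4 := i3.const_mul h⁻¹
    refine ((i4.congr (f := fun w => d w / e) (.of_forall fun w => ?_)).trans (le_of_eq ?_)).nr_le
    · rw [← hke]
      have : (k : ℝ) ≠ 0 := by rintro h0; rw [h0, zero_mul] at hke; linarith
      rw [← add_sub_assoc, ← sub_eq_add_neg]
      field_simp
      ring
    · rw [abs_of_pos (by positivity), show (k : ℝ) ^ 2 * (e ^ 2 * D) = (k * e) ^ 2 * D by ring, hke]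
      field_simp
      ring
  have := le_of_tendsto_of_tendsto' t1 ((t2.const_mul h).const_add (2 / h * R)) key
  refine Lb.of_nr_le ((hv.pd b).memLp _ μ) (this.trans ?_)
  gcongr
  exact hS.nr_le

end Interpolation

section HalfSpace

open Filter Topology

variable {M : Type*} [NormedAddCommGroup M] [NormedSpace ℝ M]

lemma pd_mul {f g : M → ℝ} {w : M} (hf : DifferentiableAt ℝ f w) (hg : DifferentiableAt ℝ g w)
    (e : M) : pd e (fun w => f w * g w) w = f w * pd e g w + pd e f w * g w := by
  unfold pd
  rw [fderiv_fun_mul hf hg]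
  simp
  ring

lemma pd_add {f g : M → ℝ} {w : M} (hf : DifferentiableAt ℝ f w) (hg : DifferentiableAt ℝ g w)
    (e : M) : pd e (fun w => f w + g w) w = pd e f w + pd e g w := by
  unfold pd
  rw [fderiv_fun_add hf hg]
  simp

lemma pd_comp {g : ℝ → ℝ} {v : M → ℝ} {w : M} (hg : DifferentiableAt ℝ g (v w))
    (hv : DifferentiableAt ℝ v w) (e : M) :
    pd e (fun w => g (v w)) w = deriv g (v w) * pd e v w := by
  unfold pd
  have := (hg.hasDerivAt.comp_hasFDerivAt w hv.hasFDerivAt).fderiv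
  rw [show (fun w => g (v w)) = g ∘ v from rfl, this]
  simp

lemma pd_eq_zero {v : M → ℝ} {w : M} (hw : w ∉ tsupport v) (e : M) : pd e v w = 0 := by
  have : v =ᶠ[𝓝 w] fun _ => 0 := notMem_tsupport_iff_eventuallyEq.1 hw
  unfold pd
  rw [this.fderiv_eq]
  simp

lemma Tst.comp {v : M → ℝ} (hv : Tst v) {g : ℝ → ℝ} (hg : ContDiff ℝ (⊤ : ℕ∞) g) (h0 : g 0 = 0) :
    Tst fun w => g (v w) :=
  ⟨hg.comp hv.smooth, hv.cpt.comp_left h0⟩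

lemma Tst.mul {v f : M → ℝ} (hv : Tst v) (hf : ContDiff ℝ (⊤ : ℕ∞) f) : Tst fun w => f w * v w :=
  ⟨hf.mul hv.smooth, hv.cpt.mul_left⟩

lemma Tst.add {v f : M → ℝ} (hv : Tst v) (hf : Tst f) : Tst fun w => f w + v w :=
  ⟨hf.smooth.add hv.smooth, hf.cpt.add hv.cpt⟩

/-- Test functions supported in the open half space `s > 0`. -/
structure TstP (s : M →L[ℝ] ℝ) (v : M → ℝ) : Prop extends Tst v where
  pos : ∀ w ∈ tsupport v, 0 < s w

variable {s : M →L[ℝ] ℝ} {u v : M → ℝ}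

lemma TstP.of_tsupport (hu : TstP s u) (hv : Tst v) (h : tsupport v ⊆ tsupport u) : TstP s v :=
  ⟨hv, fun w hw => hu.pos w (h hw)⟩

lemma TstP.pd (hu : TstP s u) (e : M) : TstP s (pd e u) :=
  hu.of_tsupport (hu.toTst.pd e) (tsupport_fderiv_apply_subset ℝ e)

lemma TstP.comp (hu : TstP s u) {g : ℝ → ℝ} (hg : ContDiff ℝ (⊤ : ℕ∞) g) (h0 : g 0 = 0) :
    TstP s fun w => g (u w) :=
  hu.of_tsupport (hu.toTst.comp hg h0) (tsupport_comp_subset h0 u)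

lemma TstP.mul (hu : TstP s u) {f : M → ℝ} (hf : ContDiff ℝ (⊤ : ℕ∞) f) : TstP s fun w => f w * u w :=
  hu.of_tsupport (hu.toTst.mul hf) (tsupport_mul_subset_right)

lemma TstP.add (hu : TstP s u) (hv : TstP s v) : TstP s fun w => u w + v w :=
  ⟨hv.toTst.add hu.toTst, fun w hw => by
    rcases (tsupport_add u v) hw with h | h
    · exact hu.pos w h
    · exact hv.pos w h⟩

lemma TstP.eq_zero (hu : TstP s u) {w : M} (hw : ¬ 0 < s w) : u w = 0 :=
  image_eq_zero_of_notMem_tsupport fun h => hw (hu.pos w h)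

lemma TstP.mul_rpow (hu : TstP s u) (r : ℝ) : TstP s fun w => s w ^ r * u w := by
  have hsub : tsupport (fun w => s w ^ r * u w) ⊆ tsupport u := tsupport_mul_subset_right
  refine ⟨⟨?_, hu.cpt.mul_left⟩, fun w hw => hu.pos w (hsub hw)⟩
  rw [contDiff_iff_contDiffAt]
  intro w
  by_cases hw : w ∈ tsupport u
  · exact (s.contDiff.contDiffAt.rpow_const_of_ne (hu.pos w hw).ne').mul hu.smooth.contDiffAt
  · have h1 : u =ᶠ[𝓝 w] fun _ => 0 := notMem_tsupport_iff_eventuallyEq.1 hw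
    refine (contDiffAt_const (c := (0 : ℝ))).congr_of_eventuallyEq ?_
    filter_upwards [h1] with y hy
    rw [hy, mul_zero]

lemma TstP.pd_mul_rpow (hu : TstP s u) (r : ℝ) (e w : M) :
    _root_.pd e (fun w => s w ^ r * u w) w =
      s w ^ r * _root_.pd e u w + r * s w ^ (r - 1) * s e * u w := by
  by_cases hw : w ∈ tsupport u
  · have hs := (hu.pos w hw).ne'
    have h1 : DifferentiableAt ℝ (fun y => s y ^ r) w :=
      s.differentiableAt.rpow_const (Or.inl hs)
    rw [pd_mul h1 (hu.differentiable w)]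
    have h2 : _root_.pd e (fun y => s y ^ r) w = r * s w ^ (r - 1) * s e := by
      unfold _root_.pd
      have := (s.hasFDerivAt (x := w)).rpow_const (p := r) (Or.inl hs)
      rw [this.fderiv]
      simp
    rw [h2]
  · rw [pd_eq_zero fun h => hw (tsupport_mul_subset_right h), pd_eq_zero hw,
      image_eq_zero_of_notMem_tsupport hw]
    simp

variable [FiniteDimensional ℝ M] [MeasurableSpace M] [BorelSpace M]

lemma integral_invariant_mul_pd (μ : Measure M) [μ.IsAddHaarMeasure] {a : M → ℝ} {K : ℝ}
    (ha : Measurable a) (haK : ∀ w, |a w| ≤ K) {e : M} (hinv : ∀ (r : ℝ) w, a (w + r • e) = a w)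
    {F : M → ℝ} (hF : Tst F) : Integrable (fun w => a w * pd e F w) μ ∧
      ∫ w, a w * pd e F w ∂μ = 0 := by
  have hint : ∀ {G : M → ℝ}, Tst G → Integrable (fun w => a w * G w) μ := fun {G} hG =>
    (hG.continuous.integrable_of_hasCompactSupport hG.cpt).bdd_mul
      ha.aestronglyMeasurable (.of_forall haK)
  refine ⟨hint (hF.pd e), ?_⟩
  have h0 : ∀ w, HasLineDerivAt ℝ a 0 w e := fun w => by
    unfold HasLineDerivAt
    simp_rw [hinv]
    exact hasDerivAt_const _ _
  have := integral_bilinear_hasLineDerivAt_right_eq_neg_left_of_integrable (μ := μ)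
    (f := a) (f' := fun _ => 0) (g := F) (g' := pd e F) (v := e)
    (B := ContinuousLinearMap.mul ℝ ℝ) (by simp) (by simpa using hint (hF.pd e))
    (by simpa using hint hF) (fun w _ => h0 w)
    fun w _ => (hF.differentiable w).hasFDerivAt.hasLineDerivAt e
  simpa using this

end HalfSpace

section WeightedTest

open Filter Topology

lemma sum_mul_delta {ι : Type*} [Fintype ι] [DecidableEq ι] (ℓ : ι) (a : ι → ι → ℝ)
    (h1 : a ℓ ℓ = 1) (h0 : ∀ j, j ≠ ℓ → a ℓ j = 0) (D : ι → ℝ) (x y x' y' : ℝ) :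
    ∑ i, ∑ j, a i j * ((x * D i + y * if i = ℓ then 1 else 0) * (x' * D j + y' * if j = ℓ then 1 else 0))
      = x * x' * (∑ i, ∑ j, a i j * D j * D i) + x * y' * (∑ i, a i ℓ * D i) + x' * y * D ℓ
        + y * y' := by
  have hin : ∀ i, ∑ j, a i j * ((x * D i + y * if i = ℓ then 1 else 0) *
      (x' * D j + y' * if j = ℓ then 1 else 0)) = x * x' * (∑ j, a i j * D j * D i) +
      x * y' * (a i ℓ * D i) + (if i = ℓ then y * (x' * ∑ j, a i j * D j) + y * y' * a i ℓ else 0) := by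
    intro i
    have : ∀ j, a i j * ((x * D i + y * if i = ℓ then 1 else 0) *
      (x' * D j + y' * if j = ℓ then 1 else 0)) = x * x' * (a i j * D j * D i) +
      (x' * y * if i = ℓ then 1 else 0) * (a i j * D j) +
      (if j = ℓ then x * y' * (a i j * D i) + (y * y' * if i = ℓ then 1 else 0) * a i j else 0) := by
      intro j
      split_ifs <;> ring
    simp_rw [this, Finset.sum_add_distrib, ← Finset.mul_sum]
    rw [Finset.sum_ite_eq']
    simp only [Finset.mem_univ, if_true]
    split_ifs <;> ring
  simp_rw [hin, Finset.sum_add_distrib, ← Finset.mul_sum]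
  rw [Finset.sum_ite_eq']
  have : ∑ j, a ℓ j * D j = D ℓ := by
    rw [Finset.sum_eq_single ℓ (fun j _ hj => by rw [h0 j hj, zero_mul]) (by simp), h1, one_mul]
  simp only [Finset.mem_univ, if_true, this, h1]
  ring

variable {ι M : Type*} [Fintype ι] [NormedAddCommGroup M] [NormedSpace ℝ M]
  [FiniteDimensional ℝ M] [MeasurableSpace M] [BorelSpace M]

/-- Testing the equation against a weighted power of the solution. -/
lemma COp.OK.weighted_test (μ : Measure M) [μ.IsAddHaarMeasure] {P : COp ι M} {b : Option ι → M}
    {ν : ℝ} {S : Set (Option ι)} (hP : P.OK b ν S) (hν : 0 < ν) {ℓ : ι}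
    (hS : ∀ k, k ≠ some ℓ → k ∈ S) (h1 : ∀ w, P.a ℓ ℓ w = 1)
    (h0 : ∀ j, j ≠ ℓ → ∀ w, P.a ℓ j w = 0) {s : M →L[ℝ] ℝ} (hs1 : s (b (some ℓ)) = 1)
    (hs0 : ∀ k, k ≠ some ℓ → s (b k) = 0) {v : M → ℝ} (hv : TstP s v) (κ : ℝ) {g Φ : ℝ → ℝ}
    (hg : ContDiff ℝ (⊤ : ℕ∞) g) (hΦ : ContDiff ℝ (⊤ : ℕ∞) Φ) (hΦg : ∀ y, deriv Φ y = g y)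
    (g0 : g 0 = 0) (Φ0 : Φ 0 = 0) (hgp : ∀ y, 0 ≤ g y * y) (hg' : ∀ y, 0 ≤ deriv g y) :
    Integrable (fun w => s w ^ (1 - κ) * g (v w) * P.app b (fun w => s w ^ κ * v w) w) μ ∧
    κ * (1 - κ) * ∫ w, s w ^ (-1 : ℝ) * (g (v w) * v w) ∂μ ≤
      ∫ w, s w ^ (1 - κ) * g (v w) * P.app b (fun w => s w ^ κ * v w) w ∂μ := by
  classical
  set u : M → ℝ := fun w => s w ^ κ * v w with hudef
  have hu : TstP s u := hv.mul_rpow κ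
  have hν' := (inv_pos.2 hν).le
  have hAb : ∀ w, |P.A w| ≤ ν⁻¹ := fun w => abs_le.2 ⟨by linarith [hP.A_lo w], hP.A_hi w⟩
  have gd : Differentiable ℝ g := hg.differentiable (by simp)
  have Φd : Differentiable ℝ Φ := hΦ.differentiable (by simp)
  have hh : ContDiff ℝ (⊤ : ℕ∞) fun y => g y * y - Φ y := (hg.mul contDiff_id).sub hΦ
  have hW : TstP s fun w => s w ^ (1 - κ) * g (v w) := (hv.comp hg g0).mul_rpow _
  have hG1 : TstP s fun w => s w * Φ (v w) := (hv.comp hΦ Φ0).mul s.contDiff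
  have hG2 : TstP s fun w => g (v w) * v w - Φ (v w) :=
    hv.comp (g := fun y => g y * y - Φ y) hh (by simp [g0, Φ0])
  have hG3 : TstP s fun w => Φ (v w) := hv.comp hΦ Φ0
  have hG : ∀ j, TstP s fun w => s w ^ (1 - κ) * g (v w) * pd (b (some j)) u w := fun j =>
    (hu.pd (b (some j))).mul hW.smooth
  have hH : TstP s fun w => s w ^ (-1 : ℝ) * (g (v w) * v w) :=
    (hv.comp (g := fun y => g y * y) (hg.mul contDiff_id) (by simp)).mul_rpow _
  have hnone : (none : Option ι) ≠ some ℓ := by simp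
  have hi0 := integral_invariant_mul_pd μ hP.A_meas hAb (hP.A_inv none hP.none_mem) hG1.toTst
  have hij := fun i j => integral_invariant_mul_pd μ (hP.a_meas i j) (hP.a_hi i j)
    (hP.a_self i j) (hG j).toTst
  have hi2 := fun i => integral_invariant_mul_pd μ (hP.a_meas i ℓ) (hP.a_hi i ℓ)
    (hP.a_self i ℓ) hG2.toTst
  have hi3 := integral_invariant_mul_pd μ (a := fun _ => (1 : ℝ)) (K := 1) measurable_const (by simp)
    (e := b (some ℓ)) (fun _ _ => rfl) hG3.toTst
  have hI : Integrable (fun w => s w ^ (1 - κ) * g (v w) * P.app b u w) μ := by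
    have happ : Integrable (P.app b u) μ :=
      memLp_one_iff_integrable.1 (hP.Lb_app hν le_rfl μ hu.toTst).memLp
    obtain ⟨B, -, -, hB, -⟩ := hW.toTst.exists_bound
    exact happ.bdd_mul hW.continuous.aestronglyMeasurable (.of_forall hB)
  have hHi : Integrable (fun w => s w ^ (-1 : ℝ) * (g (v w) * v w)) μ :=
    hH.continuous.integrable_of_hasCompactSupport hH.cpt
  refine ⟨hI, ?_⟩
  set R : M → ℝ := fun w => P.A w * pd (b none) (fun w => s w * Φ (v w)) w -
    ∑ i, ∑ j, P.a i j w * pd (b (some i)) (fun w => s w ^ (1 - κ) * g (v w) * pd (b (some j)) u w) w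
    + κ * (∑ i, P.a i ℓ w * pd (b (some i)) (fun w => g (v w) * v w - Φ (v w)) w)
    + (1 - κ) * (1 * pd (b (some ℓ)) (fun w => Φ (v w)) w) with hR
  have hs1' : Integrable (fun w => ∑ i, ∑ j, P.a i j w *
      pd (b (some i)) (fun w => s w ^ (1 - κ) * g (v w) * pd (b (some j)) u w) w) μ :=
    integrable_finset_sum _ fun i _ => integrable_finset_sum _ fun j _ => (hij i j).1
  have hs2' : Integrable (fun w => ∑ i, P.a i ℓ w *
      pd (b (some i)) (fun w => g (v w) * v w - Φ (v w)) w) μ :=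
    integrable_finset_sum _ fun i _ => (hi2 i).1
  have hRi : Integrable R μ :=
    ((hi0.1.sub hs1').add (hs2'.const_mul κ)).add (hi3.1.const_mul (1 - κ))
  have hR0 : ∫ w, R w ∂μ = 0 := by
    have t3 := integral_add ((hi0.1.sub hs1').add (hs2'.const_mul κ)) (hi3.1.const_mul (1 - κ))
    have t2 := integral_add (hi0.1.sub hs1') (hs2'.const_mul κ)
    simp only [Pi.add_apply, Pi.sub_apply] at t2 t3
    rw [hR, t3, t2, integral_sub hi0.1 hs1', integral_const_mul, integral_const_mul, hi0.2, hi3.2,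
      integral_finset_sum _ fun i _ => (hi2 i).1,
      integral_finset_sum _ fun i _ => integrable_finset_sum _ fun j _ => (hij i j).1]
    have : ∀ i, ∫ w, ∑ j, P.a i j w *
      pd (b (some i)) (fun w => s w ^ (1 - κ) * g (v w) * pd (b (some j)) u w) w ∂μ = 0 := fun i => by
      rw [integral_finset_sum _ fun j _ => (hij i j).1]
      exact Finset.sum_eq_zero fun j _ => (hij i j).2
    simp [this, (hi2 _).2]
  have key : ∀ w, R w ≤ s w ^ (1 - κ) * g (v w) * P.app b u w -
      κ * (1 - κ) * (s w ^ (-1 : ℝ) * (g (v w) * v w)) := by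
    intro w
    by_cases hw : 0 < s w
    swap
    · have hz : ∀ {f : M → ℝ} (_ : TstP s f) (e : M), pd e f w = 0 :=
        fun hf e => (hf.pd e).eq_zero hw
      simp only [hR]
      rw [hz hG1, hz hG3]
      simp [hz hG2, hz (hG _), hv.eq_zero hw, g0]
    · have e1 : pd (b none) (fun w => s w * Φ (v w)) w = s w * (g (v w) * pd (b none) v w) := by
        rw [pd_mul (g := fun w => Φ (v w)) s.differentiableAt (hG3.differentiable w),
          pd_comp (Φd _) (hv.differentiable w), hΦg]
        unfold pd
        simp [hs0 none hnone]
      have e2 : ∀ e, pd e (fun w => g (v w) * v w - Φ (v w)) w =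
          deriv g (v w) * v w * pd e v w := by
        intro e
        rw [pd_comp (g := fun y => g y * y - Φ y) (hh.differentiable (by simp) _)
          (hv.differentiable w)]
        congr 1
        have := ((gd (v w)).hasDerivAt.mul (hasDerivAt_id (v w))).sub (Φd (v w)).hasDerivAt
        refine this.deriv.trans ?_
        rw [hΦg]
        simp
      have e3 : ∀ e, pd e (fun w => Φ (v w)) w = g (v w) * pd e v w := by
        intro e
        rw [pd_comp (Φd _) (hv.differentiable w), hΦg]
      have hsb : ∀ i, s (b (some i)) = if i = ℓ then 1 else 0 := by
        intro i
        split_ifs with h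
        · rw [h, hs1]
        · exact hs0 _ (by simpa using h)
      have eu : ∀ j, pd (b (some j)) u w = s w ^ κ * pd (b (some j)) v w +
          κ * s w ^ (κ - 1) * v w * if j = ℓ then 1 else 0 := by
        intro j
        rw [hudef, hv.pd_mul_rpow, hsb]
        ring
      have eu0 : pd (b none) u w = s w ^ κ * pd (b none) v w := by
        rw [hudef, hv.pd_mul_rpow, hs0 none hnone]
        ring
      have eW : ∀ i, pd (b (some i)) (fun w => s w ^ (1 - κ) * g (v w)) w =
          s w ^ (1 - κ) * deriv g (v w) * pd (b (some i)) v w +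
          (1 - κ) * s w ^ (-κ) * g (v w) * if i = ℓ then 1 else 0 := by
        intro i
        rw [(hv.comp hg g0).pd_mul_rpow, hsb, pd_comp (gd _) (hv.differentiable w),
          show 1 - κ - 1 = -κ by ring]
        ring
      have eG : ∀ i j, pd (b (some i)) (fun w => s w ^ (1 - κ) * g (v w) * pd (b (some j)) u w) w =
          s w ^ (1 - κ) * g (v w) * pd (b (some j)) (pd (b (some i)) u) w +
          pd (b (some i)) (fun w => s w ^ (1 - κ) * g (v w)) w * pd (b (some j)) u w := by
        intro i j
        rw [pd_mul (hW.differentiable w) ((hu.pd (b (some j))).differentiable w),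
          pd_comm hu.smooth (b (some i))]
      have hsum : ∑ i, ∑ j, P.a i j w * pd (b (some i))
            (fun w => s w ^ (1 - κ) * g (v w) * pd (b (some j)) u w) w =
          s w ^ (1 - κ) * g (v w) *
            (∑ i, ∑ j, P.a i j w * pd (b (some j)) (pd (b (some i)) u) w) +
          ∑ i, ∑ j, P.a i j w * (pd (b (some i)) (fun w => s w ^ (1 - κ) * g (v w)) w *
            pd (b (some j)) u w) := by
        simp only [Finset.mul_sum, ← Finset.sum_add_distrib]
        refine Finset.sum_congr rfl fun i _ => Finset.sum_congr rfl fun j _ => ?_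
        rw [eG]
        ring
      have hQ : 0 ≤ ∑ i, ∑ j, P.a i j w * pd (b (some j)) v w * pd (b (some i)) v w :=
        le_trans (mul_nonneg hν.le (Finset.sum_nonneg fun i _ => sq_nonneg _))
          (hP.ell w fun i => pd (b (some i)) v w)
      have hdel := sum_mul_delta ℓ (fun i j => P.a i j w) (h1 w) (fun j hj => h0 j hj w)
        (fun i => pd (b (some i)) v w) (s w ^ (1 - κ) * deriv g (v w))
        ((1 - κ) * s w ^ (-κ) * g (v w)) (s w ^ κ) (κ * s w ^ (κ - 1) * v w)
      simp only [hR, COp.app]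
      rw [hsum]
      simp_rw [eW, eu]
      rw [hdel, e1, e3, eu0]
      simp_rw [e2]
      have x1 : s w ^ (1 - κ) * s w ^ κ = s w := by
        rw [← Real.rpow_add hw]; simp
      have x2 : s w ^ (1 - κ) * s w ^ (κ - 1) = 1 := by
        rw [← Real.rpow_add hw]; simp
      have x3 : s w ^ (-κ) * s w ^ κ = 1 := by
        rw [← Real.rpow_add hw]; simp
      have x4 : s w ^ (-κ) * s w ^ (κ - 1) = s w ^ (-1 : ℝ) := by
        rw [← Real.rpow_add hw]; congr 1; ring
      have hsm : ∑ i, P.a i ℓ w * (deriv g (v w) * v w * pd (b (some i)) v w) =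
          deriv g (v w) * v w * ∑ i, P.a i ℓ w * pd (b (some i)) v w := by
        rw [Finset.mul_sum]
        exact Finset.sum_congr rfl fun i _ => by ring
      rw [hsm]
      have n1 : 0 ≤ P.lam * P.C w * s w * (g (v w) * v w) :=
        mul_nonneg (mul_nonneg (mul_nonneg hP.lam_pos.le (hν.le.trans (hP.C_lo w))) hw.le) (hgp _)
      have n2 := mul_nonneg (mul_nonneg hw.le (hg' (v w))) hQ
      have y1 : u w = s w ^ κ * v w := rfl
      rw [y1]
      linear_combination n1 + n2 - (P.A w * pd (b none) v w * g (v w) +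
        P.lam * P.C w * g (v w) * v w + deriv g (v w) *
          (∑ i, ∑ j, P.a i j w * pd (b (some j)) v w * pd (b (some i)) v w)) * x1 -
        κ * deriv g (v w) * v w * (∑ i, P.a i ℓ w * pd (b (some i)) v w) * x2 -
        (1 - κ) * g (v w) * pd (b (some ℓ)) v w * x3 - κ * (1 - κ) * g (v w) * v w * x4
  have hmono := integral_mono hRi (hI.sub (hHi.const_mul (κ * (1 - κ)))) key
  rw [hR0] at hmono
  have hsub := integral_sub hI (hHi.const_mul (κ * (1 - κ)))
  rw [integral_const_mul] at hsub
  have : 0 ≤ ∫ w, (s w ^ (1 - κ) * g (v w) * P.app b u w -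
      κ * (1 - κ) * (s w ^ (-1 : ℝ) * (g (v w) * v w))) ∂μ := hmono
  linarith

end WeightedTest

section RegularizedPower

open Filter Topology

/-- A smooth regularization of `y ↦ y |y|^(p-2)`. -/
def rpw (p ε y : ℝ) : ℝ := y * (y ^ 2 + ε) ^ (p / 2 - 1)

/-- A smooth regularization of `y ↦ |y|^p / p`. -/
def rpwInt (p ε y : ℝ) : ℝ := ((y ^ 2 + ε) ^ (p / 2) - ε ^ (p / 2)) / p

variable {p ε : ℝ}

lemma contDiff_sq_add_rpow (hε : 0 < ε) (r : ℝ) : ContDiff ℝ (⊤ : ℕ∞) fun y : ℝ => (y ^ 2 + ε) ^ r :=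
  ((contDiff_id.pow 2).add contDiff_const).rpow_const_of_ne fun y => by
    have := sq_nonneg y
    simp only [id]
    positivity

lemma contDiff_rpw (hε : 0 < ε) : ContDiff ℝ (⊤ : ℕ∞) (rpw p ε) :=
  contDiff_id.mul (contDiff_sq_add_rpow hε _)

lemma contDiff_rpwInt (hε : 0 < ε) : ContDiff ℝ (⊤ : ℕ∞) (rpwInt p ε) :=
  ((contDiff_sq_add_rpow hε _).sub contDiff_const).div_const _

lemma hasDerivAt_sq_add_rpow (hε : 0 < ε) (r y : ℝ) :
    HasDerivAt (fun y : ℝ => (y ^ 2 + ε) ^ r) (2 * y * r * (y ^ 2 + ε) ^ (r - 1)) y := by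
  have h := ((hasDerivAt_pow 2 y).add_const ε).rpow_const (p := r)
    (Or.inl (by positivity))
  simpa using h

lemma deriv_rpwInt (hp : p ≠ 0) (hε : 0 < ε) (y : ℝ) : deriv (rpwInt p ε) y = rpw p ε y := by
  have h := ((hasDerivAt_sq_add_rpow hε (p / 2) y).sub_const (ε ^ (p / 2))).div_const p
  refine h.deriv.trans ?_
  unfold rpw
  field_simp

lemma deriv_rpw_nonneg (hp : 1 < p) (hε : 0 < ε) (y : ℝ) : 0 ≤ deriv (rpw p ε) y := by
  have h := (hasDerivAt_id y).mul (hasDerivAt_sq_add_rpow hε (p / 2 - 1) y)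
  have hpos : 0 < y ^ 2 + ε := by positivity
  have h2 : deriv (rpw p ε) y = (y ^ 2 + ε) ^ (p / 2 - 1 - 1) * ((p - 1) * y ^ 2 + ε) := by
    refine h.deriv.trans ?_
    have : (y ^ 2 + ε) ^ (p / 2 - 1) = (y ^ 2 + ε) ^ (p / 2 - 1 - 1) * (y ^ 2 + ε) := by
      conv_rhs => rw [← Real.rpow_add_one hpos.ne']
      congr 1
      ring
    simp only [this, id]
    ring
  rw [h2]
  have : 0 ≤ p - 1 := by linarith
  positivity

lemma rpw_mul_self_nonneg (hε : 0 < ε) (y : ℝ) : 0 ≤ rpw p ε y * y := by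
  have : rpw p ε y * y = y ^ 2 * (y ^ 2 + ε) ^ (p / 2 - 1) := by unfold rpw; ring
  rw [this]
  positivity

lemma abs_rpw_le (hp : 1 < p) (hε : 0 < ε) (hε1 : ε ≤ 1) {y B : ℝ} (hy : |y| ≤ B) :
    |rpw p ε y| ≤ (B ^ 2 + 1) ^ ((p - 1) / 2) := by
  have hpos : 0 < y ^ 2 + ε := by positivity
  have h1 : |y| ≤ (y ^ 2 + ε) ^ (1 / 2 : ℝ) := by
    rw [← Real.sqrt_eq_rpow, ← Real.sqrt_sq_eq_abs]
    exact Real.sqrt_le_sqrt (by linarith)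
  unfold rpw
  rw [abs_mul, abs_of_nonneg (Real.rpow_nonneg hpos.le _)]
  calc |y| * (y ^ 2 + ε) ^ (p / 2 - 1) ≤ (y ^ 2 + ε) ^ (1 / 2 : ℝ) * (y ^ 2 + ε) ^ (p / 2 - 1) := by
        gcongr
    _ = (y ^ 2 + ε) ^ ((p - 1) / 2) := by
        rw [← Real.rpow_add hpos]
        congr 1
        ring
    _ ≤ _ := by
        have : y ^ 2 ≤ B ^ 2 := sq_le_sq' (abs_le.1 hy).1 (abs_le.1 hy).2
        exact Real.rpow_le_rpow hpos.le (by linarith) (by linarith)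

lemma tendsto_rpw (y : ℝ) {ε : ℕ → ℝ} (hε : Tendsto ε atTop (𝓝 0)) :
    Tendsto (fun n => rpw p (ε n) y) atTop (𝓝 (rpw p 0 y)) := by
  unfold rpw
  rcases eq_or_ne y 0 with rfl | hy
  · simp
  · refine Tendsto.const_mul _ (Tendsto.rpow_const (tendsto_const_nhds.add hε) (Or.inl ?_))
    have : 0 < y ^ 2 := by positivity
    simpa using hy

lemma abs_rpw_zero (hp : 1 < p) (y : ℝ) : |rpw p 0 y| = |y| ^ (p - 1) := by
  rcases eq_or_ne y 0 with rfl | hy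
  · simp [rpw, Real.zero_rpow (by linarith : p - 1 ≠ 0)]
  · have h : 0 < |y| := abs_pos.2 hy
    unfold rpw
    rw [add_zero, abs_mul, abs_of_nonneg (Real.rpow_nonneg (sq_nonneg y) _), ← sq_abs,
      ← Real.rpow_natCast, ← Real.rpow_mul h.le]
    conv_lhs => rw [← Real.rpow_one |y|]
    rw [Real.rpow_one, ← Real.rpow_one_add' h.le (by push_cast; linarith)]
    congr 1
    push_cast
    ring

end RegularizedPower

section WeightedEstimate

open Filter Topology

variable {ι M : Type*} [Fintype ι] [NormedAddCommGroup M] [NormedSpace ℝ M]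

lemma exists_abs_le_sum {α κ : Type*} (t : Finset κ) {f : κ → α → ℝ}
    (h : ∀ k, ∃ K, ∀ w, |f k w| ≤ K) : ∃ K, ∀ w, |∑ k ∈ t, f k w| ≤ K := by
  choose K hK using h
  exact ⟨∑ k ∈ t, K k, fun w => (Finset.abs_sum_le_sum_abs _ _).trans
    (Finset.sum_le_sum fun k _ => hK k w)⟩

variable [MeasurableSpace M]

lemma COp.OK.exists_rpow_mul_app_bound {P : COp ι M} {b : Option ι → M} {ν : ℝ}
    {S : Set (Option ι)} (hP : P.OK b ν S) (hν : 0 < ν) {s : M →L[ℝ] ℝ} {u : M → ℝ} (hu : TstP s u)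
    (r : ℝ) : ∃ K, ∀ w, |s w ^ r * P.app b u w| ≤ K := by
  have hν' := (inv_pos.2 hν).le
  have hA : ∀ w, |P.A w| ≤ ν⁻¹ := fun w => abs_le.2 ⟨by linarith [hP.A_lo w], hP.A_hi w⟩
  have hC : ∀ w, |P.C w| ≤ ν⁻¹ := fun w => abs_le.2 ⟨by linarith [hP.C_lo w], hP.C_hi w⟩
  have hm : ∀ {f a : M → ℝ} (_ : TstP s f) (_ : ∀ w, |a w| ≤ ν⁻¹),
      ∃ K, ∀ w, |a w * (s w ^ r * f w)| ≤ K := by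
    intro f a hf ha
    obtain ⟨B, -, -, hB, -⟩ := (hf.mul_rpow r).toTst.exists_bound
    refine ⟨ν⁻¹ * B, fun w => ?_⟩
    rw [abs_mul]
    exact mul_le_mul (ha w) (hB w) (abs_nonneg _) hν'
  obtain ⟨K1, h1⟩ := hm (hu.pd (b none)) hA
  obtain ⟨K2, h2⟩ := hm hu hC
  obtain ⟨K3, h3⟩ := exists_abs_le_sum Finset.univ fun i => exists_abs_le_sum Finset.univ fun j =>
    hm ((hu.pd (b (some i))).pd (b (some j))) (hP.a_hi i j)
  refine ⟨K1 + |P.lam| * K2 + K3, fun w => ?_⟩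
  have : s w ^ r * P.app b u w = P.A w * (s w ^ r * pd (b none) u w) +
      P.lam * (P.C w * (s w ^ r * u w)) -
      ∑ i, ∑ j, P.a i j w * (s w ^ r * pd (b (some j)) (pd (b (some i)) u) w) := by
    have hs : ∑ i, ∑ j, P.a i j w * (s w ^ r * pd (b (some j)) (pd (b (some i)) u) w) =
        s w ^ r * ∑ i, ∑ j, P.a i j w * pd (b (some j)) (pd (b (some i)) u) w := by
      simp only [Finset.mul_sum]
      exact Finset.sum_congr rfl fun i _ => Finset.sum_congr rfl fun j _ => by ring
    rw [hs]
    unfold COp.app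
    ring
  rw [this]
  refine (abs_sub _ _).trans (add_le_add ((abs_add_le _ _).trans (add_le_add (h1 w) ?_)) (h3 w))
  rw [abs_mul]
  exact mul_le_mul_of_nonneg_left (h2 w) (abs_nonneg _)

variable [FiniteDimensional ℝ M] [BorelSpace M]

lemma COp.OK.measurable_app {P : COp ι M} {b : Option ι → M} {ν : ℝ}
    {S : Set (Option ι)} (hP : P.OK b ν S) {u : M → ℝ} (hu : Tst u) : Measurable (P.app b u) := by
  unfold COp.app
  exact ((hP.A_meas.mul (hu.pd _).continuous.measurable).add
    ((hP.C_meas.const_mul _).mul hu.continuous.measurable)).sub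
    (Finset.measurable_sum _ fun i _ => Finset.measurable_sum _ fun j _ =>
      (hP.a_meas i j).mul ((hu.pd _).pd _).continuous.measurable)

lemma lintegral_rpow_le_of_le_mul {α : Type*} [MeasurableSpace α] {μ : Measure α} {p : ℝ}
    (hp : 1 < p) {f g : α → ℝ} (hf : AEStronglyMeasurable f μ) (hg : AEStronglyMeasurable g μ)
    {c : ℝ} (hc : 0 < c) (hfin : ∫⁻ w, ‖f w‖ₑ ^ p ∂μ ≠ ∞)
    (h : ENNReal.ofReal c * ∫⁻ w, ‖f w‖ₑ ^ p ∂μ ≤ ∫⁻ w, ‖f w‖ₑ ^ (p - 1) * ‖g w‖ₑ ∂μ) :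
    eLpNorm f (ENNReal.ofReal p) μ ≤ ENNReal.ofReal c⁻¹ * eLpNorm g (ENNReal.ofReal p) μ := by
  have hp0 : 0 < p := by linarith
  have hp1 : 0 < p - 1 := by linarith
  have hpq : (p / (p - 1)).HolderConjugate p := (Real.HolderConjugate.conjExponent hp).symm
  have hH := ENNReal.lintegral_mul_le_Lp_mul_Lq μ hpq (hf.enorm.pow_const (p - 1)) hg.enorm
  simp only [Pi.mul_apply, ← ENNReal.rpow_mul, mul_div_cancel₀ p hp1.ne', one_div_div] at hH
  rw [eLpNorm_eq_lintegral hp0, eLpNorm_eq_lintegral hp0]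
  set X := ∫⁻ w, ‖f w‖ₑ ^ p ∂μ
  set Y := ∫⁻ w, ‖g w‖ₑ ^ p ∂μ
  have h2 := h.trans hH
  rcases eq_or_ne X 0 with hX | hX
  · rw [hX, ENNReal.zero_rpow_of_pos (by positivity)]
    exact zero_le
  have hXe : X = X ^ ((p - 1) / p) * X ^ (1 / p) := by
    rw [← ENNReal.rpow_add _ _ hX hfin, ← add_div, sub_add_cancel, div_self hp0.ne', ENNReal.rpow_one]
  have hne : X ^ ((p - 1) / p) ≠ 0 := (ENNReal.rpow_pos (pos_iff_ne_zero.2 hX) hfin).ne'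
  have hnt : X ^ ((p - 1) / p) ≠ ∞ := ENNReal.rpow_ne_top_of_nonneg (by positivity) hfin
  have h3 : X ^ ((p - 1) / p) * (ENNReal.ofReal c * X ^ (1 / p)) ≤ X ^ ((p - 1) / p) * Y ^ (1 / p) := by
    refine le_trans (le_of_eq ?_) h2
    conv_rhs => rw [hXe]
    ring
  rw [ENNReal.mul_le_mul_iff_right hne hnt] at h3
  calc X ^ (1 / p) = ENNReal.ofReal c⁻¹ * (ENNReal.ofReal c * X ^ (1 / p)) := by
        rw [← mul_assoc, ← ENNReal.ofReal_mul (by positivity), inv_mul_cancel₀ hc.ne',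
          ENNReal.ofReal_one, one_mul]
    _ ≤ _ := by gcongr

/-- Weighted estimate of the zero order term. -/
theorem COp.OK.weighted_le (μ : Measure M) [μ.IsAddHaarMeasure] {P : COp ι M} {b : Option ι → M}
    {ν : ℝ} {S : Set (Option ι)} (hP : P.OK b ν S) (hν : 0 < ν) {ℓ : ι}
    (hS : ∀ k, k ≠ some ℓ → k ∈ S) (h1 : ∀ w, P.a ℓ ℓ w = 1)
    (h0 : ∀ j, j ≠ ℓ → ∀ w, P.a ℓ j w = 0) {s : M →L[ℝ] ℝ} (hs1 : s (b (some ℓ)) = 1)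
    (hs0 : ∀ k, k ≠ some ℓ → s (b k) = 0) {u : M → ℝ} (hu : TstP s u) {p δ : ℝ} (hp : 1 < p)
    (hδ1 : 1 - 1 / p < δ) (hδ2 : δ < 2 - 1 / p) {R : ℝ}
    (hR : Lb μ (ENNReal.ofReal p) (fun w => s w ^ δ * P.app b u w) R) :
    Lb μ (ENNReal.ofReal p) (fun w => s w ^ (δ - 2) * u w)
      (((2 - 1 / p - δ) * (δ - (1 - 1 / p)))⁻¹ * R) := by
  have hp0 : 0 < p := by linarith
  set κ := 2 - 1 / p - δ with hκ
  have hκ' : δ - (1 - 1 / p) = 1 - κ := by rw [hκ]; ring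
  have hκ0 : 0 < κ := by linarith
  have hκ1 : 0 < 1 - κ := by linarith
  rw [hκ']
  have hc : 0 < κ * (1 - κ) := mul_pos hκ0 hκ1
  set v : M → ℝ := fun w => s w ^ (-κ) * u w with hvdef
  have hv : TstP s v := hu.mul_rpow _
  have huv : u = fun w => s w ^ κ * v w := by
    funext w
    by_cases hw : 0 < s w
    · simp only [hvdef]
      rw [← mul_assoc, ← Real.rpow_add hw]
      simp
    · simp [hvdef, hu.eq_zero hw]
  set ε : ℕ → ℝ := fun n => 1 / ((n : ℝ) + 1) with hεdef
  have hε0 : ∀ n, 0 < ε n := fun n => by simp only [hεdef]; positivity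
  have hε1 : ∀ n, ε n ≤ 1 := fun n => by
    simp only [hεdef]
    rw [div_le_one (by positivity)]
    linarith [(Nat.cast_nonneg n : (0 : ℝ) ≤ n)]
  have hεt : Tendsto ε atTop (𝓝 0) := tendsto_one_div_add_atTop_nhds_zero_nat
  obtain ⟨B, T, -, hB, hT⟩ := hv.toTst.exists_bound
  have hcv : Cvg (fun n w => rpw p (ε n) (v w)) fun w => rpw p 0 (v w) :=
    ⟨⟨_, fun n w => abs_rpw_le hp (hε0 n) (hε1 n) (hB w)⟩,
      ⟨T, fun n w hw => by simp [rpw, hT w hw]⟩, fun w => tendsto_rpw _ hεt⟩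
  obtain ⟨K, hK⟩ := hP.exists_rpow_mul_app_bound hν hu (1 - κ)
  obtain ⟨K', -, -, hK', -⟩ := (hv.mul_rpow (-1)).toTst.exists_bound
  have hmu : Measurable fun w => s w ^ (1 - κ) * P.app b u w :=
    (s.measurable.pow_const _).mul (hP.measurable_app hu.toTst)
  have hmg : ∀ n, Measurable fun w => rpw p (ε n) (v w) := fun n =>
    (contDiff_rpw (hε0 n)).continuous.measurable.comp hv.continuous.measurable
  have hL := (hcv.mul hK').tendsto_lintegral μ (fun n => (hv.mul_rpow (-1)).continuous.measurable.mul
    (hmg n)) one_pos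
  have hRt := (hcv.mul hK).tendsto_lintegral μ (fun n => hmu.mul (hmg n)) one_pos
  have hn : ∀ n, ENNReal.ofReal (κ * (1 - κ)) *
      ∫⁻ w, ‖s w ^ (-1 : ℝ) * v w * rpw p (ε n) (v w)‖ₑ ^ (1 : ℝ) ∂μ ≤
      ∫⁻ w, ‖s w ^ (1 - κ) * P.app b u w * rpw p (ε n) (v w)‖ₑ ^ (1 : ℝ) ∂μ := by
    intro n
    have hg := contDiff_rpw (p := p) (hε0 n)
    obtain ⟨i1, i2⟩ := hP.weighted_test μ hν hS h1 h0 hs1 hs0 hv κ (g := rpw p (ε n))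
      (Φ := rpwInt p (ε n)) hg (contDiff_rpwInt (hε0 n))
      (deriv_rpwInt hp0.ne' (hε0 n)) (by simp [rpw]) (by simp [rpwInt])
      (rpw_mul_self_nonneg (hε0 n)) (deriv_rpw_nonneg hp (hε0 n))
    rw [← huv] at i1 i2
    have e1 : ∀ w, s w ^ (-1 : ℝ) * v w * rpw p (ε n) (v w) =
      s w ^ (-1 : ℝ) * (rpw p (ε n) (v w) * v w) := fun w => by ring
    have e2 : ∀ w, s w ^ (1 - κ) * P.app b u w * rpw p (ε n) (v w) =
      s w ^ (1 - κ) * rpw p (ε n) (v w) * P.app b u w := fun w => by ring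
    simp only [ENNReal.rpow_one, e1, e2]
    have hpos : ∀ w, 0 ≤ s w ^ (-1 : ℝ) * (rpw p (ε n) (v w) * v w) := fun w => by
      by_cases hw : 0 < s w
      · exact mul_nonneg (Real.rpow_nonneg hw.le _) (rpw_mul_self_nonneg (hε0 n) _)
      · simp [hv.eq_zero hw]
    have hH : TstP s fun w => s w ^ (-1 : ℝ) * (rpw p (ε n) (v w) * v w) :=
      (hv.comp (g := fun y => rpw p (ε n) y * y) (hg.mul contDiff_id) (by simp)).mul_rpow _
    have hHi := hH.continuous.integrable_of_hasCompactSupport (μ := μ) hH.cpt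
    have l1 : ∫⁻ w, ‖s w ^ (-1 : ℝ) * (rpw p (ε n) (v w) * v w)‖ₑ ∂μ =
        ENNReal.ofReal (∫ w, s w ^ (-1 : ℝ) * (rpw p (ε n) (v w) * v w) ∂μ) := by
      rw [ofReal_integral_eq_lintegral_ofReal hHi (.of_forall hpos)]
      refine lintegral_congr fun w => ?_
      rw [Real.enorm_of_nonneg (hpos w)]
    rw [l1, ← ENNReal.ofReal_mul hc.le]
    refine (ENNReal.ofReal_le_ofReal i2).trans ?_
    refine (ENNReal.ofReal_le_ofReal (le_abs_self _)).trans ?_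
    rw [← Real.enorm_eq_ofReal_abs]
    exact enorm_integral_le_lintegral_enorm _
  have hlim := le_of_tendsto_of_tendsto' (ENNReal.Tendsto.const_mul hL (Or.inr ENNReal.ofReal_ne_top))
    hRt hn
  have hF1 : TstP s fun w => s w ^ (δ - 2) * u w := hu.mul_rpow _
  have hfin := (hF1.toTst.memLp (ENNReal.ofReal p) μ).2
  rw [eLpNorm_eq_lintegral hp0] at hfin
  have hfin' : ∫⁻ w, ‖s w ^ (δ - 2) * u w‖ₑ ^ p ∂μ ≠ ∞ := by
    intro h
    rw [h, ENNReal.top_rpow_of_pos (by positivity)] at hfin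
    exact lt_irrefl _ hfin
  have hF1e : ∀ w, 0 < s w → |s w ^ (δ - 2) * u w| = s w ^ (-(1 / p)) * |v w| := fun w hw => by
    rw [abs_mul, abs_of_nonneg (Real.rpow_nonneg hw.le _), hvdef, abs_mul,
      abs_of_nonneg (Real.rpow_nonneg hw.le _), ← mul_assoc, ← Real.rpow_add hw]
    congr 2
    rw [hκ]; ring
  have p1 : ∀ w, ‖s w ^ (-1 : ℝ) * v w * rpw p 0 (v w)‖ₑ ^ (1 : ℝ) =
      ‖s w ^ (δ - 2) * u w‖ₑ ^ p := fun w => by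
    by_cases hw : 0 < s w
    · rw [ENNReal.rpow_one, Real.enorm_eq_ofReal_abs, Real.enorm_eq_ofReal_abs, hF1e w hw,
        ENNReal.ofReal_rpow_of_nonneg (by positivity) hp0.le, Real.mul_rpow (by positivity)
        (abs_nonneg _), ← Real.rpow_mul hw.le, abs_mul, abs_mul, abs_rpw_zero hp,
        abs_of_nonneg (Real.rpow_nonneg hw.le _), mul_assoc, ← Real.rpow_one_add' (abs_nonneg _)
        (by linarith)]
      congr 3
      · field_simp
      · ring
    · simp [hv.eq_zero hw, hu.eq_zero hw, hp0]
  have p2 : ∀ w, ‖s w ^ (1 - κ) * P.app b u w * rpw p 0 (v w)‖ₑ ^ (1 : ℝ) =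
      ‖s w ^ (δ - 2) * u w‖ₑ ^ (p - 1) * ‖s w ^ δ * P.app b u w‖ₑ := fun w => by
    by_cases hw : 0 < s w
    · rw [ENNReal.rpow_one, Real.enorm_eq_ofReal_abs, Real.enorm_eq_ofReal_abs,
        Real.enorm_eq_ofReal_abs, hF1e w hw,
        ENNReal.ofReal_rpow_of_nonneg (by positivity) (by linarith),
        ← ENNReal.ofReal_mul (by positivity), Real.mul_rpow (by positivity)
        (abs_nonneg _), ← Real.rpow_mul hw.le, abs_mul _ (rpw p 0 (v w)),
        abs_mul (s w ^ (1 - κ)), abs_mul (s w ^ δ), abs_rpw_zero hp, abs_of_nonneg (Real.rpow_nonneg hw.le _), abs_of_nonneg (Real.rpow_nonneg hw.le _)]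
      have : s w ^ (1 - κ) = s w ^ (-(1 / p) * (p - 1)) * s w ^ δ := by
        rw [← Real.rpow_add hw, hκ]
        congr 1
        field_simp
        ring
      rw [this]
      congr 1
      ring
    · have : (p - 1) ≠ 0 := by linarith
      have : 0 < p - 1 := by linarith
      simp [hv.eq_zero hw, hu.eq_zero hw, rpw, this]
  simp only [p1, p2] at hlim
  have hm2 := hR.meas
  refine ⟨hF1.continuous.aestronglyMeasurable, mul_nonneg (inv_pos.2 hc).le hR.nonneg, ?_⟩
  rw [ENNReal.ofReal_mul (inv_pos.2 hc).le]
  refine (lintegral_rpow_le_of_le_mul hp hF1.continuous.aestronglyMeasurable hm2 hc hfin' hlim).trans ?_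
  gcongr
  exact hR.le

end WeightedEstimate

section HalfSpaceOperator

open Filter Topology

/-- Coefficients depending on one coordinate. -/
structure HOp (ι : Type*) where
  A : ℝ → ℝ
  C : ℝ → ℝ
  a : ι → ι → ℝ → ℝ

variable {ι M : Type*} [Fintype ι] [NormedAddCommGroup M] [NormedSpace ℝ M]

/-- The operator whose coefficients are evaluated at the coordinate `s`. -/
def HOp.app (H : HOp ι) (s : M →L[ℝ] ℝ) (b : Option ι → M) (lam : ℝ) (u : M → ℝ) (w : M) : ℝ :=
  H.A (s w) * pd (b none) u w + lam * H.C (s w) * u w -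
    ∑ i, ∑ j, H.a i j (s w) * pd (b (some j)) (pd (b (some i)) u) w

/-- Degenerate bounds of order `α`, ellipticity, and normalization of the row `ℓ`. -/
structure HOp.OK (H : HOp ι) (ν α : ℝ) (ℓ : ι) : Prop where
  A_meas : Measurable H.A
  C_meas : Measurable H.C
  a_meas : ∀ i j, Measurable (H.a i j)
  A_lo : ∀ σ, 0 < σ → ν * σ ^ (-α) ≤ H.A σ
  A_hi : ∀ σ, 0 < σ → H.A σ ≤ ν⁻¹ * σ ^ (-α)
  C_lo : ∀ σ, 0 < σ → ν * σ ^ (-α) ≤ H.C σ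
  C_hi : ∀ σ, 0 < σ → H.C σ ≤ ν⁻¹ * σ ^ (-α)
  a_hi : ∀ σ, 0 < σ → ∀ i j, |H.a i j σ| ≤ ν⁻¹
  ell : ∀ σ, 0 < σ → ∀ ξ : ι → ℝ, ν * ∑ i, ξ i ^ 2 ≤ ∑ i, ∑ j, H.a i j σ * ξ j * ξ i
  a_one : ∀ σ, 0 < σ → H.a ℓ ℓ σ = 1
  a_zero : ∀ σ, 0 < σ → ∀ j, j ≠ ℓ → H.a ℓ j σ = 0

/-- Truncation to the interval `[σ₀, σ₁]`. -/
def clamp (σ₀ σ₁ x : ℝ) : ℝ := max σ₀ (min x σ₁)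

lemma clamp_of_mem {σ₀ σ₁ x : ℝ} (h0 : σ₀ ≤ x) (h1 : x ≤ σ₁) : clamp σ₀ σ₁ x = x := by
  rw [clamp, min_eq_left h1, max_eq_right h0]

lemma clamp_mem {σ₀ σ₁ : ℝ} (h : σ₀ ≤ σ₁) (x : ℝ) : clamp σ₀ σ₁ x ∈ Icc σ₀ σ₁ :=
  ⟨le_max_left _ _, max_le h (min_le_right _ _)⟩

lemma measurable_clamp (σ₀ σ₁ : ℝ) : Measurable (clamp σ₀ σ₁) :=
  measurable_const.max (measurable_id.min measurable_const)

/-- Rescaling of the time direction. -/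
def timeScale (K : ℝ) (b : Option ι → M) : Option ι → M
  | none => K • b none
  | some i => b (some i)

/-- The operator with coefficients frozen outside of `σ₀ ≤ s ≤ σ₁`, in rescaled time. -/
def HOp.frz (H : HOp ι) (s : M →L[ℝ] ℝ) (lam K σ₀ σ₁ : ℝ) : COp ι M where
  A w := K⁻¹ * H.A (clamp σ₀ σ₁ (s w))
  C w := K⁻¹ * H.C (clamp σ₀ σ₁ (s w))
  a i j w := H.a i j (clamp σ₀ σ₁ (s w))
  lam := K * lam

variable {H : HOp ι} {s : M →L[ℝ] ℝ} {b : Option ι → M} {lam K σ₀ σ₁ ν α : ℝ} {ℓ : ι}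

lemma HOp.frz_app (hK : K ≠ 0) {u : M → ℝ} (hu : ∀ w ∈ tsupport u, s w ∈ Icc σ₀ σ₁) :
    (H.frz s lam K σ₀ σ₁).app (timeScale K b) u = H.app s b lam u := by
  funext w
  by_cases hw : w ∈ tsupport u
  · simp only [COp.app, HOp.app, HOp.frz, timeScale, clamp_of_mem (hu w hw).1 (hu w hw).2, pd_smul]
    field_simp
  · have h1 : ∀ e, w ∉ tsupport (pd e u) := fun e h => hw (tsupport_fderiv_apply_subset ℝ e h)
    simp [COp.app, HOp.app, pd_eq_zero hw, pd_eq_zero (h1 _), image_eq_zero_of_notMem_tsupport hw]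

lemma HOp.OK.frz [MeasurableSpace M] [BorelSpace M] (hH : H.OK ν α ℓ) (hν : 0 < ν) (hlam : 0 < lam)
    (hK : 0 < K) (h0 : 0 < σ₀) (h01 : σ₀ ≤ σ₁) (hsb : ∀ k, k ≠ some ℓ → s (b k) = 0) {θ : ℝ}
    (hθ0 : 0 < θ) (hθ1 : θ ≤ 1) (hlo : ∀ σ ∈ Icc σ₀ σ₁, θ ≤ K⁻¹ * σ ^ (-α))
    (hhi : ∀ σ ∈ Icc σ₀ σ₁, K⁻¹ * σ ^ (-α) ≤ θ⁻¹) :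
    (H.frz s lam K σ₀ σ₁).OK (timeScale K b) (ν * θ) {k | k ≠ some ℓ} := by
  have hm : ∀ w, clamp σ₀ σ₁ (s w) ∈ Icc σ₀ σ₁ := fun w => clamp_mem h01 _
  have hp : ∀ w, 0 < clamp σ₀ σ₁ (s w) := fun w => h0.trans_le (hm w).1
  have hK' := inv_pos.2 hK
  have hcs : Measurable fun w => clamp σ₀ σ₁ (s w) := (measurable_clamp _ _).comp s.measurable
  have hinv : ∀ k, k ≠ some ℓ → ∀ (r : ℝ) z, s (z + r • timeScale K b k) = s z := by
    intro k hk r z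
    have : s (timeScale K b k) = 0 := by
      cases k with
      | none => simp [timeScale, hsb none hk]
      | some i => simp [timeScale, hsb _ hk]
    simp [this]
  have lo : ∀ {f : ℝ → ℝ} (_ : ∀ σ, 0 < σ → ν * σ ^ (-α) ≤ f σ) (z : M),
      ν * θ ≤ K⁻¹ * f (clamp σ₀ σ₁ (s z)) := by
    intro f hf z
    have h1 := mul_le_mul_of_nonneg_left (hf _ (hp z)) hK'.le
    have h2 := mul_le_mul_of_nonneg_left (hlo _ (hm z)) hν.le
    linarith
  have hi : ∀ {f : ℝ → ℝ} (_ : ∀ σ, 0 < σ → f σ ≤ ν⁻¹ * σ ^ (-α)) (z : M),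
      K⁻¹ * f (clamp σ₀ σ₁ (s z)) ≤ (ν * θ)⁻¹ := by
    intro f hf z
    have h1 := mul_le_mul_of_nonneg_left (hf _ (hp z)) hK'.le
    have h2 := mul_le_mul_of_nonneg_left (hhi _ (hm z)) (inv_pos.2 hν).le
    rw [mul_inv]
    linarith
  refine ⟨lo hH.A_lo, hi hH.A_hi, lo hH.C_lo, hi hH.C_hi, fun i j z => ?_, fun z ξ => ?_,
    mul_pos hK hlam, (hH.A_meas.comp hcs).const_mul _, (hH.C_meas.comp hcs).const_mul _,
    fun i j => (hH.a_meas i j).comp hcs, fun k hk r z => ?_, fun k hk r z => ?_,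
    fun k hk i j r z => ?_, fun i j r z => ?_, by simp⟩
  · refine (hH.a_hi _ (hp z) i j).trans (inv_anti₀ (by positivity) ?_)
    exact mul_le_of_le_one_right hν.le hθ1
  · refine le_trans ?_ (hH.ell _ (hp z) ξ)
    exact mul_le_mul_of_nonneg_right (mul_le_of_le_one_right hν.le hθ1)
      (Finset.sum_nonneg fun i _ => sq_nonneg _)
  · simp only [HOp.frz, hinv k hk]
  · simp only [HOp.frz, hinv k hk]
  · simp only [HOp.frz, hinv k hk]
  · by_cases h : i = ℓ
    · subst h
      by_cases hj : j = i
      · subst hj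
        simp only [HOp.frz, hH.a_one _ (hp _)]
      · simp only [HOp.frz, hH.a_zero _ (hp _) j hj]
    · simp only [HOp.frz, hinv (some i) (by simpa using h)]

variable [FiniteDimensional ℝ M] [MeasurableSpace M] [BorelSpace M]

lemma TstP.exists_Icc {u : M → ℝ} (hu : TstP s u) :
    ∃ σ₀ σ₁, 0 < σ₀ ∧ σ₀ ≤ σ₁ ∧ ∀ w ∈ tsupport u, s w ∈ Icc σ₀ σ₁ := by
  rcases (tsupport u).eq_empty_or_nonempty with h | h
  · exact ⟨1, 1, one_pos, le_rfl, by simp [h]⟩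
  obtain ⟨w0, h0, hmin⟩ := hu.cpt.isCompact.exists_isMinOn h s.continuous.continuousOn
  obtain ⟨w1, h1, hmax⟩ := hu.cpt.isCompact.exists_isMaxOn h s.continuous.continuousOn
  exact ⟨s w0, s w1, hu.pos _ h0, hmin h1, fun w hw => ⟨hmin hw, hmax hw⟩⟩

lemma HOp.OK.weighted_le (μ : Measure M) [μ.IsAddHaarMeasure] (hH : H.OK ν α ℓ) (hν : 0 < ν)
    (hα : 0 < α) (hlam : 0 < lam) (hsb : ∀ k, k ≠ some ℓ → s (b k) = 0) (hs1 : s (b (some ℓ)) = 1)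
    {u : M → ℝ} (hu : TstP s u) {p δ : ℝ} (hp : 1 < p)
    (hδ1 : 1 - 1 / p < δ) (hδ2 : δ < 2 - 1 / p) {R : ℝ}
    (hR : Lb μ (ENNReal.ofReal p) (fun w => s w ^ δ * H.app s b lam u w) R) :
    Lb μ (ENNReal.ofReal p) (fun w => s w ^ (δ - 2) * u w)
      (((2 - 1 / p - δ) * (δ - (1 - 1 / p)))⁻¹ * R) := by
  obtain ⟨σ₀, σ₁, h0, h01, hsupp⟩ := hu.exists_Icc
  have h1 : 0 < σ₁ := h0.trans_le h01
  have hOK := hH.frz (M := M) (s := s) (b := b) hν hlam one_pos h0 h01 hsb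
    (θ := min 1 (min (σ₁ ^ (-α)) (σ₀ ^ α))) (by positivity) (min_le_left _ _)
    (fun σ hσ => by
      rw [inv_one, one_mul]
      exact (min_le_right _ _).trans ((min_le_left _ _).trans
        (Real.rpow_le_rpow_of_nonpos (h0.trans_le hσ.1) hσ.2 (by linarith))))
    (fun σ hσ => by
      rw [inv_one, one_mul]
      refine (Real.rpow_le_rpow_of_nonpos h0 hσ.1 (by linarith)).trans ?_
      rw [Real.rpow_neg h0.le]
      exact inv_anti₀ (by positivity) ((min_le_right _ _).trans (min_le_right _ _)))
  rw [← HOp.frz_app (K := 1) one_ne_zero hsupp] at hR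
  exact hOK.weighted_le μ (by positivity) (fun k hk => hk)
    (fun w => hH.a_one _ (h0.trans_le (clamp_mem h01 _).1))
    (fun j hj w => hH.a_zero _ (h0.trans_le (clamp_mem h01 _).1) j hj) (s := s) hs1
    (fun k hk => by
      cases k with
      | none => simp [timeScale, hsb none hk]
      | some i => exact hsb _ hk) hu hp hδ1 hδ2 hR

lemma HOp.exists_local_le (μ : Measure M) [μ.IsAddHaarMeasure] (ν α : ℝ) (hν : 0 < ν)
    (hα : 0 < α) (ℓ : ι) {p : ℝ} (hp : 1 < p) : ∃ N : ℝ, 0 ≤ N ∧ ∀ (H : HOp ι), H.OK ν α ℓ →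
    ∀ (b : Module.Basis (Option ι) ℝ M) (s : M →L[ℝ] ℝ), (∀ k, k ≠ some ℓ → s (b k) = 0) →
    ∀ lam, 0 < lam → ∀ r, 0 < r → ∀ v : M → ℝ, Tst v →
    (∀ w ∈ tsupport v, s w ∈ Icc (r / 2) (4 * r)) →
    ∀ R, Lb μ (ENNReal.ofReal p) (H.app s b lam v) R →
    Lb μ (ENNReal.ofReal p) (fun w => r ^ (-α) * lam * v w) (N * R) ∧
    Lb μ (ENNReal.ofReal p) (fun w => r ^ (-α) * pd (b none) v w) (N * R) ∧
    ∀ i k, Lb μ (ENNReal.ofReal p) (pd (b (some i)) (pd (b (some k)) v)) (N * R) := by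
  set θ : ℝ := 4 ^ (-α) with hθ
  have hθ0 : 0 < θ := by positivity
  obtain ⟨N, hN, hmain⟩ := COp.exists_full_le (ι := ι) μ (ν * θ) (mul_pos hν hθ0) ℓ hp
  refine ⟨N, hN, fun H hH b s hsb lam hlam r hr v hv hsupp R hR => ?_⟩
  have hK : 0 < r ^ (-α) := by positivity
  have h0 : 0 < r / 2 := by positivity
  have h01 : r / 2 ≤ 4 * r := by linarith
  have hx : ∀ σ, 0 < σ → (r ^ (-α))⁻¹ * σ ^ (-α) = (σ / r) ^ (-α) := fun σ hσ => by
    rw [Real.div_rpow hσ.le hr.le, div_eq_inv_mul]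
  have hθ1 : θ ≤ 1 := Real.rpow_le_one_of_one_le_of_nonpos (by norm_num) (by linarith)
  have hOK := hH.frz (M := M) (s := s) (b := b) hν hlam hK h0 h01 hsb hθ0 hθ1
    (fun σ hσ => by
      have hσ0 := h0.trans_le hσ.1
      rw [hx σ hσ0]
      exact Real.rpow_le_rpow_of_nonpos (by positivity) (by rw [div_le_iff₀ hr]; exact hσ.2)
        (by linarith))
    (fun σ hσ => by
      have hσ0 := h0.trans_le hσ.1
      rw [hx σ hσ0, hθ, ← Real.inv_rpow (by norm_num)]
      exact Real.rpow_le_rpow_of_nonpos (by norm_num)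
        (by rw [le_div_iff₀ hr]; linarith [hσ.1]) (by linarith))
  classical
  set b' : Module.Basis (Option ι) ℝ M :=
    b.unitsSMul (fun k => if k = none then Units.mk0 (r ^ (-α)) hK.ne' else 1) with hb'
  have hbb : timeScale (r ^ (-α)) b = b' := by
    funext k
    rw [hb', Module.Basis.unitsSMul_apply]
    cases k with
    | none => simp [timeScale, Units.smul_def]
    | some i => simp [timeScale]
  rw [← HOp.frz_app hK.ne' hsupp, hbb] at hR
  rw [hbb] at hOK
  obtain ⟨c1, c2, c3⟩ := hmain _ b' _ hOK (fun k hk => hk)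
    (fun w => hH.a_one _ (h0.trans_le (clamp_mem h01 _).1))
    (fun j hj w => hH.a_zero _ (h0.trans_le (clamp_mem h01 _).1) j hj) v hv R hR
  have e0 : b' none = r ^ (-α) • b none := by rw [← hbb]; rfl
  have e1 : ∀ i, b' (some i) = b (some i) := fun i => by rw [← hbb]; rfl
  rw [e0, pd_smul] at c2
  simp only [e1] at c3
  exact ⟨c1, c2, c3⟩

end HalfSpaceOperator

section Gluing

variable {α : Type*} [MeasurableSpace α] {μ : Measure α} {s : α → ℝ}

/-- A dyadic layer. -/
def blk (s : α → ℝ) (r : ℝ) : Set α := {w | s w ∈ Ico r (2 * r)}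

/-- An enlarged dyadic layer. -/
def big (s : α → ℝ) (r : ℝ) : Set α := {w | s w ∈ Ico (r / 2) (4 * r)}

lemma measurableSet_blk (hs : Measurable s) (r : ℝ) : MeasurableSet (blk s r) :=
  hs measurableSet_Ico

lemma measurableSet_big (hs : Measurable s) (r : ℝ) : MeasurableSet (big s r) :=
  hs measurableSet_Ico

lemma mem_blk_zpow {k : ℤ} {w : α} :
    w ∈ blk s (2 ^ k) ↔ s w ∈ Ico ((2 : ℝ) ^ k) (2 ^ (k + 1)) := by
  rw [zpow_add_one₀ (two_ne_zero), mul_comm]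
  rfl

lemma lintegral_eq_tsum_blk (hs : Measurable s) {f : α → ℝ≥0∞} (h0 : ∀ w, ¬ 0 < s w → f w = 0) :
    ∫⁻ w, f w ∂μ = ∑' k : ℤ, ∫⁻ w in blk s (2 ^ k), f w ∂μ := by
  have hU : ⋃ k : ℤ, blk s ((2 : ℝ) ^ k) = {w | 0 < s w} := by
    ext w
    rw [mem_iUnion]
    constructor
    · rintro ⟨k, hk⟩
      exact lt_of_lt_of_le (by positivity) hk.1
    · intro hw
      obtain ⟨k, hk⟩ := exists_mem_Ico_zpow (show 0 < s w from hw) one_lt_two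
      exact ⟨k, mem_blk_zpow.2 hk⟩
  rw [← lintegral_iUnion (fun k => measurableSet_blk hs _), hU]
  · refine (setLIntegral_eq_of_support_subset ?_).symm
    intro w hw
    by_contra h
    exact hw (h0 w h)
  · intro j k hjk
    refine Set.disjoint_left.2 fun w hj hk => hjk ?_
    rw [mem_blk_zpow] at hj hk
    have h1 := (zpow_lt_zpow_iff_right₀ (one_lt_two (α := ℝ))).1 (hj.1.trans_lt hk.2)
    have h2 := (zpow_lt_zpow_iff_right₀ (one_lt_two (α := ℝ))).1 (hk.1.trans_lt hj.2)
    omega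

lemma tsum_big_le (hs : Measurable s) {f : α → ℝ≥0∞} :
    ∑' k : ℤ, ∫⁻ w in big s (2 ^ k), f w ∂μ ≤ 3 * ∫⁻ w in {w | 0 < s w}, f w ∂μ := by
  set m : ℤ → ℝ≥0∞ := fun k => ∫⁻ w in blk s (2 ^ k), f w ∂μ with hm
  have h1 : ∀ k : ℤ, ∫⁻ w in big s (2 ^ k), f w ∂μ ≤ m (k + (-1)) + m k + m (k + 1) := by
    intro k
    have hsub : big s ((2 : ℝ) ^ k) ⊆ (blk s (2 ^ (k + (-1))) ∪ blk s (2 ^ k)) ∪ blk s (2 ^ (k + 1)) := by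
      intro w hw
      have hr : (0 : ℝ) < 2 ^ k := by positivity
      have e1 : (2 : ℝ) ^ (k + (-1)) = 2 ^ k / 2 := by
        rw [zpow_add₀ two_ne_zero, zpow_neg_one]; rfl
      have e2 : (2 : ℝ) ^ (k + 1) = 2 ^ k * 2 := zpow_add_one₀ two_ne_zero k
      simp only [blk, mem_union, mem_ofPred_eq, e1, e2, mem_Ico]
      obtain ⟨h1, h2⟩ := hw
      rcases lt_or_ge (s w) (2 ^ k) with h3 | h3
      · left; left; exact ⟨h1, by linarith⟩
      · rcases lt_or_ge (s w) (2 * 2 ^ k) with h4 | h4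
        · left; right; exact ⟨h3, h4⟩
        · right; exact ⟨by linarith, by linarith⟩
    refine (lintegral_mono_set hsub).trans ((lintegral_union_le _ _ _).trans ?_)
    gcongr
    exact lintegral_union_le _ _ _
  have hsum : ∑' k, m k = ∫⁻ w in {w | 0 < s w}, f w ∂μ := by
    have hp : MeasurableSet {w | 0 < s w} := measurableSet_lt measurable_const hs
    rw [← lintegral_indicator hp, lintegral_eq_tsum_blk hs]
    · refine tsum_congr fun k => setLIntegral_congr_fun (measurableSet_blk hs _) fun w hw => ?_
      have : 0 < s w := lt_of_lt_of_le (by positivity) hw.1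
      rw [indicator_of_mem (show w ∈ {w | 0 < s w} from this)]
    · intro w hw
      exact indicator_of_notMem (show w ∉ {w | 0 < s w} from hw) _
  calc ∑' k : ℤ, ∫⁻ w in big s (2 ^ k), f w ∂μ ≤ ∑' k, (m (k + (-1)) + m k + m (k + 1)) :=
        ENNReal.tsum_le_tsum h1
    _ = 3 * ∑' k, m k := by
        have e : ∀ c : ℤ, ∑' k, m (k + c) = ∑' k, m k := fun c => (Equiv.addRight c).tsum_eq m
        rw [ENNReal.tsum_add, ENNReal.tsum_add, e, e]
        ring
    _ = _ := by rw [hsum]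

/-- The constant in the gluing of local estimates. -/
def glueC (p δ N : ℝ) : ℝ := ((3 * ENNReal.ofReal (4 ^ δ * N) ^ p) ^ (1 / p)).toReal

lemma glueC_nonneg (p δ N : ℝ) : 0 ≤ glueC p δ N := ENNReal.toReal_nonneg

lemma lintegral_indicator_enorm_rpow {p : ℝ} (hp : 0 < p) {t : Set α} (ht : MeasurableSet t)
    (f : α → ℝ) : ∫⁻ w, ‖t.indicator f w‖ₑ ^ p ∂μ = ∫⁻ w in t, ‖f w‖ₑ ^ p ∂μ := by
  rw [← lintegral_indicator ht]
  refine lintegral_congr fun w => ?_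
  by_cases hw : w ∈ t
  · rw [indicator_of_mem hw, indicator_of_mem hw]
  · rw [indicator_of_notMem hw, indicator_of_notMem hw]
    simp [hp]

/-- Local estimates on dyadic layers imply a global weighted estimate. -/
lemma Lb.glue {p : ℝ} (hp : 0 < p) (hs : Measurable s) {f g : α → ℝ}
    (hf : AEStronglyMeasurable f μ) (hf0 : ∀ w, ¬ 0 < s w → f w = 0)
    (hg : AEStronglyMeasurable g μ) {δ N : ℝ} (hδ : 0 ≤ δ) (hN : 0 ≤ N)
    (hloc : ∀ r, 0 < r → ∀ R, Lb μ (ENNReal.ofReal p) ((big s r).indicator g) R →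
      Lb μ (ENNReal.ofReal p) ((blk s r).indicator f) (N * R)) {R : ℝ}
    (hR : Lb μ (ENNReal.ofReal p) (fun w => s w ^ δ * g w) R) :
    Lb μ (ENNReal.ofReal p) (fun w => s w ^ δ * f w) (glueC p δ N * R) := by
  have hsδ : Measurable fun w => s w ^ δ := hs.pow_const δ
  refine Lb.of_lintegral_le hp (ENNReal.mul_ne_top (by simp)
    (ENNReal.rpow_ne_top_of_nonneg hp.le ENNReal.ofReal_ne_top))
    (hsδ.aestronglyMeasurable.mul hf) hR ?_
  set G : α → ℝ≥0∞ := fun w => ‖s w ^ δ * g w‖ₑ ^ p with hG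
  have hk : ∀ r : ℝ, 0 < r → ∫⁻ w in blk s r, ‖s w ^ δ * f w‖ₑ ^ p ∂μ ≤
      ENNReal.ofReal (4 ^ δ * N) ^ p * ∫⁻ w in big s r, G w ∂μ := by
    intro r hr
    have hbig := measurableSet_big hs r
    have hblk := measurableSet_blk hs r
    have i1 : ∫⁻ w in blk s r, ‖s w ^ δ * f w‖ₑ ^ p ∂μ ≤
        ENNReal.ofReal ((2 * r) ^ δ) ^ p * ∫⁻ w in blk s r, ‖f w‖ₑ ^ p ∂μ := by
      rw [← lintegral_const_mul' _ _ (ENNReal.rpow_ne_top_of_nonneg hp.le ENNReal.ofReal_ne_top)]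
      refine setLIntegral_mono' hblk fun w hw => ?_
      have : 0 ≤ s w := hr.le.trans hw.1
      rw [← ENNReal.mul_rpow_of_nonneg _ _ hp.le, enorm_mul,
        Real.enorm_of_nonneg (Real.rpow_nonneg this _)]
      gcongr
      exact hw.2.le
    have i3 : ∫⁻ w in big s r, ‖g w‖ₑ ^ p ∂μ ≤
        ENNReal.ofReal (((r / 2) ^ δ)⁻¹) ^ p * ∫⁻ w in big s r, G w ∂μ := by
      rw [← lintegral_const_mul' _ _ (ENNReal.rpow_ne_top_of_nonneg hp.le ENNReal.ofReal_ne_top)]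
      refine setLIntegral_mono' hbig fun w hw => ?_
      have h0 : 0 < r / 2 := by positivity
      have h1 : 0 < s w := h0.trans_le hw.1
      have h2 : 0 < s w ^ δ := by positivity
      rw [hG, ← ENNReal.mul_rpow_of_nonneg _ _ hp.le]
      gcongr
      rw [Real.enorm_eq_ofReal_abs, Real.enorm_eq_ofReal_abs,
        ← ENNReal.ofReal_mul (by positivity), abs_mul, abs_of_pos h2, ← mul_assoc]
      refine ENNReal.ofReal_le_ofReal (le_mul_of_one_le_left (abs_nonneg _) ?_)
      rw [inv_mul_eq_div, one_le_div (by positivity)]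
      exact Real.rpow_le_rpow h0.le hw.1 hδ
    have hmem : MemLp ((big s r).indicator g) (ENNReal.ofReal p) μ := by
      refine ⟨hg.indicator hbig, ?_⟩
      rw [eLpNorm_eq_lintegral hp, lintegral_indicator_enorm_rpow hp hbig]
      refine ENNReal.rpow_lt_top_of_nonneg (by positivity) (ne_top_of_le_ne_top
        (ENNReal.mul_ne_top (ENNReal.rpow_ne_top_of_nonneg hp.le ENNReal.ofReal_ne_top) ?_) i3)
      have h4 := hR.memLp.2
      rw [eLpNorm_eq_lintegral hp] at h4
      have h5 : ∫⁻ w, G w ∂μ ≠ ∞ := by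
        intro h
        rw [hG] at h
        rw [h, ENNReal.top_rpow_of_pos (by positivity)] at h4
        exact lt_irrefl _ h4
      exact ne_top_of_le_ne_top h5 (setLIntegral_le_lintegral _ _)
    have i2 : ∫⁻ w in blk s r, ‖f w‖ₑ ^ p ∂μ ≤
        ENNReal.ofReal N ^ p * ∫⁻ w in big s r, ‖g w‖ₑ ^ p ∂μ := by
      have := (hloc r hr _ (Lb.of_memLp hmem)).le
      rw [ENNReal.ofReal_mul hN, nr, ENNReal.ofReal_toReal hmem.2.ne, eLpNorm_eq_lintegral hp,
        eLpNorm_eq_lintegral hp, lintegral_indicator_enorm_rpow hp hbig,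
        lintegral_indicator_enorm_rpow hp hblk] at this
      have h2 := ENNReal.rpow_le_rpow this hp.le
      rwa [ENNReal.mul_rpow_of_nonneg _ _ hp.le, ← ENNReal.rpow_mul, ← ENNReal.rpow_mul,
        one_div_mul_cancel hp.ne', ENNReal.rpow_one, ENNReal.rpow_one] at h2
    refine i1.trans ((mul_le_mul_right (i2.trans (mul_le_mul_right i3 _)) _).trans (le_of_eq ?_))
    rw [← mul_assoc, ← mul_assoc, ← ENNReal.mul_rpow_of_nonneg _ _ hp.le,
      ← ENNReal.mul_rpow_of_nonneg _ _ hp.le, ← ENNReal.ofReal_mul (by positivity),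
      ← ENNReal.ofReal_mul (by positivity)]
    congr 3
    have : (4 : ℝ) ^ δ = (2 * r) ^ δ * ((r / 2) ^ δ)⁻¹ := by
      rw [← div_eq_mul_inv, ← Real.div_rpow (by positivity) (by positivity)]
      congr 1
      field_simp
      norm_num
    rw [this]
    ring
  rw [lintegral_eq_tsum_blk hs]
  · refine (ENNReal.tsum_le_tsum fun k => hk (2 ^ k) (by positivity)).trans ?_
    rw [ENNReal.tsum_mul_left]
    refine (mul_le_mul_right (tsum_big_le hs) _).trans ?_
    rw [← mul_assoc, mul_comm _ (3 : ℝ≥0∞)]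
    exact mul_le_mul_right (setLIntegral_le_lintegral _ _) _
  · intro w hw
    simp [hf0 w hw, hp]

end Gluing

section Localization

open Filter Topology

/-- A cutoff function equal to one near `[1, 2]` and supported in `[1/2, 4)`. -/
def bmp : ContDiffBump (3 / 2 : ℝ) := ⟨6 / 10, 9 / 10, by norm_num, by norm_num⟩

lemma contDiff_bmp : ContDiff ℝ (⊤ : ℕ∞) bmp := bmp.contDiff

lemma exists_bmp_bound : ∃ K, 0 ≤ K ∧ ∀ x, |deriv bmp x| ≤ K ∧ |deriv (deriv bmp) x| ≤ K := by
  have h1 : ContDiff ℝ (⊤ : ℕ∞) (deriv bmp) :=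
    (contDiff_infty_iff_deriv.1 contDiff_bmp).2
  have h2 : ContDiff ℝ (⊤ : ℕ∞) (deriv (deriv bmp)) := (contDiff_infty_iff_deriv.1 h1).2
  have c1 : HasCompactSupport (deriv bmp) := bmp.hasCompactSupport.deriv
  obtain ⟨B1, hB1⟩ := c1.exists_bound_of_continuous h1.continuous
  obtain ⟨B2, hB2⟩ := c1.deriv.exists_bound_of_continuous h2.continuous
  exact ⟨max B1 B2, le_max_of_le_left ((norm_nonneg _).trans (hB1 0)), fun x =>
    ⟨(hB1 x).trans (le_max_left _ _), (hB2 x).trans (le_max_right _ _)⟩⟩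

variable {ι M : Type*} [Fintype ι] [NormedAddCommGroup M] [NormedSpace ℝ M]

/-- Localization of a function to the layer `s ∼ r`. -/
def layerCut (s : M →L[ℝ] ℝ) (r : ℝ) (u : M → ℝ) (w : M) : ℝ := bmp (s w / r) * u w

variable {s : M →L[ℝ] ℝ} {r : ℝ} {u : M → ℝ}

lemma pd_mul_div {φ : ℝ → ℝ} (hφ : Differentiable ℝ φ) {f : M → ℝ} (hf : Differentiable ℝ f)
    (s : M →L[ℝ] ℝ) (r : ℝ) (e w : M) : pd e (fun w => φ (s w / r) * f w) w =
      φ (s w / r) * pd e f w + deriv φ (s w / r) * (s e / r) * f w := by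
  have hs : DifferentiableAt ℝ (fun w => s w / r) w := by
    simpa only [div_eq_mul_inv] using (s.differentiableAt (x := w)).mul_const r⁻¹
  rw [pd_mul (f := fun w => φ (s w / r)) ((hφ _).comp w hs) (hf w),
    pd_comp (v := fun w => s w / r) (hφ _) hs]
  congr 3
  have : (fun w => s w / r) = fun w => (r⁻¹ • s) w := by
    funext w
    simp [div_eq_inv_mul]
  rw [this]
  unfold pd
  rw [ContinuousLinearMap.fderiv]
  simp [div_eq_inv_mul]

lemma Tst.layerCut (hu : Tst u) (s : M →L[ℝ] ℝ) (r : ℝ) : Tst (layerCut s r u) :=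
  hu.mul (contDiff_bmp.comp (s.contDiff.div_const r))

lemma mem_of_mem_tsupport_layerCut (hr : 0 < r) {w : M} (hw : w ∈ tsupport (layerCut s r u)) :
    w ∈ big s r := by
  have h1 : w ∈ tsupport (fun w => bmp (s w / r)) := tsupport_mul_subset_left hw
  have h2 : s w / r ∈ tsupport bmp :=
    tsupport_comp_subset_preimage (g := bmp) (f := fun w => s w / r)
      (s.continuous.div_const r) h1
  rw [bmp.tsupport_eq, Real.closedBall_eq_Icc] at h2
  obtain ⟨h3, h4⟩ := h2
  simp only [bmp] at h3 h4
  rw [le_div_iff₀ hr] at h3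
  rw [div_le_iff₀ hr] at h4
  exact ⟨by linarith, by linarith⟩

lemma layerCut_eventuallyEq (hr : 0 < r) {w : M} (hw : w ∈ blk s r) : layerCut s r u =ᶠ[𝓝 w] u := by
  have h1 : s w / r ∈ Metric.ball (3 / 2 : ℝ) (6 / 10) := by
    rw [Real.ball_eq_Ioo]
    have := hw.1
    have := hw.2
    constructor
    · rw [lt_div_iff₀ hr]; linarith
    · rw [div_lt_iff₀ hr]; linarith
  have h2 : ∀ᶠ y in 𝓝 w, s y / r ∈ Metric.ball (3 / 2 : ℝ) (6 / 10) :=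
    (s.continuous.div_const r).continuousAt.eventually_mem (Metric.isOpen_ball.mem_nhds h1)
  filter_upwards [h2] with y hy
  rw [layerCut, bmp.one_of_mem_closedBall (Metric.ball_subset_closedBall hy), one_mul]

lemma Filter.EventuallyEq.pd {f g : M → ℝ} {w : M} (h : f =ᶠ[𝓝 w] g) (e : M) :
    pd e f =ᶠ[𝓝 w] pd e g := by
  filter_upwards [h.fderiv (𝕜 := ℝ)] with y hy
  rw [_root_.pd, hy, _root_.pd]

/-- The majorant in the local estimates. -/
def HOp.maj (H : HOp ι) (s : M →L[ℝ] ℝ) (b : Option ι → M) (lam : ℝ) (u : M → ℝ) (w : M) : ℝ :=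
  |H.app s b lam u w| + ∑ i, s w ^ (-1 : ℝ) * |pd (b (some i)) u w| + s w ^ (-2 : ℝ) * |u w|

lemma HOp.app_layerCut (H : HOp ι) (b : Option ι → M) (lam : ℝ) (hb0 : s (b none) = 0) (hu : Tst u)
    (w : M) : H.app s b lam (layerCut s r u) w = bmp (s w / r) * H.app s b lam u w -
      ∑ i, ∑ j, H.a i j (s w) * (deriv bmp (s w / r) * (s (b (some j)) / r) * pd (b (some i)) u w +
        deriv bmp (s w / r) * (s (b (some i)) / r) * pd (b (some j)) u w +
        deriv (deriv bmp) (s w / r) * (s (b (some j)) / r) * (s (b (some i)) / r) * u w) := by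
  have d1 : Differentiable ℝ bmp := contDiff_bmp.differentiable (by simp)
  have c1 : ContDiff ℝ (⊤ : ℕ∞) (deriv bmp) := (contDiff_infty_iff_deriv.1 contDiff_bmp).2
  have d2 : Differentiable ℝ (deriv bmp) := c1.differentiable (by simp)
  have e1 : ∀ e, pd e (layerCut s r u) = fun w => bmp (s w / r) * pd e u w +
      (s e / r) * (deriv bmp (s w / r) * u w) := fun e => by
    funext w
    unfold layerCut
    rw [pd_mul_div d1 hu.differentiable]
    ring
  have e2 : ∀ e e', pd e' (pd e (layerCut s r u)) w = bmp (s w / r) * pd e' (pd e u) w +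
      (deriv bmp (s w / r) * (s e' / r) * pd e u w +
        deriv bmp (s w / r) * (s e / r) * pd e' u w +
        deriv (deriv bmp) (s w / r) * (s e' / r) * (s e / r) * u w) := by
    intro e e'
    have t1 : Tst fun w => bmp (s w / r) * pd e u w := (hu.pd e).layerCut s r
    have t2 : Tst fun w => deriv bmp (s w / r) * u w :=
      hu.mul (c1.comp (s.contDiff.div_const r))
    rw [e1, pd_add (t1.differentiable w) ((t2.differentiable w).const_mul _),
      pd_mul_div d1 (hu.pd e).differentiable, pd_const_mul t2.differentiable]
    simp only
    rw [pd_mul_div d2 hu.differentiable]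
    ring
  unfold HOp.app
  simp_rw [e2, mul_add, Finset.sum_add_distrib]
  rw [e1, hb0]
  have : ∑ i, ∑ j, H.a i j (s w) * (bmp (s w / r) * pd (b (some j)) (pd (b (some i)) u) w) =
      bmp (s w / r) * ∑ i, ∑ j, H.a i j (s w) * pd (b (some j)) (pd (b (some i)) u) w := by
    simp only [Finset.mul_sum]
    exact Finset.sum_congr rfl fun i _ => Finset.sum_congr rfl fun j _ => by ring
  rw [this]
  unfold layerCut
  ring

lemma HOp.OK.exists_app_layerCut_le (ν : ℝ) (hν : 0 < ν) (ι : Type*) [Fintype ι] :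
    ∃ C, 0 ≤ C ∧ ∀ (H : HOp ι) (α : ℝ) (ℓ : ι), H.OK ν α ℓ → ∀ (s : M →L[ℝ] ℝ) (b : Option ι → M),
      (∀ k, k ≠ some ℓ → s (b k) = 0) → s (b (some ℓ)) = 1 → ∀ lam (u : M → ℝ), Tst u → ∀ r, 0 < r →
      ∀ w, |H.app s b lam (layerCut s r u) w| ≤ C * (big s r).indicator (H.maj s b lam u) w := by
  obtain ⟨K, hK0, hK⟩ := exists_bmp_bound
  set n : ℝ := (Fintype.card ι : ℝ) with hn
  have hn0 : 0 ≤ n := by positivity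
  have hν' := inv_pos.2 hν
  refine ⟨1 + ν⁻¹ * K * (8 * n + 16 * n ^ 2), by positivity, ?_⟩
  intro H α ℓ hH s b hs0 hs1 lam u hu r hr w
  by_cases hw : w ∈ big s r
  swap
  · have hw' : w ∉ tsupport (layerCut s r u) := fun h => hw (mem_of_mem_tsupport_layerCut hr h)
    have h1 : ∀ e, w ∉ tsupport (pd e (layerCut s r u)) :=
      fun e h => hw' (tsupport_fderiv_apply_subset ℝ e h)
    simp [HOp.app, pd_eq_zero hw', pd_eq_zero (h1 _), image_eq_zero_of_notMem_tsupport hw', hw]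
  rw [indicator_of_mem hw, H.app_layerCut b lam (hs0 none (by simp)) hu]
  have hσ : 0 < s w := lt_of_lt_of_le (by positivity) hw.1
  have hsb : ∀ i, |s (b (some i)) / r| ≤ r⁻¹ := by
    intro i
    rw [div_eq_mul_inv, abs_mul, abs_of_pos (inv_pos.2 hr)]
    refine mul_le_of_le_one_left (inv_pos.2 hr).le ?_
    by_cases h : i = ℓ
    · rw [h, hs1, abs_one]
    · rw [hs0 _ (by simpa using h), abs_zero]; exact zero_le_one
  have hr1 : r⁻¹ ≤ 4 * s w ^ (-1 : ℝ) := by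
    rw [Real.rpow_neg_one, ← div_eq_mul_inv, le_div_iff₀ hσ, inv_mul_le_iff₀ hr]
    linarith [hw.2]
  have hr2 : r⁻¹ * r⁻¹ ≤ 16 * s w ^ (-2 : ℝ) := by
    have : s w ^ (-2 : ℝ) = s w ^ (-1 : ℝ) * s w ^ (-1 : ℝ) := by
      rw [← Real.rpow_add hσ]; norm_num
    rw [this]
    calc r⁻¹ * r⁻¹ ≤ (4 * s w ^ (-1 : ℝ)) * (4 * s w ^ (-1 : ℝ)) := by gcongr
      _ = _ := by ring
  have hσ1 : 0 < s w ^ (-1 : ℝ) := by positivity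
  have hσ2 : 0 < s w ^ (-2 : ℝ) := by positivity
  set D : ι → ℝ := fun i => |pd (b (some i)) u w| with hD
  have hterm : ∀ i j, |H.a i j (s w) * (deriv bmp (s w / r) * (s (b (some j)) / r) *
      pd (b (some i)) u w + deriv bmp (s w / r) * (s (b (some i)) / r) * pd (b (some j)) u w +
        deriv (deriv bmp) (s w / r) * (s (b (some j)) / r) * (s (b (some i)) / r) * u w)| ≤
      ν⁻¹ * (K * (4 * s w ^ (-1 : ℝ)) * D i + K * (4 * s w ^ (-1 : ℝ)) * D j +
        K * (16 * s w ^ (-2 : ℝ)) * |u w|) := by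
    intro i j
    rw [abs_mul]
    refine mul_le_mul (hH.a_hi _ hσ i j) ?_ (abs_nonneg _) hν'.le
    have k1 : ∀ i, |deriv bmp (s w / r) * (s (b (some i)) / r)| ≤ K * (4 * s w ^ (-1 : ℝ)) := by
      intro i
      rw [abs_mul]
      exact mul_le_mul (hK _).1 ((hsb i).trans hr1) (abs_nonneg _) hK0
    refine (abs_add_le _ _).trans (add_le_add ((abs_add_le _ _).trans (add_le_add ?_ ?_)) ?_)
    · rw [abs_mul]; exact mul_le_mul_of_nonneg_right (k1 j) (abs_nonneg _)
    · rw [abs_mul]; exact mul_le_mul_of_nonneg_right (k1 i) (abs_nonneg _)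
    · rw [abs_mul, mul_assoc (deriv (deriv bmp) (s w / r)), abs_mul]
      refine mul_le_mul_of_nonneg_right (mul_le_mul (hK _).2 (le_trans ?_ hr2) (abs_nonneg _) hK0)
        (abs_nonneg _)
      rw [abs_mul]
      exact mul_le_mul (hsb j) (hsb i) (abs_nonneg _) (inv_pos.2 hr).le
  have hsum : |∑ i, ∑ j, H.a i j (s w) * (deriv bmp (s w / r) * (s (b (some j)) / r) *
      pd (b (some i)) u w + deriv bmp (s w / r) * (s (b (some i)) / r) * pd (b (some j)) u w +
        deriv (deriv bmp) (s w / r) * (s (b (some j)) / r) * (s (b (some i)) / r) * u w)| ≤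
      ν⁻¹ * K * (8 * n * (∑ i, s w ^ (-1 : ℝ) * D i) + 16 * n ^ 2 * (s w ^ (-2 : ℝ) * |u w|)) := by
    refine (Finset.abs_sum_le_sum_abs _ _).trans ?_
    refine (Finset.sum_le_sum fun i _ => (Finset.abs_sum_le_sum_abs _ _).trans
      (Finset.sum_le_sum fun j _ => hterm i j)).trans (le_of_eq ?_)
    simp only [← Finset.mul_sum, Finset.sum_add_distrib, Finset.sum_const, Finset.card_univ,
      nsmul_eq_mul, ← hn]
    ring
  have hb : |bmp (s w / r)| ≤ 1 := abs_le.2 ⟨by linarith [bmp.nonneg (x := s w / r)], bmp.le_one⟩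
  have hS : 0 ≤ ∑ i, s w ^ (-1 : ℝ) * D i :=
    Finset.sum_nonneg fun i _ => mul_nonneg hσ1.le (abs_nonneg _)
  have hU : 0 ≤ s w ^ (-2 : ℝ) * |u w| := by positivity
  have hA : |bmp (s w / r) * H.app s b lam u w| ≤ |H.app s b lam u w| := by
    rw [abs_mul]; exact mul_le_of_le_one_left (abs_nonneg _) hb
  refine (abs_sub _ _).trans ((add_le_add hA hsum).trans ?_)
  unfold HOp.maj
  change _ ≤ (1 + ν⁻¹ * K * (8 * n + 16 * n ^ 2)) *
    (|H.app s b lam u w| + ∑ i, s w ^ (-1 : ℝ) * D i + s w ^ (-2 : ℝ) * |u w|)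
  set Sg := ∑ i, s w ^ (-1 : ℝ) * D i
  set U := s w ^ (-2 : ℝ) * |u w|
  have hF := abs_nonneg (H.app s b lam u w)
  set F := |H.app s b lam u w|
  have hc : 0 ≤ ν⁻¹ * K := by positivity
  have hx : 8 * n * Sg + 16 * n ^ 2 * U ≤ (8 * n + 16 * n ^ 2) * (F + Sg + U) := by
    have q1 : 0 ≤ n * U := by positivity
    have q2 : 0 ≤ n ^ 2 * Sg := by positivity
    have q3 : 0 ≤ n * F := by positivity
    have q4 : 0 ≤ n ^ 2 * F := by positivity
    nlinarith
  nlinarith [mul_le_mul_of_nonneg_left hx hc]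

end Localization

section LayerEstimate

variable {ι M : Type*} [Fintype ι] [NormedAddCommGroup M] [NormedSpace ℝ M]
  [FiniteDimensional ℝ M] [MeasurableSpace M] [BorelSpace M]

lemma Lb.indicator_of_le {α : Type*} [MeasurableSpace α] {μ : Measure α} {q : ℝ≥0∞} {f g : α → ℝ}
    {R : ℝ} {t : Set α} (h : Lb μ q g R) (ht : MeasurableSet t) (hf : AEStronglyMeasurable f μ)
    (hfg : ∀ x ∈ t, |f x| ≤ |g x|) : Lb μ q (t.indicator f) R := by
  refine h.mono (hf.indicator ht) (.of_forall fun x => ?_)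
  by_cases hx : x ∈ t
  · rw [indicator_of_mem hx]; exact hfg x hx
  · rw [indicator_of_notMem hx, abs_zero]; exact abs_nonneg _

variable {H : HOp ι} {s : M →L[ℝ] ℝ} {ν α : ℝ} {ℓ : ι} {u : M → ℝ}

lemma HOp.OK.measurable_app (hH : H.OK ν α ℓ) (s : M →L[ℝ] ℝ) (b : Option ι → M) (lam : ℝ)
    (hu : Tst u) : Measurable (H.app s b lam u) := by
  have hs := s.measurable
  have h1 : ∀ e, Measurable (pd e u) := fun e => (hu.pd e).continuous.measurable
  have h2 : ∀ e e', Measurable (pd e (pd e' u)) := fun e e' =>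
    ((hu.pd e').pd e).continuous.measurable
  refine (((hH.A_meas.comp hs).mul (h1 _)).add
    (((hH.C_meas.comp hs).const_mul lam).mul hu.continuous.measurable)).sub ?_
  exact Finset.measurable_fun_sum _ fun i _ => Finset.measurable_fun_sum _ fun j _ =>
    ((hH.a_meas i j).comp hs).mul (h2 _ _)

lemma HOp.OK.measurable_maj (hH : H.OK ν α ℓ) (s : M →L[ℝ] ℝ) (b : Option ι → M) (lam : ℝ)
    (hu : Tst u) : Measurable (H.maj s b lam u) := by
  have hs := s.measurable
  have h1 : ∀ e, Measurable (pd e u) := fun e => (hu.pd e).continuous.measurable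
  have h2 := hu.continuous.measurable
  refine (((hH.measurable_app s b lam hu).abs).add (Finset.measurable_fun_sum _ fun i _ =>
    (hs.pow_const _).mul (h1 _).abs)).add ((hs.pow_const _).mul h2.abs)

lemma abs_layerCut_le {r : ℝ} (hr : 0 < r) (w : M) :
    |layerCut s r u w| ≤ |(big s r).indicator u w| := by
  by_cases hw : w ∈ big s r
  · rw [indicator_of_mem hw, layerCut, abs_mul, abs_of_nonneg bmp.nonneg]
    exact mul_le_of_le_one_left (abs_nonneg _) bmp.le_one
  · rw [image_eq_zero_of_notMem_tsupport fun h => hw (mem_of_mem_tsupport_layerCut hr h), abs_zero]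
    exact abs_nonneg _

theorem HOp.exists_layer_le (μ : Measure M) [μ.IsAddHaarMeasure] (ν α : ℝ) (hν : 0 < ν)
    (hα : 0 < α) (ℓ : ι) {p : ℝ} (hp : 1 < p) : ∃ N : ℝ, 0 < N ∧ ∀ (H : HOp ι), H.OK ν α ℓ →
    ∀ (b : Module.Basis (Option ι) ℝ M) (s : M →L[ℝ] ℝ), (∀ k, k ≠ some ℓ → s (b k) = 0) →
    s (b (some ℓ)) = 1 → ∀ lam, 0 < lam → ∀ u : M → ℝ, Tst u → ∀ r, 0 < r →
    ∀ R, Lb μ (ENNReal.ofReal p) ((big s r).indicator (H.maj s b lam u)) R →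
    Lb μ (ENNReal.ofReal p) ((blk s r).indicator fun w => lam * (s w ^ (-α) * u w)) (N * R) ∧
    Lb μ (ENNReal.ofReal p) ((blk s r).indicator fun w => s w ^ (-α) * pd (b none) u w) (N * R) ∧
    (∀ i k, Lb μ (ENNReal.ofReal p) ((blk s r).indicator (pd (b (some i)) (pd (b (some k)) u)))
      (N * R)) ∧
    (∀ i, Lb μ (ENNReal.ofReal p)
      ((blk s r).indicator fun w => √lam * (s w ^ (-(α / 2)) * pd (b (some i)) u w)) (N * R)) ∧
    ∀ i ε, 0 < ε → ∀ R', Lb μ (ENNReal.ofReal p)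
      ((big s r).indicator fun w => s w ^ (-2 : ℝ) * u w) R' →
      Lb μ (ENNReal.ofReal p) ((blk s r).indicator fun w => s w ^ (-1 : ℝ) * pd (b (some i)) u w)
        (32 / ε * R' + ε * N * R) := by
  obtain ⟨C, hC0, hC⟩ := HOp.OK.exists_app_layerCut_le (M := M) ν hν ι
  obtain ⟨N₁, hN₁, hN⟩ := HOp.exists_local_le (M := M) μ ν α hν hα ℓ hp
  refine ⟨3 * (N₁ * C) + 1, by positivity, ?_⟩
  intro H hH b s hsb hs1 lam hlam u hu r hr R hR
  set q := ENNReal.ofReal p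
  set v := layerCut s r u with hv
  have hvT : Tst v := hu.layerCut s r
  have hR0 := hR.nonneg
  have hblk := measurableSet_blk s.measurable r
  have happ : Lb μ q (H.app s b lam v) (C * R) := by
    have := hR.const_mul C
    rw [abs_of_nonneg hC0] at this
    exact this.mono (hH.measurable_app s b lam hvT).aestronglyMeasurable (.of_forall fun w =>
      (hC H α ℓ hH s b hsb hs1 lam u hu r hr w).trans (le_abs_self _))
  obtain ⟨k1, k2, k3⟩ := hN H hH b s hsb lam hlam r hr v hvT
    (fun w hw => Ico_subset_Icc_self (mem_of_mem_tsupport_layerCut hr hw)) _ happ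
  rw [← mul_assoc] at k1 k2
  simp only [← mul_assoc] at k3
  have hNC : 0 ≤ N₁ * C := by positivity
  have hle : N₁ * C * R ≤ (3 * (N₁ * C) + 1) * R := by nlinarith
  have hle3 : 3 * (N₁ * C * R) ≤ (3 * (N₁ * C) + 1) * R := by nlinarith
  have hpos : ∀ w ∈ blk s r, 0 < s w := fun w hw => hr.trans_le hw.1
  have hpow : ∀ β : ℝ, β ≤ 0 → ∀ w ∈ blk s r, s w ^ β ≤ r ^ β := fun β hβ w hw =>
    Real.rpow_le_rpow_of_nonpos hr hw.1 hβ
  have eu : ∀ w ∈ blk s r, v w = u w := fun w hw => (layerCut_eventuallyEq hr hw).eq_of_nhds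
  have e1 : ∀ e, ∀ w ∈ blk s r, pd e v w = pd e u w := fun e w hw =>
    ((layerCut_eventuallyEq hr hw).pd e).eq_of_nhds
  have e2 : ∀ e e', ∀ w ∈ blk s r, pd e (pd e' v) w = pd e (pd e' u) w := fun e e' w hw =>
    (((layerCut_eventuallyEq hr hw).pd e').pd e).eq_of_nhds
  have hsm : ∀ β : ℝ, Measurable fun w => s w ^ β := fun β => s.measurable.pow_const β
  have mu := hu.continuous.measurable
  have m1 : ∀ e, Measurable (pd e u) := fun e => (hu.pd e).continuous.measurable
  have habs : ∀ {β x : ℝ}, β ≤ 0 → ∀ w ∈ blk s r, |s w ^ β * x| ≤ r ^ β * |x| := by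
    intro β x hβ w hw
    rw [abs_mul, abs_of_nonneg (Real.rpow_nonneg (hpos w hw).le _)]
    exact mul_le_mul_of_nonneg_right (hpow β hβ w hw) (abs_nonneg _)
  refine ⟨?_, ?_, ?_, ?_, ?_⟩
  · refine (k1.indicator_of_le hblk (((hsm _).mul mu).const_mul lam).aestronglyMeasurable
      fun w hw => ?_).trans hle
    rw [abs_mul, abs_of_pos hlam, mul_assoc, abs_mul (r ^ (-α)), abs_mul lam, abs_of_pos hlam,
      abs_of_nonneg (Real.rpow_nonneg hr.le _), eu w hw]
    have := mul_le_mul_of_nonneg_left (habs (β := -α) (x := u w) (by linarith) w hw) hlam.le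
    rw [mul_left_comm] at this
    exact this
  · refine (k2.indicator_of_le hblk ((hsm _).mul (m1 _)).aestronglyMeasurable
      fun w hw => ?_).trans hle
    rw [abs_mul (r ^ (-α)), abs_of_nonneg (Real.rpow_nonneg hr.le _), e1 _ w hw]
    exact habs (by linarith) w hw
  · intro i k
    refine ((k3 i k).indicator_of_le hblk
      ((hu.pd _).pd _).continuous.measurable.aestronglyMeasurable fun w hw => ?_).trans hle
    rw [e2 _ _ w hw]
  · intro i
    set g : ℝ := √lam * r ^ (-(α / 2)) with hg
    have hg0 : 0 < g := by positivity
    have hgg : r ^ (-α) * lam = g * g := by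
      rw [hg, mul_mul_mul_comm, Real.mul_self_sqrt hlam.le, ← Real.rpow_add hr, mul_comm]
      congr 2
      ring
    rw [hgg] at k1
    have hv0 : Lb μ q v ((g * g)⁻¹ * (N₁ * C * R)) := by
      have := k1.const_mul (g * g)⁻¹
      rw [abs_of_pos (by positivity)] at this
      exact this.congr (.of_forall fun w => by field_simp)
    have h1 := (Lb_pd μ hp.le hvT (b (some i)) (inv_pos.2 hg0) hv0 (k3 i i)).const_mul g
    rw [abs_of_pos hg0] at h1
    have h2 : g * (2 / g⁻¹ * ((g * g)⁻¹ * (N₁ * C * R)) + g⁻¹ * (N₁ * C * R)) =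
        3 * (N₁ * C * R) := by
      field_simp
      norm_num
    rw [h2] at h1
    refine (h1.indicator_of_le hblk (((hsm _).mul (m1 _)).const_mul _).aestronglyMeasurable
      fun w hw => ?_).trans hle3
    rw [e1 _ w hw, hg, abs_mul, abs_of_nonneg (Real.sqrt_nonneg _), mul_assoc,
      abs_mul √lam, abs_of_nonneg (Real.sqrt_nonneg _), abs_mul (r ^ _),
      abs_of_nonneg (Real.rpow_nonneg hr.le _)]
    exact mul_le_mul_of_nonneg_left (habs (by linarith) w hw) (Real.sqrt_nonneg _)
  · intro i ε hε R' hR'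
    have hv0 : Lb μ q v (16 * r ^ 2 * R') := by
      have := hR'.const_mul (16 * r ^ 2)
      rw [abs_of_pos (by positivity)] at this
      refine this.mono hvT.continuous.aestronglyMeasurable (.of_forall fun w => ?_)
      refine (abs_layerCut_le hr w).trans ?_
      by_cases hw : w ∈ big s r
      · have hσ : 0 < s w := lt_of_lt_of_le (by positivity) hw.1
        have h4 : s w ^ 2 ≤ 16 * r ^ 2 := by nlinarith [hw.2]
        rw [indicator_of_mem hw, indicator_of_mem hw, abs_mul, abs_mul (s w ^ _),
          abs_of_pos (by positivity : 0 < 16 * r ^ 2),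
          abs_of_nonneg (Real.rpow_nonneg hσ.le _), ← mul_assoc]
        refine le_mul_of_one_le_left (abs_nonneg _) ?_
        rw [Real.rpow_neg hσ.le, ← div_eq_mul_inv, one_le_div (by positivity), Real.rpow_two]
        exact h4
      · rw [indicator_of_notMem hw, indicator_of_notMem hw, abs_zero, mul_zero, abs_zero]
    have h1 := (Lb_pd μ hp.le hvT (b (some i)) (mul_pos hε hr) hv0 (k3 i i)).const_mul r⁻¹
    rw [abs_of_pos (inv_pos.2 hr)] at h1
    have h2 : r⁻¹ * (2 / (ε * r) * (16 * r ^ 2 * R') + ε * r * (N₁ * C * R)) ≤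
        32 / ε * R' + ε * (3 * (N₁ * C) + 1) * R := by
      have : r⁻¹ * (2 / (ε * r) * (16 * r ^ 2 * R') + ε * r * (N₁ * C * R)) =
          32 / ε * R' + ε * (N₁ * C * R) := by
        field_simp
        ring
      rw [this]
      have := mul_le_mul_of_nonneg_left hle hε.le
      linarith
    refine (h1.indicator_of_le hblk ((hsm _).mul (m1 _)).aestronglyMeasurable
      fun w hw => ?_).trans h2
    rw [e1 _ w hw, abs_mul r⁻¹, abs_of_pos (inv_pos.2 hr), ← Real.rpow_neg_one r]
    exact habs (by norm_num) w hw

end LayerEstimate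

section GlobalEstimate

variable {ι M : Type*} [Fintype ι] [NormedAddCommGroup M] [NormedSpace ℝ M]
  [FiniteDimensional ℝ M] [MeasurableSpace M] [BorelSpace M]

theorem HOp.exists_global_le (μ : Measure M) [μ.IsAddHaarMeasure] (ν α : ℝ) (hν : 0 < ν)
    (hα : 0 < α) (ℓ : ι) {p δ : ℝ} (hp : 1 < p) (hδ1 : 1 - 1 / p < δ) (hδ2 : δ < 2 - 1 / p) :
    ∃ N : ℝ, 0 ≤ N ∧ ∀ (H : HOp ι), H.OK ν α ℓ →
    ∀ (b : Module.Basis (Option ι) ℝ M) (s : M →L[ℝ] ℝ), (∀ k, k ≠ some ℓ → s (b k) = 0) →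
    s (b (some ℓ)) = 1 → ∀ lam, 0 < lam → ∀ u : M → ℝ, TstP s u →
    ∀ R, Lb μ (ENNReal.ofReal p) (fun w => s w ^ δ * H.app s b lam u w) R →
    Lb μ (ENNReal.ofReal p) (fun w => s w ^ δ * (lam * (s w ^ (-α) * u w))) (N * R) ∧
    Lb μ (ENNReal.ofReal p) (fun w => s w ^ δ * (s w ^ (-α) * pd (b none) u w)) (N * R) ∧
    (∀ i k, Lb μ (ENNReal.ofReal p) (fun w => s w ^ δ * pd (b (some i)) (pd (b (some k)) u) w)
      (N * R)) ∧
    ∀ i, Lb μ (ENNReal.ofReal p)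
      (fun w => s w ^ δ * (√lam * (s w ^ (-(α / 2)) * pd (b (some i)) u w))) (N * R) := by
  obtain ⟨N, hN, hloc⟩ := HOp.exists_layer_le (M := M) μ ν α hν hα ℓ hp
  have hp0 : 0 < p := by linarith
  have hδ0 : 0 ≤ δ := by
    have : 1 / p ≤ 1 := by rw [div_le_one hp0]; exact hp.le
    linarith
  set G := glueC p δ 2 with hG
  have hG0 : 0 ≤ G := glueC_nonneg _ _ _
  set n : ℝ := (Fintype.card ι : ℝ) with hn
  have hn0 : 0 ≤ n := by positivity
  set cX : ℝ := ((2 - 1 / p - δ) * (δ - (1 - 1 / p)))⁻¹ with hcX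
  have hcX0 : 0 ≤ cX := inv_nonneg.2 (mul_nonneg (by linarith) (by linarith))
  set ε : ℝ := (2 * (n * G * N + 1))⁻¹ with hε
  have hε0 : 0 < ε := by positivity
  set cD : ℝ := 2 * (n * G * (32 / ε * cX)) + (1 + cX) with hcD
  have hcD0 : 0 ≤ cD := by positivity
  refine ⟨glueC p δ N * (1 + cD + cX), mul_nonneg (glueC_nonneg _ _ _) (by positivity), ?_⟩
  intro H hH b s hsb hs1 lam hlam u hu R hR
  set q := ENNReal.ofReal p with hq
  have hq1 : 1 ≤ q := by rw [hq, ← ENNReal.ofReal_one]; exact ENNReal.ofReal_le_ofReal hp.le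
  have hR0 := hR.nonneg
  have hlayer := hloc H hH b s hsb hs1 lam hlam u hu.toTst
  have hsm : ∀ β : ℝ, Measurable fun w => s w ^ β := fun β => s.measurable.pow_const β
  have mu := hu.continuous.measurable
  have m1 : ∀ e, Measurable (pd e u) := fun e => (hu.toTst.pd e).continuous.measurable
  have mmaj := hH.measurable_maj s b lam hu.toTst
  have hmaj0 : ∀ w ∈ {w | 0 < s w}, 0 ≤ H.maj s b lam u w := fun w (hw : 0 < s w) => by
    unfold HOp.maj
    positivity
  have hX : Lb μ q (fun w => s w ^ δ * (s w ^ (-2 : ℝ) * |u w|)) (cX * R) := by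
    refine (hH.weighted_le μ hν hα hlam hsb hs1 hu hp hδ1 hδ2 hR).mono
      ((hsm _).mul ((hsm _).mul mu.abs)).aestronglyMeasurable (.of_forall fun w => ?_)
    by_cases hw : 0 < s w
    · rw [← mul_assoc, ← Real.rpow_add hw, abs_mul, abs_abs, ← abs_mul, sub_eq_add_neg]
    · rw [hu.eq_zero hw]; simp
  set D : ι → ℝ := fun i => nr μ q fun w => s w ^ δ * (s w ^ (-1 : ℝ) * pd (b (some i)) u w) with hD
  have hDL : ∀ i, MemLp (fun w => s w ^ δ * (s w ^ (-1 : ℝ) * pd (b (some i)) u w)) q μ :=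
    fun i => (((hu.pd _).mul_rpow _).mul_rpow _).memLp q μ
  have hM : Lb μ q (fun w => s w ^ δ * H.maj s b lam u w) (R + ∑ i, D i + cX * R) := by
    have h1 : Lb μ q (fun w => s w ^ δ * |H.app s b lam u w|) R :=
      hR.mono ((hsm _).mul (hH.measurable_app s b lam hu.toTst).abs).aestronglyMeasurable
        (.of_forall fun w => by rw [abs_mul, abs_abs, ← abs_mul])
    have h2 : ∀ i ∈ Finset.univ,
        Lb μ q (fun w => s w ^ δ * (s w ^ (-1 : ℝ) * |pd (b (some i)) u w|)) (D i) := fun i _ =>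
      (Lb.of_memLp (hDL i)).mono ((hsm _).mul ((hsm _).mul (m1 _).abs)).aestronglyMeasurable
        (.of_forall fun w => by simp only [abs_mul, abs_abs]; exact le_rfl)
    refine ((h1.add hq1 (Lb.sum hq1 _ h2)).add hq1 hX).congr (.of_forall fun w => ?_)
    unfold HOp.maj
    simp only [mul_add, Finset.mul_sum]
  have hDle : ∀ i, D i ≤ G * (32 / ε * (cX * R) + ε * N * (R + ∑ i, D i + cX * R)) := by
    intro i
    have hc1 : 0 < 32 / ε := by positivity
    have hc2 : 0 < ε * N := by positivity
    set g : M → ℝ := fun w => 32 / ε * (s w ^ (-2 : ℝ) * |u w|) + ε * N * H.maj s b lam u w with hg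
    have mg : Measurable g := (((hsm _).mul mu.abs).const_mul _).add (mmaj.const_mul _)
    refine Lb.nr_le (Lb.glue hp0 s.measurable (f := fun w => s w ^ (-1 : ℝ) * pd (b (some i)) u w)
      (g := g) ((hsm _).mul (m1 _)).aestronglyMeasurable
      (fun w hw => by rw [(hu.pd _).eq_zero hw, mul_zero]) mg.aestronglyMeasurable hδ0 zero_le_two
      (fun r hr S hS => ?_) ?_)
    · have hbig := measurableSet_big s.measurable r
      have key : ∀ {f : M → ℝ} {c : ℝ}, Measurable f → 0 < c →
          (∀ w, 0 < s w → c * |f w| ≤ g w) → Lb μ q ((big s r).indicator f) (c⁻¹ * S) := by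
        intro f c hf hc hfg
        have := hS.const_mul c⁻¹
        rw [abs_of_pos (inv_pos.2 hc)] at this
        refine this.indicator_of_le hbig hf.aestronglyMeasurable fun w hw => ?_
        have hσ : 0 < s w := lt_of_lt_of_le (by positivity) hw.1
        rw [indicator_of_mem hw]
        refine le_trans ?_ (le_abs_self _)
        rw [le_inv_mul_iff₀ hc]
        exact hfg w hσ
      have h1 : Lb μ q ((big s r).indicator fun w => s w ^ (-2 : ℝ) * u w) ((32 / ε)⁻¹ * S) := by
        refine key ((hsm _).mul mu) hc1 fun w hw => ?_
        rw [abs_mul, abs_of_nonneg (Real.rpow_nonneg hw.le _)]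
        exact le_add_of_nonneg_right (mul_nonneg hc2.le (hmaj0 w hw))
      have h2 : Lb μ q ((big s r).indicator (H.maj s b lam u)) ((ε * N)⁻¹ * S) := by
        refine key mmaj hc2 fun w hw => ?_
        rw [abs_of_nonneg (hmaj0 w hw)]
        exact le_add_of_nonneg_left (mul_nonneg hc1.le (by positivity))
      have h3 := (hlayer r hr _ h2).2.2.2.2 i ε hε0 _ h1
      rwa [mul_inv_cancel_left₀ hc1.ne', mul_inv_cancel_left₀ hc2.ne', ← two_mul] at h3
    · have h1 := hX.const_mul (32 / ε)
      have h2 := hM.const_mul (ε * N)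
      rw [abs_of_pos hc1] at h1
      rw [abs_of_pos hc2] at h2
      exact (h1.add hq1 h2).congr (.of_forall fun w => by rw [hg]; ring)
  have hDS : ∑ i, D i ≤ cD * R := by
    have h1 := Finset.sum_le_sum fun i (_ : i ∈ Finset.univ) => hDle i
    rw [Finset.sum_const, Finset.card_univ, nsmul_eq_mul, ← hn] at h1
    set DS := ∑ i, D i
    have hDS0 : 0 ≤ DS := Finset.sum_nonneg fun i _ => nr_nonneg
    have h2 : n * G * N * ε ≤ 1 / 2 := by
      rw [hε, ← div_eq_mul_inv, div_le_iff₀ (by positivity)]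
      linarith
    have h3 : 0 ≤ R + DS + cX * R := by positivity
    have h4 := mul_le_mul_of_nonneg_right h2 h3
    have h5 : n * (G * (32 / ε * (cX * R) + ε * N * (R + DS + cX * R))) =
      n * G * (32 / ε * cX) * R + n * G * N * ε * (R + DS + cX * R) := by ring
    rw [hcD]
    linarith
  have hM' : Lb μ q (fun w => s w ^ δ * H.maj s b lam u w) ((1 + cD + cX) * R) :=
    hM.trans (by linarith)
  have hglue : ∀ {f : M → ℝ}, Measurable f → (∀ w, ¬ 0 < s w → f w = 0) →
      (∀ r, 0 < r → ∀ R, Lb μ q ((big s r).indicator (H.maj s b lam u)) R →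
        Lb μ q ((blk s r).indicator f) (N * R)) →
      Lb μ q (fun w => s w ^ δ * f w) (glueC p δ N * (1 + cD + cX) * R) := by
    intro f hf hf0 h
    rw [mul_assoc]
    exact Lb.glue hp0 s.measurable hf.aestronglyMeasurable hf0 mmaj.aestronglyMeasurable hδ0 hN.le
      h hM'
  refine ⟨hglue (((hsm _).mul mu).const_mul _) (fun w hw => by rw [hu.eq_zero hw]; simp)
      fun r hr S hS => (hlayer r hr S hS).1,
    hglue ((hsm _).mul (m1 _)) (fun w hw => by rw [(hu.pd _).eq_zero hw]; simp)
      fun r hr S hS => (hlayer r hr S hS).2.1,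
    fun i k => hglue ((hu.pd _).pd _).continuous.measurable
      (fun w hw => ((hu.pd _).pd _).eq_zero hw) fun r hr S hS => (hlayer r hr S hS).2.2.1 i k,
    fun i => hglue (((hsm _).mul (m1 _)).const_mul _)
      (fun w hw => by rw [(hu.pd _).eq_zero hw]; simp)
      fun r hr S hS => (hlayer r hr S hS).2.2.2.1 i⟩

end GlobalEstimate

section Coordinates

variable {d : ℕ}

/-- The normal coordinate as a continuous linear map. -/
def normalCoord (ℓ : Fin d) : ℝ × Ed d →L[ℝ] ℝ :=
  (EuclideanSpace.proj ℓ).comp (ContinuousLinearMap.snd ℝ ℝ (Ed d))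

lemma normalCoord_apply (ℓ : Fin d) (z : ℝ × Ed d) : normalCoord ℓ z = z.2 ℓ := rfl

/-- The standard space-time basis, with the time direction at index `none`. -/
def timeSpaceBasis (d : ℕ) : Module.Basis (Option (Fin d)) ℝ (ℝ × Ed d) :=
  ((Module.Basis.singleton PUnit.{1} ℝ).prod (EuclideanSpace.basisFun (Fin d) ℝ).toBasis).reindex
    ((Equiv.sumComm _ _).trans (Equiv.optionEquivSumPUnit _).symm)

lemma timeSpaceBasis_none : timeSpaceBasis d none = (1, 0) := by
  simp [timeSpaceBasis]

lemma timeSpaceBasis_some (i : Fin d) :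
    timeSpaceBasis d (some i) = (0, EuclideanSpace.single i 1) := by
  simp [timeSpaceBasis]

variable {u : ℝ × Ed d → ℝ}

lemma ut_eq_pd (hu : Differentiable ℝ u) (z : ℝ × Ed d) :
    ut u z = pd (timeSpaceBasis d none) u z := by
  rw [timeSpaceBasis_none]
  have h1 : HasDerivAt (fun s : ℝ => (s, z.2)) (1, 0) z.1 :=
    (hasDerivAt_id z.1).prodMk (hasDerivAt_const _ _)
  exact ((hu z).hasFDerivAt.comp_hasDerivAt z.1 h1).deriv

lemma Du_eq (hu : Differentiable ℝ u) (z : ℝ × Ed d) :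
    Du u z = (fderiv ℝ u z).comp (ContinuousLinearMap.inr ℝ ℝ (Ed d)) :=
  ((hu z).hasFDerivAt.comp z.2 (hasFDerivAt_prodMk_right z.1 z.2)).fderiv

lemma Du_apply (hu : Differentiable ℝ u) (z : ℝ × Ed d) (i : Fin d) :
    Du u z (EuclideanSpace.single i 1) = pd (timeSpaceBasis d (some i)) u z := by
  rw [Du_eq hu, timeSpaceBasis_some]
  rfl

lemma D2u_apply (hu : Tst u) (z : ℝ × Ed d) (i j : Fin d) :
    D2u u z (EuclideanSpace.single i 1) (EuclideanSpace.single j 1) =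
      pd (timeSpaceBasis d (some i)) (pd (timeSpaceBasis d (some j)) u) z := by
  have h1 : (fun y => Du u (z.1, y)) = fun y =>
      (fderiv ℝ u (z.1, y)).comp (ContinuousLinearMap.inr ℝ ℝ (Ed d)) := by
    funext y
    exact Du_eq hu.differentiable _
  have h2 : ContDiff ℝ (⊤ : ℕ∞) fun y => Du u (z.1, y) := by
    rw [h1]
    exact ((hu.smooth.fderiv_right (m := (⊤ : ℕ∞)) (by simp)).comp
      (contDiff_const.prodMk contDiff_id)).clm_comp contDiff_const
  rw [← Du_apply (hu.pd _).differentiable]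
  unfold D2u
  have h3 := (h2.differentiable (by simp) z.2).hasFDerivAt.clm_apply
    (hasFDerivAt_const (EuclideanSpace.single j (1 : ℝ)) z.2)
  have h4 : (fun y => Du u (z.1, y) (EuclideanSpace.single j 1)) =
      fun y => pd (timeSpaceBasis d (some j)) u (z.1, y) := by
    funext y
    exact Du_apply hu.differentiable _ _
  rw [h4] at h3
  rw [Du, h3.fderiv]
  simp

lemma opNorm_le_sum_single {F : Type*} [NormedAddCommGroup F] [NormedSpace ℝ F]
    (L : Ed d →L[ℝ] F) : ‖L‖ ≤ ∑ i, ‖L (EuclideanSpace.single i 1)‖ := by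
  refine L.opNorm_le_bound (Finset.sum_nonneg fun i _ => norm_nonneg _) fun x => ?_
  have hx : x = ∑ i, x i • EuclideanSpace.single i (1 : ℝ) := by
    simpa using ((EuclideanSpace.basisFun (Fin d) ℝ).sum_repr x).symm
  conv_lhs => rw [hx, map_sum]
  refine (norm_sum_le _ _).trans ?_
  rw [Finset.sum_mul]
  refine Finset.sum_le_sum fun i _ => ?_
  rw [map_smul, norm_smul, mul_comm]
  exact mul_le_mul_of_nonneg_left (PiLp.norm_apply_le x i) (norm_nonneg _)

lemma norm_Du_le (hu : Differentiable ℝ u) (z : ℝ × Ed d) :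
    ‖Du u z‖ ≤ ∑ i, |pd (timeSpaceBasis d (some i)) u z| := by
  simpa only [Du_apply hu, Real.norm_eq_abs] using opNorm_le_sum_single (Du u z)

lemma norm_D2u_le (hu : Tst u) (z : ℝ × Ed d) : ‖D2u u z‖ ≤
    ∑ i, ∑ j, |pd (timeSpaceBasis d (some i)) (pd (timeSpaceBasis d (some j)) u) z| := by
  refine (opNorm_le_sum_single (D2u u z)).trans (Finset.sum_le_sum fun i _ => ?_)
  simpa only [D2u_apply hu, Real.norm_eq_abs] using
    opNorm_le_sum_single (D2u u z (EuclideanSpace.single i 1))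

end Coordinates

section Normalization

variable {ι : Type*} [Fintype ι] [DecidableEq ι]

/-- The correction which moves the mixed entries of row `ℓ` into column `ℓ`. -/
def mixShift (a : ι → ι → ℝ) (ℓ i j : ι) : ℝ := if j = ℓ ∧ i ≠ ℓ then a ℓ i else 0

/-- An equivalent coefficient matrix with row `ℓ` equal to a unit vector. -/
def rowNorm (a : ι → ι → ℝ) (ℓ i j : ι) : ℝ :=
  (a ℓ ℓ)⁻¹ * (a i j + mixShift a ℓ i j - mixShift a ℓ j i)

lemma sum_rowNorm_mul (a : ι → ι → ℝ) (ℓ : ι) {X : ι → ι → ℝ} (hX : ∀ i j, X i j = X j i) :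
    ∑ i, ∑ j, rowNorm a ℓ i j * X i j = (a ℓ ℓ)⁻¹ * ∑ i, ∑ j, a i j * X i j := by
  have h : ∑ i, ∑ j, mixShift a ℓ j i * X i j = ∑ i, ∑ j, mixShift a ℓ i j * X i j := by
    rw [Finset.sum_comm]
    exact Finset.sum_congr rfl fun i _ => Finset.sum_congr rfl fun j _ => by rw [hX]
  have h2 : ∀ i j, rowNorm a ℓ i j * X i j = (a ℓ ℓ)⁻¹ * (a i j * X i j +
      mixShift a ℓ i j * X i j - mixShift a ℓ j i * X i j) := fun i j => by
    rw [rowNorm]; ring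
  simp_rw [h2, ← Finset.mul_sum, Finset.sum_sub_distrib, Finset.sum_add_distrib, h]
  ring

lemma abs_mixShift_le {a : ι → ι → ℝ} {K : ℝ} (hK : 0 ≤ K) (ha : ∀ i j, |a i j| ≤ K) (ℓ i j : ι) :
    |mixShift a ℓ i j| ≤ K := by
  unfold mixShift
  split_ifs
  · exact ha _ _
  · simpa using hK

/-- The operator of the problem, normalized by the entry `a_{ℓℓ}`. -/
def HOp.normalized (μc a0 c0 : ℝ → ℝ) (a : ι → ι → ℝ → ℝ) (ℓ : ι) : HOp ι where
  A σ := (μc σ)⁻¹ * a0 σ * (a ℓ ℓ σ)⁻¹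
  C σ := (μc σ)⁻¹ * c0 σ * (a ℓ ℓ σ)⁻¹
  a i j σ := rowNorm (fun i j => a i j σ) ℓ i j

end Normalization

lemma CoeffOK.diag_mem {d : ℕ} {ν α : ℝ} {μc a0 c0 : ℝ → ℝ} {a : Fin d → Fin d → ℝ → ℝ}
    (h : CoeffOK d ν α μc a0 c0 a) (ℓ : Fin d) {σ : ℝ} (hσ : 0 < σ) : a ℓ ℓ σ ∈ Icc ν ν⁻¹ := by
  obtain ⟨-, -, -, -, -, hell, hbd⟩ := h
  refine ⟨?_, (le_abs_self _).trans (hbd σ hσ ℓ ℓ)⟩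
  have := hell σ hσ (Pi.single ℓ 1)
  simpa [Pi.single_apply, ite_pow] using this

lemma CoeffOK.normalized_OK {d : ℕ} {ν α : ℝ} (hν : ν ∈ Ioo (0 : ℝ) 1) {μc a0 c0 : ℝ → ℝ}
    {a : Fin d → Fin d → ℝ → ℝ} (h : CoeffOK d ν α μc a0 c0 a) (ℓ : Fin d) :
    (HOp.normalized μc a0 c0 a ℓ).OK (ν ^ 3 / 3) α ℓ := by
  have hdiag := fun {σ : ℝ} (hσ : 0 < σ) => h.diag_mem ℓ hσ
  obtain ⟨hμm, hAm, hCm, ham, hcoef, hell, hbd⟩ := h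
  obtain ⟨hν0, hν1⟩ := hν
  have hν' := inv_pos.2 hν0
  have hν'1 : 1 ≤ ν⁻¹ := (one_le_inv₀ hν0).2 hν1.le
  have hinvmem : ∀ {x : ℝ}, x ∈ Icc ν ν⁻¹ → x⁻¹ ∈ Icc ν ν⁻¹ := fun {x} hx =>
    ⟨(le_inv_comm₀ hν0 (hν0.trans_le hx.1)).2 hx.2, inv_anti₀ hν0 hx.1⟩
  have hq : (ν ^ 3 / 3)⁻¹ = 3 * (ν⁻¹ * ν⁻¹ * ν⁻¹) := by field_simp
  have hμ : ∀ σ, 0 < σ → ν * σ ^ (-α) ≤ (μc σ)⁻¹ ∧ (μc σ)⁻¹ ≤ ν⁻¹ * σ ^ (-α) := by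
    intro σ hσ
    have hs : 0 < σ ^ α := by positivity
    have := hinvmem (hcoef σ hσ).2.2
    rw [inv_div, div_eq_mul_inv, mem_Icc, ← le_div_iff₀' hs, ← div_le_iff₀' hs] at *
    rw [Real.rpow_neg hσ.le]
    exact ⟨by simpa [div_eq_mul_inv] using this.1, by simpa [div_eq_mul_inv] using this.2⟩
  have key : ∀ {g : ℝ → ℝ}, (∀ σ, 0 < σ → g σ ∈ Icc ν ν⁻¹) → ∀ σ, 0 < σ →
      ν ^ 3 / 3 * σ ^ (-α) ≤ (μc σ)⁻¹ * g σ * (a ℓ ℓ σ)⁻¹ ∧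
      (μc σ)⁻¹ * g σ * (a ℓ ℓ σ)⁻¹ ≤ (ν ^ 3 / 3)⁻¹ * σ ^ (-α) := by
    intro g hg σ hσ
    have hs : 0 < σ ^ (-α) := by positivity
    obtain ⟨m1, m2⟩ := hμ σ hσ
    obtain ⟨g1, g2⟩ := hg σ hσ
    obtain ⟨d1, d2⟩ := hinvmem (hdiag hσ)
    have hm0 : 0 ≤ (μc σ)⁻¹ := le_trans (by positivity) m1
    have hg0 : 0 ≤ g σ := hν0.le.trans g1
    have hd0 : 0 ≤ (a ℓ ℓ σ)⁻¹ := hν0.le.trans d1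
    constructor
    · have : ν * σ ^ (-α) * ν * ν ≤ (μc σ)⁻¹ * g σ * (a ℓ ℓ σ)⁻¹ := by gcongr
      refine le_trans ?_ this
      have : 0 ≤ ν ^ 3 * σ ^ (-α) := by positivity
      linarith
    · have : (μc σ)⁻¹ * g σ * (a ℓ ℓ σ)⁻¹ ≤ ν⁻¹ * σ ^ (-α) * ν⁻¹ * ν⁻¹ := by gcongr
      refine this.trans ?_
      rw [hq]
      have : 0 ≤ ν⁻¹ * ν⁻¹ * ν⁻¹ * σ ^ (-α) := by positivity
      linarith
  have hA := key fun σ hσ => (hcoef σ hσ).1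
  have hC := key fun σ hσ => (hcoef σ hσ).2.1
  refine ⟨(hμm.inv.mul hAm).mul (ham ℓ ℓ).inv, (hμm.inv.mul hCm).mul (ham ℓ ℓ).inv, fun i j => ?_,
    fun σ hσ => (hA σ hσ).1, fun σ hσ => (hA σ hσ).2, fun σ hσ => (hC σ hσ).1,
    fun σ hσ => (hC σ hσ).2, fun σ hσ i j => ?_, fun σ hσ ξ => ?_, fun σ hσ => ?_,
    fun σ hσ j hj => ?_⟩
  · have hB : ∀ i j, Measurable fun σ => mixShift (fun i j => a i j σ) ℓ i j := by
      intro i j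
      unfold mixShift
      split_ifs
      · exact ham _ _
      · exact measurable_const
    exact (ham ℓ ℓ).inv.mul (((ham i j).add (hB i j)).sub (hB j i))
  · have hm := abs_mixShift_le (a := fun i j => a i j σ) hν'.le (hbd σ hσ) ℓ
    have hd := hinvmem (hdiag hσ)
    change |(a ℓ ℓ σ)⁻¹ * (a i j σ + _ - _)| ≤ _
    rw [abs_mul, abs_of_nonneg (hν0.le.trans hd.1), hq]
    have h1 : |a i j σ + mixShift (fun i j => a i j σ) ℓ i j - mixShift (fun i j => a i j σ) ℓ j i|
        ≤ ν⁻¹ + ν⁻¹ + ν⁻¹ :=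
      (abs_sub _ _).trans (add_le_add ((abs_add_le _ _).trans (add_le_add (hbd σ hσ i j) (hm i j)))
        (hm j i))
    refine (mul_le_mul hd.2 h1 (abs_nonneg _) hν'.le).trans ?_
    have : ν⁻¹ * ν⁻¹ * 1 ≤ ν⁻¹ * ν⁻¹ * ν⁻¹ := by gcongr
    linarith
  · have h1 := sum_rowNorm_mul (fun i j => a i j σ) ℓ (X := fun i j => ξ j * ξ i)
      fun i j => mul_comm _ _
    simp only [← mul_assoc] at h1
    change _ ≤ ∑ i, ∑ j, rowNorm (fun i j => a i j σ) ℓ i j * ξ j * ξ i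
    rw [h1]
    have h2 : ∑ i, ∑ j, a i j σ * ξ j * ξ i = ∑ i, ∑ j, a i j σ * ξ i * ξ j :=
      Finset.sum_congr rfl fun i _ => Finset.sum_congr rfl fun j _ => by ring
    rw [h2]
    have hS : 0 ≤ ∑ i, ξ i ^ 2 := Finset.sum_nonneg fun i _ => sq_nonneg _
    have hd := hinvmem (hdiag hσ)
    refine le_trans ?_ (mul_le_mul hd.1 (hell σ hσ ξ) (by positivity) (hν0.le.trans hd.1))
    rw [← mul_assoc]
    refine mul_le_mul_of_nonneg_right ?_ hS
    nlinarith [mul_pos hν0 hν0]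
  · change (a ℓ ℓ σ)⁻¹ * (a ℓ ℓ σ + _ - _) = 1
    have : a ℓ ℓ σ ≠ 0 := (hν0.trans_le (hdiag hσ).1).ne'
    simp [mixShift, this]
  · change (a ℓ ℓ σ)⁻¹ * (a ℓ j σ + _ - _) = 0
    simp [mixShift, hj]

lemma CoeffOK.fL0_eq {d : ℕ} {ν α : ℝ} (hν : 0 < ν) {μc a0 c0 : ℝ → ℝ}
    {a : Fin d → Fin d → ℝ → ℝ} (h : CoeffOK d ν α μc a0 c0 a) (ℓ : Fin d)
    (hxd : ∀ x : Ed d, xd x = x ℓ) (lam : ℝ) {u : ℝ × Ed d → ℝ} (hu : Tst u) {z : ℝ × Ed d}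
    (hz : 0 < xd z.2) : fL0 μc a0 c0 a lam u z = a ℓ ℓ (xd z.2) *
      (HOp.normalized μc a0 c0 a ℓ).app (normalCoord ℓ) (timeSpaceBasis d) lam u z := by
  have hne : a ℓ ℓ (xd z.2) ≠ 0 := (hν.trans_le (h.diag_mem ℓ hz).1).ne'
  have h1 := sum_rowNorm_mul (fun i j => a i j (xd z.2)) ℓ
    (X := fun i j => pd (timeSpaceBasis d (some i)) (pd (timeSpaceBasis d (some j)) u) z)
    fun i j => by rw [pd_comm hu.smooth]
  unfold fL0 HOp.app
  simp only [D2u_apply hu, ut_eq_pd hu.differentiable, normalCoord_apply, ← hxd]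
  have h2 : ∑ i, ∑ j, (HOp.normalized μc a0 c0 a ℓ).a i j (xd z.2) *
      pd (timeSpaceBasis d (some j)) (pd (timeSpaceBasis d (some i)) u) z =
      (a ℓ ℓ (xd z.2))⁻¹ * ∑ i, ∑ j, a i j (xd z.2) *
        pd (timeSpaceBasis d (some i)) (pd (timeSpaceBasis d (some j)) u) z := by
    rw [← h1]
    exact Finset.sum_congr rfl fun i _ => Finset.sum_congr rfl fun j _ => by
      rw [pd_comm hu.smooth]; rfl
  rw [h2]
  simp only [HOp.normalized]
  field_simp

section WeightedNorm

variable {d : ℕ} {T : EReal} {p γ : ℝ}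

lemma ofReal_weight_eq (hp : 0 < p) {x y : ℝ} (hx : 0 < x) :
    ENNReal.ofReal (|y| ^ p * x ^ γ) = ‖x ^ (γ / p) * y‖ₑ ^ p := by
  rw [Real.enorm_eq_ofReal_abs, ENNReal.ofReal_rpow_of_nonneg (abs_nonneg _) hp.le, abs_mul,
    Real.mul_rpow (abs_nonneg _) (abs_nonneg _), abs_of_pos (a := x ^ (γ / p)) (by positivity),
    ← Real.rpow_mul hx.le, div_mul_cancel₀ _ hp.ne', mul_comm]

lemma measurable_xd : Measurable (xd : Ed d → ℝ) := by
  unfold xd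
  split_ifs
  · exact Continuous.measurable (by fun_prop)
  · exact measurable_const

lemma measurableSet_OmegaT : MeasurableSet (OmegaT d T) :=
  (measurableSet_lt (measurable_coe_real_ereal.comp measurable_fst) measurable_const).inter
    (measurableSet_lt measurable_const (measurable_xd.comp measurable_snd))

lemma wLp_eq (hp : 0 < p) (g : ℝ × Ed d → ℝ) : wLp d T p γ g =
    (∫⁻ z in OmegaT d T, ‖xd z.2 ^ (γ / p) * g z‖ₑ ^ p) ^ (1 / p) := by
  rw [wLp, setLIntegral_congr_fun measurableSet_OmegaT]
  exact fun z hz => ofReal_weight_eq hp hz.2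

lemma ofReal_mul_wLp_le (hp : 0 < p) {c R : ℝ} (hc : 0 ≤ c) {g g' : ℝ × Ed d → ℝ}
    (hg : ∀ z ∈ OmegaT d T, |g z| ≤ |g' z|)
    (h : Lb volume (ENNReal.ofReal p) (fun z => xd z.2 ^ (γ / p) * (c * g' z)) R) :
    ENNReal.ofReal c * wLp d T p γ g ≤ ENNReal.ofReal R := by
  refine le_trans ?_ h.le
  have e1 : (fun z : ℝ × Ed d => xd z.2 ^ (γ / p) * (c * g' z)) =
      c • fun z => xd z.2 ^ (γ / p) * g' z := by
    funext z
    simp only [Pi.smul_apply, smul_eq_mul]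
    ring
  rw [e1, eLpNorm_const_smul, Real.enorm_of_nonneg hc]
  gcongr
  rw [wLp_eq hp, eLpNorm_eq_lintegral hp]
  refine ENNReal.rpow_le_rpow ?_ (by positivity)
  refine (setLIntegral_mono' measurableSet_OmegaT fun z hz => ?_).trans
    (setLIntegral_le_lintegral _ _)
  refine ENNReal.rpow_le_rpow ?_ hp.le
  rw [enorm_mul, enorm_mul]
  gcongr
  rw [Real.enorm_eq_ofReal_abs, Real.enorm_eq_ofReal_abs]
  exact ENNReal.ofReal_le_ofReal (hg z hz)

lemma eLpNorm_le_wLp (hp : 0 < p) {K : ℝ} (hK : 0 ≤ K) {F f : ℝ × Ed d → ℝ}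
    (hF0 : ∀ z, z ∉ OmegaT d T → F z = 0) (hF : ∀ z ∈ OmegaT d T, |F z| ≤ K * |f z|) :
    eLpNorm (fun z => xd z.2 ^ (γ / p) * F z) (ENNReal.ofReal p) volume ≤
      ENNReal.ofReal K * wLp d T p γ f := by
  have h1 : ENNReal.ofReal K = (ENNReal.ofReal K ^ p) ^ (1 / p) := by
    rw [← ENNReal.rpow_mul, mul_one_div_cancel hp.ne', ENNReal.rpow_one]
  rw [wLp_eq hp, eLpNorm_eq_lintegral hp, h1, ← ENNReal.mul_rpow_of_nonneg _ _ (by positivity),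
    ← lintegral_const_mul' _ _ (ENNReal.rpow_ne_top_of_nonneg hp.le ENNReal.ofReal_ne_top),
    ← setLIntegral_eq_of_support_subset (s := OmegaT d T)]
  · refine ENNReal.rpow_le_rpow (setLIntegral_mono' measurableSet_OmegaT fun z hz => ?_)
      (by positivity)
    rw [← ENNReal.mul_rpow_of_nonneg _ _ hp.le]
    refine ENNReal.rpow_le_rpow ?_ hp.le
    rw [enorm_mul, enorm_mul, mul_left_comm]
    gcongr
    rw [Real.enorm_eq_ofReal_abs, Real.enorm_eq_ofReal_abs, ← ENNReal.ofReal_mul hK]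
    exact ENNReal.ofReal_le_ofReal (hF z hz)
  · intro z hz
    by_contra h
    exact hz (by simp [hF0 z h, hp])

end WeightedNorm

/-- Lemma 3.5: full a priori estimate when the power of the weight is large,
`γ ∈ (p-1, 2p-1)`. -/
theorem stmt4 (d : ℕ) (hd : 1 ≤ d) (ν α p γ : ℝ)
    (hν : ν ∈ Set.Ioo (0 : ℝ) 1) (hα : α ∈ Set.Ioo (0 : ℝ) 2) (hp : 1 < p)
    (hγ₁ : p - 1 < γ) (hγ₂ : γ < 2 * p - 1) :
    ∃ N : ℝ, 0 < N ∧
      ∀ (T : EReal) (lam : ℝ), 0 < lam →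
        ∀ (μc a0 c0 : ℝ → ℝ) (aij : Fin d → Fin d → ℝ → ℝ),
          CoeffOK d ν α μc a0 c0 aij →
          ∀ u : ℝ × Ed d → ℝ, ContDiff ℝ (⊤ : ℕ∞) u → HasCompactSupport u →
            tsupport u ⊆ OmegaT d T →
            ENNReal.ofReal lam * wLp d T p γ (fun z => xd z.2 ^ (-α) * u z)
              + ENNReal.ofReal (Real.sqrt lam) *
                  wLp d T p γ (fun z => xd z.2 ^ (-(α / 2)) * ‖Du u z‖)
              + wLp d T p γ (fun z => ‖D2u u z‖)
              + wLp d T p γ (fun z => xd z.2 ^ (-α) * ut u z)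
            ≤ ENNReal.ofReal N * wLp d T p γ (fL0 μc a0 c0 aij lam u) := by
  have hd0 : 0 < d := hd
  have hp0 : 0 < p := by linarith
  have hν0 : 0 < ν := hν.1
  set ℓ : Fin d := ⟨d - 1, Nat.sub_lt hd0 one_pos⟩ with hℓ
  have hxd : ∀ x : Ed d, xd x = x ℓ := fun x => dif_pos hd0
  have hδ1 : 1 - 1 / p < γ / p := by
    rw [lt_div_iff₀ hp0, sub_mul, one_mul, one_div_mul_cancel hp0.ne']
    exact hγ₁
  have hδ2 : γ / p < 2 - 1 / p := by
    rw [div_lt_iff₀ hp0, sub_mul, one_div_mul_cancel hp0.ne']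
    exact hγ₂
  have : (volume : Measure (ℝ × Ed d)).IsAddHaarMeasure :=
    inferInstanceAs ((volume : Measure ℝ).prod (volume : Measure (Ed d))).IsAddHaarMeasure
  obtain ⟨N, hN, hmain⟩ := HOp.exists_global_le (volume : Measure (ℝ × Ed d)) (ν ^ 3 / 3) α
    (by positivity) hα.1 ℓ hp hδ1 hδ2
  have hν' := inv_pos.2 hν0
  set n : ℝ := (d : ℝ) with hn
  refine ⟨(N + n * N + n * (n * N) + N) * ν⁻¹ + 1, by positivity, ?_⟩
  intro T lam hlam μc a0 c0 a hcoef u hu hcpt hsupp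
  rcases eq_or_ne (wLp d T p γ (fL0 μc a0 c0 a lam u)) ∞ with htop | htop
  · rw [htop, ENNReal.mul_top (by simp; positivity)]
    exact le_top
  set s := normalCoord ℓ with hs
  have hsx : ∀ z, s z = xd z.2 := fun z => (hxd z.2).symm
  have huT : TstP s u := ⟨⟨hu, hcpt⟩, fun z hz => by rw [hsx]; exact (hsupp hz).2⟩
  set H := HOp.normalized μc a0 c0 a ℓ with hH
  set b := timeSpaceBasis d with hb
  have hOK : H.OK (ν ^ 3 / 3) α ℓ := hcoef.normalized_OK hν ℓ
  set q := ENNReal.ofReal p with hq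
  have hq1 : 1 ≤ q := by rw [hq, ← ENNReal.ofReal_one]; exact ENNReal.ofReal_le_ofReal hp.le
  set W := ENNReal.ofReal ν⁻¹ * wLp d T p γ (fL0 μc a0 c0 a lam u) with hW
  have hWtop : W ≠ ∞ := ENNReal.mul_ne_top ENNReal.ofReal_ne_top htop
  set R := W.toReal with hR
  have hRW : ENNReal.ofReal R = W := ENNReal.ofReal_toReal hWtop
  have hR0 : 0 ≤ R := ENNReal.toReal_nonneg
  have hF : Lb volume q (fun z => s z ^ (γ / p) * H.app s b lam u z) R := by
    refine ⟨((s.measurable.pow_const _).mul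
      (hOK.measurable_app s b lam huT.toTst)).aestronglyMeasurable, hR0, ?_⟩
    rw [hRW]
    simp only [hsx]
    refine eLpNorm_le_wLp hp0 hν'.le (fun z hz => ?_) fun z hz => ?_
    · have hz' : z ∉ tsupport u := fun h => hz (hsupp h)
      have h1 : ∀ e, z ∉ tsupport (pd e u) := fun e h => hz' (tsupport_fderiv_apply_subset ℝ e h)
      simp [HOp.app, pd_eq_zero hz', pd_eq_zero (h1 _), image_eq_zero_of_notMem_tsupport hz']
    · have hd := (hcoef.diag_mem ℓ hz.2).1
      rw [hcoef.fL0_eq hν0 ℓ hxd lam huT.toTst hz.2, abs_mul, abs_of_pos (hν0.trans_le hd),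
        ← mul_assoc]
      refine le_mul_of_one_le_left (abs_nonneg _) ?_
      rw [inv_mul_eq_div, one_le_div hν0]
      exact hd
  have hsb : ∀ k, k ≠ some ℓ → s (b k) = 0 := by
    intro k hk
    cases k with
    | none => rw [hb, timeSpaceBasis_none]; simp [hs, normalCoord_apply]
    | some i =>
      rw [hb, timeSpaceBasis_some, hs, normalCoord_apply]
      have : ℓ ≠ i := fun h => hk (by rw [h])
      simp [this]
  have hs1 : s (b (some ℓ)) = 1 := by
    rw [hb, timeSpaceBasis_some, hs, normalCoord_apply]
    simp
  obtain ⟨k1, k2, k3, k4⟩ := hmain H hOK b s hsb hs1 lam hlam u huT R hF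
  simp only [hsx] at k1 k2 k3 k4
  have hw : ∀ β : ℝ, Measurable fun z : ℝ × Ed d => xd z.2 ^ β := fun β =>
    (measurable_xd.comp measurable_snd).pow_const β
  have m1 : ∀ e, Measurable (pd e u) := fun e => (huT.toTst.pd e).continuous.measurable
  have t1 := ofReal_mul_wLp_le (T := T) (g := fun z => xd z.2 ^ (-α) * u z) hp0 hlam.le
    (fun z _ => le_rfl) k1
  have t4 := ofReal_mul_wLp_le (T := T) (γ := γ) (R := N * R) (g := fun z => xd z.2 ^ (-α) * ut u z)
    (g' := fun z => xd z.2 ^ (-α) * pd (b none) u z) hp0 zero_le_one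
    (fun z _ => by rw [ut_eq_pd huT.differentiable])
    (by simpa only [one_mul] using k2)
  have t2 := ofReal_mul_wLp_le (T := T) (γ := γ) (R := n * (N * R))
    (g := fun z => xd z.2 ^ (-(α / 2)) * ‖Du u z‖)
    (g' := fun z => xd z.2 ^ (-(α / 2)) * ∑ i, |pd (b (some i)) u z|) hp0 (Real.sqrt_nonneg lam)
    (fun z _ => by
      rw [abs_mul, abs_mul, abs_norm]
      exact mul_le_mul_of_nonneg_left
        ((norm_Du_le huT.differentiable z).trans (le_abs_self _)) (abs_nonneg _))
    (by
      have h : ∀ i ∈ Finset.univ, Lb volume q (fun z => xd z.2 ^ (γ / p) *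
          (√lam * (xd z.2 ^ (-(α / 2)) * |pd (b (some i)) u z|))) (N * R) := fun i _ =>
        (k4 i).mono ((hw _).mul (((hw _).mul (m1 _).abs).const_mul _)).aestronglyMeasurable
          (.of_forall fun z => by simp only [abs_mul, abs_abs]; exact le_rfl)
      have h2 := Lb.sum hq1 Finset.univ h
      rw [Finset.sum_const, Finset.card_univ, Fintype.card_fin, nsmul_eq_mul] at h2
      refine h2.congr (.of_forall fun z => ?_)
      simp only [Finset.mul_sum])
  have t3 := ofReal_mul_wLp_le (T := T) (γ := γ) (R := n * (n * (N * R)))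
    (g := fun z => ‖D2u u z‖)
    (g' := fun z => ∑ i, ∑ j, |pd (b (some i)) (pd (b (some j)) u) z|) hp0 zero_le_one
    (fun z _ => by
      exact (abs_of_nonneg (ContinuousLinearMap.opNorm_nonneg _)).trans_le
        ((norm_D2u_le huT.toTst z).trans (le_abs_self _)))
    (by
      have h : ∀ i ∈ Finset.univ, ∀ j ∈ Finset.univ, Lb volume q (fun z => xd z.2 ^ (γ / p) *
          |pd (b (some i)) (pd (b (some j)) u) z|) (N * R) := fun i _ j _ =>
        (k3 i j).mono ((hw _).mul
          ((huT.toTst.pd _).pd _).continuous.measurable.abs).aestronglyMeasurable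
          (.of_forall fun z => by simp only [abs_mul, abs_abs]; exact le_rfl)
      have h2 := Lb.sum hq1 Finset.univ fun i hi => Lb.sum hq1 Finset.univ (h i hi)
      simp only [Finset.sum_const, Finset.card_univ, Fintype.card_fin, nsmul_eq_mul] at h2
      refine h2.congr (.of_forall fun z => ?_)
      simp only [Finset.mul_sum, one_mul])
  rw [ENNReal.ofReal_one, one_mul] at t3 t4
  refine (add_le_add (add_le_add (add_le_add t1 t2) t3) t4).trans ?_
  have hNR : 0 ≤ N * R := by positivity
  rw [← ENNReal.ofReal_add hNR (by positivity), ← ENNReal.ofReal_add (by positivity)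
    (by positivity), ← ENNReal.ofReal_add (by positivity) hNR]
  have e1 : N * R + n * (N * R) + n * (n * (N * R)) + N * R =
      (N + n * N + n * (n * N) + N) * R := by ring
  rw [e1, ENNReal.ofReal_mul (by positivity), hRW, hW, ← mul_assoc,
    ← ENNReal.ofReal_mul (by positivity)]
  gcongr
  linarith
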